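/- Let ν > n/2 − 1, 1 < p ≤ 2 with conjugate exponent p' = p/(p−1), and let m ≥ 0 be an integer such that ν + mp' > n/2 − 1 and the Hardy inequality holds for (p', ν + mp'). For a holomorphic G on T_Λ with Δ(Im ·)^m □^m G ∈ L^{p'}_ν, define γ_G(F) = ∫_{T_Λ} F(z) \overline{□^m G(z)} Δ(Im z)^m dV_ν(z) for F ∈ A^p_ν. Then: (a) there is C such that |γ_G(F)| ≤ C ‖Δ(Im ·)^m □^m G‖_{L^{p'}_ν} ‖F‖_{L^p_ν} for all such G and all F ∈ A^p_ν; (b) every continuous linear functional γ on A^p_ν equals γ_G for some such G, with ‖Δ(Im ·)^m □^m G‖_{L^{p'}_ν} ≤ C ‖γ‖; (c) γ_{G₁} = γ_{G₂} if and only if □^m G₁ = □^m G₂. -/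

import Mathlib

open MeasureTheory Complex Set
open scoped ENNReal

noncomputable section

/-- The Lorentz form `Δ(y) = y₁² − y₂² − ⋯ − yₙ²` on `ℝⁿ`
(written as `2 y₀² − ∑ yᵢ²` with 0-based indexing). -/
def lor {n : ℕ} [NeZero n] (y : Fin n → ℝ) : ℝ := 2 * y 0 ^ 2 - ∑ i, y i ^ 2

/-- The holomorphic extension of the Lorentz form to `ℂⁿ`. -/
def lorC {n : ℕ} [NeZero n] (z : Fin n → ℂ) : ℂ := 2 * z 0 ^ 2 - ∑ i, z i ^ 2

/-- Componentwise imaginary part. -/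
def imP {n : ℕ} (z : Fin n → ℂ) : Fin n → ℝ := fun i => (z i).im

/-- The forward light cone `Λ`. -/
def cone (n : ℕ) [NeZero n] : Set (Fin n → ℝ) := {y | 0 < lor y ∧ 0 < y 0}

/-- The tube domain `T_Λ` over the forward light cone. -/
def tube (n : ℕ) [NeZero n] : Set (Fin n → ℂ) := {z | imP z ∈ cone n}

/-- The weighted measure `dV_ν = Δ(Im z)^{ν − n/2} dz` on `T_Λ`. -/
def dV (n : ℕ) [NeZero n] (ν : ℝ) : Measure (Fin n → ℂ) :=
  ((volume : Measure (Fin n → ℂ)).restrict (tube n)).withDensity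
    (fun z => ENNReal.ofReal (lor (imP z) ^ (ν - (n : ℝ) / 2)))

/-- `∫ |F|^p dV_ν` (as an extended nonnegative real). -/
def lpInt (n : ℕ) [NeZero n] (p ν : ℝ) (F : (Fin n → ℂ) → ℂ) : ℝ≥0∞ :=
  ∫⁻ z, ENNReal.ofReal (‖F z‖ ^ p) ∂(dV n ν)

/-- The `L^p_ν` norm `(∫ |F|^p dV_ν)^{1/p}`. -/
def lpNorm (n : ℕ) [NeZero n] (p ν : ℝ) (F : (Fin n → ℂ) → ℂ) : ℝ≥0∞ :=
  (lpInt n p ν F) ^ (1 / p)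

/-- The Bergman space `A^p_ν`: holomorphic on `T_Λ` and in `L^p_ν`. -/
def memA (n : ℕ) [NeZero n] (p ν : ℝ) (F : (Fin n → ℂ) → ℂ) : Prop :=
  DifferentiableOn ℂ F (tube n) ∧ lpInt n p ν F < ⊤

/-- Partial derivative `∂/∂zᵢ`. -/
def pd {n : ℕ} (i : Fin n) (F : (Fin n → ℂ) → ℂ) : (Fin n → ℂ) → ℂ :=
  fun z => fderiv ℂ F z (Pi.single i 1)

/-- The wave (Box) operator `□ = −(∂₁² − ∂₂² − ⋯ − ∂ₙ²)`, so that
`□ e^{i z·ξ} = Δ(ξ) e^{i z·ξ}`. -/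
def BoxOp {n : ℕ} [NeZero n] (F : (Fin n → ℂ) → ℂ) : (Fin n → ℂ) → ℂ :=
  fun z => -(2 * pd 0 (pd 0 F) z - ∑ i, pd i (pd i F) z)

/-- The (unnormalized) Bergman kernel `B_β(z,w) = Δ((z − w̄)/i)^{−(β+n)}`. -/
def berg (n : ℕ) [NeZero n] (β : ℝ) (z w : Fin n → ℂ) : ℂ :=
  lorC (fun i => (z i - (starRingEnd ℂ) (w i)) / Complex.I) ^ (-(β + (n : ℝ)) : ℂ)

/-- The Hardy inequality holds for `(p, ν)`:
`∫ |F|^p dV_ν ≤ C ∫ |Δ(Im z) □F(z)|^p dV_ν(z)` for all `F ∈ A^p_ν`. -/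
def hardy (n : ℕ) [NeZero n] (p ν : ℝ) : Prop :=
  ∃ C > (0 : ℝ), ∀ F, memA n p ν F →
    lpInt n p ν F ≤ ENNReal.ofReal C *
      lpInt n p ν (fun z => (lor (imP z) : ℂ) * BoxOp F z)

/-- `g` is the orthogonal projection of `f ∈ L²_ν` onto the closed subspace `A²_ν`:
`g ∈ A²_ν` and `f − g ⊥ A²_ν`. -/
def isProj (n : ℕ) [NeZero n] (ν : ℝ) (f g : (Fin n → ℂ) → ℂ) : Prop :=
  memA n 2 ν g ∧ ∀ h, memA n 2 ν h →
    ∫ z, f z * (starRingEnd ℂ) (h z) ∂(dV n ν) =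
      ∫ z, g z * (starRingEnd ℂ) (h z) ∂(dV n ν)

/-- The Bergman projection `P_ν` admits a bounded extension to `L^p_ν`:
`‖P_ν f‖_{L^p_ν} ≤ C ‖f‖_{L^p_ν}` for all `f ∈ L²_ν ∩ L^p_ν`. -/
def projBounded (n : ℕ) [NeZero n] (p ν : ℝ) : Prop :=
  ∃ C > (0 : ℝ), ∀ f g : (Fin n → ℂ) → ℂ,
    AEStronglyMeasurable f (dV n ν) → lpInt n 2 ν f < ⊤ → lpInt n p ν f < ⊤ →
    isProj n ν f g → lpNorm n p ν g ≤ ENNReal.ofReal C * lpNorm n p ν f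

/-- A bounded (continuous) linear functional on `A^p_ν`. -/
def isBddFunc (n : ℕ) [NeZero n] (p ν : ℝ) (γ : ((Fin n → ℂ) → ℂ) → ℂ) : Prop :=
  (∀ F G, memA n p ν F → memA n p ν G → γ (F + G) = γ F + γ G) ∧
  (∀ (c : ℂ) (F), memA n p ν F → γ (fun z => c * F z) = c * γ F) ∧
  ∃ C : ℝ, ∀ F, memA n p ν F → ‖γ F‖ ≤ C * (lpNorm n p ν F).toReal

set_option linter.unusedSectionVars false

section Lorentz

variable {n : ℕ} [NeZero n]

/-- The Lorentz bilinear form over a commutative ring. -/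
def lorB {R : Type*} [CommRing R] (x y : Fin n → R) : R := 2 * (x 0 * y 0) - ∑ i, x i * y i

section Ring

variable {R : Type*} [CommRing R]

lemma lorB_comm (x y : Fin n → R) : lorB x y = lorB y x := by
  simp only [lorB, mul_comm]

lemma lorB_add_left (x y z : Fin n → R) : lorB (x + y) z = lorB x z + lorB y z := by
  simp only [lorB, Pi.add_apply, add_mul, Finset.sum_add_distrib]; ring

lemma lorB_smul_left (c : R) (x y : Fin n → R) : lorB (c • x) y = c * lorB x y := by
  simp only [lorB, Pi.smul_apply, smul_eq_mul, mul_assoc, ← Finset.mul_sum]; ring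

lemma lorB_add_right (x y z : Fin n → R) : lorB x (y + z) = lorB x y + lorB x z := by
  rw [lorB_comm, lorB_add_left, lorB_comm y, lorB_comm z]

lemma lorB_smul_right (c : R) (x y : Fin n → R) : lorB x (c • y) = c * lorB x y := by
  rw [lorB_comm, lorB_smul_left, lorB_comm]

lemma lorB_neg_left (x y : Fin n → R) : lorB (-x) y = -lorB x y := by
  rw [← neg_one_smul R x, lorB_smul_left]; ring

lemma lorB_neg_right (x y : Fin n → R) : lorB x (-y) = -lorB x y := by
  rw [lorB_comm, lorB_neg_left, lorB_comm]

lemma lorB_sub_left (x y z : Fin n → R) : lorB (x - y) z = lorB x z - lorB y z := by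
  rw [sub_eq_add_neg, lorB_add_left, lorB_neg_left]; ring

lemma lorB_sub_right (x y z : Fin n → R) : lorB x (y - z) = lorB x y - lorB x z := by
  rw [sub_eq_add_neg, lorB_add_right, lorB_neg_right]; ring

/-- The base point `(1, 0, …, 0)`. -/
def eVec (n : ℕ) [NeZero n] (R : Type*) [CommRing R] : Fin n → R := Pi.single 0 1

@[simp] lemma eVec_zero : eVec n R 0 = 1 := by simp [eVec]

lemma lorB_eVec_right (x : Fin n → R) : lorB x (eVec n R) = x 0 := by
  simp [lorB, eVec, Pi.single_apply]; ring

lemma lorB_eVec_left (x : Fin n → R) : lorB (eVec n R) x = x 0 := by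
  rw [lorB_comm, lorB_eVec_right]

/-- The Lorentz boost built from a vector `k` (non-isotropic) and a dilation factor `l`. -/
def boost {K : Type*} [Field K] (l : K) (k : Fin n → K) : (Fin n → K) →ₗ[K] (Fin n → K) where
  toFun v := (-l) • v + (2 * l * lorB v k / lorB k k) • k
  map_add' x y := by
    ext i; simp only [lorB_add_left, Pi.add_apply, Pi.smul_apply, smul_eq_mul]; ring
  map_smul' c x := by
    ext i
    simp only [lorB_smul_left, Pi.add_apply, Pi.smul_apply, smul_eq_mul, RingHom.id_apply]; ring

variable {K : Type*} [Field K]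

lemma boost_apply (l : K) (k v : Fin n → K) :
    boost l k v = (-l) • v + (2 * l * lorB v k / lorB k k) • k := rfl

lemma lorB_boost {l : K} {k : Fin n → K} (hk : lorB k k ≠ 0) (v w : Fin n → K) :
    lorB (boost l k v) (boost l k w) = l ^ 2 * lorB v w := by
  simp only [boost_apply, lorB_add_left, lorB_add_right, lorB_smul_left, lorB_smul_right,
    lorB_comm k w]
  field_simp
  ring

lemma boost_boost {l : K} {k : Fin n → K} (hk : lorB k k ≠ 0) (v : Fin n → K) :
    boost l k (boost l k v) = l ^ 2 • v := by
  ext i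
  simp only [boost_apply, lorB_add_left, lorB_smul_left, Pi.add_apply, Pi.smul_apply, smul_eq_mul]
  field_simp
  ring

end Ring

lemma lor_eq (y : Fin n → ℝ) : lor y = lorB y y := by simp [lor, lorB, sq]

lemma lorC_eq (y : Fin n → ℂ) : lorC y = lorB y y := by simp [lorC, lorB, sq]

lemma lor_add (x y : Fin n → ℝ) : lor (x + y) = lor x + 2 * lorB x y + lor y := by
  simp only [lor_eq, lorB_add_left, lorB_add_right, lorB_comm y x]; ring

lemma lorC_add (x y : Fin n → ℂ) : lorC (x + y) = lorC x + 2 * lorB x y + lorC y := by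
  simp only [lorC_eq, lorB_add_left, lorB_add_right, lorB_comm y x]; ring

lemma lor_smul (c : ℝ) (x : Fin n → ℝ) : lor (c • x) = c ^ 2 * lor x := by
  simp only [lor_eq, lorB_smul_left, lorB_smul_right]; ring

lemma lorC_smul (c : ℂ) (x : Fin n → ℂ) : lorC (c • x) = c ^ 2 * lorC x := by
  simp only [lorC_eq, lorB_smul_left, lorB_smul_right]; ring

lemma lor_eVec : lor (eVec n ℝ) = 1 := by rw [lor_eq, lorB_eVec_right, eVec_zero]

lemma cone_sum_sq {y : Fin n → ℝ} (hy : y ∈ cone n) : ∑ i, y i ^ 2 < 2 * y 0 ^ 2 := by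
  have := hy.1; simp only [lor] at this; linarith

lemma eVec_mem_cone : eVec n ℝ ∈ cone n := ⟨by rw [lor_eVec]; norm_num, by simp⟩

lemma lorB_pos {y v : Fin n → ℝ} (hy : y ∈ cone n) (hv : v ∈ cone n) : 0 < lorB y v := by
  have h1 := cone_sum_sq hy
  have h2 := cone_sum_sq hv
  have h3 := Finset.sum_mul_sq_le_sq_mul_sq Finset.univ y v
  have hp : 0 < 2 * (y 0 * v 0) := by have := mul_pos hy.2 hv.2; linarith
  have h4 : (∑ i, y i * v i) ^ 2 < (2 * (y 0 * v 0)) ^ 2 := by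
    calc _ ≤ (∑ i, y i ^ 2) * ∑ i, v i ^ 2 := h3
      _ < (2 * y 0 ^ 2) * (2 * v 0 ^ 2) := by
        apply mul_lt_mul'' h1 h2 <;> positivity
      _ = _ := by ring
  have := abs_lt_of_sq_lt_sq h4 hp.le
  rw [lorB]; linarith [(abs_lt.1 this).2]

lemma cone_add {x y : Fin n → ℝ} (hx : x ∈ cone n) (hy : y ∈ cone n) : x + y ∈ cone n :=
  ⟨by rw [lor_add]; linarith [hx.1, hy.1, lorB_pos hx hy], add_pos hx.2 hy.2⟩

lemma cone_smul {c : ℝ} (hc : 0 < c) {x : Fin n → ℝ} (hx : x ∈ cone n) : c • x ∈ cone n :=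
  ⟨by rw [lor_smul]; exact mul_pos (by positivity) hx.1, mul_pos hc hx.2⟩

lemma lor_le_lor_add {x y : Fin n → ℝ} (hx : x ∈ cone n) (hy : y ∈ cone n) :
    lor x ≤ lor (x + y) := by
  rw [lor_add]; linarith [hy.1, lorB_pos hx hy]

lemma lor_nonpos_of_orth {y u : Fin n → ℝ} (hy : y ∈ cone n) (h : lorB u y = 0) : lor u ≤ 0 := by
  by_contra! hu
  have h1 := cone_sum_sq hy
  have h2 : ∑ i, u i ^ 2 < 2 * u 0 ^ 2 := by simp only [lor] at hu; linarith
  have h3 := Finset.sum_mul_sq_le_sq_mul_sq Finset.univ u y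
  have h4 : ∑ i, u i * y i = 2 * (u 0 * y 0) := by simp only [lorB] at h; linarith
  rw [h4] at h3
  have h5 : (∑ i, u i ^ 2) * ∑ i, y i ^ 2 < (2 * u 0 ^ 2) * (2 * y 0 ^ 2) := by
    apply mul_lt_mul'' h2 h1 <;> positivity
  nlinarith

lemma lor_mul_lor_le {y : Fin n → ℝ} (hy : y ∈ cone n) (x : Fin n → ℝ) :
    lor x * lor y ≤ lorB x y ^ 2 := by
  have hy0 := hy.1
  have h := lor_nonpos_of_orth (u := x - (lorB x y / lor y) • y) hy (by
    rw [lorB_sub_left, lorB_smul_left, ← lor_eq]; field_simp; ring)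
  simp only [lor_eq, lorB_sub_left, lorB_sub_right, lorB_smul_left, lorB_smul_right,
    lorB_comm y x] at h hy0 ⊢
  have : lorB x x - lorB x y / lorB y y * lorB x y
      - (lorB x y / lorB y y * lorB x y
        - lorB x y / lorB y y * (lorB x y / lorB y y * lorB y y))
      = (lorB x x * lorB y y - lorB x y ^ 2) / lorB y y := by
    field_simp; ring
  have h2 : (lorB x x * lorB y y - lorB x y ^ 2) / lorB y y ≤ 0 := by
    rw [← this]; linarith
  rw [div_le_iff₀ hy0] at h2
  linarith

lemma mem_cone_of_lorB_pos {y u : Fin n → ℝ} (hy : y ∈ cone n) (hu : 0 < lor u)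
    (h : 0 < lorB u y) : u ∈ cone n := by
  refine ⟨hu, ?_⟩
  by_contra! h0
  rcases h0.lt_or_eq with h1 | h1
  · have : -u ∈ cone n := ⟨by rw [← neg_one_smul ℝ u, lor_smul]; linarith, by simpa using h1⟩
    have := lorB_pos this hy
    rw [lorB_neg_left] at this
    linarith
  · rw [lor, h1] at hu
    have : 0 ≤ ∑ i, u i ^ 2 := Finset.sum_nonneg fun i _ => sq_nonneg _
    linarith [hu, sq (0 : ℝ)]

/-- The boost mapping the base point to `y`. -/
def rboost (y : Fin n → ℝ) : (Fin n → ℝ) →ₗ[ℝ] (Fin n → ℝ) :=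
  boost (√(lor y)) ((√(lor y)) • eVec n ℝ + y)

lemma rboost_vec_mem {y : Fin n → ℝ} (hy : y ∈ cone n) :
    (√(lor y)) • eVec n ℝ + y ∈ cone n :=
  cone_add (cone_smul (Real.sqrt_pos.2 hy.1) eVec_mem_cone) hy

lemma rboost_vec_ne {y : Fin n → ℝ} (hy : y ∈ cone n) :
    lorB ((√(lor y)) • eVec n ℝ + y) ((√(lor y)) • eVec n ℝ + y) ≠ 0 := by
  rw [← lor_eq]; exact (rboost_vec_mem hy).1.ne'

lemma rboost_eVec {y : Fin n → ℝ} (hy : y ∈ cone n) : rboost y (eVec n ℝ) = y := by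
  have hs := Real.sq_sqrt hy.1.le
  have hk := rboost_vec_ne hy
  set l := √(lor y) with hl
  have hl0 : 0 < l := Real.sqrt_pos.2 hy.1
  have h1 : lorB (l • eVec n ℝ + y) (l • eVec n ℝ + y) = 2 * l * (l + y 0) := by
    rw [← lor_eq, lor_add, lor_smul, lor_eVec, lorB_smul_left, lorB_eVec_left, ← hs]; ring
  rw [rboost, boost_apply, ← hl, lorB_add_right, lorB_smul_right, lorB_eVec_right, eVec_zero,
    lorB_eVec_left, mul_one, h1, div_self (h1 ▸ hk), one_smul]
  ext i; simp

lemma lorB_rboost {y : Fin n → ℝ} (hy : y ∈ cone n) (v w : Fin n → ℝ) :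
    lorB (rboost y v) (rboost y w) = lor y * lorB v w := by
  rw [rboost, lorB_boost (rboost_vec_ne hy), Real.sq_sqrt hy.1.le]

lemma lor_rboost {y : Fin n → ℝ} (hy : y ∈ cone n) (v : Fin n → ℝ) :
    lor (rboost y v) = lor y * lor v := by
  rw [lor_eq, lorB_rboost hy, ← lor_eq]

lemma rboost_rboost {y : Fin n → ℝ} (hy : y ∈ cone n) (v : Fin n → ℝ) :
    rboost y (rboost y v) = lor y • v := by
  rw [rboost, boost_boost (rboost_vec_ne hy), Real.sq_sqrt hy.1.le]

lemma rboost_mem_cone_iff {y : Fin n → ℝ} (hy : y ∈ cone n) {v : Fin n → ℝ} :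
    rboost y v ∈ cone n ↔ v ∈ cone n := by
  have h : ∀ {v}, v ∈ cone n → rboost y v ∈ cone n := by
    intro v hv
    apply mem_cone_of_lorB_pos hy
    · rw [lor_rboost hy]; exact mul_pos hy.1 hv.1
    · nth_rewrite 2 [← rboost_eVec hy]
      rw [lorB_rboost hy, lorB_eVec_right]; exact mul_pos hy.1 hv.2
  refine ⟨fun hv => ?_, h⟩
  have h1 := h hv
  rw [rboost_rboost hy] at h1
  have := cone_smul (inv_pos.2 hy.1) h1
  rwa [smul_smul, inv_mul_cancel₀ hy.1.ne', one_smul] at this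

lemma abs_det_rboost {y : Fin n → ℝ} (hy : y ∈ cone n) :
    |LinearMap.det (rboost y)| = lor y ^ ((n : ℝ) / 2) := by
  have h : rboost y * rboost y = lor y • (1 : Module.End ℝ (Fin n → ℝ)) := by
    ext1 v; ext i; simp [Module.End.mul_apply, rboost_rboost hy]
  have h2 := congrArg LinearMap.det h
  rw [map_mul, LinearMap.det_smul, map_one, mul_one, Module.finrank_pi, Fintype.card_fin] at h2
  rw [← abs_mul_abs_self] at h2
  have h3 : (lor y ^ ((n : ℝ) / 2)) * (lor y ^ ((n : ℝ) / 2)) = lor y ^ n := by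
    rw [← Real.rpow_add hy.1, add_halves, Real.rpow_natCast]
  exact (mul_self_inj (abs_nonneg _) (Real.rpow_nonneg hy.1.le _)).1 (h2.trans h3.symm)

lemma isOpen_cone : IsOpen (cone n) := by
  have : Continuous (lor : (Fin n → ℝ) → ℝ) := by unfold lor; fun_prop
  exact (isOpen_lt continuous_const this).inter (isOpen_lt continuous_const (continuous_apply 0))

end Lorentz

section Kernel

variable {n : ℕ} [NeZero n]

/-- Componentwise real part. -/
def reP (z : Fin n → ℂ) : Fin n → ℝ := fun i => (z i).re

/-- Componentwise inclusion of real vectors. -/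
def ofR (x : Fin n → ℝ) : Fin n → ℂ := fun i => (x i : ℂ)

/-- Componentwise conjugation. -/
def cj (z : Fin n → ℂ) : Fin n → ℂ := fun i => (starRingEnd ℂ) (z i)

/-- The base point `i e` of the tube. -/
def iE (n : ℕ) [NeZero n] : Fin n → ℂ := Complex.I • ofR (eVec n ℝ)

/-- The function `Δ(Im z)`. -/
def dl (z : Fin n → ℂ) : ℝ := lor (imP z)

/-- The sesqui-holomorphic function `Δ((z - w̄)/i)`. -/
def kb (z w : Fin n → ℂ) : ℂ := -lorC (z - cj w)

lemma reP_add_imP (z : Fin n → ℂ) : ofR (reP z) + Complex.I • ofR (imP z) = z := by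
  ext i; simp [ofR, reP, imP, mul_comm Complex.I, Complex.re_add_im]

lemma lorB_ofR (x y : Fin n → ℝ) : lorB (ofR x) (ofR y) = ((lorB x y : ℝ) : ℂ) := by
  simp [lorB, ofR]

lemma lorB_ofR_right (w : Fin n → ℂ) (y : Fin n → ℝ) :
    lorB w (ofR y) = ((lorB (reP w) y : ℝ) : ℂ) + Complex.I * ((lorB (imP w) y : ℝ) : ℂ) := by
  conv_lhs => rw [← reP_add_imP w]
  rw [lorB_add_left, lorB_smul_left, lorB_ofR, lorB_ofR]

lemma lorB_cj (z w : Fin n → ℂ) : lorB (cj z) (cj w) = (starRingEnd ℂ) (lorB z w) := by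
  simp only [lorB, cj, map_sub, map_mul, map_sum, Complex.conj_ofNat]

lemma lorC_cj (z : Fin n → ℂ) : lorC (cj z) = (starRingEnd ℂ) (lorC z) := by
  rw [lorC_eq, lorB_cj, lorC_eq]

@[simp] lemma cj_cj (z : Fin n → ℂ) : cj (cj z) = z := by ext i; simp [cj]

lemma cj_add (z w : Fin n → ℂ) : cj (z + w) = cj z + cj w := by ext i; simp [cj]

lemma cj_sub (z w : Fin n → ℂ) : cj (z - w) = cj z - cj w := by ext i; simp [cj]

lemma cj_iE : cj (iE n) = -iE n := by ext i; simp [cj, iE, ofR]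

lemma imP_add (z w : Fin n → ℂ) : imP (z + w) = imP z + imP w := by ext i; simp [imP]

lemma imP_cj (z : Fin n → ℂ) : imP (cj z) = -imP z := by ext i; simp [imP, cj]

lemma imP_sub (z w : Fin n → ℂ) : imP (z - w) = imP z - imP w := by ext i; simp [imP]

lemma imP_sub_cj (z w : Fin n → ℂ) : imP (z - cj w) = imP z + imP w := by
  rw [imP_sub, imP_cj, sub_neg_eq_add]

lemma imP_iE : imP (iE n) = eVec n ℝ := by ext i; simp [imP, iE, ofR]

lemma reP_iE : reP (iE n) = 0 := by ext i; simp [reP, iE, ofR]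

lemma iE_mem : iE n ∈ tube n := by
  show imP (iE n) ∈ cone n
  rw [imP_iE]; exact eVec_mem_cone

lemma dl_iE : dl (iE n) = 1 := by rw [dl, imP_iE, lor_eVec]

lemma dl_pos {z : Fin n → ℂ} (hz : z ∈ tube n) : 0 < dl z := hz.1

lemma sub_cj_mem {z w : Fin n → ℂ} (hz : z ∈ tube n) (hw : w ∈ tube n) : z - cj w ∈ tube n := by
  show imP _ ∈ cone n
  rw [imP_sub_cj]; exact cone_add hz hw

lemma add_iE_mem {z : Fin n → ℂ} (hz : z ∈ tube n) : z + iE n ∈ tube n := by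
  show imP _ ∈ cone n
  rw [imP_add, imP_iE]; exact cone_add hz eVec_mem_cone

lemma lorC_re_im (z : Fin n → ℂ) :
    lorC z = ((lor (reP z) - lor (imP z) : ℝ) : ℂ) + ((2 * lorB (reP z) (imP z) : ℝ) : ℂ) * I := by
  conv_lhs => rw [← reP_add_imP z]
  rw [lorC_add, lorC_smul, lorB_smul_right, lorB_ofR, lorC_eq, lorC_eq, lorB_ofR, lorB_ofR,
    ← lor_eq, ← lor_eq, I_sq]
  push_cast; ring

lemma lorC_re (z : Fin n → ℂ) : (lorC z).re = lor (reP z) - lor (imP z) := by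
  rw [lorC_re_im]; simp

lemma lorC_im (z : Fin n → ℂ) : (lorC z).im = 2 * lorB (reP z) (imP z) := by
  rw [lorC_re_im]; simp

lemma sq_norm_lorC (z : Fin n → ℂ) : ‖lorC z‖ ^ 2 =
    lor (imP z) ^ 2 + lor (reP z) ^ 2 - 2 * (lor (reP z) * lor (imP z))
      + 4 * lorB (reP z) (imP z) ^ 2 := by
  rw [Complex.sq_norm, Complex.normSq_apply, lorC_re, lorC_im]; ring

lemma neg_lorC_mem_slitPlane {z : Fin n → ℂ} (hz : z ∈ tube n) : -lorC z ∈ slitPlane := by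
  rw [mem_slitPlane_iff, neg_re, neg_im, lorC_re, lorC_im]
  by_cases h : lorB (reP z) (imP z) = 0
  · left
    have := lor_nonpos_of_orth hz h
    have := hz.1
    linarith
  · right; simpa using h

lemma dl_le_norm_lorC {z : Fin n → ℂ} (hz : z ∈ tube n) : dl z ≤ ‖lorC z‖ := by
  have h := lor_mul_lor_le hz (reP z)
  have h0 := hz.1
  apply le_of_sq_le_sq _ (norm_nonneg _)
  rw [sq_norm_lorC, dl]
  rcases le_total (lor (reP z)) 0 with h1 | h1
  · nlinarith [sq_nonneg (lor (reP z)), sq_nonneg (lorB (reP z) (imP z)),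
      mul_nonneg (neg_nonneg.2 h1) h0.le]
  · nlinarith [sq_nonneg (lor (reP z)), mul_nonneg h1 h0.le]

lemma kb_mem_slitPlane {z w : Fin n → ℂ} (hz : z ∈ tube n) (hw : w ∈ tube n) :
    kb z w ∈ slitPlane := neg_lorC_mem_slitPlane (sub_cj_mem hz hw)

lemma kb_ne_zero {z w : Fin n → ℂ} (hz : z ∈ tube n) (hw : w ∈ tube n) : kb z w ≠ 0 :=
  slitPlane_ne_zero (kb_mem_slitPlane hz hw)

lemma norm_kb_pos {z w : Fin n → ℂ} (hz : z ∈ tube n) (hw : w ∈ tube n) : 0 < ‖kb z w‖ :=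
  norm_pos_iff.2 (kb_ne_zero hz hw)

lemma lorC_neg (z : Fin n → ℂ) : lorC (-z) = lorC z := by
  rw [← neg_one_smul ℂ z, lorC_smul]; ring

lemma kb_conj (z w : Fin n → ℂ) : (starRingEnd ℂ) (kb z w) = kb w z := by
  rw [kb, kb, map_neg, ← lorC_cj, cj_sub, cj_cj, ← lorC_neg]; congr 2; abel

lemma norm_kb_comm (z w : Fin n → ℂ) : ‖kb z w‖ = ‖kb w z‖ := by
  rw [← kb_conj, RCLike.norm_conj]

lemma dl_le_norm_kb_left {z w : Fin n → ℂ} (hz : z ∈ tube n) (hw : w ∈ tube n) :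
    dl z ≤ ‖kb z w‖ := by
  rw [kb, norm_neg]
  refine le_trans ?_ (dl_le_norm_lorC (sub_cj_mem hz hw))
  rw [dl, dl, imP_sub_cj]; exact lor_le_lor_add hz hw

lemma dl_le_norm_kb_right {z w : Fin n → ℂ} (hz : z ∈ tube n) (hw : w ∈ tube n) :
    dl w ≤ ‖kb z w‖ := by
  rw [norm_kb_comm]; exact dl_le_norm_kb_left hw hz

lemma quad_aux {a N Y r X : ℝ} (hN : 0 ≤ N) (hr : 0 ≤ r) (hX : X ^ 2 ≤ r ^ 2 * N)
    (hY : r + 1 ≤ Y) : a ^ 2 + N ≤ 2 * (a * Y - X) ^ 2 - (Y ^ 2 - r ^ 2) * (a ^ 2 - N) := by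
  rcases hr.eq_or_lt with h | h
  · subst h
    have : X = 0 := by nlinarith
    subst this
    nlinarith [mul_nonneg hN (by nlinarith : 0 ≤ Y ^ 2 - 1), sq_nonneg a,
      mul_nonneg (sq_nonneg a) (by nlinarith : 0 ≤ Y ^ 2 - 1)]
  · obtain ⟨t, rfl⟩ : ∃ t, X = r * t := ⟨X / r, by field_simp⟩
    obtain ⟨d, rfl⟩ : ∃ d, N = t ^ 2 + d := ⟨N - t ^ 2, by ring⟩
    have hd : 0 ≤ d := by
      have : 0 ≤ r ^ 2 * d := by nlinarith
      exact nonneg_of_mul_nonneg_right this (by positivity)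
    have h1 : 0 ≤ (Y - r) ^ 2 - 1 := by nlinarith
    have h2 : 0 ≤ Y ^ 2 - r ^ 2 - 1 := by nlinarith
    nlinarith [mul_nonneg h1 (add_nonneg (sq_nonneg a) (sq_nonneg t)), mul_nonneg h2 hd,
      mul_nonneg (mul_nonneg (by linarith : 0 ≤ Y) h.le) (sq_nonneg (a - t))]

lemma sum_sq_le_quad {y : Fin n → ℝ} (hy : y ∈ cone n) (x : Fin n → ℝ) :
    ∑ i, x i ^ 2 ≤ 2 * lorB x (y + eVec n ℝ) ^ 2 - lor (y + eVec n ℝ) * lor x := by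
  set Y := y + eVec n ℝ with hYd
  set S := Finset.univ.erase (0 : Fin n)
  have hs : ∀ f : Fin n → ℝ, ∑ i, f i = f 0 + ∑ i ∈ S, f i := fun f =>
    (Finset.add_sum_erase _ _ (Finset.mem_univ _)).symm
  have hY0 : Y 0 = y 0 + 1 := by simp [hYd]
  have hYi : ∀ i ∈ S, Y i = y i := by
    intro i hi
    have : i ≠ 0 := (Finset.mem_erase.1 hi).1
    simp [hYd, eVec, this]
  have hρ : ∑ i ∈ S, Y i ^ 2 = ∑ i ∈ S, y i ^ 2 :=
    Finset.sum_congr rfl fun i hi => by rw [hYi i hi]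
  have hlt : ∑ i ∈ S, y i ^ 2 < y 0 ^ 2 := by
    have := cone_sum_sq hy
    rw [hs] at this; linarith
  have hnn : 0 ≤ ∑ i ∈ S, Y i ^ 2 := Finset.sum_nonneg fun i _ => sq_nonneg _
  have hsq := Real.sq_sqrt hnn
  have hcs := Finset.sum_mul_sq_le_sq_mul_sq S x Y
  have key := quad_aux (a := x 0) (N := ∑ i ∈ S, x i ^ 2) (Y := Y 0)
    (r := √(∑ i ∈ S, Y i ^ 2)) (X := ∑ i ∈ S, x i * Y i)
    (Finset.sum_nonneg fun i _ => sq_nonneg _) (Real.sqrt_nonneg _)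
    (by rw [hsq]; linarith) (by
      rw [hY0]
      have : √(∑ i ∈ S, Y i ^ 2) ≤ y 0 := by
        rw [hρ]; exact Real.sqrt_le_iff.2 ⟨hy.2.le, hlt.le⟩
      linarith)
  rw [hsq] at key
  simp only [lor, lorB, hs]
  linarith

lemma one_add_norm_le {z : Fin n → ℂ} (hz : z ∈ tube n) : 1 + ‖z‖ ≤ 4 * ‖lorC (z + iE n)‖ := by
  set b := ‖lorC (z + iE n)‖
  have hre : reP (z + iE n) = reP z := by ext i; simp [reP, iE, ofR]
  have him : imP (z + iE n) = imP z + eVec n ℝ := by rw [imP_add, imP_iE]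
  have hb := sq_norm_lorC (z + iE n)
  rw [hre, him] at hb
  have hq := sum_sq_le_quad hz (reP z)
  have hd := dl_le_norm_lorC (add_iE_mem hz)
  have hb0 : 0 ≤ b := norm_nonneg _
  have h2 : 1 + 2 * imP z 0 ≤ b := by
    rw [dl, him, lor_add, lor_eVec, lorB_eVec_right] at hd
    linarith [hz.1]
  have hx : ∑ i, reP z i ^ 2 ≤ b ^ 2 := by
    have : 0 ≤ lor (imP z + eVec n ℝ) ^ 2 := sq_nonneg _
    have := sq_nonneg (lor (reP z))
    have := Finset.sum_nonneg (s := Finset.univ) fun i _ => sq_nonneg (reP z i)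
    show _ ≤ ‖lorC (z + iE n)‖ ^ 2
    linarith
  have hy := cone_sum_sq hz
  have hz0 : 0 < imP z 0 := hz.2
  have hn : ‖z‖ ≤ 3 * b := by
    rw [pi_norm_le_iff_of_nonneg (by positivity)]
    intro i
    have h3 : |reP z i| ≤ b := by
      apply abs_le_of_sq_le_sq _ hb0
      exact (Finset.single_le_sum (f := fun i => reP z i ^ 2) (fun i _ => sq_nonneg _)
        (Finset.mem_univ i)).trans hx
    have h4 : |imP z i| ≤ 2 * imP z 0 := by
      apply abs_le_of_sq_le_sq _ (by linarith)
      have := (Finset.single_le_sum (f := fun i => imP z i ^ 2) (fun i _ => sq_nonneg _)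
        (Finset.mem_univ i)).trans hy.le
      nlinarith
    have h5 := Complex.norm_le_abs_re_add_abs_im (z i)
    have : |(z i).re| = |reP z i| := rfl
    have : |(z i).im| = |imP z i| := rfl
    linarith
  linarith

lemma norm_lorB_le (z w : Fin n → ℂ) : ‖lorB z w‖ ≤ (n + 2) * ‖z‖ * ‖w‖ := by
  have h1 : ∀ i, ‖z i * w i‖ ≤ ‖z‖ * ‖w‖ := fun i => by
    rw [norm_mul]; gcongr <;> exact norm_le_pi_norm _ _
  have h2 : ‖∑ i, z i * w i‖ ≤ n * (‖z‖ * ‖w‖) := by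
    calc _ ≤ ∑ i : Fin n, ‖z‖ * ‖w‖ := norm_sum_le_of_le _ fun i _ => h1 i
      _ = _ := by simp
  calc ‖lorB z w‖ ≤ ‖2 * (z 0 * w 0)‖ + ‖∑ i, z i * w i‖ := norm_sub_le _ _
    _ ≤ 2 * (‖z‖ * ‖w‖) + n * (‖z‖ * ‖w‖) := by
      rw [norm_mul, Complex.norm_ofNat]; gcongr; exact h1 0
    _ = _ := by ring

lemma norm_iE_le : ‖iE n‖ ≤ 1 := by
  rw [pi_norm_le_iff_of_nonneg zero_le_one]
  intro i
  by_cases h : i = 0 <;> simp [iE, ofR, eVec, h]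

lemma kb_iE_right (z : Fin n → ℂ) : kb z (iE n) = -lorC (z + iE n) := by
  rw [kb, cj_iE, sub_neg_eq_add]

lemma norm_cj (z : Fin n → ℂ) : ‖cj z‖ = ‖z‖ := by
  simp only [Pi.norm_def]
  congr 1
  apply Finset.sup_congr rfl
  intro i _
  ext; simp [cj]

lemma one_add_norm_le_kb {z : Fin n → ℂ} (hz : z ∈ tube n) : 1 + ‖z‖ ≤ 4 * ‖kb z (iE n)‖ := by
  rw [kb_iE_right, norm_neg]; exact one_add_norm_le hz

lemma one_le_norm_kb_iE {z : Fin n → ℂ} (hz : z ∈ tube n) : 1 ≤ ‖kb z (iE n)‖ := by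
  have := dl_le_norm_kb_right hz iE_mem
  rwa [dl_iE] at this

/-- The constant in the triangle-type inequality for `kb`. -/
def triC (n : ℕ) : ℝ := 1 + 48 * (n + 2)

lemma triC_pos : 0 < triC n := by unfold triC; positivity

lemma norm_kb_le_base {z v : Fin n → ℂ} (hz : z ∈ tube n) (hv : v ∈ tube n) :
    ‖kb z v‖ ≤ triC n * (‖kb z (iE n)‖ * ‖kb v (iE n)‖ ^ 2) := by
  set D := ‖kb z (iE n)‖ with hD
  set D' := ‖kb v (iE n)‖ with hD'
  have h1 : 1 ≤ D := one_le_norm_kb_iE hz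
  have h2 : 1 ≤ D' := one_le_norm_kb_iE hv
  have h3 := one_add_norm_le_kb hz
  have h4 := one_add_norm_le_kb hv
  have hni := norm_iE_le (n := n)
  have e : z - cj v = (z + iE n) + (-(cj v + iE n)) := by abel
  have ha : ‖z + iE n‖ ≤ 4 * D := (norm_add_le _ _).trans (by linarith)
  have hb : ‖cj v + iE n‖ ≤ 4 * D' := (norm_add_le _ _).trans (by rw [norm_cj]; linarith)
  have e1 : ‖lorC (z + iE n)‖ = D := by rw [hD, kb_iE_right, norm_neg]
  rw [kb, norm_neg, e, lorC_add, lorC_neg, lorB_neg_right]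
  have h5 : ‖lorB (z + iE n) (cj v + iE n)‖ ≤ (n + 2) * (4 * D) * (4 * D') :=
    (norm_lorB_le _ _).trans (by gcongr)
  have h6 : ‖lorC (cj v + iE n)‖ ≤ (n + 2) * (4 * D') * (4 * D') := by
    rw [lorC_eq]; exact (norm_lorB_le _ _).trans (by gcongr)
  calc _ ≤ ‖lorC (z + iE n) + 2 * -lorB (z + iE n) (cj v + iE n)‖ + ‖lorC (cj v + iE n)‖ :=
        norm_add_le _ _
    _ ≤ ‖lorC (z + iE n)‖ + ‖2 * -lorB (z + iE n) (cj v + iE n)‖ + ‖lorC (cj v + iE n)‖ := by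
        gcongr; exact norm_add_le _ _
    _ ≤ D + 2 * ((n + 2) * (4 * D) * (4 * D')) + (n + 2) * (4 * D') * (4 * D') := by
        rw [e1, norm_mul, norm_neg, Complex.norm_ofNat]; gcongr
    _ ≤ triC n * (D * D' ^ 2) := by
        have h7 : D ≤ D * D' ^ 2 := le_mul_of_one_le_right (by linarith) (one_le_pow₀ h2)
        have h8 : D * D' ≤ D * D' ^ 2 := by gcongr; nlinarith
        have h9 : D' * D' ≤ D * D' ^ 2 := by
          rw [← sq]; exact le_mul_of_one_le_left (by positivity) h1
        have hn : (0 : ℝ) ≤ n + 2 := by positivity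
        unfold triC
        nlinarith [mul_le_mul_of_nonneg_left h8 hn, mul_le_mul_of_nonneg_left h9 hn]

/-- The complex-linear extension of `rboost`. -/
def cboost (y : Fin n → ℝ) : (Fin n → ℂ) →ₗ[ℂ] (Fin n → ℂ) :=
  boost (√(lor y) : ℂ) (ofR ((√(lor y)) • eVec n ℝ + y))

lemma reP_cboost (y : Fin n → ℝ) (w : Fin n → ℂ) : reP (cboost y w) = rboost y (reP w) := by
  ext i
  rw [cboost, rboost, boost_apply, boost_apply, lorB_ofR, lorB_ofR_right]
  simp only [reP, Pi.add_apply, Pi.smul_apply, smul_eq_mul, ofR, Complex.add_re,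
    Complex.re_mul_ofReal, ← Complex.ofReal_neg, Complex.re_ofReal_mul, Complex.div_ofReal_re]
  congr 2
  rw [show (2 : ℂ) = ((2 : ℝ) : ℂ) by norm_num, ← Complex.ofReal_mul, Complex.re_ofReal_mul]
  simp

lemma imP_cboost (y : Fin n → ℝ) (w : Fin n → ℂ) : imP (cboost y w) = rboost y (imP w) := by
  ext i
  rw [cboost, rboost, boost_apply, boost_apply, lorB_ofR, lorB_ofR_right]
  simp only [imP, Pi.add_apply, Pi.smul_apply, smul_eq_mul, ofR, Complex.add_im,
    Complex.im_mul_ofReal, ← Complex.ofReal_neg, Complex.im_ofReal_mul, Complex.div_ofReal_im]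
  congr 2
  rw [show (2 : ℂ) = ((2 : ℝ) : ℂ) by norm_num, ← Complex.ofReal_mul, Complex.im_ofReal_mul]
  simp

lemma ext_reP_imP {z w : Fin n → ℂ} (h1 : reP z = reP w) (h2 : imP z = imP w) : z = w := by
  rw [← reP_add_imP z, ← reP_add_imP w, h1, h2]

lemma reP_cj (z : Fin n → ℂ) : reP (cj z) = reP z := by ext i; simp [reP, cj]

lemma reP_ofR (x : Fin n → ℝ) : reP (ofR x) = x := by ext i; simp [reP, ofR]

lemma imP_ofR (x : Fin n → ℝ) : imP (ofR x) = 0 := by ext i; simp [imP, ofR]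

lemma reP_add (z w : Fin n → ℂ) : reP (z + w) = reP z + reP w := by ext i; simp [reP]

lemma cj_cboost (y : Fin n → ℝ) (w : Fin n → ℂ) : cj (cboost y w) = cboost y (cj w) := by
  apply ext_reP_imP
  · rw [reP_cj, reP_cboost, reP_cboost, reP_cj]
  · rw [imP_cj, imP_cboost, imP_cboost, imP_cj, map_neg]

lemma lorB_cboost {y : Fin n → ℝ} (hy : y ∈ cone n) (v w : Fin n → ℂ) :
    lorB (cboost y v) (cboost y w) = lor y * lorB v w := by
  rw [cboost, lorB_boost, ← Complex.ofReal_pow, Real.sq_sqrt hy.1.le]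
  rw [lorB_ofR]; exact_mod_cast rboost_vec_ne hy

lemma cboost_cboost {y : Fin n → ℝ} (hy : y ∈ cone n) (v : Fin n → ℂ) :
    cboost y (cboost y v) = (lor y : ℂ) • v := by
  rw [cboost, boost_boost, ← Complex.ofReal_pow, Real.sq_sqrt hy.1.le]
  rw [lorB_ofR]; exact_mod_cast rboost_vec_ne hy

/-- The affine automorphism of the tube sending `iE` to `z`. -/
def aff (z w : Fin n → ℂ) : Fin n → ℂ := cboost (imP z) w + ofR (reP z)

lemma imP_aff (z w : Fin n → ℂ) : imP (aff z w) = rboost (imP z) (imP w) := by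
  rw [aff, imP_add, imP_cboost, imP_ofR, add_zero]

lemma aff_mem_iff {z w : Fin n → ℂ} (hz : z ∈ tube n) : aff z w ∈ tube n ↔ w ∈ tube n := by
  show imP (aff z w) ∈ cone n ↔ imP w ∈ cone n
  rw [imP_aff, rboost_mem_cone_iff hz]

lemma aff_iE {z : Fin n → ℂ} (hz : z ∈ tube n) : aff z (iE n) = z := by
  apply ext_reP_imP
  · rw [aff, reP_add, reP_cboost, reP_ofR, reP_iE, map_zero, zero_add]
  · rw [imP_aff, imP_iE, rboost_eVec hz]

lemma dl_aff {z : Fin n → ℂ} (hz : z ∈ tube n) (w : Fin n → ℂ) :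
    dl (aff z w) = dl z * dl w := by
  rw [dl, imP_aff, lor_rboost hz, dl, dl]

lemma kb_aff {z : Fin n → ℂ} (hz : z ∈ tube n) (v w : Fin n → ℂ) :
    kb (aff z v) (aff z w) = dl z * kb v w := by
  have : aff z v - cj (aff z w) = cboost (imP z) (v - cj w) := by
    rw [aff, aff, cj_add, cj_cboost, map_sub]
    have : cj (ofR (reP z)) = ofR (reP z) := by ext i; simp [cj, ofR]
    rw [this]; abel
  rw [kb, this, lorC_eq, lorB_cboost hz, kb, lorC_eq, dl]; ring

/-- The affine inverse of `aff z`. -/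
def affInv (z w : Fin n → ℂ) : Fin n → ℂ :=
  ((dl z)⁻¹ : ℂ) • cboost (imP z) (w - ofR (reP z))

lemma aff_affInv {z : Fin n → ℂ} (hz : z ∈ tube n) (w : Fin n → ℂ) : aff z (affInv z w) = w := by
  have : (lor (imP z) : ℂ) ≠ 0 := by exact_mod_cast hz.1.ne'
  rw [aff, affInv, map_smul, cboost_cboost hz, smul_smul, dl, inv_mul_cancel₀ this, one_smul,
    sub_add_cancel]

lemma affInv_mem {z w : Fin n → ℂ} (hz : z ∈ tube n) (hw : w ∈ tube n) : affInv z w ∈ tube n := by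
  rw [← aff_mem_iff hz, aff_affInv hz]; exact hw

lemma norm_kb_le {z v w : Fin n → ℂ} (hz : z ∈ tube n) (hv : v ∈ tube n) (hw : w ∈ tube n) :
    ‖kb z v‖ * dl w ^ 2 ≤ triC n * (‖kb z w‖ * ‖kb v w‖ ^ 2) := by
  have h0 := dl_pos hw
  have h := norm_kb_le_base (affInv_mem hw hz) (affInv_mem hw hv)
  have e1 : ‖kb z v‖ = dl w * ‖kb (affInv w z) (affInv w v)‖ := by
    conv_lhs => rw [← aff_affInv hw z, ← aff_affInv hw v, kb_aff hw]
    rw [norm_mul, Complex.norm_real, Real.norm_of_nonneg h0.le]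
  have e2 : ∀ u, ‖kb u w‖ = dl w * ‖kb (affInv w u) (iE n)‖ := by
    intro u
    have : kb u w = kb (aff w (affInv w u)) (aff w (iE n)) := by
      rw [aff_affInv hw, aff_iE hw]
    rw [this, kb_aff hw]
    rw [norm_mul, Complex.norm_real, Real.norm_of_nonneg h0.le]
  rw [e1, e2 z, e2 v]
  have := mul_le_mul_of_nonneg_left h (by positivity : 0 ≤ dl w ^ 3)
  nlinarith

lemma isOpen_tube : IsOpen (tube n) := by
  have : Continuous (imP : (Fin n → ℂ) → Fin n → ℝ) := by unfold imP; fun_prop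
  exact isOpen_cone.preimage this

lemma measurableSet_tube : MeasurableSet (tube n) := isOpen_tube.measurableSet

lemma continuous_imP : Continuous (imP : (Fin n → ℂ) → Fin n → ℝ) := by unfold imP; fun_prop

lemma continuous_dl : Continuous (dl : (Fin n → ℂ) → ℝ) := by unfold dl lor imP; fun_prop

lemma continuous_kb : Continuous fun p : (Fin n → ℂ) × (Fin n → ℂ) => kb p.1 p.2 := by
  unfold kb lorC cj
  simp only [Pi.sub_apply]
  fun_prop

/-- The power `Δ((z - w̄)/i)^{-s}`. -/
def Ks (s : ℝ) (z w : Fin n → ℂ) : ℂ := kb z w ^ ((-s : ℝ) : ℂ)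

lemma norm_Ks (s : ℝ) (z w : Fin n → ℂ) : ‖Ks s z w‖ = ‖kb z w‖ ^ (-s) := by
  rw [Ks, Complex.norm_cpow_real]

lemma Ks_conj (s : ℝ) {z w : Fin n → ℂ} (hz : z ∈ tube n) (hw : w ∈ tube n) :
    (starRingEnd ℂ) (Ks s z w) = Ks s w z := by
  rw [Ks, Ks, ← kb_conj z w, Complex.conj_cpow _ _ (slitPlane_arg_ne_pi (kb_mem_slitPlane hz hw)),
    Complex.conj_ofReal]

lemma measurable_Ks (s : ℝ) : Measurable fun p : (Fin n → ℂ) × (Fin n → ℂ) => Ks s p.1 p.2 :=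
  continuous_kb.measurable.pow_const _

end Kernel

section ForelliRudin

lemma lintegral_comp_linear {V : Type*} [NormedAddCommGroup V] [NormedSpace ℝ V]
    [MeasurableSpace V] [BorelSpace V] [FiniteDimensional ℝ V] (μ : Measure V)
    [μ.IsAddHaarMeasure] {L : V →ₗ[ℝ] V} (hL : LinearMap.det L ≠ 0) {f : V → ℝ≥0∞}
    (hf : Measurable f) :
    ∫⁻ x, f x ∂μ = ENNReal.ofReal |LinearMap.det L| * ∫⁻ x, f (L x) ∂μ := by
  have hLm : Measurable L := (LinearMap.continuous_of_finiteDimensional L).measurable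
  rw [← lintegral_map hf hLm, Measure.map_linearMap_addHaar_eq_smul_addHaar μ hL,
    lintegral_smul_measure, smul_eq_mul, ← mul_assoc, ← ENNReal.ofReal_mul (abs_nonneg _),
    ← abs_mul, mul_inv_cancel₀ hL, abs_one, ENNReal.ofReal_one, one_mul]

lemma lintegral_comp_smul_real {V : Type*} [NormedAddCommGroup V] [NormedSpace ℝ V]
    [MeasurableSpace V] [BorelSpace V] [FiniteDimensional ℝ V] (μ : Measure V)
    [μ.IsAddHaarMeasure] {c : ℝ} (hc : 0 < c) {f : V → ℝ≥0∞}
    (hf : Measurable f) :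
    ∫⁻ x, f x ∂μ = ENNReal.ofReal (c ^ Module.finrank ℝ V) * ∫⁻ x, f (c • x) ∂μ := by
  have h : LinearMap.det (c • (LinearMap.id : V →ₗ[ℝ] V)) = c ^ Module.finrank ℝ V := by
    rw [LinearMap.det_smul, LinearMap.det_id, mul_one]
  have := lintegral_comp_linear μ (L := c • LinearMap.id) (by rw [h]; positivity) hf
  rw [h, abs_of_pos (by positivity)] at this
  simpa using this

/-- Real and imaginary parts as a measurable equivalence. -/
def reImEquiv (n : ℕ) : (Fin n → ℂ) ≃ᵐ (Fin n → ℝ) × (Fin n → ℝ) :=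
  (MeasurableEquiv.piCongrRight fun _ => Complex.measurableEquivRealProd).trans
    (MeasurableEquiv.arrowProdEquivProdArrow ℝ ℝ (Fin n))

lemma reImEquiv_mp (n : ℕ) : MeasurePreserving (reImEquiv n) volume volume :=
  (volume_measurePreserving_arrowProdEquivProdArrow ℝ ℝ (Fin n)).comp
    (volume_preserving_pi fun _ => Complex.volume_preserving_equiv_real_prod)

lemma reImEquiv_apply {n : ℕ} [NeZero n] (z : Fin n → ℂ) : reImEquiv n z = (reP z, imP z) := rfl

lemma lintegral_reIm {n : ℕ} [NeZero n] {f : (Fin n → ℂ) → ℝ≥0∞} (hf : Measurable f) :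
    ∫⁻ z, f z = ∫⁻ y, ∫⁻ x, f (ofR x + Complex.I • ofR y) := by
  have h := (reImEquiv_mp n).lintegral_comp_emb (reImEquiv n).measurableEmbedding
    (fun p => f (ofR p.1 + Complex.I • ofR p.2))
  have hm : Measurable fun p : (Fin n → ℝ) × (Fin n → ℝ) => f (ofR p.1 + Complex.I • ofR p.2) :=
    hf.comp (Continuous.measurable (by unfold ofR; fun_prop))
  simp only [reImEquiv_apply, reP_add_imP] at h
  rw [h, Measure.volume_eq_prod, lintegral_prod_symm' _ hm]

/-- Cons of two scalars and a vector. -/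
def vcons {k : ℕ} (a b : ℝ) (x : Fin k → ℝ) : Fin (k + 2) → ℝ :=
  Fin.cons a (Fin.cons b x : Fin (k + 1) → ℝ)

lemma measurable_vcons {k : ℕ} :
    Measurable fun p : ℝ × ℝ × (Fin k → ℝ) => vcons p.1 p.2.1 p.2.2 := by
  rw [measurable_pi_iff]
  intro i
  refine Fin.cases ?_ (fun j => ?_) i
  · simpa [vcons] using measurable_fst
  · refine Fin.cases ?_ (fun l => ?_) j
    · simpa [vcons] using measurable_snd.fst
    · simp only [vcons, Fin.cons_succ]
      exact (measurable_pi_apply l).comp measurable_snd.snd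

lemma lintegral_cons {k : ℕ} {f : (Fin (k + 1) → ℝ) → ℝ≥0∞} (hf : Measurable f) :
    ∫⁻ y, f y = ∫⁻ a : ℝ, ∫⁻ x : Fin k → ℝ, f (Fin.cons a x : Fin (k + 1) → ℝ) := by
  have hmp := (volume_preserving_piFinSuccAbove (fun _ : Fin (k + 1) => ℝ) 0).symm
  have h := hmp.lintegral_comp_emb (MeasurableEquiv.measurableEmbedding _) f
  rw [← h, Measure.volume_eq_prod, lintegral_prod (fun p =>
    f ((MeasurableEquiv.piFinSuccAbove (fun _ => ℝ) 0).symm p))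
    (hf.comp (MeasurableEquiv.measurable _)).aemeasurable]
  refine lintegral_congr fun a => lintegral_congr fun x => ?_
  congr 1
  simp [MeasurableEquiv.piFinSuccAbove, Fin.insertNthEquiv]

lemma lintegral_vcons {k : ℕ} {f : (Fin (k + 2) → ℝ) → ℝ≥0∞} (hf : Measurable f) :
    ∫⁻ y, f y = ∫⁻ a : ℝ, ∫⁻ b : ℝ, ∫⁻ x : Fin k → ℝ, f (vcons a b x) := by
  rw [lintegral_cons hf]
  refine lintegral_congr fun a => ?_
  rw [lintegral_cons]
  · rfl
  · apply hf.comp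
    rw [measurable_pi_iff]
    intro i
    refine Fin.cases ?_ (fun j => ?_) i
    · simp
    · simpa using measurable_pi_apply j

/-- Light-cone coordinates: `u = y₀ + y₁`, `c = Δ(y)/u`. -/
def lcone {k : ℕ} (u c : ℝ) (x : Fin k → ℝ) : Fin (k + 2) → ℝ :=
  vcons ((u + (c + (∑ i, x i ^ 2) / u)) / 2) ((u - (c + (∑ i, x i ^ 2) / u)) / 2) x

lemma measurable_lcone {k : ℕ} :
    Measurable fun p : ℝ × ℝ × (Fin k → ℝ) => lcone p.1 p.2.1 p.2.2 := by
  have h : Measurable fun p : ℝ × ℝ × (Fin k → ℝ) =>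
      ((p.1 + (p.2.1 + (∑ i, p.2.2 i ^ 2) / p.1)) / 2,
        (p.1 - (p.2.1 + (∑ i, p.2.2 i ^ 2) / p.1)) / 2, p.2.2) := by fun_prop
  exact measurable_vcons.comp h

lemma lintegral_affine_real {g : ℝ → ℝ≥0∞} (hg : Measurable g) (a : ℝ) :
    ∫⁻ b, g b = ENNReal.ofReal (1 / 2) * ∫⁻ c, g ((a - c) / 2) := by
  rw [lintegral_comp_smul_real volume (c := 1 / 2) (by norm_num) hg]
  simp only [Module.finrank_self, pow_one]
  congr 1
  rw [← lintegral_sub_left_eq_self _ a]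
  refine lintegral_congr fun c => ?_
  congr 1
  simp; ring

lemma lintegral_lcone {k : ℕ} {f : (Fin (k + 2) → ℝ) → ℝ≥0∞} (hf : Measurable f) :
    ∫⁻ y, f y = ENNReal.ofReal (1 / 2) *
      ∫⁻ u : ℝ, ∫⁻ c : ℝ, ∫⁻ x : Fin k → ℝ, f (lcone u c x) := by
  have h1 : Measurable fun p : ℝ × ℝ × (Fin k → ℝ) => f (vcons p.1 p.2.1 p.2.2) :=
    hf.comp measurable_vcons
  have h1' : Measurable fun p : ℝ × ℝ × (Fin k → ℝ) => f (vcons (p.1 - p.2.1) p.2.1 p.2.2) :=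
    h1.comp (f := fun p : ℝ × ℝ × (Fin k → ℝ) => (p.1 - p.2.1, p.2.1, p.2.2)) (by fun_prop)
  have h2 : Measurable fun p : ℝ × ℝ × (Fin k → ℝ) => f (lcone p.1 p.2.1 p.2.2) :=
    hf.comp measurable_lcone
  rw [lintegral_vcons hf]
  calc ∫⁻ a : ℝ, ∫⁻ b : ℝ, ∫⁻ x : Fin k → ℝ, f (vcons a b x)
      = ∫⁻ b : ℝ, ∫⁻ a : ℝ, ∫⁻ x : Fin k → ℝ, f (vcons a b x) := by
        apply lintegral_lintegral_swap
        apply Measurable.aemeasurable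
        refine Measurable.lintegral_prod_right' (f := fun p : (ℝ × ℝ) × (Fin k → ℝ) =>
          f (vcons p.1.1 p.1.2 p.2)) ?_
        exact h1.comp (f := fun p : (ℝ × ℝ) × (Fin k → ℝ) => (p.1.1, p.1.2, p.2)) (by fun_prop)
    _ = ∫⁻ b : ℝ, ∫⁻ u : ℝ, ∫⁻ x : Fin k → ℝ, f (vcons (u - b) b x) := by
        refine lintegral_congr fun b => ?_
        rw [← lintegral_sub_right_eq_self _ b]
    _ = ∫⁻ u : ℝ, ∫⁻ b : ℝ, ∫⁻ x : Fin k → ℝ, f (vcons (u - b) b x) := by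
        apply lintegral_lintegral_swap
        apply Measurable.aemeasurable
        refine Measurable.lintegral_prod_right' (f := fun p : (ℝ × ℝ) × (Fin k → ℝ) =>
          f (vcons (p.1.2 - p.1.1) p.1.1 p.2)) ?_
        exact h1'.comp (f := fun p : (ℝ × ℝ) × (Fin k → ℝ) => (p.1.2, p.1.1, p.2)) (by fun_prop)
    _ = ∫⁻ u : ℝ, ∫⁻ x : Fin k → ℝ, ∫⁻ b : ℝ, f (vcons (u - b) b x) := by
        refine lintegral_congr fun u => ?_
        apply lintegral_lintegral_swap
        apply Measurable.aemeasurable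
        exact h1'.comp (f := fun p : ℝ × (Fin k → ℝ) => (u, p.1, p.2)) (by fun_prop)
    _ = ∫⁻ u : ℝ, ∫⁻ x : Fin k → ℝ, ENNReal.ofReal (1 / 2) * ∫⁻ c : ℝ, f (lcone u c x) := by
        refine lintegral_congr fun u => lintegral_congr fun x => ?_
        rw [lintegral_affine_real (g := fun b => f (vcons (u - b) b x))
          (h1'.comp (f := fun b : ℝ => (u, b, x)) (by fun_prop)) (u - (∑ i, x i ^ 2) / u)]
        congr 1
        refine lintegral_congr fun c => ?_
        simp only [lcone]
        congr 2 <;> ring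
    _ = ∫⁻ u : ℝ, ENNReal.ofReal (1 / 2) * ∫⁻ c : ℝ, ∫⁻ x : Fin k → ℝ, f (lcone u c x) := by
        refine lintegral_congr fun u => ?_
        rw [lintegral_const_mul' _ _ ENNReal.ofReal_ne_top, lintegral_lintegral_swap]
        apply Measurable.aemeasurable
        exact h2.comp (f := fun p : (Fin k → ℝ) × ℝ => (u, p.2, p.1)) (by fun_prop)
    _ = _ := lintegral_const_mul' _ _ ENNReal.ofReal_ne_top

variable {n : ℕ} [NeZero n]

/-- The `x`-integral of the kernel at the base point. -/
def fibC (n : ℕ) [NeZero n] (a : ℝ) : ℝ≥0∞ :=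
  ∫⁻ x : Fin n → ℝ, ENNReal.ofReal (‖lorC (ofR x + Complex.I • ofR (eVec n ℝ))‖ ^ (-a))

lemma continuous_lorC : Continuous (lorC : (Fin n → ℂ) → ℂ) := by unfold lorC; fun_prop

lemma continuous_ofR : Continuous (ofR : (Fin n → ℝ) → Fin n → ℂ) := by unfold ofR; fun_prop

lemma fibC_integral {Y : Fin n → ℝ} (hY : Y ∈ cone n) (a : ℝ) :
    ∫⁻ x : Fin n → ℝ, ENNReal.ofReal (‖lorC (ofR x + Complex.I • ofR Y)‖ ^ (-a)) =
      fibC n a * ENNReal.ofReal (lor Y ^ ((n : ℝ) / 2 - a)) := by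
  have hm : Measurable fun x : Fin n → ℝ =>
      ENNReal.ofReal (‖lorC (ofR x + Complex.I • ofR Y)‖ ^ (-a)) := by
    apply Measurable.ennreal_ofReal
    apply Measurable.pow_const
    exact (continuous_lorC.comp (continuous_ofR.add continuous_const)).norm.measurable
  have hd := abs_det_rboost hY
  have hp : 0 < lor Y ^ ((n : ℝ) / 2) := Real.rpow_pos_of_pos hY.1 _
  rw [lintegral_comp_linear volume (L := rboost Y) (by rw [← abs_pos, hd]; exact hp) hm, hd, fibC]
  have : ∀ x : Fin n → ℝ, ofR (rboost Y x) + Complex.I • ofR Y =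
      cboost Y (ofR x + Complex.I • ofR (eVec n ℝ)) := by
    intro x
    apply ext_reP_imP
    · rw [reP_cboost]
      have h1 : ∀ u v : Fin n → ℝ, reP (ofR u + Complex.I • ofR v) = u := by
        intro u v; ext i; simp [reP, ofR]
      rw [h1, h1]
    · rw [imP_cboost]
      have h1 : ∀ u v : Fin n → ℝ, imP (ofR u + Complex.I • ofR v) = v := by
        intro u v; ext i; simp [imP, ofR]
      rw [h1, h1, rboost_eVec hY]
  simp_rw [this]
  have h2 : ∀ w : Fin n → ℂ, ENNReal.ofReal (‖lorC (cboost Y w)‖ ^ (-a)) =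
      ENNReal.ofReal (‖lorC w‖ ^ (-a)) * ENNReal.ofReal (lor Y ^ (-a)) := by
    intro w
    rw [← ENNReal.ofReal_mul (by positivity), lorC_eq, lorB_cboost hY, ← lorC_eq, norm_mul,
      Complex.norm_real, Real.norm_of_nonneg hY.1.le,
      Real.mul_rpow hY.1.le (norm_nonneg _), mul_comm]
  simp_rw [h2]
  rw [lintegral_mul_const' _ _ ENNReal.ofReal_ne_top, mul_left_comm, ← ENNReal.ofReal_mul hp.le,
    ← Real.rpow_add hY.1]
  rfl

lemma fibC_lt_top {a : ℝ} (ha : (n : ℝ) < a) : fibC n a < ⊤ := by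
  have h := (integrable_rpow_neg_one_add_norm_sq (E := Fin n → ℝ) (μ := volume) (r := a)
    (by simpa using ha)).lintegral_lt_top
  refine lt_of_le_of_lt (lintegral_mono fun x => ENNReal.ofReal_le_ofReal ?_) h
  have h0 : (0 : ℝ) < 1 + ‖x‖ ^ 2 := by positivity
  have h1 : 1 + ‖x‖ ^ 2 ≤ ‖lorC (ofR x + Complex.I • ofR (eVec n ℝ))‖ ^ 2 := by
    rw [sq_norm_lorC]
    have hr : reP (ofR x + Complex.I • ofR (eVec n ℝ)) = x := by ext i; simp [reP, ofR]
    have hi : imP (ofR x + Complex.I • ofR (eVec n ℝ)) = eVec n ℝ := by ext i; simp [imP, ofR]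
    rw [hr, hi, lor_eVec, lorB_eVec_right]
    have hx : ‖x‖ ^ 2 ≤ ∑ i, x i ^ 2 := by
      have hs : 0 ≤ ∑ i, x i ^ 2 := Finset.sum_nonneg fun i _ => sq_nonneg _
      have : ‖x‖ ≤ √(∑ i, x i ^ 2) := by
        rw [pi_norm_le_iff_of_nonneg (Real.sqrt_nonneg _)]
        intro i
        rw [Real.norm_eq_abs]
        apply Real.abs_le_sqrt
        exact Finset.single_le_sum (f := fun i => x i ^ 2) (fun i _ => sq_nonneg _)
          (Finset.mem_univ i)
      calc ‖x‖ ^ 2 ≤ (√(∑ i, x i ^ 2)) ^ 2 := by gcongr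
        _ = _ := Real.sq_sqrt hs
    have := sq_nonneg (lor x)
    have hs : 0 ≤ ∑ i, x i ^ 2 := Finset.sum_nonneg fun i _ => sq_nonneg _
    have e : lor x = 2 * x 0 ^ 2 - ∑ i, x i ^ 2 := rfl
    nlinarith
  have ha0 : 0 < a := lt_of_le_of_lt (by positivity) ha
  calc ‖lorC (ofR x + Complex.I • ofR (eVec n ℝ))‖ ^ (-a)
      = (‖lorC (ofR x + Complex.I • ofR (eVec n ℝ))‖ ^ 2) ^ (-a / 2) := by
        rw [← Real.rpow_natCast, ← Real.rpow_mul (norm_nonneg _)]; congr 1; push_cast; ring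
    _ ≤ _ := Real.rpow_le_rpow_of_nonpos h0 h1 (by linarith)

/-- Integration of the modulus of the kernel along real directions. -/
lemma lintegral_kb {z : Fin n → ℂ} (hz : z ∈ tube n) (a : ℝ) {ψ : (Fin n → ℝ) → ℝ≥0∞}
    (hψ : Measurable ψ) :
    ∫⁻ w in tube n, ENNReal.ofReal (‖kb z w‖ ^ (-a)) * ψ (imP w) =
      fibC n a * ∫⁻ y in cone n, ENNReal.ofReal (lor (imP z + y) ^ ((n : ℝ) / 2 - a)) * ψ y := by
  have hk : Measurable fun w => ENNReal.ofReal (‖kb z w‖ ^ (-a)) := by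
    apply Measurable.ennreal_ofReal
    apply Measurable.pow_const
    exact (continuous_kb.comp (Continuous.prodMk_right z)).norm.measurable
  rw [← lintegral_indicator measurableSet_tube, ← lintegral_indicator isOpen_cone.measurableSet,
    lintegral_reIm (f := (tube n).indicator fun w => ENNReal.ofReal (‖kb z w‖ ^ (-a)) * ψ (imP w))
      ((hk.mul (hψ.comp continuous_imP.measurable)).indicator measurableSet_tube),
    ← lintegral_const_mul _ (by
      refine Measurable.indicator (Measurable.mul ?_ hψ) isOpen_cone.measurableSet
      apply Measurable.ennreal_ofReal
      apply Measurable.pow_const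
      have : Continuous (lor : (Fin n → ℝ) → ℝ) := by unfold lor; fun_prop
      exact (this.comp (continuous_const.add continuous_id)).measurable)]
  refine lintegral_congr fun y => ?_
  have him : ∀ x, imP (ofR x + Complex.I • ofR y) = y := by
    intro x; ext i; simp [imP, ofR]
  by_cases hy : y ∈ cone n
  · rw [indicator_of_mem hy]
    have h1 : ∀ x, (tube n).indicator (fun w => ENNReal.ofReal (‖kb z w‖ ^ (-a)) * ψ (imP w))
        (ofR x + Complex.I • ofR y) =
        ENNReal.ofReal (‖lorC (ofR (reP z - x) + Complex.I • ofR (imP z + y))‖ ^ (-a)) * ψ y := by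
      intro x
      have : ofR x + Complex.I • ofR y ∈ tube n := by
        show imP _ ∈ cone n
        rw [him]; exact hy
      rw [indicator_of_mem this, him, kb, norm_neg]
      congr 5
      ext i
      conv_lhs => rw [← reP_add_imP z]
      simp [ofR, cj]
      ring
    simp_rw [h1]
    rw [lintegral_mul_const'', ← mul_assoc, ← fibC_integral (cone_add hz hy)]
    · congr 1
      exact lintegral_sub_left_eq_self (fun x : Fin n → ℝ =>
        ENNReal.ofReal (‖lorC (ofR x + Complex.I • ofR (imP z + y))‖ ^ (-a))) (reP z)
    · apply Measurable.aemeasurable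
      apply Measurable.ennreal_ofReal
      apply Measurable.pow_const
      exact (continuous_lorC.comp ((continuous_ofR.comp (by fun_prop)).add
        continuous_const)).norm.measurable
  · rw [indicator_of_notMem hy, mul_zero]
    rw [← lintegral_zero (μ := (volume : Measure (Fin n → ℝ)))]
    refine lintegral_congr fun x => indicator_of_notMem (fun h => hy ?_) _
    have : imP (ofR x + Complex.I • ofR y) ∈ cone n := h
    rwa [him] at this

end ForelliRudin

section ForelliRudinCone

/-- The one-dimensional beta integral. -/
def betaI (p q b : ℝ) : ℝ≥0∞ := ∫⁻ u in Ioi (0 : ℝ), ENNReal.ofReal (u ^ p * (b + u) ^ (-q))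

lemma betaI_scale (p q : ℝ) {b : ℝ} (hb : 0 < b) :
    betaI p q b = ENNReal.ofReal (b ^ (p + 1 - q)) * betaI p q 1 := by
  have hm : Measurable ((Ioi (0 : ℝ)).indicator
      fun u => ENNReal.ofReal (u ^ p * (b + u) ^ (-q))) := by
    refine Measurable.indicator ?_ measurableSet_Ioi
    fun_prop
  rw [betaI, betaI, ← lintegral_indicator measurableSet_Ioi,
    lintegral_comp_smul_real volume hb hm, ← lintegral_indicator measurableSet_Ioi,
    Module.finrank_self, pow_one, ← lintegral_const_mul' _ _ ENNReal.ofReal_ne_top,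
    ← lintegral_const_mul' _ _ ENNReal.ofReal_ne_top]
  refine lintegral_congr fun u => ?_
  by_cases hu : 0 < u
  · rw [indicator_of_mem (by simpa using mul_pos hb hu), indicator_of_mem (by simpa using hu),
      ← ENNReal.ofReal_mul hb.le, ← ENNReal.ofReal_mul (by positivity)]
    congr 1
    have : b + b • u = b * (1 + u) := by simp; ring
    rw [this, smul_eq_mul, Real.mul_rpow hb.le hu.le, Real.mul_rpow hb.le (by positivity),
      show p + 1 - q = 1 + p + -q by ring, Real.rpow_add hb, Real.rpow_add hb, Real.rpow_one]
    ring
  · rw [indicator_of_notMem (by simpa using fun h => hu (pos_of_mul_pos_right h hb.le)),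
      indicator_of_notMem (by simpa using hu)]
    simp

lemma betaI_one_lt_top {p q : ℝ} (hp : -1 < p) (hq : p + 1 < q) : betaI p q 1 < ⊤ := by
  have hsplit : Ioi (0 : ℝ) = Ioc 0 1 ∪ Ioi 1 := (Ioc_union_Ioi_eq_Ioi zero_le_one).symm
  rw [betaI, hsplit]
  refine (lintegral_union_le _ _ _).trans_lt (ENNReal.add_lt_top.2 ⟨?_, ?_⟩)
  · have h : IntegrableOn (fun u : ℝ => u ^ p) (Ioc 0 1) := by
      rw [← intervalIntegrable_iff_integrableOn_Ioc_of_le zero_le_one]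
      exact intervalIntegral.intervalIntegrable_rpow' hp
    refine lt_of_le_of_lt ?_ h.lintegral_lt_top
    refine setLIntegral_mono_ae' measurableSet_Ioc (ae_of_all _ fun u hu => ?_)
    apply ENNReal.ofReal_le_ofReal
    have : (1 + u) ^ (-q) ≤ 1 :=
      Real.rpow_le_one_of_one_le_of_nonpos (by linarith [hu.1]) (by linarith)
    have h0 : 0 ≤ u ^ p := Real.rpow_nonneg hu.1.le _
    nlinarith
  · have h : IntegrableOn (fun u : ℝ => u ^ (p - q)) (Ioi 1) :=
      integrableOn_Ioi_rpow_of_lt (by linarith) zero_lt_one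
    refine lt_of_le_of_lt ?_ h.lintegral_lt_top
    refine setLIntegral_mono_ae' measurableSet_Ioi (ae_of_all _ fun u hu => ?_)
    apply ENNReal.ofReal_le_ofReal
    have hu0 : (0 : ℝ) < u := zero_lt_one.trans hu
    rw [sub_eq_add_neg, Real.rpow_add hu0]
    exact mul_le_mul_of_nonneg_left
      (Real.rpow_le_rpow_of_nonpos hu0 (by linarith) (by linarith)) (Real.rpow_nonneg hu0.le _)

/-- The normalised transversal integral. -/
def transC (k : ℕ) (A : ℝ) : ℝ≥0∞ :=
  ∫⁻ x : Fin k → ℝ, ENNReal.ofReal ((1 + ∑ i, x i ^ 2) ^ (-A))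

lemma transC_lt_top {k : ℕ} {A : ℝ} (hA : (k : ℝ) < 2 * A) : transC k A < ⊤ := by
  have h := (integrable_rpow_neg_one_add_norm_sq (E := Fin k → ℝ) (μ := volume) (r := 2 * A)
    (by simpa using hA)).lintegral_lt_top
  refine lt_of_le_of_lt (lintegral_mono fun x => ENNReal.ofReal_le_ofReal ?_) h
  have hx : ‖x‖ ^ 2 ≤ ∑ i, x i ^ 2 := by
    have hs : 0 ≤ ∑ i, x i ^ 2 := Finset.sum_nonneg fun i _ => sq_nonneg _
    have : ‖x‖ ≤ √(∑ i, x i ^ 2) := by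
      rw [pi_norm_le_iff_of_nonneg (Real.sqrt_nonneg _)]
      intro i
      rw [Real.norm_eq_abs]
      apply Real.abs_le_sqrt
      exact Finset.single_le_sum (f := fun i => x i ^ 2) (fun i _ => sq_nonneg _)
        (Finset.mem_univ i)
    calc ‖x‖ ^ 2 ≤ (√(∑ i, x i ^ 2)) ^ 2 := by gcongr
      _ = _ := Real.sq_sqrt hs
  have hk : (0 : ℝ) ≤ k := Nat.cast_nonneg k
  rw [show -(2 * A) / 2 = -A by ring]
  exact Real.rpow_le_rpow_of_nonpos (by positivity) (by linarith) (by linarith)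

lemma lintegral_trans {k : ℕ} (A : ℝ) {P t : ℝ} (hP : 0 < P) (ht : 0 < t) (x₁ : Fin k → ℝ) :
    ∫⁻ x : Fin k → ℝ, ENNReal.ofReal ((P + t * ∑ i, (x i - x₁ i) ^ 2) ^ (-A)) =
      ENNReal.ofReal ((P / t) ^ ((k : ℝ) / 2) * P ^ (-A)) * transC k A := by
  have hm : Measurable fun x : Fin k → ℝ => ENNReal.ofReal ((P + t * ∑ i, x i ^ 2) ^ (-A)) := by
    fun_prop
  have h1 := lintegral_sub_right_eq_self (μ := (volume : Measure (Fin k → ℝ)))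
    (fun x => ENNReal.ofReal ((P + t * ∑ i, x i ^ 2) ^ (-A))) x₁
  simp only [Pi.sub_apply] at h1
  rw [h1, lintegral_comp_smul_real volume (c := √(P / t)) (by positivity) hm, transC,
    ENNReal.ofReal_mul (by positivity), mul_assoc]
  congr 1
  · congr 1
    rw [Module.finrank_fin_fun, Real.sqrt_eq_rpow, ← Real.rpow_natCast,
      ← Real.rpow_mul (by positivity)]
    congr 1; ring
  · rw [← lintegral_const_mul' _ _ ENNReal.ofReal_ne_top]
    refine lintegral_congr fun x => ?_
    rw [← ENNReal.ofReal_mul (by positivity), ← Real.mul_rpow hP.le (by positivity)]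
    congr 2
    simp only [Pi.smul_apply, smul_eq_mul, mul_pow, Real.sq_sqrt (show 0 ≤ P / t by positivity)]
    rw [← Finset.mul_sum, ← mul_assoc, mul_div_cancel₀ _ ht.ne']
    ring_nf

/-- The null linear form `y₀ + y₁`. -/
def nul {n : ℕ} [NeZero n] (y : Fin n → ℝ) : ℝ := y 0 + y 1

variable {k : ℕ}

lemma vcons_zero (a b : ℝ) (x : Fin k → ℝ) : vcons a b x 0 = a := rfl

lemma vcons_one (a b : ℝ) (x : Fin k → ℝ) : vcons a b x 1 = b := rfl

lemma lor_split (y : Fin (k + 2) → ℝ) :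
    lor y = y 0 ^ 2 - y 1 ^ 2 - ∑ i : Fin k, y i.succ.succ ^ 2 := by
  rw [lor, Fin.sum_univ_succ, Fin.sum_univ_succ, Fin.succ_zero_eq_one]; ring

lemma nul_lcone (u c : ℝ) (x : Fin k → ℝ) : nul (lcone u c x) = u := by
  rw [nul, lcone, vcons_zero, vcons_one]; ring

lemma lor_lcone {u : ℝ} (hu : u ≠ 0) (c : ℝ) (x : Fin k → ℝ) : lor (lcone u c x) = u * c := by
  rw [lor_split, lcone, vcons_zero, vcons_one]
  have : ∀ i : Fin k, vcons ((u + (c + (∑ i, x i ^ 2) / u)) / 2)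
    ((u - (c + (∑ i, x i ^ 2) / u)) / 2) x i.succ.succ = x i := fun i => rfl
  simp_rw [this]
  field_simp
  ring

lemma lor_add_lcone {u u₀ : ℝ} (hu : u ≠ 0) (hu₀ : u₀ ≠ 0) (c c₀ : ℝ) (x x₀ : Fin k → ℝ) :
    lor (lcone u₀ c₀ x₀ + lcone u c x) =
      (u₀ + u) * (c₀ + c) + u₀ / u * ∑ i, (x i - u / u₀ * x₀ i) ^ 2 := by
  have h1 : ∀ i : Fin k, ∀ a b : ℝ, vcons a b x i.succ.succ = x i := fun i a b => rfl
  have h2 : ∀ i : Fin k, ∀ a b : ℝ, vcons a b x₀ i.succ.succ = x₀ i := fun i a b => rfl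
  have e1 : ∑ i, (x i - u / u₀ * x₀ i) ^ 2 =
      ∑ i, x i ^ 2 - 2 * (u / u₀) * ∑ i, x i * x₀ i + (u / u₀) ^ 2 * ∑ i, x₀ i ^ 2 := by
    rw [Finset.mul_sum, Finset.mul_sum, ← Finset.sum_sub_distrib, ← Finset.sum_add_distrib]
    exact Finset.sum_congr rfl fun i _ => by ring
  have e2 : ∑ i, (x₀ i + x i) ^ 2 =
      ∑ i, x i ^ 2 + 2 * ∑ i, x i * x₀ i + ∑ i, x₀ i ^ 2 := by
    rw [Finset.mul_sum, ← Finset.sum_add_distrib, ← Finset.sum_add_distrib]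
    exact Finset.sum_congr rfl fun i _ => by ring
  rw [lor_split, e1]
  simp only [Pi.add_apply, lcone, vcons_zero, vcons_one, h1, h2]
  rw [e2]
  field_simp
  ring

lemma exists_lcone {y : Fin (k + 2) → ℝ} (hy : nul y ≠ 0) :
    ∃ x, y = lcone (nul y) (lor y / nul y) x := by
  refine ⟨fun i => y i.succ.succ, ?_⟩
  have h : lor y / nul y + (∑ i : Fin k, y i.succ.succ ^ 2) / nul y = y 0 - y 1 := by
    rw [← add_div, lor_split, div_eq_iff hy, nul]; ring
  rw [lcone, h, nul]
  ext i
  refine Fin.cases ?_ (fun j => ?_) i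
  · rw [vcons_zero]; ring
  · refine Fin.cases ?_ (fun l => rfl) j
    show y 1 = vcons _ _ _ 1
    rw [vcons_one]; ring

lemma nul_pos {y : Fin (k + 2) → ℝ} (hy : y ∈ cone (k + 2)) : 0 < nul y := by
  have h1 := hy.1
  have h2 : 0 < y 0 := hy.2
  rw [lor_split] at h1
  have hs : 0 ≤ ∑ i : Fin k, y i.succ.succ ^ 2 := Finset.sum_nonneg fun i _ => sq_nonneg _
  rw [nul]
  nlinarith

lemma lcone_mem_cone {u c : ℝ} (hu : u ≠ 0) (x : Fin k → ℝ) :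
    lcone u c x ∈ cone (k + 2) ↔ 0 < u ∧ 0 < c := by
  constructor
  · intro h
    have h1 := nul_pos h
    rw [nul_lcone] at h1
    have h2 : 0 < lor (lcone u c x) := h.1
    rw [lor_lcone hu] at h2
    exact ⟨h1, pos_of_mul_pos_right h2 h1.le⟩
  · rintro ⟨h1, h2⟩
    refine ⟨by rw [lor_lcone hu]; positivity, ?_⟩
    rw [lcone, vcons_zero]
    have hs : 0 ≤ ∑ i : Fin k, x i ^ 2 := Finset.sum_nonneg fun i _ => sq_nonneg _
    positivity

lemma measurable_lor {n : ℕ} [NeZero n] : Measurable (lor : (Fin n → ℝ) → ℝ) := by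
  unfold lor; fun_prop

/-- The Forelli–Rudin integral over the cone, in separated form. -/
lemma lintegral_cone {y₀ : Fin (k + 2) → ℝ} (hy₀ : y₀ ∈ cone (k + 2)) (A s : ℝ)
    {φ : ℝ → ℝ≥0∞} (hφ : Measurable φ) :
    ∫⁻ y in cone (k + 2), ENNReal.ofReal (lor (y₀ + y) ^ (-A)) *
        (ENNReal.ofReal (lor y ^ s) * φ (nul y)) =
      ENNReal.ofReal (1 / 2) * transC k A * ENNReal.ofReal (nul y₀ ^ (-((k : ℝ) / 2))) *
      betaI s (A - (k : ℝ) / 2) (lor y₀ / nul y₀) *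
      ∫⁻ u in Ioi (0 : ℝ), ENNReal.ofReal (u ^ (s + (k : ℝ) / 2) *
        (nul y₀ + u) ^ (-(A - (k : ℝ) / 2))) * φ u := by
  have hu₀ := nul_pos hy₀
  obtain ⟨x₀, hx₀⟩ := exists_lcone hu₀.ne'
  set u₀ := nul y₀
  set c₀ := lor y₀ / u₀ with hc₀d
  have hc₀ : 0 < c₀ := div_pos hy₀.1 hu₀
  have hm : Measurable ((cone (k + 2)).indicator fun y => ENNReal.ofReal (lor (y₀ + y) ^ (-A)) *
      (ENNReal.ofReal (lor y ^ s) * φ (nul y))) := by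
    refine Measurable.indicator ?_ isOpen_cone.measurableSet
    have h1 : Measurable fun y : Fin (k + 2) → ℝ => lor (y₀ + y) :=
      measurable_lor.comp (measurable_const.add measurable_id)
    have h2 : Measurable (nul : (Fin (k + 2) → ℝ) → ℝ) := by unfold nul; fun_prop
    exact (h1.pow_const _).ennreal_ofReal.mul
      ((measurable_lor.pow_const _).ennreal_ofReal.mul (hφ.comp h2))
  rw [← lintegral_indicator isOpen_cone.measurableSet, lintegral_lcone hm, mul_assoc, mul_assoc,
    mul_assoc]
  congr 1
  have hmu : Measurable fun u : ℝ => ENNReal.ofReal (u ^ (s + (k : ℝ) / 2) *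
        (u₀ + u) ^ (-(A - (k : ℝ) / 2))) * φ u := by
    apply Measurable.mul _ hφ
    fun_prop
  have hmc : Measurable fun c : ℝ => ENNReal.ofReal (c ^ s * (c₀ + c) ^ (-(A - (k : ℝ) / 2))) := by
    fun_prop
  rw [betaI, ← mul_assoc, ← mul_assoc, ← lintegral_const_mul'' _ hmu.aemeasurable.restrict,
    ← lintegral_indicator measurableSet_Ioi]
  refine lintegral_congr_ae ?_
  filter_upwards [measure_eq_zero_iff_ae_notMem.1 (measure_singleton (0 : ℝ))] with u hu
  have hu : u ≠ 0 := hu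
  by_cases hup : 0 < u
  · rw [indicator_of_mem (by simpa using hup), mul_comm (transC _ _ * _), mul_assoc,
      ← lintegral_mul_const'' _ hmc.aemeasurable.restrict, ← lintegral_indicator measurableSet_Ioi]
    refine lintegral_congr fun c => ?_
    by_cases hc : 0 < c
    · rw [indicator_of_mem (by simpa using hc)]
      have : ∀ x : Fin k → ℝ, (cone (k + 2)).indicator (fun y =>
          ENNReal.ofReal (lor (y₀ + y) ^ (-A)) * (ENNReal.ofReal (lor y ^ s) * φ (nul y)))
            (lcone u c x) = ENNReal.ofReal (((u₀ + u) * (c₀ + c) + u₀ / u *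
              ∑ i, (x i - (fun i => u / u₀ * x₀ i) i) ^ 2) ^ (-A)) *
            (ENNReal.ofReal ((u * c) ^ s) * φ u) := by
        intro x
        rw [indicator_of_mem ((lcone_mem_cone hu x).2 ⟨hup, hc⟩), nul_lcone, lor_lcone hu, hx₀,
          lor_add_lcone hu hu₀.ne']
      simp_rw [this]
      rw [lintegral_mul_const'', lintegral_trans A (by positivity) (by positivity)]
      · have h3 : ENNReal.ofReal (((u₀ + u) * (c₀ + c) / (u₀ / u)) ^ ((k : ℝ) / 2) *
            ((u₀ + u) * (c₀ + c)) ^ (-A)) * ENNReal.ofReal ((u * c) ^ s) =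
            ENNReal.ofReal (c ^ s * (c₀ + c) ^ (-(A - (k : ℝ) / 2))) *
            (ENNReal.ofReal (u₀ ^ (-((k : ℝ) / 2))) * ENNReal.ofReal (u ^ (s + (k : ℝ) / 2) *
        (u₀ + u) ^ (-(A - (k : ℝ) / 2)))) := by
          rw [← ENNReal.ofReal_mul (by positivity), ← ENNReal.ofReal_mul (by positivity),
            ← ENNReal.ofReal_mul (by positivity)]
          congr 1
          have e : (u₀ + u) * (c₀ + c) / (u₀ / u) = u₀⁻¹ * u * ((u₀ + u) * (c₀ + c)) := by
            field_simp
          rw [e, Real.mul_rpow (by positivity) (by positivity),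
            Real.mul_rpow (by positivity) (by positivity),
            Real.mul_rpow (by positivity) (by positivity),
            Real.mul_rpow (by positivity) (by positivity),
            Real.mul_rpow (by positivity) (by positivity), neg_sub, sub_eq_add_neg,
            Real.rpow_add (by positivity), Real.rpow_add (by positivity),
            Real.rpow_add (by positivity), Real.inv_rpow hu₀.le, Real.rpow_neg hu₀.le]
          ring
        calc _ = transC k A * φ u * (ENNReal.ofReal (((u₀ + u) * (c₀ + c) / (u₀ / u)) ^ ((k : ℝ) / 2) *
            ((u₀ + u) * (c₀ + c)) ^ (-A)) * ENNReal.ofReal ((u * c) ^ s)) := by ring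
          _ = _ := by rw [h3]; ring
      · apply Measurable.aemeasurable
        fun_prop
    · rw [indicator_of_notMem (by simpa using hc), ← lintegral_zero (μ := (volume : Measure (Fin k → ℝ)))]
      exact lintegral_congr fun x => indicator_of_notMem
        (fun h => hc ((lcone_mem_cone hu x).1 h).2) _
  · rw [indicator_of_notMem (by simpa using hup), ← lintegral_zero (μ := (volume : Measure ℝ))]
    refine lintegral_congr fun c => ?_
    rw [← lintegral_zero (μ := (volume : Measure (Fin k → ℝ)))]
    exact lintegral_congr fun x => indicator_of_notMem
        (fun h => hup ((lcone_mem_cone hu x).1 h).1) _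

/-- The null coordinate of the imaginary part. -/
def el {n : ℕ} [NeZero n] (z : Fin n → ℂ) : ℝ := nul (imP z)

variable {n : ℕ} [NeZero n]

lemma el_pos (hn : 2 ≤ n) {z : Fin n → ℂ} (hz : z ∈ tube n) : 0 < el z := by
  obtain ⟨k, rfl⟩ := Nat.exists_eq_add_of_le' hn
  exact nul_pos hz

lemma continuous_el : Continuous (el : (Fin n → ℂ) → ℝ) := by unfold el nul imP; fun_prop

/-- The constant in the Forelli–Rudin identity. -/
def frC (n : ℕ) [NeZero n] (a b : ℝ) : ℝ≥0∞ :=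
  fibC n a * (ENNReal.ofReal (1 / 2) * transC (n - 2) (a - n / 2)) *
    betaI (b - n / 2) (a - n + 1) 1

lemma frC_lt_top (hn : 2 ≤ n) {a b : ℝ} (ha : (n : ℝ) < a) (hb : (n : ℝ) / 2 - 1 < b)
    (hab : b < a - n / 2) : frC n a b < ⊤ := by
  refine ENNReal.mul_lt_top (ENNReal.mul_lt_top (fibC_lt_top ha)
    (ENNReal.mul_lt_top ENNReal.ofReal_lt_top (transC_lt_top ?_)))
    (betaI_one_lt_top (by linarith) (by linarith))
  push_cast [hn]
  linarith

/-- The Forelli–Rudin identity. -/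
lemma forelli_rudin_eq (hn : 2 ≤ n) {z : Fin n → ℂ} (hz : z ∈ tube n) (a b : ℝ)
    {φ : ℝ → ℝ≥0∞} (hφ : Measurable φ) :
    ∫⁻ w in tube n, ENNReal.ofReal (‖kb z w‖ ^ (-a)) *
        (ENNReal.ofReal (dl w ^ (b - (n : ℝ) / 2)) * φ (el w)) =
      frC n a b * ENNReal.ofReal (el z ^ (1 - (n : ℝ) / 2) *
        (dl z / el z) ^ (b + (n : ℝ) / 2 - a)) *
      ∫⁻ u in Ioi (0 : ℝ), ENNReal.ofReal (u ^ (b - 1) * (el z + u) ^ (n - 1 - a)) * φ u := by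
  have he : 0 < el z := el_pos hn hz
  obtain ⟨k, rfl⟩ := Nat.exists_eq_add_of_le' hn
  have h2 : Measurable (nul : (Fin (k + 2) → ℝ) → ℝ) := by unfold nul; fun_prop
  have h := lintegral_kb hz a (ψ := fun y =>
    ENNReal.ofReal (lor y ^ (b - ((k + 2 : ℕ) : ℝ) / 2)) * φ (nul y))
    ((measurable_lor.pow_const _).ennreal_ofReal.mul (hφ.comp h2))
  have hz1 : imP z ∈ cone (k + 2) := hz
  have hd : 0 < dl z := dl_pos hz
  have e1 : (((k + 2 : ℕ) : ℝ) / 2 - a) = -(a - ((k + 2 : ℕ) : ℝ) / 2) := by ring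
  rw [e1, lintegral_cone hz1 _ _ hφ] at h
  simp only [dl, el] at he hd ⊢
  have e2 : a - ((k + 2 : ℕ) : ℝ) / 2 - k / 2 = a - (k + 2 : ℕ) + 1 := by push_cast; ring
  have e3 : b - ((k + 2 : ℕ) : ℝ) / 2 + 1 - (a - (k + 2 : ℕ) + 1) =
    b + ((k + 2 : ℕ) : ℝ) / 2 - a := by ring
  have e4 : b - ((k + 2 : ℕ) : ℝ) / 2 + k / 2 = b - 1 := by push_cast; ring
  have e5 : -(a - ((k + 2 : ℕ) : ℝ) + 1) = (k + 2 : ℕ) - 1 - a := by ring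
  have e6 : -((k : ℝ) / 2) = 1 - ((k + 2 : ℕ) : ℝ) / 2 := by push_cast; ring
  rw [h, frC, Nat.add_sub_cancel, e2, betaI_scale _ _ (div_pos hd he),
    ENNReal.ofReal_mul (by positivity), e3, e4, e5, e6]
  ring

lemma continuous_kb_right (z : Fin n → ℂ) : Continuous fun w => kb z w :=
  Continuous.comp (g := fun p : (Fin n → ℂ) × (Fin n → ℂ) => kb p.1 p.2) continuous_kb
    (f := fun w => (z, w)) (by fun_prop)

lemma lintegral_dV (ν : ℝ) (f : (Fin n → ℂ) → ℝ≥0∞) :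
    ∫⁻ z, f z ∂(dV n ν) = ∫⁻ z in tube n, ENNReal.ofReal (dl z ^ (ν - (n : ℝ) / 2)) * f z := by
  rw [dV, lintegral_withDensity_eq_lintegral_mul_non_measurable]
  · rfl
  · exact (continuous_dl.measurable.pow_const _).ennreal_ofReal
  · exact ae_of_all _ fun _ => ENNReal.ofReal_lt_top

lemma ae_dV {ν : ℝ} : ∀ᵐ z ∂(dV n ν), z ∈ tube n := by
  have h : ∀ᵐ z ∂((volume : Measure (Fin n → ℂ)).restrict (tube n)), z ∈ tube n :=
    ae_restrict_mem measurableSet_tube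
  exact (withDensity_absolutelyContinuous _ _).ae_le h

lemma lintegral_dV_shift (ν t : ℝ) (f : (Fin n → ℂ) → ℝ≥0∞) :
    ∫⁻ z, ENNReal.ofReal (dl z ^ t) * f z ∂(dV n ν) = ∫⁻ z, f z ∂(dV n (ν + t)) := by
  rw [lintegral_dV, lintegral_dV]
  refine setLIntegral_congr_fun measurableSet_tube fun z hz => ?_
  have := dl_pos hz
  rw [← mul_assoc, ← ENNReal.ofReal_mul (by positivity), ← Real.rpow_add this]
  ring_nf

lemma lintegral_congr_dV {ν : ℝ} {f g : (Fin n → ℂ) → ℝ≥0∞} (h : ∀ z ∈ tube n, f z = g z) :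
    ∫⁻ z, f z ∂(dV n ν) = ∫⁻ z, g z ∂(dV n ν) :=
  lintegral_congr_ae (ae_dV.mono h)

lemma lintegral_mono_dV {ν : ℝ} {f g : (Fin n → ℂ) → ℝ≥0∞} (h : ∀ z ∈ tube n, f z ≤ g z) :
    ∫⁻ z, f z ∂(dV n ν) ≤ ∫⁻ z, g z ∂(dV n ν) :=
  lintegral_mono_ae (ae_dV.mono h)

/-- The Forelli–Rudin estimate. -/
lemma forelli_rudin_le (hn : 2 ≤ n) {a b d : ℝ} (ha : (n : ℝ) < a) (hb : (n : ℝ) / 2 - 1 < b)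
    (hbd : 0 < b + d) (hab : b < a - n / 2) (had : b + d < a - n + 1) :
    ∃ C : ℝ, 0 < C ∧ ∀ z ∈ tube n,
      ∫⁻ w, ENNReal.ofReal (‖kb z w‖ ^ (-a)) * ENNReal.ofReal (el w ^ d) ∂(dV n b) ≤
        ENNReal.ofReal (C * (dl z ^ (b + (n : ℝ) / 2 - a) * el z ^ d)) := by
  have h1 := frC_lt_top hn ha hb hab
  have h2 : betaI (b - 1 + d) (a - n + 1) 1 < ⊤ := betaI_one_lt_top (by linarith) (by linarith)
  refine ⟨(frC n a b).toReal * (betaI (b - 1 + d) (a - n + 1) 1).toReal + 1, by positivity,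
    fun z hz => ?_⟩
  have he : 0 < el z := el_pos hn hz
  have hd : 0 < dl z := dl_pos hz
  rw [lintegral_dV]
  calc _ = ∫⁻ w in tube n, ENNReal.ofReal (‖kb z w‖ ^ (-a)) *
        (ENNReal.ofReal (dl w ^ (b - (n : ℝ) / 2)) * ENNReal.ofReal (el w ^ d)) :=
        lintegral_congr fun w => by ring
    _ = frC n a b * ENNReal.ofReal (el z ^ (1 - (n : ℝ) / 2) *
        (dl z / el z) ^ (b + (n : ℝ) / 2 - a)) * betaI (b - 1 + d) (a - n + 1) (el z) := by
        rw [forelli_rudin_eq hn hz a b (φ := fun u => ENNReal.ofReal (u ^ d)) (by fun_prop), betaI]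
        congr 1
        refine setLIntegral_congr_fun measurableSet_Ioi fun u hu => ?_
        have hu : 0 < u := hu
        rw [← ENNReal.ofReal_mul (by positivity)]
        congr 1
        rw [Real.rpow_add hu]
        ring_nf
    _ = ENNReal.ofReal ((frC n a b).toReal * (betaI (b - 1 + d) (a - n + 1) 1).toReal *
          (dl z ^ (b + (n : ℝ) / 2 - a) * el z ^ d)) := by
        rw [betaI_scale _ _ he, ENNReal.ofReal_mul (by positivity : 0 ≤ (frC n a b).toReal *
          (betaI (b - 1 + d) (a - n + 1) 1).toReal), ENNReal.ofReal_mul ENNReal.toReal_nonneg,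
          ENNReal.ofReal_toReal h1.ne, ENNReal.ofReal_toReal h2.ne]
        have : ENNReal.ofReal (dl z ^ (b + (n : ℝ) / 2 - a) * el z ^ d) =
            ENNReal.ofReal (el z ^ (1 - (n : ℝ) / 2) * (dl z / el z) ^ (b + (n : ℝ) / 2 - a)) *
            ENNReal.ofReal (el z ^ (b - 1 + d + 1 - (a - n + 1))) := by
          rw [← ENNReal.ofReal_mul (by positivity), Real.div_rpow hd.le he.le]
          congr 1
          have : el z ^ d = el z ^ (1 - (n : ℝ) / 2) / el z ^ (b + (n : ℝ) / 2 - a) *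
              el z ^ (b - 1 + d + 1 - (a - n + 1)) := by
            rw [← Real.rpow_sub he, ← Real.rpow_add he]
            congr 1; ring
          rw [this]; ring
        rw [this]; ring
    _ ≤ _ := by
        apply ENNReal.ofReal_le_ofReal
        have : 0 ≤ dl z ^ (b + (n : ℝ) / 2 - a) * el z ^ d := by positivity
        nlinarith

end ForelliRudinCone

section Schur

/-- Schur's test. -/
lemma schur_test {X Y : Type*} [MeasurableSpace X] [MeasurableSpace Y] (μ : Measure X)
    (ν : Measure Y) [SFinite μ] [SFinite ν] {p q : ℝ} (hpq : p.HolderConjugate q)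
    {k : X → Y → ℝ≥0∞} (hk : Measurable (Function.uncurry k)) {φ : Y → ℝ≥0∞} {ψ : X → ℝ≥0∞}
    (hφ : Measurable φ) (hψ : Measurable ψ) (hφ0 : ∀ᵐ y ∂ν, φ y ≠ 0 ∧ φ y ≠ ⊤) {A B : ℝ≥0∞}
    (h1 : ∀ᵐ x ∂μ, ∫⁻ y, k x y * φ y ^ p ∂ν ≤ A * ψ x ^ p)
    (h2 : ∀ᵐ y ∂ν, ∫⁻ x, k x y * ψ x ^ q ∂μ ≤ B * φ y ^ q) {f : Y → ℝ≥0∞} (hf : Measurable f) :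
    ∫⁻ x, (∫⁻ y, k x y * f y ∂ν) ^ q ∂μ ≤ A ^ (q / p) * B * ∫⁻ y, f y ^ q ∂ν := by
  have hp := hpq.pos
  have hq := hpq.symm.pos
  have hkx : ∀ x, Measurable fun y => k x y := fun x => hk.comp measurable_prodMk_left
  have step : ∀ᵐ x ∂μ, (∫⁻ y, k x y * f y ∂ν) ^ q ≤
      ∫⁻ y, A ^ (q / p) * (k x y * ψ x ^ q * ((φ y)⁻¹ * f y) ^ q) ∂ν := by
    filter_upwards [h1] with x hx
    have e : ∫⁻ y, k x y * f y ∂ν =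
        ∫⁻ y, ((fun y => k x y ^ (1 / p) * φ y) * fun y => k x y ^ (1 / q) * ((φ y)⁻¹ * f y)) y ∂ν := by
      refine lintegral_congr_ae ?_
      filter_upwards [hφ0] with y hy
      have e1 : k x y = k x y ^ (1 / p) * k x y ^ (1 / q) := by
        rw [← ENNReal.rpow_add_of_nonneg _ _ (by positivity) (by positivity), one_div, one_div,
          hpq.inv_add_inv_eq_one, ENNReal.rpow_one]
      have e2 := ENNReal.mul_inv_cancel hy.1 hy.2
      simp only [Pi.mul_apply]
      calc k x y * f y = k x y ^ (1 / p) * k x y ^ (1 / q) * (φ y * (φ y)⁻¹) * f y := by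
            rw [e2, ← e1, mul_one]
        _ = _ := by ring
    have hh := ENNReal.lintegral_mul_le_Lp_mul_Lq ν hpq
      (f := fun y => k x y ^ (1 / p) * φ y) (g := fun y => k x y ^ (1 / q) * ((φ y)⁻¹ * f y))
      (((hkx x).pow_const _).mul hφ).aemeasurable
      (((hkx x).pow_const _).mul (hφ.inv.mul hf)).aemeasurable
    have r1 : ∀ y, (k x y ^ (1 / p) * φ y) ^ p = k x y * φ y ^ p := fun y => by
      rw [ENNReal.mul_rpow_of_nonneg _ _ hp.le, ← ENNReal.rpow_mul, one_div_mul_cancel hp.ne',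
        ENNReal.rpow_one]
    have r2 : ∀ y, (k x y ^ (1 / q) * ((φ y)⁻¹ * f y)) ^ q = k x y * ((φ y)⁻¹ * f y) ^ q :=
      fun y => by
        rw [ENNReal.mul_rpow_of_nonneg _ _ hq.le, ← ENNReal.rpow_mul, one_div_mul_cancel hq.ne',
          ENNReal.rpow_one]
    simp only [r1, r2] at hh
    rw [e]
    calc _ ≤ ((A * ψ x ^ p) ^ (1 / p) * (∫⁻ y, k x y * ((φ y)⁻¹ * f y) ^ q ∂ν) ^ (1 / q)) ^ q := by
          refine ENNReal.rpow_le_rpow (hh.trans ?_) hq.le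
          gcongr
      _ = A ^ (q / p) * (ψ x ^ q * ∫⁻ y, k x y * ((φ y)⁻¹ * f y) ^ q ∂ν) := by
          rw [ENNReal.mul_rpow_of_nonneg _ _ hq.le, ← ENNReal.rpow_mul, ← ENNReal.rpow_mul,
            one_div_mul_cancel hq.ne', ENNReal.rpow_one, ENNReal.mul_rpow_of_nonneg _ _ (by positivity),
            ← ENNReal.rpow_mul, mul_assoc, show p * (1 / p * q) = q by field_simp,
            show 1 / p * q = q / p by ring]
      _ = _ := by
          rw [← lintegral_const_mul, ← lintegral_const_mul]
          · exact lintegral_congr fun y => by ring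
          · exact ((hkx x).mul ((hφ.inv.mul hf).pow_const _)).const_mul _
          · exact (hkx x).mul ((hφ.inv.mul hf).pow_const _)
  calc _ ≤ ∫⁻ x, ∫⁻ y, A ^ (q / p) * (k x y * ψ x ^ q * ((φ y)⁻¹ * f y) ^ q) ∂ν ∂μ :=
        lintegral_mono_ae step
    _ = ∫⁻ y, ∫⁻ x, A ^ (q / p) * (k x y * ψ x ^ q * ((φ y)⁻¹ * f y) ^ q) ∂μ ∂ν := by
        apply lintegral_lintegral_swap
        apply Measurable.aemeasurable
        exact (((hk.mul ((hψ.comp measurable_fst).pow_const _)).mul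
          (((hφ.inv.mul hf).comp measurable_snd).pow_const _)).const_mul _)
    _ ≤ ∫⁻ y, A ^ (q / p) * B * f y ^ q ∂ν := by
        refine lintegral_mono_ae ?_
        filter_upwards [h2, hφ0] with y hy hy0
        have m : Measurable fun x => k x y * ψ x ^ q :=
          (hk.comp measurable_prodMk_right).mul (hψ.pow_const _)
        rw [lintegral_const_mul _ (m.mul_const _), lintegral_mul_const _ m, mul_assoc]
        refine mul_le_mul' le_rfl ?_
        calc _ ≤ B * φ y ^ q * ((φ y)⁻¹ * f y) ^ q := mul_le_mul' hy le_rfl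
          _ = B * (φ y * (φ y)⁻¹ * f y) ^ q := by
              rw [mul_assoc, ← ENNReal.mul_rpow_of_nonneg _ _ hq.le, mul_assoc]
          _ = _ := by rw [ENNReal.mul_inv_cancel hy0.1 hy0.2, one_mul]
    _ = _ := lintegral_const_mul _ (hf.pow_const _)

variable {n : ℕ} [NeZero n]

instance (ν : ℝ) : SigmaFinite (dV n ν) := by
  unfold dV
  exact SigmaFinite.withDensity_ofReal _

lemma dV_ac (ν : ℝ) : dV n ν ≪ volume.restrict (tube n) := withDensity_absolutelyContinuous _ _

/-- The positive kernel operator `Δ^{ez} ∫ |kb|^{-a} f dV_{ew}`. -/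
lemma kernel_bounded (hn : 2 ≤ n) {p q : ℝ} (hpq : p.HolderConjugate q) {ez ew μ t₁ t₂ : ℝ}
    (ha : (n : ℝ) / 2 < ez + ew) (c1 : (n : ℝ) / 2 - 1 < ew + t₂ * p) (c2 : 0 < ew + t₁ * p)
    (c3 : t₂ * p < ez) (c4 : t₁ * p < ez - (n / 2 - 1))
    (d1 : (n : ℝ) / 2 - 1 < ez + μ + t₂ * q) (d2 : 0 < ez + μ + t₁ * q)
    (d3 : μ + t₂ * q < ew) (d4 : μ + t₁ * q < ew - (n / 2 - 1)) :
    ∃ C : ℝ, 0 < C ∧ ∀ f : (Fin n → ℂ) → ℝ≥0∞, AEMeasurable f (volume.restrict (tube n)) →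
      ∫⁻ z, (ENNReal.ofReal (dl z ^ ez) *
        ∫⁻ w, ENNReal.ofReal (‖kb z w‖ ^ (-(ez + ew + n / 2))) * f w ∂(dV n ew)) ^ q ∂(dV n μ) ≤
      ENNReal.ofReal C * ∫⁻ z, f z ^ q ∂(dV n μ) := by
  have hp := hpq.pos
  have hq := hpq.symm.pos
  obtain ⟨A, hA, H1⟩ := forelli_rudin_le hn (a := ez + ew + n / 2) (b := ew + t₂ * p)
    (d := (t₁ - t₂) * p) (by linarith) c1 (by linarith) (by linarith) (by linarith)
  obtain ⟨B, hB, H2⟩ := forelli_rudin_le hn (a := ez + ew + n / 2) (b := μ + ez + t₂ * q)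
    (d := (t₁ - t₂) * q) (by linarith) (by linarith) (by linarith) (by linarith) (by linarith)
  refine ⟨A ^ (q / p) * B, by positivity, fun f hf => ?_⟩
  have key : ∀ g : (Fin n → ℂ) → ℝ≥0∞, Measurable g →
      ∫⁻ z, (ENNReal.ofReal (dl z ^ ez) *
        ∫⁻ w, ENNReal.ofReal (‖kb z w‖ ^ (-(ez + ew + n / 2))) * g w ∂(dV n ew)) ^ q ∂(dV n μ) ≤
      ENNReal.ofReal (A ^ (q / p) * B) * ∫⁻ z, g z ^ q ∂(dV n μ) := by
    intro g hg
    have mk : Measurable fun x : (Fin n → ℂ) × (Fin n → ℂ) =>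
        ENNReal.ofReal (‖kb x.1 x.2‖ ^ (-(ez + ew + n / 2))) :=
      (continuous_kb.norm.measurable.pow_const _).ennreal_ofReal
    have md : Measurable (dl : (Fin n → ℂ) → ℝ) := continuous_dl.measurable
    have me : Measurable (el : (Fin n → ℂ) → ℝ) := continuous_el.measurable
    have mφ : Measurable fun w : Fin n → ℂ => ENNReal.ofReal (dl w ^ t₂ * el w ^ (t₁ - t₂)) :=
      ((md.pow_const _).mul (me.pow_const _)).ennreal_ofReal
    have hφr : ∀ w ∈ tube n, ∀ r > 0, ENNReal.ofReal (dl w ^ t₂ * el w ^ (t₁ - t₂)) ^ r =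
        ENNReal.ofReal (dl w ^ (t₂ * r)) * ENNReal.ofReal (el w ^ ((t₁ - t₂) * r)) := by
      intro w hw r hr
      have h1 := dl_pos hw
      have h2 := el_pos hn hw
      rw [ENNReal.ofReal_rpow_of_pos (by positivity), Real.mul_rpow (by positivity) (by positivity),
        ← Real.rpow_mul h1.le, ← Real.rpow_mul h2.le, ENNReal.ofReal_mul (by positivity)]
    have := schur_test (dV n μ) (dV n μ) hpq (k := fun z w => ENNReal.ofReal (dl z ^ ez) *
      (ENNReal.ofReal (‖kb z w‖ ^ (-(ez + ew + n / 2))) * ENNReal.ofReal (dl w ^ (ew - μ))))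
      (φ := fun w => ENNReal.ofReal (dl w ^ t₂ * el w ^ (t₁ - t₂)))
      (ψ := fun w => ENNReal.ofReal (dl w ^ t₂ * el w ^ (t₁ - t₂)))
      (A := ENNReal.ofReal A) (B := ENNReal.ofReal B)
      ((((md.comp measurable_fst).pow_const _).ennreal_ofReal).mul
        (mk.mul ((md.comp measurable_snd).pow_const _).ennreal_ofReal)) mφ mφ
      (ae_dV.mono fun w hw => ⟨by
        have h1 := dl_pos hw
        have h2 := el_pos hn hw
        rw [ne_eq, ENNReal.ofReal_eq_zero, not_le]; positivity, ENNReal.ofReal_ne_top⟩)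
      (ae_dV.mono fun z hz => ?_) (ae_dV.mono fun w hw => ?_) hg
    · rw [ENNReal.ofReal_mul (by positivity), ← ENNReal.ofReal_rpow_of_pos hA]
      refine le_trans (le_of_eq ?_) this
      refine lintegral_congr fun z => ?_
      congr 1
      rw [show ew = μ + (ew - μ) by ring, ← lintegral_dV_shift, ← lintegral_const_mul' _ _ ENNReal.ofReal_ne_top]
      refine lintegral_congr fun w => ?_
      rw [show μ + (ew - μ) = ew by ring]
      ring
    · have h := H1 z hz
      have h1 := dl_pos hz
      have h2 := el_pos hn hz
      rw [← lintegral_dV_shift, ] at h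
      rw [hφr z hz p hp]
      calc _ = ENNReal.ofReal (dl z ^ ez) * ∫⁻ w, ENNReal.ofReal (dl w ^ (t₂ * p)) *
            (ENNReal.ofReal (‖kb z w‖ ^ (-(ez + ew + n / 2))) *
              ENNReal.ofReal (el w ^ ((t₁ - t₂) * p))) ∂(dV n ew) := by
            rw [show ew = μ + (ew - μ) by ring, ← lintegral_dV_shift,
              ← lintegral_const_mul' _ _ ENNReal.ofReal_ne_top]
            refine lintegral_congr_dV fun w hw => ?_
            rw [hφr w hw p hp, show μ + (ew - μ) = ew by ring]
            ring
        _ ≤ ENNReal.ofReal (dl z ^ ez) * ENNReal.ofReal (A *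
            (dl z ^ (ew + t₂ * p + (n : ℝ) / 2 - (ez + ew + n / 2)) * el z ^ ((t₁ - t₂) * p))) := by
            gcongr
        _ = _ := by
            rw [← ENNReal.ofReal_mul (by positivity), ← ENNReal.ofReal_mul (by positivity),
              ← ENNReal.ofReal_mul (by positivity)]
            congr 1
            rw [show t₂ * p = ez + (ew + t₂ * p + (n : ℝ) / 2 - (ez + ew + n / 2)) by ring,
              Real.rpow_add h1]
            ring_nf
    · have h := H2 w hw
      have h1 := dl_pos hw
      have h2 := el_pos hn hw
      rw [show μ + ez + t₂ * q = μ + (ez + t₂ * q) by ring, ← lintegral_dV_shift] at h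
      rw [hφr w hw q hq]
      calc _ = ENNReal.ofReal (dl w ^ (ew - μ)) * ∫⁻ z, ENNReal.ofReal (dl z ^ (ez + t₂ * q)) *
            (ENNReal.ofReal (‖kb w z‖ ^ (-(ez + ew + n / 2))) *
              ENNReal.ofReal (el z ^ ((t₁ - t₂) * q))) ∂(dV n μ) := by
            rw [← lintegral_const_mul' _ _ ENNReal.ofReal_ne_top]
            refine lintegral_congr_dV fun z hz => ?_
            have h3 := dl_pos hz
            rw [hφr z hz q hq, norm_kb_comm, Real.rpow_add h3, ENNReal.ofReal_mul (by positivity)]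
            ring
        _ ≤ ENNReal.ofReal (dl w ^ (ew - μ)) * ENNReal.ofReal (B *
            (dl w ^ (μ + (ez + t₂ * q) + (n : ℝ) / 2 - (ez + ew + n / 2)) *
              el w ^ ((t₁ - t₂) * q))) := by
            gcongr
        _ = _ := by
            rw [← ENNReal.ofReal_mul (by positivity), ← ENNReal.ofReal_mul (by positivity),
              ← ENNReal.ofReal_mul (by positivity)]
            congr 1
            rw [show dl w ^ (t₂ * q) = dl w ^ ((ew - μ) +
              (μ + (ez + t₂ * q) + (n : ℝ) / 2 - (ez + ew + n / 2))) by ring_nf,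
              Real.rpow_add h1]
            ring
  have e := hf.ae_eq_mk
  have e1 : ∀ z, ∫⁻ w, ENNReal.ofReal (‖kb z w‖ ^ (-(ez + ew + n / 2))) * f w ∂(dV n ew) =
      ∫⁻ w, ENNReal.ofReal (‖kb z w‖ ^ (-(ez + ew + n / 2))) * hf.mk f w ∂(dV n ew) := by
    intro z
    refine lintegral_congr_ae ?_
    filter_upwards [(dV_ac ew).ae_le e] with w hw
    rw [hw]
  have e2 : ∫⁻ z, f z ^ q ∂(dV n μ) = ∫⁻ z, hf.mk f z ^ q ∂(dV n μ) := by
    refine lintegral_congr_ae ?_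
    filter_upwards [(dV_ac μ).ae_le e] with w hw
    rw [hw]
  simp_rw [e1, e2]
  exact key _ hf.measurable_mk

end Schur

section ParametricHolomorphy
variable {n : ℕ} {X : Type*} [MeasurableSpace X] {μ : Measure X} {U : Set (Fin n → ℂ)}

/-- A family of functions, holomorphic on `U` and locally uniformly dominated by integrable
functions of the parameter. -/
structure LocDom (U : Set (Fin n → ℂ)) (μ : Measure X) (k : (Fin n → ℂ) → X → ℂ) : Prop where
  diff : ∀ᵐ w ∂μ, DifferentiableOn ℂ (fun z => k z w) U
  meas : ∀ z ∈ U, AEStronglyMeasurable (k z) μ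
  dom : ∀ z₀ ∈ U, ∃ ε > 0, Metric.ball z₀ ε ⊆ U ∧
    ∃ g : X → ℝ, Integrable g μ ∧ ∀ᵐ w ∂μ, ∀ z ∈ Metric.ball z₀ ε, ‖k z w‖ ≤ g w

lemma norm_fderiv_le_of_ball {F : (Fin n → ℂ) → ℂ} {z₀ : Fin n → ℂ} {ε M : ℝ} (hε : 0 < ε)
    (hd : DifferentiableOn ℂ F (Metric.ball z₀ ε)) (hM : ∀ z ∈ Metric.ball z₀ ε, ‖F z‖ ≤ M)
    {z : Fin n → ℂ} (hz : z ∈ Metric.ball z₀ (ε / 2)) : ‖fderiv ℂ F z‖ ≤ 2 * M / (ε / 2) := by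
  have hsub : Metric.ball z (ε / 2) ⊆ Metric.ball z₀ ε := by
    refine Metric.ball_subset_ball' ?_
    rw [Metric.mem_ball] at hz
    linarith
  refine Complex.norm_fderiv_le_div_of_mapsTo_ball (hd.mono hsub) (fun w hw => ?_) (by positivity)
  have h1 := hM w (hsub hw)
  have h2 := hM z (hsub (Metric.mem_ball_self (by positivity)))
  rw [mem_closedBall_iff_norm]
  exact (norm_sub_le _ _).trans (by linarith)

lemma clm_eq_sum (L : (Fin n → ℂ) →L[ℂ] ℂ) :
    L = ∑ i, L (Pi.single i 1) • ContinuousLinearMap.proj (R := ℂ) (φ := fun _ : Fin n => ℂ) i := by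
  ext v
  conv_lhs => rw [pi_eq_sum_univ' v, map_sum]
  simp only [map_smul, _root_.sum_apply, _root_.smul_apply,
    ContinuousLinearMap.proj_apply, smul_eq_mul]
  refine Finset.sum_congr rfl fun i _ => ?_
  rw [mul_comm]

lemma norm_single_one_le (i : Fin n) : ‖(Pi.single i 1 : Fin n → ℂ)‖ ≤ 1 := by
  rw [Pi.norm_single]; simp

lemma norm_pd_le (i : Fin n) (F : (Fin n → ℂ) → ℂ) (z : Fin n → ℂ) :
    ‖pd i F z‖ ≤ ‖fderiv ℂ F z‖ :=
  ((fderiv ℂ F z).le_opNorm _).trans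
    (mul_le_of_le_one_right (norm_nonneg _) (norm_single_one_le i))

namespace LocDom
variable {k k' : (Fin n → ℂ) → X → ℂ}

lemma integrable (h : LocDom U μ k) {z : Fin n → ℂ} (hz : z ∈ U) : Integrable (k z) μ := by
  obtain ⟨ε, hε, -, g, hg, hb⟩ := h.dom z hz
  exact hg.mono' (h.meas z hz) (hb.mono fun w hw => hw z (Metric.mem_ball_self hε))

lemma pd_meas (hU : IsOpen U) (h : LocDom U μ k) (i : Fin n) {z : Fin n → ℂ} (hz : z ∈ U) :
    AEStronglyMeasurable (fun w => pd i (fun z => k z w) z) μ := by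
  have hc : Filter.Tendsto (fun N : ℕ => z + ((N : ℂ) + 1)⁻¹ • (Pi.single i 1 : Fin n → ℂ))
      Filter.atTop (nhds z) := by
    have : Filter.Tendsto (fun N : ℕ => ((N : ℂ) + 1)⁻¹) Filter.atTop (nhds 0) := by
      simpa [one_div] using tendsto_one_div_add_atTop_nhds_zero_nat (𝕜 := ℂ)
    have h2 := (tendsto_const_nhds (x := z) (f := Filter.atTop (α := ℕ))).add
      (this.smul_const (Pi.single i 1 : Fin n → ℂ))
    rwa [zero_smul, add_zero] at h2
  obtain ⟨N₀, hN₀⟩ := Filter.eventually_atTop.1 (hc.eventually (hU.mem_nhds hz))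
  refine aestronglyMeasurable_of_tendsto_ae Filter.atTop
    (f := fun (N : ℕ) w => (((N + N₀ : ℕ) : ℂ) + 1) •
      (k (z + ((((N + N₀ : ℕ) : ℂ) + 1))⁻¹ • (Pi.single i 1 : Fin n → ℂ)) w - k z w)) ?_ ?_
  · intro N
    have h1 := h.meas _ (hN₀ (N + N₀) (by omega))
    exact AEStronglyMeasurable.const_smul (h1.sub (h.meas z hz)) (((N + N₀ : ℕ) : ℂ) + 1)
  · filter_upwards [h.diff] with w hw
    have hd : HasFDerivAt (fun z => k z w) (fderiv ℂ (fun z => k z w) z) z :=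
      ((hw z hz).differentiableAt (hU.mem_nhds hz)).hasFDerivAt
    refine hd.lim (Pi.single i 1) (c := fun N : ℕ => (((N + N₀ : ℕ) : ℂ) + 1)) ?_
    have : ∀ N : ℕ, ‖(((N + N₀ : ℕ) : ℂ) + 1)‖ = (N : ℝ) + (N₀ + 1) := by
      intro N
      rw [show (((N + N₀ : ℕ) : ℂ) + 1) = ((N + N₀ + 1 : ℕ) : ℂ) by push_cast; ring,
        Complex.norm_natCast]
      push_cast; ring
    simp_rw [this]
    exact Filter.tendsto_atTop_add_const_right _ _ tendsto_natCast_atTop_atTop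

lemma fderiv_meas (hU : IsOpen U) (h : LocDom U μ k) {z : Fin n → ℂ} (hz : z ∈ U) :
    AEStronglyMeasurable (fun w => fderiv ℂ (fun z => k z w) z) μ := by
  have : (fun w => fderiv ℂ (fun z => k z w) z) = fun w => ∑ i : Fin n,
      pd i (fun z => k z w) z •
        ContinuousLinearMap.proj (R := ℂ) (φ := fun _ : Fin n => ℂ) i := by
    ext1 w
    exact clm_eq_sum _
  rw [this]
  refine Finset.aestronglyMeasurable_fun_sum _ fun i _ => ?_
  exact (h.pd_meas hU i hz).smul_const _

lemma fderiv_dom (h : LocDom U μ k) {z₀ : Fin n → ℂ} (hz : z₀ ∈ U) :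
    ∃ ε > 0, Metric.ball z₀ ε ⊆ U ∧ ∃ g : X → ℝ, Integrable g μ ∧
      ∀ᵐ w ∂μ, ∀ z ∈ Metric.ball z₀ ε, ‖fderiv ℂ (fun z => k z w) z‖ ≤ g w := by
  obtain ⟨ε, hε, hsub, g, hg, hb⟩ := h.dom z₀ hz
  refine ⟨ε / 2, by positivity, (Metric.ball_subset_ball (by linarith)).trans hsub,
    fun w => 2 * g w / (ε / 2), (hg.const_mul 2).div_const _, ?_⟩
  filter_upwards [hb, h.diff] with w hw hd z hz
  exact norm_fderiv_le_of_ball hε (hd.mono hsub) hw hz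

lemma hasFDerivAt (hU : IsOpen U) (h : LocDom U μ k) {z : Fin n → ℂ} (hz : z ∈ U) :
    HasFDerivAt (fun z => ∫ w, k z w ∂μ) (∫ w, fderiv ℂ (fun z => k z w) z ∂μ) z := by
  obtain ⟨ε, hε, hsub, g, hg, hb⟩ := h.fderiv_dom hz
  refine hasFDerivAt_integral_of_dominated_of_fderiv_le (s := Metric.ball z ε)
    (F' := fun z w => fderiv ℂ (fun z => k z w) z) (Metric.ball_mem_nhds _ hε) ?_
    (h.integrable hz) (h.fderiv_meas hU hz) hb hg ?_
  · filter_upwards [hU.mem_nhds hz] with z' hz' using h.meas z' hz'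
  · filter_upwards [h.diff] with w hw z' hz'
    exact ((hw z' (hsub hz')).differentiableAt (hU.mem_nhds (hsub hz'))).hasFDerivAt

lemma differentiableOn (hU : IsOpen U) (h : LocDom U μ k) :
    DifferentiableOn ℂ (fun z => ∫ w, k z w ∂μ) U := fun _ hz =>
  (h.hasFDerivAt hU hz).differentiableAt.differentiableWithinAt

lemma pd_integral (hU : IsOpen U) (h : LocDom U μ k) (i : Fin n) {z : Fin n → ℂ} (hz : z ∈ U) :
    pd i (fun z => ∫ w, k z w ∂μ) z = ∫ w, pd i (fun z => k z w) z ∂μ := by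
  obtain ⟨ε, hε, hsub, g, hg, hb⟩ := h.fderiv_dom hz
  unfold pd
  rw [(h.hasFDerivAt hU hz).fderiv, ContinuousLinearMap.integral_apply]
  exact hg.mono' (h.fderiv_meas hU hz) (hb.mono fun w hw => hw z (Metric.mem_ball_self hε))

end LocDom

lemma pd_differentiableOn (hU : IsOpen U) {F : (Fin n → ℂ) → ℂ} (hF : DifferentiableOn ℂ F U)
    (i : Fin n) : DifferentiableOn ℂ (pd i F) U := by
  intro z₀ hz₀
  obtain ⟨δ, hδ, hδU⟩ := Metric.isOpen_iff.1 hU z₀ hz₀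
  have hcont : ContinuousAt F z₀ := (hF.continuousOn).continuousAt (hU.mem_nhds hz₀)
  obtain ⟨δ', hδ', hδM⟩ := Metric.continuousAt_iff.1 hcont 1 one_pos
  set ε := min δ δ' / 3 with hεdef
  have hm : 0 < min δ δ' := lt_min hδ hδ'
  have hε : 0 < ε := by positivity
  have h3 : 3 * ε = min δ δ' := by rw [hεdef]; ring
  have hbig : ∀ z ∈ Metric.ball z₀ (3 * ε), z ∈ U ∧ ‖F z‖ ≤ ‖F z₀‖ + 1 := by
    intro z hz
    rw [h3, Metric.mem_ball] at hz
    refine ⟨hδU (hz.trans_le (min_le_left _ _)), ?_⟩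
    have := (hδM (hz.trans_le (min_le_right _ _))).le
    rw [dist_eq_norm] at this
    calc ‖F z‖ = ‖F z₀ + (F z - F z₀)‖ := by congr 1; ring
      _ ≤ _ := (norm_add_le _ _).trans (by linarith)
  set e : Fin n → ℂ := Pi.single i 1
  have he : ‖e‖ ≤ 1 := norm_single_one_le i
  have hmem : ∀ z ∈ Metric.ball z₀ ε, ∀ t : ℂ, ‖t‖ < 2 * ε → z + t • e ∈ Metric.ball z₀ (3 * ε) := by
    intro z hz t ht
    rw [mem_ball_iff_norm] at hz ⊢
    calc ‖z + t • e - z₀‖ = ‖(z - z₀) + t • e‖ := by congr 1; abel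
      _ ≤ ‖z - z₀‖ + ‖t‖ * ‖e‖ := (norm_add_le _ _).trans (by rw [norm_smul])
      _ ≤ ‖z - z₀‖ + ‖t‖ := by
        gcongr; exact mul_le_of_le_one_right (norm_nonneg _) he
      _ < 3 * ε := by linarith
  have hmemθ : ∀ z ∈ Metric.ball z₀ ε, ∀ θ : ℝ, z + circleMap 0 ε θ • e ∈ Metric.ball z₀ (3 * ε) := by
    intro z hz θ
    refine hmem z hz _ ?_
    have : ‖circleMap 0 ε θ‖ = ε := by rw [norm_circleMap_zero, abs_of_pos hε]
    linarith
  let kk : (Fin n → ℂ) → ℝ → ℂ := fun z θ => (2 * Real.pi * I : ℂ)⁻¹ • (deriv (circleMap 0 ε) θ •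
    (((circleMap 0 ε θ - 0) ^ 2)⁻¹ • F (z + circleMap 0 ε θ • e)))
  have hcm : ∀ θ, circleMap 0 ε θ ≠ 0 := fun θ => by
    simpa using circleMap_ne_center (c := 0) hε.ne' (θ := θ)
  have hLD : LocDom (Metric.ball z₀ ε) (volume.restrict (Ioc 0 (2 * Real.pi))) kk := by
    refine ⟨Filter.Eventually.of_forall fun θ => ?_, fun z hz => ?_, fun z hz => ?_⟩
    · have hc : DifferentiableOn ℂ (fun z => F (z + circleMap 0 ε θ • e)) (Metric.ball z₀ ε) :=
        hF.comp (by fun_prop) fun z hz => (hbig _ (hmemθ z hz θ)).1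
      simp only [kk, smul_eq_mul]
      exact ((hc.const_mul _).const_mul _).const_mul _
    · refine Continuous.aestronglyMeasurable ?_
      have hFc : Continuous fun θ : ℝ => F (z + circleMap 0 ε θ • e) := by
        refine continuous_iff_continuousAt.2 fun θ => ?_
        refine ContinuousAt.comp (g := F) ?_ ?_
        · exact hF.continuousOn.continuousAt (hU.mem_nhds (hbig _ (hmemθ z hz θ)).1)
        · exact (continuous_const.add ((continuous_circleMap 0 ε).smul continuous_const)).continuousAt
      simp only [kk, smul_eq_mul]
      refine Continuous.mul continuous_const (Continuous.mul ?_ (Continuous.mul ?_ hFc))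
      · rw [show deriv (circleMap 0 ε) = fun θ => circleMap 0 ε θ * I from
          funext fun θ => deriv_circleMap 0 ε θ]
        exact (continuous_circleMap 0 ε).mul continuous_const
      · refine Continuous.inv₀ (by fun_prop) fun θ => ?_
        simpa using hcm θ
    · obtain ⟨r, hr, hrs⟩ := Metric.isOpen_iff.1 Metric.isOpen_ball z hz
      refine ⟨r, hr, hrs, fun _ => ‖(2 * Real.pi * I : ℂ)⁻¹‖ * (ε * ((ε ^ 2)⁻¹ * (‖F z₀‖ + 1))),
        integrable_const _, Filter.Eventually.of_forall fun θ z' hz' => ?_⟩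
      simp only [kk, norm_smul, deriv_circleMap, norm_mul, sub_zero, norm_inv, norm_pow,
        norm_circleMap_zero, abs_of_pos hε, norm_I, mul_one]
      have := (hbig _ (hmemθ z' (hrs hz') θ)).2
      gcongr
  have hd := hLD.differentiableOn Metric.isOpen_ball
  have heq : ∀ z ∈ Metric.ball z₀ ε, pd i F z =
      ∫ θ in Ioc 0 (2 * Real.pi), kk z θ := by
    intro z hz
    have hzU : z ∈ U := by simpa using (hbig _ (hmem z hz 0 (by simpa using hε))).1
    have hline : DifferentiableOn ℂ (fun t : ℂ => F (z + t • e)) (Metric.ball 0 (2 * ε)) := by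
      refine hF.comp (by fun_prop) fun t ht => (hbig _ (hmem z hz t (by simpa using ht))).1
    have hcau := Complex.two_pi_I_inv_smul_circleIntegral_sub_sq_inv_smul_of_differentiable
      (Metric.isOpen_ball) (c := 0) (w₀ := 0) (R := ε)
      (Metric.closedBall_subset_ball (by linarith)) hline (Metric.mem_ball_self hε)
    have hder : deriv (fun t : ℂ => F (z + t • e)) 0 = pd i F z := by
      have h1 : HasFDerivAt F (fderiv ℂ F z) (z + (0 : ℂ) • e) := by
        rw [zero_smul, add_zero]
        exact ((hF z hzU).differentiableAt (hU.mem_nhds hzU)).hasFDerivAt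
      have h2 : HasDerivAt (fun t : ℂ => z + t • e) e 0 := by
        simpa using ((hasDerivAt_id (0 : ℂ)).smul_const e).const_add z
      exact (h1.comp_hasDerivAt (0 : ℂ) h2).deriv
    rw [← hder, ← hcau, circleIntegral, intervalIntegral.integral_of_le (by positivity),
      ← integral_smul]
  have : pd i F =ᶠ[nhds z₀] fun z => ∫ θ in Ioc 0 (2 * Real.pi), kk z θ := by
    filter_upwards [Metric.ball_mem_nhds z₀ hε] with z hz using heq z hz
  exact ((hd z₀ (Metric.mem_ball_self hε)).differentiableAt
    (Metric.ball_mem_nhds z₀ hε)).congr_of_eventuallyEq this |>.differentiableWithinAt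

namespace LocDom
variable {k k' : (Fin n → ℂ) → X → ℂ}

lemma pd (hU : IsOpen U) (h : LocDom U μ k) (i : Fin n) :
    LocDom U μ (fun z w => pd i (fun z => k z w) z) := by
  refine ⟨h.diff.mono fun w hw => pd_differentiableOn hU hw i, fun z hz => h.pd_meas hU i hz,
    fun z₀ hz₀ => ?_⟩
  obtain ⟨ε, hε, hsub, g, hg, hb⟩ := h.fderiv_dom hz₀
  exact ⟨ε, hε, hsub, g, hg, hb.mono fun w hw z hz => (norm_pd_le i _ z).trans (hw z hz)⟩

lemma add (h : LocDom U μ k) (h' : LocDom U μ k') : LocDom U μ (fun z w => k z w + k' z w) := by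
  refine ⟨?_, fun z hz => (h.meas z hz).add (h'.meas z hz), fun z₀ hz₀ => ?_⟩
  · filter_upwards [h.diff, h'.diff] with w h1 h2 using h1.add h2
  · obtain ⟨ε, hε, hsub, g, hg, hb⟩ := h.dom z₀ hz₀
    obtain ⟨ε', hε', hsub', g', hg', hb'⟩ := h'.dom z₀ hz₀
    refine ⟨min ε ε', lt_min hε hε', (Metric.ball_subset_ball (min_le_left _ _)).trans hsub,
      g + g', hg.add hg', ?_⟩
    filter_upwards [hb, hb'] with w h1 h2 z hz
    exact (norm_add_le _ _).trans (add_le_add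
      (h1 z (Metric.ball_subset_ball (min_le_left _ _) hz))
      (h2 z (Metric.ball_subset_ball (min_le_right _ _) hz)))

lemma const_mul (h : LocDom U μ k) (c : ℂ) : LocDom U μ (fun z w => c * k z w) := by
  refine ⟨h.diff.mono fun w hw => hw.const_mul c, fun z hz => (h.meas z hz).const_mul c,
    fun z₀ hz₀ => ?_⟩
  obtain ⟨ε, hε, hsub, g, hg, hb⟩ := h.dom z₀ hz₀
  refine ⟨ε, hε, hsub, fun w => ‖c‖ * g w, hg.const_mul _, hb.mono fun w hw z hz => ?_⟩
  rw [norm_mul]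
  exact mul_le_mul_of_nonneg_left (hw z hz) (norm_nonneg c)

lemma sum (hU : IsOpen U) {ι : Type*} (s : Finset ι) {k : ι → (Fin n → ℂ) → X → ℂ}
    (h : ∀ i ∈ s, LocDom U μ (k i)) : LocDom U μ (fun z w => ∑ i ∈ s, k i z w) := by
  classical
  induction s using Finset.induction_on with
  | empty =>
    simp only [Finset.sum_empty]
    refine ⟨Filter.Eventually.of_forall fun _ => differentiableOn_const _,
      fun _ _ => aestronglyMeasurable_const, fun z hz => ?_⟩
    obtain ⟨ε, hε, hs⟩ := Metric.isOpen_iff.1 hU z hz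
    exact ⟨ε, hε, hs, fun _ => 0, integrable_zero _ _ _, Filter.Eventually.of_forall (by simp)⟩
  | insert a s ha ih =>
    simp only [Finset.sum_insert ha]
    exact (h a (Finset.mem_insert_self _ _)).add
      (ih fun i hi => h i (Finset.mem_insert_of_mem hi))

end LocDom

section Box
variable [NeZero n]

lemma pd_congr (hU : IsOpen U) {F G : (Fin n → ℂ) → ℂ} (h : EqOn F G U) (i : Fin n) :
    EqOn (pd i F) (pd i G) U := by
  intro z hz
  unfold pd
  rw [Filter.EventuallyEq.fderiv_eq (Filter.eventuallyEq_of_mem (hU.mem_nhds hz) h)]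

lemma BoxOp_congr (hU : IsOpen U) {F G : (Fin n → ℂ) → ℂ} (h : EqOn F G U) :
    EqOn (BoxOp F) (BoxOp G) U := by
  intro z hz
  unfold BoxOp
  simp only [pd_congr hU (pd_congr hU h _) _ hz]

lemma BoxOp_iter_congr (hU : IsOpen U) {F G : (Fin n → ℂ) → ℂ} (h : EqOn F G U) (m : ℕ) :
    EqOn (BoxOp^[m] F) (BoxOp^[m] G) U := by
  induction m with
  | zero => exact h
  | succ m ih =>
    simp only [Function.iterate_succ_apply']
    exact BoxOp_congr hU ih

lemma BoxOp_differentiableOn (hU : IsOpen U) {F : (Fin n → ℂ) → ℂ} (hF : DifferentiableOn ℂ F U) :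
    DifferentiableOn ℂ (BoxOp F) U := by
  have h2 : ∀ i, DifferentiableOn ℂ (pd i (pd i F)) U := fun i =>
    pd_differentiableOn hU (pd_differentiableOn hU hF i) i
  refine DifferentiableOn.neg (((h2 0).const_mul 2).sub ?_)
  exact DifferentiableOn.fun_sum fun i _ => h2 i

lemma BoxOp_iter_differentiableOn (hU : IsOpen U) {F : (Fin n → ℂ) → ℂ}
    (hF : DifferentiableOn ℂ F U) (m : ℕ) : DifferentiableOn ℂ (BoxOp^[m] F) U := by
  induction m with
  | zero => exact hF
  | succ m ih =>
    simp only [Function.iterate_succ_apply']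
    exact BoxOp_differentiableOn hU ih

variable {k : (Fin n → ℂ) → X → ℂ}

lemma LocDom.boxOp (hU : IsOpen U) (h : LocDom U μ k) :
    LocDom U μ (fun z w => BoxOp (fun z => k z w) z) := by
  have h2 : ∀ i, LocDom U μ (fun z w => _root_.pd i (_root_.pd i (fun z => k z w)) z) := fun i =>
    (h.pd hU i).pd hU i
  have := (((h2 0).const_mul 2).add ((LocDom.sum hU Finset.univ fun i _ => h2 i).const_mul
    (-1))).const_mul (-1)
  convert this using 3
  unfold BoxOp
  ring

lemma LocDom.boxOp_integral (hU : IsOpen U) (h : LocDom U μ k) {z : Fin n → ℂ} (hz : z ∈ U) :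
    BoxOp (fun z => ∫ w, k z w ∂μ) z = ∫ w, BoxOp (fun z => k z w) z ∂μ := by
  have h2 : ∀ i, LocDom U μ (fun z w => _root_.pd i (_root_.pd i (fun z => k z w)) z) := fun i =>
    (h.pd hU i).pd hU i
  have e2 : ∀ i, _root_.pd i (_root_.pd i (fun z => ∫ w, k z w ∂μ)) z =
      ∫ w, _root_.pd i (_root_.pd i (fun z => k z w)) z ∂μ := by
    intro i
    rw [pd_congr hU (fun z hz => h.pd_integral hU i hz) i hz, (h.pd hU i).pd_integral hU i hz]
  unfold BoxOp
  rw [e2 0, Finset.sum_congr rfl fun i _ => e2 i, integral_neg, integral_sub, integral_const_mul,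
    integral_finsetSum]
  · exact fun i _ => (h2 i).integrable hz
  · exact ((h2 0).integrable hz).const_mul 2
  · exact integrable_finsetSum _ fun i _ => (h2 i).integrable hz

lemma LocDom.boxOp_iter (hU : IsOpen U) (h : LocDom U μ k) (m : ℕ) :
    LocDom U μ (fun z w => BoxOp^[m] (fun z => k z w) z) := by
  induction m with
  | zero => exact h
  | succ m ih =>
    simp only [Function.iterate_succ_apply']
    exact ih.boxOp hU

lemma LocDom.boxOp_iter_integral (hU : IsOpen U) (h : LocDom U μ k) (m : ℕ) :
    ∀ z ∈ U, BoxOp^[m] (fun z => ∫ w, k z w ∂μ) z = ∫ w, BoxOp^[m] (fun z => k z w) z ∂μ := by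
  induction m with
  | zero => exact fun _ _ => rfl
  | succ m ih =>
    intro z hz
    simp only [Function.iterate_succ_apply']
    rw [BoxOp_congr hU ih hz, (h.boxOp_iter hU m).boxOp_integral hU hz]

end Box

end ParametricHolomorphy

section BoxKernel
variable {n : ℕ}

lemma pd_mul {F G : (Fin n → ℂ) → ℂ} {z : Fin n → ℂ} (i : Fin n) (hF : DifferentiableAt ℂ F z)
    (hG : DifferentiableAt ℂ G z) :
    pd i (fun z => F z * G z) z = pd i F z * G z + F z * pd i G z := by
  simp only [pd, fderiv_fun_mul hF hG, _root_.add_apply, _root_.smul_apply, smul_eq_mul]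
  ring

lemma pd_add {F G : (Fin n → ℂ) → ℂ} {z : Fin n → ℂ} (i : Fin n) (hF : DifferentiableAt ℂ F z)
    (hG : DifferentiableAt ℂ G z) :
    pd i (fun z => F z + G z) z = pd i F z + pd i G z := by
  simp only [pd, fderiv_fun_add hF hG, _root_.add_apply]

lemma pd_const_mul {F : (Fin n → ℂ) → ℂ} {z : Fin n → ℂ} (i : Fin n)
    (hF : DifferentiableAt ℂ F z) (c : ℂ) : pd i (fun z => c * F z) z = c * pd i F z := by
  simp only [pd, fderiv_const_mul hF, _root_.smul_apply, smul_eq_mul]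

lemma pd_const (i : Fin n) (c : ℂ) (z : Fin n → ℂ) : pd i (fun _ => c) z = 0 := by
  simp [pd]

lemma pd_pow {F : (Fin n → ℂ) → ℂ} {z : Fin n → ℂ} (i : Fin n) (hF : DifferentiableAt ℂ F z)
    (j : ℕ) : pd i (fun z => F z ^ j) z = j * F z ^ (j - 1) * pd i F z := by
  simp only [pd, (hF.hasFDerivAt.pow j).fderiv, _root_.smul_apply, smul_eq_mul, nsmul_eq_mul]

lemma pd_cpow {F : (Fin n → ℂ) → ℂ} {z : Fin n → ℂ} (i : Fin n) (hF : DifferentiableAt ℂ F z)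
    (h : F z ∈ slitPlane) (c : ℂ) :
    pd i (fun z => F z ^ c) z = c * F z ^ (c - 1) * pd i F z := by
  have h1 : HasDerivAt (fun x : ℂ => x ^ c) (c * F z ^ (c - 1)) (F z) := by
    simpa using (hasDerivAt_id (F z)).cpow_const (c := c) h
  simp only [pd, (h1.comp_hasFDerivAt z hF.hasFDerivAt).fderiv, _root_.smul_apply, smul_eq_mul,
    show (fun z => F z ^ c) = (fun x : ℂ => x ^ c) ∘ F from rfl]

lemma pd_coord (i j : Fin n) (z : Fin n → ℂ) :
    pd i (fun z => z j) z = if i = j then 1 else 0 := by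
  rw [pd, (hasFDerivAt_apply j z).fderiv]
  simp [Pi.single_apply, eq_comm]

variable [NeZero n]

/-- The signature `(1, -1, …, -1)` of the Lorentz form. -/
def sg (i : Fin n) : ℂ := 2 * (if i = 0 then 1 else 0) - 1

lemma sg_mul_self (i : Fin n) : sg i * sg i = 1 := by unfold sg; split_ifs <;> norm_num

lemma sum_sg (f : Fin n → ℂ) : ∑ i, sg i * f i = 2 * f 0 - ∑ i, f i := by
  simp only [sg, sub_mul, one_mul, mul_assoc, Finset.sum_sub_distrib, ← Finset.mul_sum, ite_mul,
    zero_mul, Finset.sum_ite_eq', Finset.mem_univ, if_true]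

lemma lorC_eq_sum_sg (z : Fin n → ℂ) : lorC z = ∑ i, sg i * z i ^ 2 := by
  rw [sum_sg, lorC]

lemma BoxOp_eq_sum_sg (F : (Fin n → ℂ) → ℂ) (z : Fin n → ℂ) :
    BoxOp F z = -∑ i, sg i * pd i (pd i F) z := by
  rw [sum_sg, BoxOp]

lemma differentiable_kb (w : Fin n → ℂ) : Differentiable ℂ fun z => kb z w := by
  unfold kb lorC
  simp only [Pi.sub_apply]
  fun_prop

lemma pd_zeta (i j : Fin n) (a z : Fin n → ℂ) :
    pd i (fun z => (z - a) j) z = if i = j then 1 else 0 := by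
  simp only [Pi.sub_apply, sub_eq_add_neg]
  rw [pd_add i (by fun_prop) (by fun_prop), pd_const, pd_coord, add_zero]

lemma pd_kb (i : Fin n) (z w : Fin n → ℂ) :
    pd i (fun z => kb z w) z = -2 * sg i * (z - cj w) i := by
  have hd : ∀ j : Fin n, DifferentiableAt ℂ (fun z : Fin n → ℂ => (z - cj w) j) z := fun j => by
    simp only [Pi.sub_apply]; fun_prop
  have h : (fun z => kb z w) = fun z => ∑ j : Fin n, (-sg j) * (z - cj w) j ^ 2 := by
    ext z
    rw [kb, lorC_eq_sum_sg, ← Finset.sum_neg_distrib]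
    exact Finset.sum_congr rfl fun j _ => by ring
  rw [h, pd, fderiv_fun_sum fun j _ => ((hd j).fun_pow 2).const_mul _, _root_.sum_apply]
  change ∑ j, pd i (fun z => (-sg j) * (z - cj w) j ^ 2) z = _
  rw [Finset.sum_congr rfl fun j _ => by
    rw [pd_const_mul i ((hd j).fun_pow 2), pd_pow i (hd j), pd_zeta]]
  simp only [mul_ite, mul_one, mul_zero, Finset.sum_ite_eq, Finset.mem_univ, if_true]
  push_cast
  ring

/-- The value of the null linear form `ζ₀ + ζ₁` at `z - w̄`. -/
def nt (z w : Fin n → ℂ) : ℂ := (z - cj w) 0 + (z - cj w) 1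

/-- The coefficients of the null linear form. -/
def nco (n : ℕ) [NeZero n] (i : Fin n) : ℂ := (if i = 0 then 1 else 0) + (if i = 1 then 1 else 0)

lemma differentiable_nt (w : Fin n → ℂ) : Differentiable ℂ fun z => nt z w := by
  unfold nt
  simp only [Pi.sub_apply]
  fun_prop

lemma pd_nt (i : Fin n) (z w : Fin n → ℂ) : pd i (fun z => nt z w) z = nco n i := by
  unfold nt
  rw [pd_add i (by simp only [Pi.sub_apply]; fun_prop) (by simp only [Pi.sub_apply]; fun_prop),
    pd_zeta, pd_zeta, nco]

lemma sum_sg_nco_sq (hn : 2 ≤ n) : ∑ i, sg i * nco n i ^ 2 = 0 := by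
  have h01 : (0 : Fin n) ≠ 1 := by
    obtain ⟨k, rfl⟩ := Nat.exists_eq_add_of_le' hn
    simp
  rw [Finset.sum_eq_add (0 : Fin n) 1 h01 ?_ (by simp) (by simp)]
  · simp [sg, nco, h01, h01.symm]; norm_num
  · rintro c - ⟨h0, h1⟩
    simp [nco, h0, h1]

lemma sum_nco_mul (z : Fin n → ℂ) : ∑ i, nco n i * z i = z 0 + z 1 := by
  simp [nco, add_mul, Finset.sum_add_distrib]

/-- Action of the wave operator on products of a power kernel and a power of a null form. -/
lemma BoxOp_Ks_nt (hn : 2 ≤ n) (s : ℝ) (j : ℕ) {w : Fin n → ℂ} (hw : w ∈ tube n) :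
    EqOn (BoxOp fun z => Ks s z w * nt z w ^ j)
      (fun z => (4 * s * (s + 1 - n / 2 - j) : ℝ) * (Ks (s + 1) z w * nt z w ^ j)) (tube n) := by
  have hb : ∀ z, DifferentiableAt ℂ (fun z => kb z w) z := fun z => differentiable_kb w z
  have ht : ∀ z, DifferentiableAt ℂ (fun z => nt z w) z := fun z => differentiable_nt w z
  have hK : ∀ s' : ℝ, ∀ z ∈ tube n, DifferentiableAt ℂ (fun z => Ks s' z w) z := fun s' z hz =>
    (hb z).cpow_const (kb_mem_slitPlane hz hw)
  have pK : ∀ (s' : ℝ) (i : Fin n), ∀ z ∈ tube n, pd i (fun z => Ks s' z w) z =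
      2 * s' * sg i * (z - cj w) i * Ks (s' + 1) z w := by
    intro s' i z hz
    unfold Ks
    rw [pd_cpow i (hb z) (kb_mem_slitPlane hz hw), pd_kb]
    rw [show ((-s' : ℝ) : ℂ) - 1 = ((-(s' + 1) : ℝ) : ℂ) by push_cast; ring]
    push_cast; ring
  have p1 : ∀ (s' : ℝ) (j : ℕ) (i : Fin n), ∀ z ∈ tube n,
      pd i (fun z => Ks s' z w * nt z w ^ j) z =
        2 * s' * sg i * ((z - cj w) i * (Ks (s' + 1) z w * nt z w ^ j)) +
          j * nco n i * (Ks s' z w * nt z w ^ (j - 1)) := by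
    intro s' j i z hz
    rw [pd_mul i (hK s' z hz) ((ht z).fun_pow j), pK s' i z hz, pd_pow i (ht z), pd_nt]
    ring
  intro z hz
  have hζ : ∀ i, DifferentiableAt ℂ (fun z : Fin n → ℂ => (z - cj w) i) z := fun i => by
    simp only [Pi.sub_apply]; fun_prop
  have p2 : ∀ i, pd i (pd i (fun z => Ks s z w * nt z w ^ j)) z =
      2 * s * sg i * (Ks (s + 1) z w * nt z w ^ j) +
      (4 * s * (s + 1) * sg i ^ 2 * (z - cj w) i ^ 2 * (Ks (s + 1 + 1) z w * nt z w ^ j)) +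
      4 * s * j * sg i * (nco n i * (z - cj w) i) * (Ks (s + 1) z w * nt z w ^ (j - 1)) +
      j * ((j - 1 : ℕ) : ℂ) * nco n i ^ 2 * (Ks s z w * nt z w ^ (j - 1 - 1)) := by
    intro i
    rw [pd_congr isOpen_tube (fun z hz => p1 s j i z hz) i hz]
    have d1 : ∀ (s' : ℝ) (j : ℕ), DifferentiableAt ℂ (fun z => Ks s' z w * nt z w ^ j) z :=
      fun s' j => (hK s' z hz).mul ((ht z).fun_pow j)
    rw [pd_add i (((hζ i).fun_mul (d1 _ _)).const_mul _) ((d1 _ _).const_mul _),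
      pd_const_mul i ((hζ i).fun_mul (d1 _ _)), pd_const_mul i (d1 _ _),
      pd_mul i (hζ i) (d1 _ _), pd_zeta, p1 _ _ _ z hz, p1 _ _ _ z hz]
    simp only [if_true]
    push_cast
    ring
  have hsum : ∑ i, sg i * pd i (pd i (fun z => Ks s z w * nt z w ^ j)) z =
      2 * s * n * (Ks (s + 1) z w * nt z w ^ j) +
      4 * s * (s + 1) * lorC (z - cj w) * (Ks (s + 1 + 1) z w * nt z w ^ j) +
      4 * s * j * nt z w * (Ks (s + 1) z w * nt z w ^ (j - 1)) := by
    have e : ∀ i : Fin n, sg i * pd i (pd i (fun z => Ks s z w * nt z w ^ j)) z =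
      2 * s * (Ks (s + 1) z w * nt z w ^ j) +
      4 * s * (s + 1) * (Ks (s + 1 + 1) z w * nt z w ^ j) * (sg i * (z - cj w) i ^ 2) +
      4 * s * j * (Ks (s + 1) z w * nt z w ^ (j - 1)) * (nco n i * (z - cj w) i) +
      j * ((j - 1 : ℕ) : ℂ) * (Ks s z w * nt z w ^ (j - 1 - 1)) * (sg i * nco n i ^ 2) := by
      intro i
      rw [p2 i]
      have := sg_mul_self i
      linear_combination (2 * s * (Ks (s + 1) z w * nt z w ^ j) +
        4 * s * (s + 1) * (Ks (s + 1 + 1) z w * nt z w ^ j) * (sg i * (z - cj w) i ^ 2) +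
        4 * s * j * (Ks (s + 1) z w * nt z w ^ (j - 1)) * (nco n i * (z - cj w) i)) * this
    rw [Finset.sum_congr rfl fun i _ => e i]
    simp only [Finset.sum_add_distrib, ← Finset.mul_sum, sum_sg_nco_sq hn, sum_nco_mul,
      ← lorC_eq_sum_sg, Finset.sum_const, Finset.card_univ, Fintype.card_fin, nsmul_eq_mul]
    rw [nt]
    ring
  have hbK : lorC (z - cj w) * Ks (s + 1 + 1) z w = -Ks (s + 1) z w := by
    have h0 := kb_ne_zero hz hw
    rw [show lorC (z - cj w) = -kb z w by rw [kb, neg_neg], neg_mul]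
    congr 1
    unfold Ks
    rw [show ((-(s + 1) : ℝ) : ℂ) = 1 + ((-(s + 1 + 1) : ℝ) : ℂ) by push_cast; ring,
      Complex.cpow_add _ _ h0, Complex.cpow_one]
  have hj : (j : ℂ) * (nt z w * nt z w ^ (j - 1)) = j * nt z w ^ j := by
    rcases Nat.eq_zero_or_pos j with rfl | h
    · simp
    · rw [mul_pow_sub_one h.ne']
  show BoxOp _ z = _
  rw [BoxOp_eq_sum_sg, hsum]
  push_cast
  linear_combination (-4 * s * (s + 1) * nt z w ^ j) * hbK - 4 * s * Ks (s + 1) z w * hj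

lemma Ks_nt_differentiableOn (s : ℝ) (j : ℕ) {w : Fin n → ℂ} (hw : w ∈ tube n) :
    DifferentiableOn ℂ (fun z => Ks s z w * nt z w ^ j) (tube n) := fun z hz =>
  (((differentiable_kb w z).cpow_const (kb_mem_slitPlane hz hw)).mul
    ((differentiable_nt w z).pow j)).differentiableWithinAt

lemma Ks_differentiableOn (s : ℝ) {w : Fin n → ℂ} (hw : w ∈ tube n) :
    DifferentiableOn ℂ (fun z => Ks s z w) (tube n) := by
  simpa using Ks_nt_differentiableOn s 0 hw

lemma pd_const_mul_on {U : Set (Fin n → ℂ)} (hU : IsOpen U) {F : (Fin n → ℂ) → ℂ}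
    (hF : DifferentiableOn ℂ F U) (c : ℂ) (i : Fin n) :
    EqOn (pd i fun z => c * F z) (fun z => c * pd i F z) U := fun _ hz =>
  pd_const_mul i (hF.differentiableAt (hU.mem_nhds hz)) c

lemma BoxOp_const_mul {U : Set (Fin n → ℂ)} (hU : IsOpen U) {F : (Fin n → ℂ) → ℂ}
    (hF : DifferentiableOn ℂ F U) (c : ℂ) :
    EqOn (BoxOp fun z => c * F z) (fun z => c * BoxOp F z) U := by
  intro z hz
  have e : ∀ i, pd i (pd i fun z => c * F z) z = c * pd i (pd i F) z := fun i => by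
    rw [pd_congr hU (pd_const_mul_on hU hF c i) i hz,
      pd_const_mul_on hU (pd_differentiableOn hU hF i) c i hz]
  simp only [BoxOp, e, ← Finset.mul_sum]
  ring

lemma BoxOp_iter_const_mul {U : Set (Fin n → ℂ)} (hU : IsOpen U) {F : (Fin n → ℂ) → ℂ}
    (hF : DifferentiableOn ℂ F U) (c : ℂ) (m : ℕ) :
    EqOn (BoxOp^[m] fun z => c * F z) (fun z => c * BoxOp^[m] F z) U := by
  induction m with
  | zero => exact fun _ _ => rfl
  | succ m ih =>
    simp only [Function.iterate_succ_apply']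
    exact (BoxOp_congr hU ih).trans
      (BoxOp_const_mul hU (BoxOp_iter_differentiableOn hU hF m) c)

lemma BoxOp_add {U : Set (Fin n → ℂ)} (hU : IsOpen U) {F G : (Fin n → ℂ) → ℂ}
    (hF : DifferentiableOn ℂ F U) (hG : DifferentiableOn ℂ G U) :
    EqOn (BoxOp fun z => F z + G z) (fun z => BoxOp F z + BoxOp G z) U := by
  intro z hz
  have e1 : ∀ i, EqOn (pd i fun z => F z + G z) (fun z => pd i F z + pd i G z) U := fun i z hz =>
    pd_add i (hF.differentiableAt (hU.mem_nhds hz)) (hG.differentiableAt (hU.mem_nhds hz))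
  have e : ∀ i, pd i (pd i fun z => F z + G z) z = pd i (pd i F) z + pd i (pd i G) z := fun i => by
    rw [pd_congr hU (e1 i) i hz]
    exact pd_add i ((pd_differentiableOn hU hF i).differentiableAt (hU.mem_nhds hz))
      ((pd_differentiableOn hU hG i).differentiableAt (hU.mem_nhds hz))
  simp only [BoxOp, e, Finset.sum_add_distrib]
  ring

lemma BoxOp_iter_add {U : Set (Fin n → ℂ)} (hU : IsOpen U) {F G : (Fin n → ℂ) → ℂ}
    (hF : DifferentiableOn ℂ F U) (hG : DifferentiableOn ℂ G U) (m : ℕ) :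
    EqOn (BoxOp^[m] fun z => F z + G z) (fun z => BoxOp^[m] F z + BoxOp^[m] G z) U := by
  induction m with
  | zero => exact fun _ _ => rfl
  | succ m ih =>
    simp only [Function.iterate_succ_apply']
    exact (BoxOp_congr hU ih).trans (BoxOp_add hU (BoxOp_iter_differentiableOn hU hF m)
      (BoxOp_iter_differentiableOn hU hG m))

lemma BoxOp_iter_zero (m : ℕ) : BoxOp^[m] (fun _ : Fin n → ℂ => (0 : ℂ)) = fun _ => 0 := by
  have h : BoxOp (fun _ : Fin n → ℂ => (0 : ℂ)) = fun _ => 0 := by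
    have : ∀ i : Fin n, pd i (fun _ : Fin n → ℂ => (0 : ℂ)) = fun _ => 0 := fun i =>
      funext fun z => pd_const i 0 z
    ext z
    simp [BoxOp, this]
  exact Function.iterate_fixed h m

lemma BoxOp_iter_sum {U : Set (Fin n → ℂ)} (hU : IsOpen U) {ι : Type*} (s : Finset ι)
    {F : ι → (Fin n → ℂ) → ℂ} (hF : ∀ i ∈ s, DifferentiableOn ℂ (F i) U) (m : ℕ) :
    EqOn (BoxOp^[m] fun z => ∑ i ∈ s, F i z) (fun z => ∑ i ∈ s, BoxOp^[m] (F i) z) U := by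
  classical
  induction s using Finset.induction_on with
  | empty =>
    simp only [Finset.sum_empty, BoxOp_iter_zero]
    exact fun _ _ => rfl
  | insert a s ha ih =>
    simp only [Finset.sum_insert ha]
    refine (BoxOp_iter_add hU (hF a (Finset.mem_insert_self _ _))
      (DifferentiableOn.fun_sum fun i hi => hF i (Finset.mem_insert_of_mem hi)) m).trans
      fun z hz => ?_
    have := ih (fun i hi => hF i (Finset.mem_insert_of_mem hi)) hz
    simp only at this ⊢
    rw [this]

/-- The constant produced by `m` applications of the wave operator. -/
def boxC (n : ℕ) (s : ℝ) (j m : ℕ) : ℝ :=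
  ∏ i ∈ Finset.range m, (4 * (s + i) * (s + i + 1 - n / 2 - j))

lemma BoxOp_iter_Ks_nt (hn : 2 ≤ n) (s : ℝ) (j m : ℕ) {w : Fin n → ℂ} (hw : w ∈ tube n) :
    EqOn (BoxOp^[m] fun z => Ks s z w * nt z w ^ j)
      (fun z => (boxC n s j m : ℝ) * (Ks (s + m) z w * nt z w ^ j)) (tube n) := by
  induction m with
  | zero => intro z _; simp [boxC]
  | succ m ih =>
    simp only [Function.iterate_succ_apply']
    refine (BoxOp_congr isOpen_tube ih).trans ((BoxOp_const_mul isOpen_tube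
      (Ks_nt_differentiableOn _ j hw) _).trans fun z hz => ?_)
    simp only
    have hp : boxC n s j (m + 1) =
        boxC n s j m * (4 * (s + m) * (s + m + 1 - n / 2 - j)) := Finset.prod_range_succ _ _
    rw [BoxOp_Ks_nt hn (s + m) j hw hz, hp,
      show s + (m : ℝ) + 1 = s + ((m + 1 : ℕ) : ℝ) by push_cast; ring]
    push_cast
    ring

lemma BoxOp_iter_Ks (hn : 2 ≤ n) (s : ℝ) (m : ℕ) {w : Fin n → ℂ} (hw : w ∈ tube n) :
    EqOn (BoxOp^[m] fun z => Ks s z w)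
      (fun z => (boxC n s 0 m : ℝ) * Ks (s + m) z w) (tube n) := by
  simpa using BoxOp_iter_Ks_nt hn s 0 m hw

lemma boxC_ne_zero (hn : 2 ≤ n) {s : ℝ} (hs : (n : ℝ) / 2 - 1 < s) (m : ℕ) :
    boxC n s 0 m ≠ 0 := by
  have hn' : (2 : ℝ) ≤ n := by exact_mod_cast hn
  refine Finset.prod_ne_zero_iff.2 fun i _ => ?_
  have hi : (0 : ℝ) ≤ i := Nat.cast_nonneg i
  have h1 : 0 < s + i := by linarith
  have h2 : 0 < s + i + 1 - n / 2 - ((0 : ℕ) : ℝ) := by push_cast; linarith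
  positivity

end BoxKernel

section Harnack
variable {n : ℕ} [NeZero n]

/-- The Harnack constant comparing `kb · w` at `z` and `z₀`. -/
def harC (z₀ z : Fin n → ℂ) : ℝ := triC n * ‖kb z₀ z‖ ^ 2 / dl z ^ 2

lemma harC_pos {z₀ z : Fin n → ℂ} (hz₀ : z₀ ∈ tube n) (hz : z ∈ tube n) : 0 < harC z₀ z :=
  div_pos (mul_pos triC_pos (pow_pos (norm_kb_pos hz₀ hz) 2)) (pow_pos (dl_pos hz) 2)

lemma norm_kb_harnack {z₀ z w : Fin n → ℂ} (hz₀ : z₀ ∈ tube n) (hz : z ∈ tube n)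
    (hw : w ∈ tube n) : ‖kb z₀ w‖ ≤ harC z₀ z * ‖kb z w‖ := by
  have h := norm_kb_le hw hz₀ hz
  have h0 := dl_pos hz
  rw [norm_kb_comm w z₀, norm_kb_comm w z] at h
  rw [harC, div_mul_eq_mul_div, le_div_iff₀ (by positivity)]
  linarith

lemma norm_Ks_harnack {s : ℝ} (hs : 0 ≤ s) {z₀ z w : Fin n → ℂ} (hz₀ : z₀ ∈ tube n)
    (hz : z ∈ tube n) (hw : w ∈ tube n) : ‖Ks s z w‖ ≤ harC z₀ z ^ s * ‖Ks s z₀ w‖ := by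
  rw [norm_Ks, norm_Ks]
  have h1 := norm_kb_pos hz₀ hw
  have h2 := norm_kb_pos hz hw
  have h3 := harC_pos hz₀ hz
  have h := Real.rpow_le_rpow h1.le (norm_kb_harnack hz₀ hz hw) hs
  rw [Real.mul_rpow h3.le h2.le] at h
  rw [Real.rpow_neg h1.le, Real.rpow_neg h2.le, ← div_eq_mul_inv, le_div_iff₀ (by positivity),
    inv_mul_le_iff₀ (by positivity), mul_comm (_ ^ s)]
  exact h

lemma continuousOn_harC (z₀ : Fin n → ℂ) :
    ContinuousOn (fun z => harC z₀ z) (tube n) := by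
  unfold harC
  refine ContinuousOn.div ?_ ?_ fun z hz => ?_
  · exact (continuous_const.mul ((continuous_kb_right z₀).norm.pow 2)).continuousOn
  · exact (continuous_dl.pow 2).continuousOn
  · exact pow_ne_zero 2 (dl_pos hz).ne'

lemma LocDom.of_bound {X : Type*} [MeasurableSpace X] {μ : Measure X} {U : Set (Fin n → ℂ)}
    (hU : IsOpen U) {k : (Fin n → ℂ) → X → ℂ}
    (hd : ∀ᵐ w ∂μ, DifferentiableOn ℂ (fun z => k z w) U)
    (hm : ∀ z ∈ U, AEStronglyMeasurable (k z) μ) {C : (Fin n → ℂ) → ℝ} (hC : ContinuousOn C U)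
    {g : X → ℝ} (hg : Integrable g μ) (hg0 : ∀ w, 0 ≤ g w)
    (hb : ∀ᵐ w ∂μ, ∀ z ∈ U, ‖k z w‖ ≤ C z * g w) : LocDom U μ k := by
  refine ⟨hd, hm, fun z₀ hz₀ => ?_⟩
  obtain ⟨ε, hε, hs⟩ := Metric.isOpen_iff.1 hU z₀ hz₀
  obtain ⟨δ, hδ, hδC⟩ := Metric.continuousAt_iff.1 (hC.continuousAt (hU.mem_nhds hz₀)) 1 one_pos
  refine ⟨min ε δ, lt_min hε hδ, (Metric.ball_subset_ball (min_le_left _ _)).trans hs,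
    fun w => (C z₀ + 1) * g w, hg.const_mul _, ?_⟩
  filter_upwards [hb] with w hw z hz
  refine (hw z (hs (Metric.ball_subset_ball (min_le_left _ _) hz))).trans
    (mul_le_mul_of_nonneg_right ?_ (hg0 w))
  have := hδC (Metric.ball_subset_ball (min_le_right _ _) hz)
  rw [Real.dist_eq] at this
  linarith [(abs_lt.1 this).2]

lemma measurable_Ks_right (s : ℝ) (z : Fin n → ℂ) : Measurable fun w => Ks s z w :=
  (continuous_kb_right z).measurable.pow_const _

lemma locDom_Ks {s : ℝ} (hs : 0 ≤ s) {β : ℝ} {f : (Fin n → ℂ) → ℂ}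
    (hf : AEStronglyMeasurable f (dV n β)) {z₀ : Fin n → ℂ} (hz₀ : z₀ ∈ tube n)
    (hi : Integrable (fun w => Ks s z₀ w * f w) (dV n β)) :
    LocDom (tube n) (dV n β) (fun z w => Ks s z w * f w) := by
  refine LocDom.of_bound isOpen_tube ?_ (fun z _ =>
    (measurable_Ks_right s z).aestronglyMeasurable.mul hf)
    (C := fun z => harC z₀ z ^ s) ((continuousOn_harC z₀).rpow_const fun z _ => Or.inr hs)
    hi.norm (fun w => norm_nonneg _) ?_
  · filter_upwards [ae_dV] with w hw using (Ks_differentiableOn s hw).mul_const _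
  · filter_upwards [ae_dV] with w hw z hz
    rw [norm_mul, norm_mul, ← mul_assoc]
    exact mul_le_mul_of_nonneg_right (norm_Ks_harnack hs hz₀ hz hw) (norm_nonneg _)

end Harnack

section CircularMean

variable {n : ℕ} [NeZero n]

lemma integral_dV (γ : ℝ) (f : (Fin n → ℂ) → ℂ) :
    ∫ z, f z ∂dV n γ = ∫ z in tube n, ((dl z ^ (γ - (n : ℝ) / 2) : ℝ) : ℂ) * f z := by
  rw [dV, integral_withDensity_eq_integral_toReal_smul]
  · refine setIntegral_congr_fun measurableSet_tube fun z hz => ?_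
    simp only [Complex.real_smul]
    rw [ENNReal.toReal_ofReal (Real.rpow_nonneg hz.1.le _)]; rfl
  · exact (continuous_dl.measurable.pow_const _).ennreal_ofReal
  · exact ae_of_all _ fun _ => ENNReal.ofReal_lt_top

lemma integrable_dV_iff (γ : ℝ) (f : (Fin n → ℂ) → ℂ) :
    Integrable f (dV n γ) ↔
      IntegrableOn (fun z => ((dl z ^ (γ - (n : ℝ) / 2) : ℝ) : ℂ) * f z) (tube n) := by
  rw [dV, integrable_withDensity_iff_integrable_smul', IntegrableOn]
  · refine integrable_congr ?_
    filter_upwards [ae_restrict_mem measurableSet_tube] with z hz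
    simp only [Complex.real_smul]
    rw [ENNReal.toReal_ofReal (Real.rpow_nonneg hz.1.le _)]; rfl
  · exact (continuous_dl.measurable.pow_const _).ennreal_ofReal
  · exact ae_of_all _ fun _ => ENNReal.ofReal_lt_top

lemma abs_det_restrictScalars (L : (Fin n → ℂ) →L[ℂ] (Fin n → ℂ)) :
    |(L.restrictScalars ℝ).det| = ‖LinearMap.det (L : (Fin n → ℂ) →ₗ[ℂ] (Fin n → ℂ))‖ ^ 2 := by
  have : (L.restrictScalars ℝ).det =
      Algebra.norm ℝ (LinearMap.det (L : (Fin n → ℂ) →ₗ[ℂ] (Fin n → ℂ))) :=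
    LinearMap.det_restrictScalars (R := ℝ) (f := (L : (Fin n → ℂ) →ₗ[ℂ] (Fin n → ℂ)))
  rw [this, Algebra.norm_complex_apply, Complex.normSq_eq_norm_sq, abs_of_nonneg (sq_nonneg _)]

lemma measurePreserving_circle_smul (a : Circle) :
    MeasurePreserving (fun z : Fin n → ℂ => (a : ℂ) • z) := by
  have := volume_preserving_pi (fun _ : Fin n => (rotation a).measurePreserving)
  convert this using 1
  ext z i; simp [rotation_apply]

lemma circle_integral_mul {D : Set (Fin n → ℂ)} (hD : IsOpen D)
    (hbal : ∀ ξ ∈ D, ∀ c : ℂ, ‖c‖ ≤ 1 → c • ξ ∈ D) {H : (Fin n → ℂ) → ℂ}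
    (hH : DifferentiableOn ℂ H D) {ω : (Fin n → ℂ) → ℝ} (hω : Measurable ω)
    (hinv : ∀ ξ, ∀ c : ℂ, ‖c‖ = 1 → ω (c • ξ) = ω ξ)
    (hi : IntegrableOn (fun ξ => (ω ξ : ℂ) * H ξ) D) :
    ∫ ξ in D, (ω ξ : ℂ) * H ξ = H 0 * ∫ ξ in D, (ω ξ : ℂ) := by
  set J : (Fin n → ℂ) → ℂ := D.indicator fun ξ => (ω ξ : ℂ) * H ξ with hJ
  have hm : Measurable (D.indicator H) := by
    classical
    rw [← Set.piecewise_eq_indicator]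
    exact hH.continuousOn.measurable_piecewise continuousOn_const hD.measurableSet
  have hJm : Measurable J := by
    have : J = fun ξ => (ω ξ : ℂ) * D.indicator H ξ := by
      ext ξ; by_cases h : ξ ∈ D <;> simp [hJ, h]
    rw [this]; exact (Complex.measurable_ofReal.comp hω).mul hm
  have hJi : Integrable J := hi.integrable_indicator hD.measurableSet
  have hmem : ∀ ξ, ∀ c : ℂ, ‖c‖ = 1 → (c • ξ ∈ D ↔ ξ ∈ D) := by
    intro ξ c hc
    refine ⟨fun h => ?_, fun h => hbal ξ h c hc.le⟩
    have hc0 : c ≠ 0 := by rintro rfl; simp at hc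
    have := hbal _ h c⁻¹ (by simp [hc])
    rwa [smul_smul, inv_mul_cancel₀ hc0, one_smul] at this
  set e : ℝ → ℂ := fun θ => Complex.exp (θ * Complex.I) with he
  have he1 : ∀ θ, ‖e θ‖ = 1 := fun θ => Complex.norm_exp_ofReal_mul_I θ
  have hmp : ∀ θ, MeasurePreserving (fun z : Fin n → ℂ => e θ • z) := fun θ =>
    measurePreserving_circle_smul (Circle.exp θ)
  have hmeas : Measurable fun p : ℝ × (Fin n → ℂ) => e p.1 • p.2 := by
    apply Continuous.measurable; simp only [he]; fun_prop
  set μθ : Measure ℝ := volume.restrict (Ioc 0 (2 * Real.pi)) with hμ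
  have hJint : Integrable (fun p : ℝ × (Fin n → ℂ) => J (e p.1 • p.2)) (μθ.prod volume) := by
    rw [integrable_prod_iff (f := fun p : ℝ × (Fin n → ℂ) => J (e p.1 • p.2))
      (hJm.comp hmeas).aestronglyMeasurable]
    refine ⟨ae_of_all _ fun θ => (hmp θ).integrable_comp_of_integrable hJi, ?_⟩
    have : ∀ θ, ∫ y, ‖J (e θ • y)‖ = ∫ y, ‖J y‖ := by
      intro θ
      have h := (hmp θ).integral_comp' (f := (Homeomorph.smulOfNeZero (e θ)
        (by intro h; simpa [h] using he1 θ)).toMeasurableEquiv) (fun y => ‖J y‖)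
      exact h
    simp only [this]
    exact integrable_const _
  have hsw := integral_integral_swap (f := fun θ z => J (e θ • z)) hJint
  have hL : ∀ θ, ∫ z, J (e θ • z) = ∫ z, J z := by
    intro θ
    exact (hmp θ).integral_comp' (f := (Homeomorph.smulOfNeZero (e θ)
        (by intro h; simpa [h] using he1 θ)).toMeasurableEquiv) (fun y => J y)
  have hR : ∀ z, ∫ θ, J (e θ • z) ∂μθ = (2 * Real.pi : ℝ) • (H 0 * D.indicator (fun ξ => (ω ξ : ℂ)) z) := by
    intro z
    by_cases hz : z ∈ D
    · have h1 : ∀ θ, J (e θ • z) = (ω z : ℂ) * H (e θ • z) := by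
        intro θ
        rw [hJ, indicator_of_mem ((hmem z _ (he1 θ)).2 hz), hinv z _ (he1 θ)]
      simp only [h1]
      rw [integral_const_mul, indicator_of_mem hz]
      have hc : DiffContOnCl ℂ (fun t : ℂ => H (t • z)) (Metric.ball 0 |1|) := by
        apply DifferentiableOn.diffContOnCl
        intro t ht
        rw [abs_one, closure_ball _ one_ne_zero, mem_closedBall_zero_iff] at ht
        have h2 : DifferentiableAt ℂ H (t • z) :=
          (hH _ (hbal z hz t ht)).differentiableAt (hD.mem_nhds (hbal z hz t ht))
        have h3 : DifferentiableAt ℂ (fun t : ℂ => t • z) t := by fun_prop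
        exact (h2.comp t h3).differentiableWithinAt
      have h4 := hc.circleAverage
      rw [Real.circleAverage_def, zero_smul, intervalIntegral.integral_of_le (by positivity)] at h4
      have h5 : ∀ θ, circleMap 0 1 θ = e θ := by intro θ; simp [circleMap, he]
      simp only [h5] at h4
      rw [← h4, Complex.real_smul, Complex.real_smul]
      have : (Real.pi : ℂ) ≠ 0 := by exact_mod_cast Real.pi_ne_zero
      push_cast
      field_simp
      simp only [hμ]
    · have h1 : ∀ θ, J (e θ • z) = 0 := fun θ =>
        indicator_of_notMem (fun h => hz ((hmem z _ (he1 θ)).1 h)) _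
      simp [h1, hz]
  simp only [hL, hR] at hsw
  rw [integral_const, integral_smul, integral_const_mul, integral_indicator hD.measurableSet,
    integral_indicator hD.measurableSet] at hsw
  have h2 : (μθ.real univ) = 2 * Real.pi := by
    simp [hμ, Measure.real, Real.pi_pos.le]
  rw [h2] at hsw
  exact smul_right_injective _ (show (2 * Real.pi : ℝ) ≠ 0 by positivity) hsw

end CircularMean

section Cayley

variable {n : ℕ} [NeZero n]

/-- Reversal of the signs of the spatial coordinates. -/
def sgM (n : ℕ) [NeZero n] : (Fin n → ℂ) →ₗ[ℂ] (Fin n → ℂ) where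
  toFun v i := sg i * v i
  map_add' x y := by ext i; simp [mul_add]
  map_smul' c x := by ext i; simp; ring

lemma sgM_apply (v : Fin n → ℂ) (i : Fin n) : sgM n v i = sg i * v i := rfl

lemma sgM_sgM (v : Fin n → ℂ) : sgM n (sgM n v) = v := by
  ext i; rw [sgM_apply, sgM_apply, ← mul_assoc, sg_mul_self, one_mul]

lemma lorB_eq_sum_sg (v w : Fin n → ℂ) : lorB v w = ∑ i, sg i * (v i * w i) := by
  rw [sum_sg, lorB]

lemma lorB_sgM (v w : Fin n → ℂ) : lorB (sgM n v) (sgM n w) = lorB v w := by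
  rw [lorB_eq_sum_sg, lorB_eq_sum_sg]
  refine Finset.sum_congr rfl fun i _ => ?_
  rw [sgM_apply, sgM_apply, show sg i * (sg i * v i * (sg i * w i)) =
    (sg i * sg i) * (sg i * (v i * w i)) by ring, sg_mul_self, one_mul]

lemma sg_zero : sg (0 : Fin n) = 1 := by norm_num [sg]

lemma sgM_zero (v : Fin n → ℂ) : sgM n v 0 = v 0 := by rw [sgM_apply, sg_zero, one_mul]

lemma sgM_eVec : sgM n (eVec n ℂ) = eVec n ℂ := by
  ext i; rw [sgM_apply, eVec, Pi.single_apply]; split_ifs with h <;> simp [h, sg_zero]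

lemma cj_sgM (v : Fin n → ℂ) : cj (sgM n v) = sgM n (cj v) := by
  ext i; simp only [cj, sgM_apply, map_mul]; congr 1; unfold sg; split_ifs <;> simp [Complex.conj_ofNat]

lemma iE_eq : iE n = Complex.I • eVec n ℂ := by
  ext i; simp only [iE, ofR, eVec, Pi.smul_apply, Pi.single_apply]; split_ifs <;> simp

lemma cj_smul (c : ℂ) (v : Fin n → ℂ) : cj (c • v) = (starRingEnd ℂ) c • cj v := by
  ext i; simp [cj]

lemma cj_eVec : cj (eVec n ℂ) = eVec n ℂ := by
  ext i; simp only [cj, eVec, Pi.single_apply]; split_ifs <;> simp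

lemma kb_self (w : Fin n → ℂ) : kb w w = 4 * dl w := by
  have : w - cj w = (2 * Complex.I) • ofR (imP w) := by
    ext i; simp [cj, ofR, imP, Complex.sub_conj]; ring
  rw [kb, this, lorC_smul, lorC_eq, lorB_ofR, dl, lor_eq]
  ring_nf; simp

/-- The squared Euclidean norm on `ℂⁿ`. -/
def hermQ (ξ : Fin n → ℂ) : ℝ := ∑ i, ‖ξ i‖ ^ 2

/-- The defining function of the Lie ball. -/
def lieF (ξ : Fin n → ℂ) : ℝ := 1 - 2 * hermQ ξ + ‖lorC ξ‖ ^ 2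

/-- The bounded realisation (Lie ball) of the tube. -/
def lieBall (n : ℕ) [NeZero n] : Set (Fin n → ℂ) := {ξ | 0 < lieF ξ ∧ hermQ ξ < 1}

lemma hermQ_eq (ξ : Fin n → ℂ) :
    (hermQ ξ : ℂ) = 2 * (ξ 0 * (starRingEnd ℂ) (ξ 0)) - lorB ξ (cj ξ) := by
  simp only [lorB, cj, hermQ, Complex.ofReal_sum, Complex.ofReal_pow, Complex.mul_conj,
    Complex.normSq_eq_norm_sq]
  ring

lemma lieF_eq (ξ : Fin n → ℂ) :
    (lieF ξ : ℂ) = 1 - 2 * (2 * (ξ 0 * (starRingEnd ℂ) (ξ 0)) - lorB ξ (cj ξ)) +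
      lorC ξ * (starRingEnd ℂ) (lorC ξ) := by
  rw [lieF, ← hermQ_eq, Complex.mul_conj, Complex.normSq_eq_norm_sq]; push_cast; ring

lemma lieF_eVec_sub (η : Fin n → ℂ) :
    (lieF (eVec n ℂ - η) : ℂ) = lorC η * (starRingEnd ℂ) (lorC η) + lorC η +
      (starRingEnd ℂ) (lorC η) + 2 * lorB η (cj η) -
      2 * (η 0 * (starRingEnd ℂ) (lorC η) + (starRingEnd ℂ) (η 0) * lorC η) := by
  rw [lieF_eq, cj_sub, cj_eVec, ← lorC_cj, ← lorC_cj, cj_sub, cj_eVec]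
  simp only [lorC_eq, lorB_sub_left, lorB_sub_right, lorB_eVec_left, lorB_eVec_right, eVec_zero,
    Pi.sub_apply, map_sub, map_one]
  simp only [cj]
  ring

lemma norm_lorC_le_hermQ (ξ : Fin n → ℂ) : ‖lorC ξ‖ ≤ hermQ ξ := by
  rw [lorC_eq_sum_sg, hermQ]
  refine (norm_sum_le _ _).trans (Finset.sum_le_sum fun i _ => ?_)
  have : ‖sg i‖ = 1 := by unfold sg; split_ifs <;> norm_num
  rw [norm_mul, this, one_mul, norm_pow]

lemma lorC_ne_zero_of_lieF_pos {ξ : Fin n → ℂ} (h : 0 < lieF ξ) : lorC (eVec n ℂ - ξ) ≠ 0 := by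
  intro h0
  set η := eVec n ℂ - ξ with hη
  have h1 := lieF_eVec_sub η
  have h2 := hermQ_eq η
  rw [h0] at h1
  simp only [hη, sub_sub_cancel] at h1
  rw [← hη] at h1
  have h3 : lieF ξ = 2 * (2 * ‖η 0‖ ^ 2 - hermQ η) := by
    have : (lieF ξ : ℂ) = ((2 * (2 * ‖η 0‖ ^ 2 - hermQ η) : ℝ) : ℂ) := by
      rw [Complex.mul_conj, Complex.normSq_eq_norm_sq] at h2
      rw [h1]; push_cast at h2 ⊢; rw [h2]; simp
    exact_mod_cast this
  have h4 : η 0 ^ 2 = ∑ i ∈ Finset.univ.erase 0, η i ^ 2 := by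
    rw [lorC, ← Finset.add_sum_erase _ _ (Finset.mem_univ 0)] at h0
    linear_combination h0
  have h5 : ‖η 0‖ ^ 2 ≤ ∑ i ∈ Finset.univ.erase 0, ‖η i‖ ^ 2 := by
    rw [← norm_pow, h4]
    refine (norm_sum_le _ _).trans_eq (by simp)
  have h6 : hermQ η = ‖η 0‖ ^ 2 + ∑ i ∈ Finset.univ.erase 0, ‖η i‖ ^ 2 := by
    rw [hermQ, ← Finset.add_sum_erase _ _ (Finset.mem_univ 0)]
  linarith

lemma hermQ_ne_one_of_lieF_pos {ξ : Fin n → ℂ} (h : 0 < lieF ξ) : hermQ ξ ≠ 1 := by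
  intro h1
  have := norm_lorC_le_hermQ ξ
  rw [lieF] at h
  nlinarith [norm_nonneg (lorC ξ)]

lemma hermQ_smul (c : ℂ) (ξ : Fin n → ℂ) : hermQ (c • ξ) = ‖c‖ ^ 2 * hermQ ξ := by
  simp [hermQ, Finset.mul_sum, mul_pow]

lemma lieF_smul (c : ℂ) (ξ : Fin n → ℂ) :
    lieF (c • ξ) = 1 - 2 * (‖c‖ ^ 2 * hermQ ξ) + (‖c‖ ^ 2) ^ 2 * ‖lorC ξ‖ ^ 2 := by
  rw [lieF, hermQ_smul, lorC_smul, norm_mul, norm_pow]; ring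

lemma hermQ_nonneg (ξ : Fin n → ℂ) : 0 ≤ hermQ ξ := Finset.sum_nonneg fun _ _ => sq_nonneg _

lemma smul_mem_lieBall {ξ : Fin n → ℂ} (h : ξ ∈ lieBall n) {c : ℂ} (hc : ‖c‖ ≤ 1) :
    c • ξ ∈ lieBall n := by
  obtain ⟨h1, h2⟩ := h
  have ha := hermQ_nonneg ξ
  have hd := norm_lorC_le_hermQ ξ
  have hd0 := norm_nonneg (lorC ξ)
  have hs : ‖c‖ ^ 2 ≤ 1 := pow_le_one₀ (norm_nonneg _) hc
  have hs0 : 0 ≤ ‖c‖ ^ 2 := sq_nonneg _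
  refine ⟨?_, ?_⟩
  · rw [lieF_smul]
    rw [lieF] at h1
    set s := ‖c‖ ^ 2
    set a := hermQ ξ
    set d := ‖lorC ξ‖
    have e : d ^ 2 ≤ a := by nlinarith
    nlinarith [mul_nonneg (sub_nonneg.2 hs) (sub_nonneg.2 e),
      mul_nonneg (mul_nonneg (sub_nonneg.2 hs) (sub_nonneg.2 hs)) (sq_nonneg d)]
  · rw [hermQ_smul]; nlinarith

lemma continuous_hermQ : Continuous (hermQ : (Fin n → ℂ) → ℝ) := by unfold hermQ; fun_prop

lemma continuous_lieF : Continuous (lieF : (Fin n → ℂ) → ℝ) :=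
  (continuous_const.sub (continuous_const.mul continuous_hermQ)).add
    ((continuous_lorC.norm).pow 2)

lemma isOpen_lieBall : IsOpen (lieBall n) :=
  (isOpen_lt continuous_const continuous_lieF).inter (isOpen_lt continuous_hermQ continuous_const)

/-- The Cayley transform from the Lie ball to the tube. -/
def cay (ξ : Fin n → ℂ) : Fin n → ℂ :=
  (2 * Complex.I / lorC (eVec n ℂ - ξ)) • sgM n (eVec n ℂ - ξ) - iE n

/-- The inverse Cayley transform. -/
def cayInv (w : Fin n → ℂ) : Fin n → ℂ :=
  eVec n ℂ - (2 * Complex.I / lorC (w + iE n)) • sgM n (w + iE n)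

lemma lorC_sgM (v : Fin n → ℂ) : lorC (sgM n v) = lorC v := by rw [lorC_eq, lorB_sgM, ← lorC_eq]

lemma lorC_cay_add {ξ : Fin n → ℂ} (h : lorC (eVec n ℂ - ξ) ≠ 0) :
    lorC (cay ξ + iE n) = -4 / lorC (eVec n ℂ - ξ) := by
  rw [cay, sub_add_cancel, lorC_smul, lorC_sgM]
  field_simp
  ring_nf; simp

lemma kb_cay {ξ : Fin n → ℂ} (h : lorC (eVec n ℂ - ξ) ≠ 0) :
    kb (cay ξ) (iE n) = 4 / lorC (eVec n ℂ - ξ) := by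
  rw [kb_iE_right, lorC_cay_add h]; ring

lemma lorC_eVec_sub_cayInv {w : Fin n → ℂ} (h : lorC (w + iE n) ≠ 0) :
    lorC (eVec n ℂ - cayInv w) = -4 / lorC (w + iE n) := by
  rw [cayInv, sub_sub_cancel, lorC_smul, lorC_sgM]
  field_simp
  ring_nf; simp

lemma cay_cayInv {w : Fin n → ℂ} (h : lorC (w + iE n) ≠ 0) : cay (cayInv w) = w := by
  rw [cay, lorC_eVec_sub_cayInv h, cayInv, sub_sub_cancel, map_smul, sgM_sgM, smul_smul]
  have : 2 * Complex.I / (-4 / lorC (w + iE n)) * (2 * Complex.I / lorC (w + iE n)) = 1 := by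
    field_simp; ring_nf; simp
  rw [this, one_smul, add_sub_cancel_right]

lemma cayInv_cay {ξ : Fin n → ℂ} (h : lorC (eVec n ℂ - ξ) ≠ 0) : cayInv (cay ξ) = ξ := by
  rw [cayInv, lorC_cay_add h, cay, sub_add_cancel, map_smul, sgM_sgM, smul_smul]
  have : 2 * Complex.I / (-4 / lorC (eVec n ℂ - ξ)) * (2 * Complex.I / lorC (eVec n ℂ - ξ)) = 1 := by
    field_simp; ring_nf; simp
  rw [this, one_smul, sub_sub_cancel]

lemma dl_cay {ξ : Fin n → ℂ} (h : lorC (eVec n ℂ - ξ) ≠ 0) :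
    dl (cay ξ) = lieF ξ / ‖lorC (eVec n ℂ - ξ)‖ ^ 2 := by
  have h1 := lieF_eVec_sub (eVec n ℂ - ξ)
  rw [sub_sub_cancel] at h1
  have h2 := kb_self (cay ξ)
  set η := eVec n ℂ - ξ with hη
  have e : cay ξ - cj (cay ξ) = (2 * Complex.I / lorC η) • sgM n η +
      (2 * Complex.I / (starRingEnd ℂ) (lorC η)) • sgM n (cj η) - (2 * Complex.I) • eVec n ℂ := by
    rw [cay, ← hη, cj_sub, cj_smul, cj_sgM, cj_iE, iE_eq, map_div₀, map_mul, Complex.conj_I,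
      Complex.conj_ofNat]
    ext i; simp only [Pi.sub_apply, Pi.add_apply, Pi.smul_apply, Pi.neg_apply, smul_eq_mul]; ring
  have h3 : (starRingEnd ℂ) (lorC η) ≠ 0 := by simpa using h
  have h4 : ((dl (cay ξ) : ℝ) : ℂ) * (lorC η * (starRingEnd ℂ) (lorC η)) = (lieF ξ : ℂ) := by
    rw [kb, e, lorC_eq] at h2
    have e1 : lorB η η = lorC η := (lorC_eq η).symm
    have e2 : lorB (cj η) (cj η) = (starRingEnd ℂ) (lorC η) := by rw [← lorC_eq, lorC_cj]
    have e3 : cj η 0 = (starRingEnd ℂ) (η 0) := rfl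
    simp only [lorB_sub_left, lorB_sub_right, lorB_add_left, lorB_add_right, lorB_smul_left,
      lorB_smul_right, lorB_sgM, lorB_eVec_left, lorB_eVec_right, Pi.sub_apply,
      Pi.add_apply, Pi.smul_apply, smul_eq_mul, eVec_zero, sgM_zero,
      lorB_comm (cj η) η, e1, e2, e3] at h2
    rw [h1, ← mul_right_inj' (show (4 : ℂ) ≠ 0 by norm_num), ← mul_assoc, ← h2]
    field_simp
    ring_nf
    simp only [Complex.I_sq]
    ring
  rw [Complex.mul_conj, Complex.normSq_eq_norm_sq] at h4
  rw [eq_div_iff (by positivity)]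
  exact_mod_cast h4

lemma cay_zero : cay (0 : Fin n → ℂ) = iE n := by
  have : lorC (eVec n ℂ) = 1 := by rw [lorC_eq, lorB_eVec_right, eVec_zero]
  rw [cay, sub_zero, this, sgM_eVec, iE_eq, div_one]
  ext i; simp only [Pi.sub_apply, Pi.smul_apply, smul_eq_mul]; ring

lemma cayInv_iE : cayInv (iE n) = 0 := by
  have : lorC (eVec n ℂ - 0) ≠ 0 := by rw [sub_zero, lorC_eq, lorB_eVec_right, eVec_zero]; simp
  conv_lhs => rw [← cay_zero]
  exact cayInv_cay this

lemma continuousOn_cay : ContinuousOn cay {ξ : Fin n → ℂ | lorC (eVec n ℂ - ξ) ≠ 0} := by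
  have h1 : Continuous fun ξ : Fin n → ℂ => lorC (eVec n ℂ - ξ) :=
    continuous_lorC.comp (by fun_prop)
  have h2 : Continuous fun ξ : Fin n → ℂ => sgM n (eVec n ℂ - ξ) :=
    (sgM n).continuous_of_finiteDimensional.comp (by fun_prop)
  exact ((continuousOn_const.div h1.continuousOn fun _ h => h).smul h2.continuousOn).sub
    continuousOn_const

lemma continuousOn_cayInv : ContinuousOn cayInv {w : Fin n → ℂ | lorC (w + iE n) ≠ 0} := by
  have h1 : Continuous fun w : Fin n → ℂ => lorC (w + iE n) := continuous_lorC.comp (by fun_prop)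
  have h2 : Continuous fun w : Fin n → ℂ => sgM n (w + iE n) :=
    (sgM n).continuous_of_finiteDimensional.comp (by fun_prop)
  exact continuousOn_const.sub
    ((continuousOn_const.div h1.continuousOn fun _ h => h).smul h2.continuousOn)

lemma pos_of_path {f : ℝ → ℝ} (hf : ContinuousOn f (Icc 0 1)) (h0 : 0 < f 0)
    (hne : ∀ t ∈ Icc (0 : ℝ) 1, f t ≠ 0) : 0 < f 1 := by
  by_contra h
  obtain ⟨t, ht, h1⟩ := intermediate_value_Icc' zero_le_one hf ⟨not_lt.1 h, h0.le⟩
  exact hne t ht h1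

lemma ne_zero_of_lor_pos {y : Fin n → ℝ} (h : 0 < lor y) : y 0 ≠ 0 := by
  intro h0
  have : 0 ≤ ∑ i, y i ^ 2 := Finset.sum_nonneg fun _ _ => sq_nonneg _
  simp only [lor, h0] at h
  linarith

lemma cay_mem {ξ : Fin n → ℂ} (h : ξ ∈ lieBall n) : cay ξ ∈ tube n := by
  have hmem : ∀ t ∈ Icc (0 : ℝ) 1, (t : ℂ) • ξ ∈ lieBall n := fun t ht =>
    smul_mem_lieBall h (by rw [Complex.norm_real, Real.norm_of_nonneg ht.1]; exact ht.2)
  have hpos : ∀ ξ ∈ lieBall n, 0 < lor (imP (cay ξ)) := by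
    intro ξ h
    have h1 := lorC_ne_zero_of_lieF_pos h.1
    have h2 := dl_cay h1
    rw [dl] at h2
    rw [h2]
    exact div_pos h.1 (by positivity)
  refine ⟨hpos ξ h, ?_⟩
  have := pos_of_path (f := fun t : ℝ => imP (cay ((t : ℂ) • ξ)) 0) ?_ ?_ ?_
  · simpa using this
  · have h1 : ContinuousOn (fun t : ℝ => cay ((t : ℂ) • ξ)) (Icc 0 1) :=
      continuousOn_cay.comp (by fun_prop) fun t ht => lorC_ne_zero_of_lieF_pos (hmem t ht).1
    exact (((continuous_apply 0).comp continuous_imP).comp_continuousOn h1)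
  · simp [cay_zero, imP_iE, eVec_zero]
  · intro t ht
    exact ne_zero_of_lor_pos (hpos _ (hmem t ht))

lemma lorC_add_iE_ne {w : Fin n → ℂ} (hw : w ∈ tube n) : lorC (w + iE n) ≠ 0 := by
  have := kb_ne_zero hw iE_mem
  rwa [kb_iE_right, neg_ne_zero] at this

lemma cayInv_mem {w : Fin n → ℂ} (hw : w ∈ tube n) : cayInv w ∈ lieBall n := by
  have hpos : ∀ w ∈ tube n, 0 < lieF (cayInv w) := by
    intro w hw
    have h0 := lorC_add_iE_ne hw
    have h1 : lorC (eVec n ℂ - cayInv w) ≠ 0 := by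
      rw [lorC_eVec_sub_cayInv h0]; exact div_ne_zero (by norm_num) h0
    have h2 := dl_cay h1
    rw [cay_cayInv h0, eq_div_iff (by positivity)] at h2
    rw [← h2]
    exact mul_pos (dl_pos hw) (by positivity)
  refine ⟨hpos w hw, ?_⟩
  have hmem : ∀ t ∈ Icc (0 : ℝ) 1, (1 - t : ℂ) • iE n + (t : ℂ) • w ∈ tube n := by
    intro t ht
    have e : imP ((1 - t : ℂ) • iE n + (t : ℂ) • w) = (1 - t) • eVec n ℝ + t • imP w := by
      ext i
      have := congrFun (imP_iE (n := n)) i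
      simp only [imP, Pi.add_apply, Pi.smul_apply, smul_eq_mul, Complex.add_im,
        ← Complex.ofReal_one, ← Complex.ofReal_sub, Complex.im_ofReal_mul] at this ⊢
      rw [this]
    show imP _ ∈ cone n
    rw [e]
    rcases ht.1.eq_or_lt with h | h
    · rw [← h]; simpa using eVec_mem_cone
    rcases ht.2.eq_or_lt with h' | h'
    · rw [h']; simpa using (show imP w ∈ cone n from hw)
    exact cone_add (cone_smul (sub_pos.2 h') eVec_mem_cone) (cone_smul h hw)
  have := pos_of_path
    (f := fun t : ℝ => 1 - hermQ (cayInv ((1 - t : ℂ) • iE n + (t : ℂ) • w))) ?_ ?_ ?_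
  · simpa using this
  · have h1 : ContinuousOn (fun t : ℝ => cayInv ((1 - t : ℂ) • iE n + (t : ℂ) • w)) (Icc 0 1) :=
      continuousOn_cayInv.comp (by fun_prop) fun t ht => lorC_add_iE_ne (hmem t ht)
    exact continuousOn_const.sub (continuous_hermQ.comp_continuousOn h1)
  · simp [cayInv_iE, hermQ]
  · intro t ht
    exact sub_ne_zero.2 (hermQ_ne_one_of_lieF_pos (hpos _ (hmem t ht))).symm

lemma cay_injOn : InjOn cay (lieBall n) := fun ξ h ξ' h' e => by
  rw [← cayInv_cay (lorC_ne_zero_of_lieF_pos h.1), e, cayInv_cay (lorC_ne_zero_of_lieF_pos h'.1)]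

lemma cay_image : cay '' lieBall n = tube n := by
  ext w; constructor
  · rintro ⟨ξ, h, rfl⟩; exact cay_mem h
  · intro hw; exact ⟨cayInv w, cayInv_mem hw, cay_cayInv (lorC_add_iE_ne hw)⟩

end Cayley

section Reproducing

variable {n : ℕ} [NeZero n]

lemma hasFDerivAt_lorC (z : Fin n → ℂ) :
    HasFDerivAt lorC (∑ i, (sg i * (2 * z i)) • ContinuousLinearMap.proj (R := ℂ) (φ := fun _ : Fin n => ℂ) i) z := by
  have h : (lorC : (Fin n → ℂ) → ℂ) = fun z => ∑ i, sg i * z i ^ 2 := by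
    ext z; exact lorC_eq_sum_sg z
  rw [h]
  refine HasFDerivAt.fun_sum fun i _ => ?_
  have h := ((ContinuousLinearMap.proj (R := ℂ) (φ := fun _ : Fin n => ℂ) i).hasFDerivAt
    (x := z))
  refine ((h.mul h).const_mul (sg i)).congr_of_eventuallyEq
    (Filter.Eventually.of_forall fun x => ?_) |>.congr_fderiv ?_
  · simp [sq]
  · ext v; simp; ring

/-- The derivative of the Cayley transform. -/
def cayD (ξ : Fin n → ℂ) : (Fin n → ℂ) →L[ℂ] (Fin n → ℂ) :=
  LinearMap.toContinuousLinearMap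
    ((-(2 * Complex.I / lorC (eVec n ℂ - ξ))) • (sgM n * boost (-1) (eVec n ℂ - ξ)))

lemma hasFDerivAt_cay {ξ : Fin n → ℂ} (h : lorC (eVec n ℂ - ξ) ≠ 0) :
    HasFDerivAt cay (cayD ξ) ξ := by
  have h1 : HasFDerivAt (fun ξ : Fin n → ℂ => eVec n ℂ - ξ)
      (-ContinuousLinearMap.id ℂ (Fin n → ℂ)) ξ := (hasFDerivAt_id ξ).const_sub _
  have h2 := (hasFDerivAt_lorC (eVec n ℂ - ξ)).comp ξ h1
  have h3 := ((LinearMap.toContinuousLinearMap (sgM n)).hasFDerivAt (x := eVec n ℂ - ξ)).comp ξ h1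
  have h4 := ((hasDerivAt_inv h).comp_hasFDerivAt ξ h2).const_mul (2 * Complex.I)
  have h5 := (h4.smul h3).sub_const (iE n)
  refine (h5.congr_of_eventuallyEq (Filter.Eventually.of_forall fun x => ?_)).congr_fderiv ?_
  · simp only [cay, div_eq_mul_inv]; rfl
  · ext v i
    have e : (∑ i, (sg i * (2 * (eVec n ℂ - ξ) i)) •
        ContinuousLinearMap.proj (R := ℂ) (φ := fun _ : Fin n => ℂ) i) (-v) =
        -(2 * lorB v (eVec n ℂ - ξ)) := by
      rw [map_neg, lorB_comm, lorB_eq_sum_sg, _root_.sum_apply, Finset.mul_sum]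
      congr 1
      refine Finset.sum_congr rfl fun i _ => ?_
      simp only [_root_.smul_apply, ContinuousLinearMap.proj_apply, smul_eq_mul]; ring
    have e3 : cayD ξ v = (-(2 * Complex.I / lorC (eVec n ℂ - ξ))) •
        sgM n (boost (-1) (eVec n ℂ - ξ) v) := rfl
    rw [e3, boost_apply, ← lorC_eq]
    simp only [_root_.add_apply, _root_.smul_apply, ContinuousLinearMap.comp_apply,
      ContinuousLinearMap.smulRight_apply, _root_.neg_apply, ContinuousLinearMap.id_apply, e,
      Function.comp_apply]
    generalize eVec n ℂ - ξ = η at *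
    simp [sgM_apply]
    field_simp
    ring

lemma norm_det_cayD {ξ : Fin n → ℂ} (h : lorC (eVec n ℂ - ξ) ≠ 0) :
    ‖LinearMap.det (cayD ξ : (Fin n → ℂ) →ₗ[ℂ] (Fin n → ℂ))‖ = (2 / ‖lorC (eVec n ℂ - ξ)‖) ^ n := by
  have hinv : ∀ f : Module.End ℂ (Fin n → ℂ), f * f = 1 → ‖LinearMap.det f‖ = 1 := by
    intro f hf
    have := congrArg (fun g => ‖LinearMap.det g‖) hf
    simp only [map_mul, map_one, norm_mul, norm_one] at this
    nlinarith [norm_nonneg (LinearMap.det f)]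
  have h1 := hinv (sgM n) (LinearMap.ext fun v => sgM_sgM v)
  have h2 := hinv (boost (-1) (eVec n ℂ - ξ)) (by
    refine LinearMap.ext fun v => ?_
    rw [Module.End.mul_apply, boost_boost (by rwa [← lorC_eq])]; simp)
  rw [cayD, LinearMap.coe_toContinuousLinearMap, LinearMap.det_smul, map_mul, norm_mul, norm_mul,
    h1, h2, Module.finrank_pi, Fintype.card_fin]
  simp

lemma cayley_scalar {t ρ γ s : ℝ} (ht : 0 < t) (hρ : 0 < ρ) (hs : s = γ + (n : ℝ) / 2) :
    ((2 / t) ^ n) ^ 2 * (ρ / t ^ 2) ^ (γ - (n : ℝ) / 2) * (4 / t) ^ (-(2 * s)) =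
      ((2 ^ n) ^ 2 * 4 ^ (-(2 * s))) * ρ ^ (γ - (n : ℝ) / 2) := by
  have e1 : (((2 : ℝ) / t) ^ n) ^ 2 = (2 ^ n) ^ 2 * t ^ (-(2 * n : ℝ)) := by
    rw [Real.rpow_neg ht.le, mul_comm (2 : ℝ), Real.rpow_mul ht.le, Real.rpow_natCast,
      Real.rpow_ofNat, div_pow, div_pow]; rfl
  have e2 : (ρ / t ^ 2) ^ (γ - (n : ℝ) / 2) =
      ρ ^ (γ - (n : ℝ) / 2) * t ^ (-(2 * (γ - (n : ℝ) / 2))) := by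
    rw [Real.div_rpow hρ.le (by positivity), Real.rpow_neg ht.le, Real.rpow_mul ht.le,
      Real.rpow_ofNat]; rfl
  have e3 : ((4 : ℝ) / t) ^ (-(2 * s)) = 4 ^ (-(2 * s)) * t ^ (2 * s) := by
    rw [Real.div_rpow (by norm_num) ht.le, Real.rpow_neg ht.le, div_inv_eq_mul]
  have e4 : t ^ (-(2 * n : ℝ)) * t ^ (-(2 * (γ - (n : ℝ) / 2))) * t ^ (2 * s) = 1 := by
    rw [← Real.rpow_add ht, ← Real.rpow_add ht, hs]
    ring_nf; exact Real.rpow_zero t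
  rw [e1, e2, e3]
  linear_combination ((2 ^ n) ^ 2 * 4 ^ (-(2 * s)) * ρ ^ (γ - (n : ℝ) / 2)) * e4

/-- The weight of the pulled back reproducing integral on the Lie ball. -/
def lieW (n : ℕ) [NeZero n] (γ : ℝ) (ξ : Fin n → ℂ) : ℝ :=
  ((2 ^ n) ^ 2 * 4 ^ (-(2 * (γ + (n : ℝ) / 2)))) * lieF ξ ^ (γ - (n : ℝ) / 2)

lemma conj_cpow_neg {U : ℂ} (hU : U ∈ slitPlane) (s : ℝ) :
    (starRingEnd ℂ) (U ^ ((-s : ℝ) : ℂ)) = ((‖U‖ ^ (-(2 * s)) : ℝ) : ℂ) * U ^ (s : ℂ) := by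
  have hU0 : U ≠ 0 := slitPlane_ne_zero hU
  have h1 : U ^ ((-s : ℝ) : ℂ) * U ^ (s : ℂ) = 1 := by
    rw [← Complex.cpow_add _ _ hU0]; simp
  have h2 : U ^ ((-s : ℝ) : ℂ) * (starRingEnd ℂ) (U ^ ((-s : ℝ) : ℂ)) =
      ((‖U‖ ^ (-(2 * s)) : ℝ) : ℂ) := by
    rw [Complex.mul_conj, Complex.normSq_eq_norm_sq, Complex.norm_cpow_real, ← Real.rpow_natCast,
      ← Real.rpow_mul (norm_nonneg _)]
    congr 2; push_cast; ring
  linear_combination (-(starRingEnd ℂ) (U ^ ((-s : ℝ) : ℂ))) * h1 + (U ^ (s : ℂ)) * h2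

lemma cayley_pullback {γ : ℝ} (F : (Fin n → ℂ) → ℂ) {ξ : Fin n → ℂ} (hξ : ξ ∈ lieBall n) :
    |((cayD ξ).restrictScalars ℝ).det| • (((dl (cay ξ) ^ (γ - (n : ℝ) / 2) : ℝ) : ℂ) *
      (Ks (γ + (n : ℝ) / 2) (iE n) (cay ξ) * F (cay ξ))) =
    (lieW n γ ξ : ℂ) * (F (cay ξ) * kb (cay ξ) (iE n) ^ (((γ + (n : ℝ) / 2 : ℝ)) : ℂ)) := by
  have h0 := lorC_ne_zero_of_lieF_pos hξ.1
  have hm := cay_mem hξ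
  rw [abs_det_restrictScalars, norm_det_cayD h0, ← Ks_conj _ hm iE_mem, Ks,
    conj_cpow_neg (kb_mem_slitPlane hm iE_mem), dl_cay h0, Complex.real_smul, lieW,
    ← cayley_scalar (norm_pos_iff.2 h0) hξ.1 rfl]
  have : ‖kb (cay ξ) (iE n)‖ = 4 / ‖lorC (eVec n ℂ - ξ)‖ := by
    rw [kb_cay h0, norm_div]; norm_num
  rw [this]; push_cast; ring

lemma integral_tube_cayley (g : (Fin n → ℂ) → ℂ) :
    ∫ w in tube n, g w = ∫ ξ in lieBall n, |((cayD ξ).restrictScalars ℝ).det| • g (cay ξ) := by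
  rw [← cay_image]
  exact integral_image_eq_integral_abs_det_fderiv_smul volume isOpen_lieBall.measurableSet
    (fun ξ h => ((hasFDerivAt_cay (lorC_ne_zero_of_lieF_pos h.1)).restrictScalars ℝ).hasFDerivWithinAt)
    cay_injOn g

lemma integrableOn_tube_cayley (g : (Fin n → ℂ) → ℂ) :
    IntegrableOn g (tube n) ↔
      IntegrableOn (fun ξ => |((cayD ξ).restrictScalars ℝ).det| • g (cay ξ)) (lieBall n) := by
  rw [← cay_image]
  exact integrableOn_image_iff_integrableOn_abs_det_fderiv_smul volume
    isOpen_lieBall.measurableSet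
    (fun ξ h => ((hasFDerivAt_cay (lorC_ne_zero_of_lieF_pos h.1)).restrictScalars ℝ).hasFDerivWithinAt)
    cay_injOn g

/-- The constant of the reproducing formula. -/
def rfC (n : ℕ) [NeZero n] (γ : ℝ) : ℂ :=
  4 ^ (((γ + (n : ℝ) / 2 : ℝ)) : ℂ) * ∫ ξ in lieBall n, (lieW n γ ξ : ℂ)

lemma kb_iE_iE : kb (iE n) (iE n) = 4 := by rw [kb_self, dl_iE]; simp

lemma reproducing_iE (γ : ℝ) {F : (Fin n → ℂ) → ℂ}
    (hF : DifferentiableOn ℂ F (tube n))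
    (hi : Integrable (fun w => Ks (γ + (n : ℝ) / 2) (iE n) w * F w) (dV n γ)) :
    ∫ w, Ks (γ + (n : ℝ) / 2) (iE n) w * F w ∂dV n γ = rfC n γ * F (iE n) := by
  rw [integrable_dV_iff, integrableOn_tube_cayley] at hi
  rw [integral_dV, integral_tube_cayley]
  have hcong : ∀ ξ ∈ lieBall n, _ := fun ξ hξ => cayley_pullback (γ := γ) F hξ
  rw [integrableOn_congr_fun hcong isOpen_lieBall.measurableSet] at hi
  rw [setIntegral_congr_fun isOpen_lieBall.measurableSet hcong]
  have hd : DifferentiableOn ℂ (cay : (Fin n → ℂ) → _) (lieBall n) := fun ξ hξ =>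
    (hasFDerivAt_cay (lorC_ne_zero_of_lieF_pos hξ.1)).differentiableAt.differentiableWithinAt
  have hH : DifferentiableOn ℂ (fun ξ : Fin n → ℂ =>
      F (cay ξ) * kb (cay ξ) (iE n) ^ (((γ + (n : ℝ) / 2 : ℝ)) : ℂ)) (lieBall n) := by
    refine (hF.comp hd fun ξ hξ => cay_mem hξ).mul ?_
    refine DifferentiableOn.cpow_const ?_ fun ξ hξ => kb_mem_slitPlane (cay_mem hξ) iE_mem
    exact (differentiable_kb (iE n)).comp_differentiableOn hd
  have h := circle_integral_mul isOpen_lieBall (fun ξ hξ c hc => smul_mem_lieBall hξ hc) hH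
    (ω := lieW n γ) ?_ ?_ hi
  · rw [h, cay_zero, kb_iE_iE, rfC]; ring
  · exact (continuous_lieF.measurable.pow_const _).const_mul _
  · intro ξ c hc
    rw [lieW, lieW, lieF_smul, hc, lieF]; ring_nf

lemma dV_tube_ne_zero (γ : ℝ) : dV n γ (tube n) ≠ 0 := by
  intro h
  rw [dV, withDensity_apply_eq_zero
    (f := fun z : Fin n → ℂ => ENNReal.ofReal (lor (imP z) ^ (γ - (n : ℝ) / 2)))
    (continuous_dl.measurable.pow_const _).ennreal_ofReal,
    Measure.restrict_apply' measurableSet_tube] at h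
  have : ({x : Fin n → ℂ | ENNReal.ofReal (lor (imP x) ^ (γ - (n : ℝ) / 2)) ≠ 0} ∩ tube n) ∩ tube n
      = tube n := by
    ext z
    simp only [mem_inter_iff, and_assoc, and_self, and_iff_right_iff_imp, mem_ofPred_eq]
    intro hz
    simpa using Real.rpow_pos_of_pos hz.1 _
  rw [this] at h
  exact isOpen_tube.measure_ne_zero volume ⟨iE n, iE_mem⟩ h

lemma rfC_ne_zero (hn : 2 ≤ n) {γ : ℝ} (hγ : (n : ℝ) / 2 - 1 < γ) : rfC n γ ≠ 0 := by
  set s := γ + (n : ℝ) / 2 with hs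
  have hn' : (2 : ℝ) ≤ n := by exact_mod_cast hn
  have e : ∀ᵐ w ∂dV n γ, Ks s (iE n) w * Ks s w (iE n) = ((‖kb (iE n) w‖ ^ (-(2 * s)) : ℝ) : ℂ) := by
    filter_upwards [ae_dV (n := n) (ν := γ)] with w hw
    rw [← Ks_conj s iE_mem hw, Complex.mul_conj, Complex.normSq_eq_norm_sq, norm_Ks,
      ← Real.rpow_natCast, ← Real.rpow_mul (norm_nonneg _)]
    congr 2; push_cast; ring
  have hm : Measurable fun w : Fin n → ℂ => ‖kb (iE n) w‖ ^ (-(2 * s)) :=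
    (continuous_kb_right (iE n)).norm.measurable.pow_const _
  have hir : Integrable (fun w => ‖kb (iE n) w‖ ^ (-(2 * s))) (dV n γ) := by
    obtain ⟨C, hC, h⟩ := forelli_rudin_le hn (a := 2 * s) (b := γ) (d := 0) (by linarith) hγ
      (by linarith) (by linarith) (by linarith)
    refine ⟨hm.aestronglyMeasurable, ?_⟩
    rw [hasFiniteIntegral_iff_ofReal (ae_of_all _ fun _ => by positivity)]
    have := h (iE n) iE_mem
    simp only [Real.rpow_zero, ENNReal.ofReal_one, mul_one] at this
    exact this.trans_lt ENNReal.ofReal_lt_top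
  have hi : Integrable (fun w => Ks s (iE n) w * Ks s w (iE n)) (dV n γ) :=
    (hir.ofReal (𝕜 := ℂ)).congr (e.mono fun _ h => h.symm)
  have h := reproducing_iE γ (Ks_differentiableOn s iE_mem) hi
  rw [integral_congr_ae e, integral_complex_ofReal] at h
  have hpos : 0 < ∫ w, ‖kb (iE n) w‖ ^ (-(2 * s)) ∂dV n γ := by
    rw [integral_pos_iff_support_of_nonneg (fun _ => by positivity) hir]
    refine (pos_iff_ne_zero.2 (dV_tube_ne_zero γ)).trans_le (measure_mono fun w hw => ?_)
    exact (Real.rpow_pos_of_pos (norm_kb_pos iE_mem hw) _).ne'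
  intro h0
  rw [h0, zero_mul] at h
  exact hpos.ne' (by exact_mod_cast h)

lemma norm_det_cboost {y : Fin n → ℝ} (hy : y ∈ cone n) :
    ‖LinearMap.det (cboost y)‖ ^ 2 = lor y ^ n := by
  have h : cboost y * cboost y = (lor y : ℂ) • (1 : Module.End ℂ (Fin n → ℂ)) := by
    refine LinearMap.ext fun v => ?_
    rw [Module.End.mul_apply, cboost_cboost hy]; rfl
  have h2 := congrArg (fun f => ‖LinearMap.det f‖) h
  simp only [map_mul, LinearMap.det_smul, map_one, mul_one, Module.finrank_pi, Fintype.card_fin,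
    norm_mul, norm_pow, Complex.norm_real, Real.norm_of_nonneg hy.1.le] at h2
  rw [sq, h2]

lemma hasFDerivAt_aff (z w : Fin n → ℂ) :
    HasFDerivAt (aff z) (LinearMap.toContinuousLinearMap (cboost (imP z))) w :=
  ((LinearMap.toContinuousLinearMap (cboost (imP z))).hasFDerivAt).add_const _

lemma aff_image {z : Fin n → ℂ} (hz : z ∈ tube n) : aff z '' tube n = tube n := by
  ext w; constructor
  · rintro ⟨v, hv, rfl⟩; exact (aff_mem_iff hz).2 hv
  · intro hw; exact ⟨affInv z w, affInv_mem hz hw, aff_affInv hz w⟩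

lemma aff_injective {z : Fin n → ℂ} (hz : z ∈ tube n) : Function.Injective (aff z) := by
  intro v w h
  have h1 : cboost (imP z) v = cboost (imP z) w := by simpa [aff] using h
  have h2 := congrArg (cboost (imP z)) h1
  rw [cboost_cboost hz, cboost_cboost hz] at h2
  exact smul_right_injective _ (by exact_mod_cast hz.1.ne') h2

lemma Ks_aff (s : ℝ) {z v w : Fin n → ℂ} (hz : z ∈ tube n) (hv : v ∈ tube n) (hw : w ∈ tube n) :
    Ks s (aff z v) (aff z w) = ((dl z ^ (-s) : ℝ) : ℂ) * Ks s v w := by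
  have h0 : (dl z : ℂ) ≠ 0 := by exact_mod_cast (dl_pos hz).ne'
  rw [Ks, kb_aff hz, Ks, Complex.ofReal_cpow (dl_pos hz).le, Complex.cpow_def_of_ne_zero h0,
    Complex.cpow_def_of_ne_zero (kb_ne_zero hv hw),
    Complex.cpow_def_of_ne_zero (mul_ne_zero h0 (kb_ne_zero hv hw)),
    Complex.log_ofReal_mul (dl_pos hz) (kb_ne_zero hv hw), ← Complex.exp_add,
    Complex.ofReal_log (dl_pos hz).le, add_mul]

lemma aff_pullback {γ : ℝ} (F : (Fin n → ℂ) → ℂ) {z w : Fin n → ℂ} (hz : z ∈ tube n)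
    (hw : w ∈ tube n) :
    |((LinearMap.toContinuousLinearMap (cboost (imP z))).restrictScalars ℝ).det| •
      (((dl (aff z w) ^ (γ - (n : ℝ) / 2) : ℝ) : ℂ) *
        (Ks (γ + (n : ℝ) / 2) z (aff z w) * F (aff z w))) =
    ((dl w ^ (γ - (n : ℝ) / 2) : ℝ) : ℂ) * (Ks (γ + (n : ℝ) / 2) (iE n) w * F (aff z w)) := by
  have h0 := dl_pos hz
  have e : Ks (γ + (n : ℝ) / 2) z (aff z w) = Ks (γ + (n : ℝ) / 2) (aff z (iE n)) (aff z w) := by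
    rw [aff_iE hz]
  rw [abs_det_restrictScalars, LinearMap.coe_toContinuousLinearMap, norm_det_cboost hz, e,
    Ks_aff _ hz iE_mem hw, dl_aff hz, Complex.real_smul, Real.mul_rpow h0.le (dl_pos hw).le]
  have e2 : lor (imP z) ^ n * dl z ^ (γ - (n : ℝ) / 2) * dl z ^ (-(γ + (n : ℝ) / 2)) = 1 := by
    rw [show lor (imP z) = dl z from rfl, ← Real.rpow_natCast, ← Real.rpow_add h0,
      ← Real.rpow_add h0]
    ring_nf; exact Real.rpow_zero _
  have e3 := congrArg (fun x : ℝ => (x : ℂ)) e2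
  push_cast at e3 ⊢
  linear_combination ((dl w ^ (γ - (n : ℝ) / 2) : ℝ) : ℂ) *
    (Ks (γ + (n : ℝ) / 2) (iE n) w * F (aff z w)) * e3

/-- The reproducing formula for the weighted Bergman kernel. -/
theorem reproducing (γ : ℝ) {F : (Fin n → ℂ) → ℂ}
    (hF : DifferentiableOn ℂ F (tube n)) {z : Fin n → ℂ} (hz : z ∈ tube n)
    (hi : Integrable (fun w => Ks (γ + (n : ℝ) / 2) z w * F w) (dV n γ)) :
    ∫ w, Ks (γ + (n : ℝ) / 2) z w * F w ∂dV n γ = rfC n γ * F z := by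
  have hF' : DifferentiableOn ℂ (fun w => F (aff z w)) (tube n) :=
    hF.comp (fun w _ => (hasFDerivAt_aff z w).differentiableAt.differentiableWithinAt)
      fun w hw => (aff_mem_iff hz).2 hw
  have hder : ∀ w ∈ tube n, HasFDerivWithinAt (aff z)
      ((LinearMap.toContinuousLinearMap (cboost (imP z))).restrictScalars ℝ) (tube n) w :=
    fun w _ => ((hasFDerivAt_aff z w).restrictScalars ℝ).hasFDerivWithinAt
  have hcong : ∀ w ∈ tube n, _ := fun w hw => aff_pullback (γ := γ) F hz hw
  have h1 : Integrable (fun w => Ks (γ + (n : ℝ) / 2) (iE n) w * F (aff z w)) (dV n γ) := by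
    rw [integrable_dV_iff, ← aff_image hz, integrableOn_image_iff_integrableOn_abs_det_fderiv_smul
      volume measurableSet_tube hder ((aff_injective hz).injOn),
      integrableOn_congr_fun hcong measurableSet_tube] at hi
    rwa [integrable_dV_iff]
  have h2 := reproducing_iE γ hF' h1
  rw [aff_iE hz] at h2
  rw [← h2, integral_dV, integral_dV, ← setIntegral_congr_fun measurableSet_tube hcong]
  conv_lhs => rw [← aff_image hz]
  exact integral_image_eq_integral_abs_det_fderiv_smul
      volume measurableSet_tube hder ((aff_injective hz).injOn) _

end Reproducing

section PositiveOperators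

variable {n : ℕ} [NeZero n]

/-- The size of the kernel against the base point. -/
def kE (w : Fin n → ℂ) : ℝ := ‖kb w (iE n)‖

/-- The positive kernel operator `∫ |kb|^{-a} f dV_b`. -/
def pker (a b : ℝ) (f : (Fin n → ℂ) → ℝ≥0∞) (z : Fin n → ℂ) : ℝ≥0∞ :=
  ∫⁻ w, ENNReal.ofReal (‖kb z w‖ ^ (-a)) * f w ∂(dV n b)

lemma one_le_kE {w : Fin n → ℂ} (hw : w ∈ tube n) : 1 ≤ kE w := one_le_norm_kb_iE hw

lemma dl_le_kE {w : Fin n → ℂ} (hw : w ∈ tube n) : dl w ≤ kE w := dl_le_norm_kb_left hw iE_mem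

lemma kE_pos {w : Fin n → ℂ} (hw : w ∈ tube n) : 0 < kE w := norm_kb_pos hw iE_mem

lemma continuous_kE : Continuous (kE : (Fin n → ℂ) → ℝ) :=
  (differentiable_kb (iE n)).continuous.norm

lemma aemeas_dV {X : Type*} [MeasurableSpace X] {f : (Fin n → ℂ) → X}
    (hf : AEMeasurable f (volume.restrict (tube n))) (ν : ℝ) : AEMeasurable f (dV n ν) :=
  hf.mono_ac (dV_ac ν)

lemma lintegral_kb_lt_top (hn : 2 ≤ n) {a b : ℝ} (ha : (n : ℝ) < a) (hb : (n : ℝ) / 2 - 1 < b)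
    (hab : b < a - n + 1) {z : Fin n → ℂ} (hz : z ∈ tube n) :
    ∫⁻ w, ENNReal.ofReal (‖kb z w‖ ^ (-a)) ∂(dV n b) < ⊤ := by
  have hn' : (2 : ℝ) ≤ n := by exact_mod_cast hn
  obtain ⟨C, -, h⟩ := forelli_rudin_le hn (d := 0) ha hb (by linarith) (by linarith) (by linarith)
  have := h z hz
  simp only [Real.rpow_zero, ENNReal.ofReal_one, mul_one] at this
  exact this.trans_lt ENNReal.ofReal_lt_top

lemma lintegral_kE_lt_top (hn : 2 ≤ n) {a b : ℝ} (ha : (n : ℝ) < a) (hb : (n : ℝ) / 2 - 1 < b)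
    (hab : b < a - n + 1) : ∫⁻ w : Fin n → ℂ, ENNReal.ofReal (kE w ^ (-a)) ∂(dV n b) < ⊤ := by
  simp only [kE, norm_kb_comm _ (iE n)]
  exact lintegral_kb_lt_top hn ha hb hab iE_mem

lemma measurable_pker (a b : ℝ) {f : (Fin n → ℂ) → ℝ≥0∞}
    (hf : AEMeasurable f (volume.restrict (tube n))) : Measurable (pker a b f) := by
  have h1 : pker a b f = pker a b (hf.mk f) := by
    ext z
    exact lintegral_congr_ae (Filter.Eventually.mono ((dV_ac b).ae_le hf.ae_eq_mk) fun w hw => by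
      simp only [hw])
  rw [h1]
  exact Measurable.lintegral_prod_right' (f := fun x : (Fin n → ℂ) × (Fin n → ℂ) =>
      ENNReal.ofReal (‖kb x.1 x.2‖ ^ (-a)) * hf.mk f x.2)
    ((continuous_kb.norm.measurable.pow_const _).ennreal_ofReal.mul
      (hf.measurable_mk.comp measurable_snd))

lemma pker_mono {a b : ℝ} {f g : (Fin n → ℂ) → ℝ≥0∞} (h : ∀ w ∈ tube n, f w ≤ g w)
    (z : Fin n → ℂ) : pker a b f z ≤ pker a b g z :=
  lintegral_mono_dV fun w hw => mul_le_mul' le_rfl (h w hw)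

lemma pker_harnack {a : ℝ} (ha : 0 ≤ a) (b : ℝ) (f : (Fin n → ℂ) → ℝ≥0∞) {z₀ z : Fin n → ℂ}
    (hz₀ : z₀ ∈ tube n) (hz : z ∈ tube n) :
    pker a b f z ≤ ENNReal.ofReal (harC z₀ z ^ a) * pker a b f z₀ := by
  rw [pker, pker, ← lintegral_const_mul' _ _ ENNReal.ofReal_ne_top]
  refine lintegral_mono_dV fun w hw => ?_
  have h := norm_Ks_harnack ha hz₀ hz hw
  rw [norm_Ks, norm_Ks] at h
  have h0 : 0 ≤ harC z₀ z ^ a := Real.rpow_nonneg (harC_pos hz₀ hz).le _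
  rw [← mul_assoc, ← ENNReal.ofReal_mul h0]
  exact mul_le_mul' (ENNReal.ofReal_le_ofReal h) le_rfl

lemma pker_lt_top_of {a : ℝ} (ha : 0 ≤ a) {b : ℝ} {f : (Fin n → ℂ) → ℝ≥0∞} {z₀ z : Fin n → ℂ}
    (hz₀ : z₀ ∈ tube n) (hz : z ∈ tube n) (h : pker a b f z₀ < ⊤) : pker a b f z < ⊤ :=
  (pker_harnack ha b f hz₀ hz).trans_lt (ENNReal.mul_lt_top ENNReal.ofReal_lt_top h)

/-- If a positive operator has finite weighted norm then it is finite everywhere. -/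
lemma pker_lt_top_of_lintegral {a : ℝ} (ha : 0 ≤ a) {b μ q s : ℝ} (hq : 0 < q)
    {f : (Fin n → ℂ) → ℝ≥0∞} (hf : AEMeasurable f (volume.restrict (tube n)))
    (h : ∫⁻ z, (ENNReal.ofReal (dl z ^ s) * pker a b f z) ^ q ∂(dV n μ) < ⊤)
    {z : Fin n → ℂ} (hz : z ∈ tube n) : pker a b f z < ⊤ := by
  have hm : Measurable fun z => (ENNReal.ofReal (dl z ^ s) * pker a b f z) ^ q :=
    ((continuous_dl.measurable.pow_const _).ennreal_ofReal.mul (measurable_pker a b hf)).pow_const _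
  have h1 := ae_lt_top hm h.ne
  have h2 : ∃ᵐ z ∂(dV n μ), z ∈ tube n := by
    have : Filter.NeBot (ae (dV n μ)) := by
      rw [ae_neBot]; intro h0
      exact dV_tube_ne_zero (n := n) μ (by rw [h0]; rfl)
    exact (ae_dV (n := n) (ν := μ)).frequently
  obtain ⟨z₀, hz₀, hlt⟩ := (h2.and_eventually h1).exists
  refine pker_lt_top_of ha hz₀ hz ?_
  rw [ENNReal.rpow_lt_top_iff_of_pos hq] at hlt
  by_contra hcon
  rw [not_lt, top_le_iff] at hcon
  rw [hcon, ENNReal.mul_top] at hlt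
  · exact lt_irrefl _ hlt
  · simpa using Real.rpow_pos_of_pos (dl_pos hz₀) _

lemma enorm_Ks (s : ℝ) (z w : Fin n → ℂ) : ‖Ks s z w‖ₑ = ENNReal.ofReal (‖kb z w‖ ^ (-s)) := by
  rw [← norm_Ks, ofReal_norm]

lemma integrable_Ks_iff {s b : ℝ} {f : (Fin n → ℂ) → ℂ} (hf : AEStronglyMeasurable f (dV n b))
    (z : Fin n → ℂ) : Integrable (fun w => Ks s z w * f w) (dV n b) ↔
      pker s b (fun w => ‖f w‖ₑ) z < ⊤ := by
  have hm : AEStronglyMeasurable (fun w => Ks s z w * f w) (dV n b) :=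
    (measurable_Ks_right s z).aestronglyMeasurable.mul hf
  simp only [Integrable, hm, true_and, HasFiniteIntegral, enorm_mul, enorm_Ks, pker]

lemma enorm_integral_Ks_le (s b : ℝ) (f : (Fin n → ℂ) → ℂ) (z : Fin n → ℂ) :
    ‖∫ w, Ks s z w * f w ∂(dV n b)‖ₑ ≤ pker s b (fun w => ‖f w‖ₑ) z := by
  refine (enorm_integral_le_lintegral_enorm _).trans_eq ?_
  simp only [enorm_mul, enorm_Ks, pker]

lemma weight_aux {x y a b c r β μ R ε s : ℝ} (hx : 0 < x) (hy : 0 < y) (ha : 0 < a) (hc : 0 < c)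
    (hR : 0 ≤ R) (hr : R ≤ r) (hε : 0 ≤ ε) (hε1 : ε ≤ 1) (hrs : r = β + s)
    (h1 : a * y ^ 2 ≤ c * (x * b ^ 2)) (h2 : y ≤ x) (h3 : 1 ≤ b) (h4 : y ≤ b) :
    y ^ (β - μ) * (x ^ (-r) * y ^ (-ε)) ≤
      c ^ R * a ^ (-R) * (b ^ (-R) * (b ^ (3 * R + 1) * y ^ (-(s + μ + R + 1)))) := by
  have hb : 0 < b := by linarith
  obtain ⟨X, rfl⟩ : ∃ X, x = Real.exp X := ⟨_, (Real.exp_log hx).symm⟩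
  obtain ⟨Y, rfl⟩ : ∃ X, y = Real.exp X := ⟨_, (Real.exp_log hy).symm⟩
  obtain ⟨A, rfl⟩ : ∃ X, a = Real.exp X := ⟨_, (Real.exp_log ha).symm⟩
  obtain ⟨B, rfl⟩ : ∃ X, b = Real.exp X := ⟨_, (Real.exp_log hb).symm⟩
  obtain ⟨C, rfl⟩ : ∃ X, c = Real.exp X := ⟨_, (Real.exp_log hc).symm⟩
  simp only [← Real.exp_mul, ← Real.exp_add, ← Real.exp_nat_mul, Real.exp_le_exp, Real.one_le_exp_iff] at *
  push_cast at h1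
  nlinarith [mul_le_mul_of_nonneg_left h1 hR, mul_le_mul_of_nonneg_left h2 (sub_nonneg.2 hr),
    mul_le_mul_of_nonneg_left h4 (sub_nonneg.2 hε1), mul_nonneg hε h3]

lemma weight_aux_left {x y a b c d r A B j : ℝ} (hx : 0 < x) (hy : 0 < y) (ha : 0 < a)
    (hb : 0 < b) (hd : 0 < d) (hc : 0 < c) (hA : 0 ≤ A) (h1 : a * y ^ 2 ≤ c * (b * x ^ 2)) :
    a ^ A * d ^ (-B) * d ^ j * x ^ (-r) ≤
      c ^ A * d ^ (j - B) * y ^ (B - 2 * A) * x ^ (-(r - 2 * A)) * (b ^ A * y ^ (-B)) := by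
  obtain ⟨X, rfl⟩ : ∃ X, x = Real.exp X := ⟨_, (Real.exp_log hx).symm⟩
  obtain ⟨Y, rfl⟩ : ∃ X, y = Real.exp X := ⟨_, (Real.exp_log hy).symm⟩
  obtain ⟨A, rfl⟩ : ∃ X, a = Real.exp X := ⟨_, (Real.exp_log ha).symm⟩
  obtain ⟨B, rfl⟩ : ∃ X, b = Real.exp X := ⟨_, (Real.exp_log hb).symm⟩
  obtain ⟨C, rfl⟩ : ∃ X, c = Real.exp X := ⟨_, (Real.exp_log hc).symm⟩
  obtain ⟨D, rfl⟩ : ∃ X, d = Real.exp X := ⟨_, (Real.exp_log hd).symm⟩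
  simp only [← Real.exp_mul, ← Real.exp_add, ← Real.exp_nat_mul, Real.exp_le_exp] at *
  push_cast at h1
  nlinarith [mul_le_mul_of_nonneg_left h1 hA]

/-- A weighted pointwise bound for the positive Bergman operator. -/
lemma pker_weighted_le (hn : 2 ≤ n) {p q : ℝ} (hpq : p.HolderConjugate q) {μ R : ℝ}
    (hμ : (n : ℝ) / 2 - 1 < μ) (hR : n + μ + 1 ≤ R) :
    ∃ C : ℝ, 0 < C ∧ ∀ β ε : ℝ, R ≤ β + n / 2 → 0 ≤ ε → ε ≤ 1 →
      ∀ g : (Fin n → ℂ) → ℝ≥0∞, AEMeasurable g (volume.restrict (tube n)) → ∀ z ∈ tube n,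
      pker (β + n / 2) β (fun w => ENNReal.ofReal (dl w ^ (-ε)) * g w) z ≤
        ENNReal.ofReal (C * kE z ^ (-R)) * (∫⁻ w, (ENNReal.ofReal (kE w ^ (3 * R + 1) *
          dl w ^ (-(n / 2 + μ + R + 1))) * g w) ^ q ∂(dV n μ)) ^ (1 / q) := by
  have hn' : (2 : ℝ) ≤ n := by exact_mod_cast hn
  have hp := hpq.lt
  have hR0 : 0 ≤ R := by linarith
  have hRp : R ≤ R * p := le_mul_of_one_le_right hR0 hp.le
  have hI := lintegral_kE_lt_top hn (a := R * p) (b := μ) (by linarith) hμ (by linarith)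
  set I := ∫⁻ w : Fin n → ℂ, ENNReal.ofReal (kE w ^ (-(R * p))) ∂(dV n μ) with hIdef
  have hI2 : I ^ (1 / p) < ⊤ := ENNReal.rpow_lt_top_of_nonneg (by positivity) hI.ne
  have ht : 0 < triC n := triC_pos
  refine ⟨triC n ^ R * ((I ^ (1 / p)).toReal + 1), by positivity,
    fun β ε hβ hε hε1 g hg z hz => ?_⟩
  set W : (Fin n → ℂ) → ℝ := fun w => kE w ^ (3 * R + 1) * dl w ^ (-(n / 2 + μ + R + 1)) with hW
  have mk : Measurable fun w : Fin n → ℂ => ENNReal.ofReal (kE w ^ (-R)) :=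
    (continuous_kE.measurable.pow_const _).ennreal_ofReal
  have mW : Measurable fun w : Fin n → ℂ => ENNReal.ofReal (W w) :=
    ((continuous_kE.measurable.pow_const _).mul
      (continuous_dl.measurable.pow_const _)).ennreal_ofReal
  have h1 : pker (β + n / 2) β (fun w => ENNReal.ofReal (dl w ^ (-ε)) * g w) z ≤
      ENNReal.ofReal (triC n ^ R * kE z ^ (-R)) *
        ∫⁻ w, ((fun w : Fin n → ℂ => ENNReal.ofReal (kE w ^ (-R))) *
          fun w : Fin n → ℂ => ENNReal.ofReal (W w) * g w) w ∂(dV n μ) := by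
    have e : β = μ + (β - μ) := by ring
    rw [pker, ← lintegral_const_mul' _ _ ENNReal.ofReal_ne_top]
    conv_lhs => rw [e]
    rw [← lintegral_dV_shift]
    refine lintegral_mono_dV fun w hw => ?_
    have hx := norm_kb_pos hz hw
    have hy := dl_pos hw
    have hz' := kE_pos hz
    have hw' := kE_pos hw
    simp only [Pi.mul_apply]
    rw [← e, ← mul_assoc, ← mul_assoc, ← mul_assoc, ← mul_assoc, ← ENNReal.ofReal_mul (by positivity),
      ← ENNReal.ofReal_mul (by positivity), ← ENNReal.ofReal_mul (by positivity),
      ← ENNReal.ofReal_mul (by positivity)]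
    refine mul_le_mul' (ENNReal.ofReal_le_ofReal ?_) le_rfl
    have h := weight_aux (r := β + n / 2) (s := n / 2) (μ := μ) hx hy hz' ht hR0 hβ hε hε1 rfl
      (b := kE w) ?_ (dl_le_norm_kb_right hz hw) (one_le_kE hw) (dl_le_kE hw)
    · simp only [hW, mul_assoc] at h ⊢
      exact h
    · have := norm_kb_le hz iE_mem hw
      rwa [norm_kb_comm (iE n) w] at this
  refine h1.trans ?_
  have h2 := ENNReal.lintegral_mul_le_Lp_mul_Lq (dV n μ) hpq mk.aemeasurable
    (mW.aemeasurable.mul (aemeas_dV hg μ))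
  have h3 : ∫⁻ w, ENNReal.ofReal (kE w ^ (-R)) ^ p ∂(dV n μ) = I := by
    refine lintegral_congr_dV fun w hw => ?_
    have := kE_pos hw
    rw [ENNReal.ofReal_rpow_of_pos (by positivity), ← Real.rpow_mul this.le, neg_mul]
  rw [h3] at h2
  have h4 : I ^ (1 / p) ≤ ENNReal.ofReal ((I ^ (1 / p)).toReal + 1) := by
    rw [ENNReal.ofReal_add ENNReal.toReal_nonneg zero_le_one, ENNReal.ofReal_toReal hI2.ne]
    exact le_self_add
  have hz' := kE_pos hz
  calc _ ≤ ENNReal.ofReal (triC n ^ R * kE z ^ (-R)) * (ENNReal.ofReal ((I ^ (1 / p)).toReal + 1) *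
        (∫⁻ w, (ENNReal.ofReal (W w) * g w) ^ q ∂(dV n μ)) ^ (1 / q)) :=
        mul_le_mul' le_rfl (h2.trans (mul_le_mul' h4 le_rfl))
    _ = _ := by
      rw [← mul_assoc, ← ENNReal.ofReal_mul (by positivity), mul_right_comm]

lemma pker_weighted_bounded (hn : 2 ≤ n) {p q : ℝ} (hpq : p.HolderConjugate q) {μ R : ℝ}
    (hμ : (n : ℝ) / 2 - 1 < μ) (hR : n + μ + 1 ≤ R) :
    ∃ C : ℝ, 0 < C ∧ ∀ β ε : ℝ, R ≤ β + n / 2 → 0 ≤ ε → ε ≤ 1 →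
      ∀ g : (Fin n → ℂ) → ℝ≥0∞, AEMeasurable g (volume.restrict (tube n)) →
      ∫⁻ z, pker (β + n / 2) β (fun w => ENNReal.ofReal (dl w ^ (-ε)) * g w) z ^ q ∂(dV n μ) ≤
        ENNReal.ofReal C * ∫⁻ w, (ENNReal.ofReal (kE w ^ (3 * R + 1) *
          dl w ^ (-(n / 2 + μ + R + 1))) * g w) ^ q ∂(dV n μ) := by
  have hn' : (2 : ℝ) ≤ n := by exact_mod_cast hn
  have hq := hpq.symm.lt
  have hR0 : 0 ≤ R := by linarith
  have hRq : R ≤ R * q := le_mul_of_one_le_right hR0 hq.le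
  have hI := lintegral_kE_lt_top hn (a := R * q) (b := μ) (by linarith) hμ (by linarith)
  set I := ∫⁻ w : Fin n → ℂ, ENNReal.ofReal (kE w ^ (-(R * q))) ∂(dV n μ) with hIdef
  obtain ⟨C, hC, H⟩ := pker_weighted_le hn hpq hμ hR
  refine ⟨C ^ q * (I.toReal + 1), by positivity, fun β ε hβ hε hε1 g hg => ?_⟩
  set J := ∫⁻ w, (ENNReal.ofReal (kE w ^ (3 * R + 1) *
          dl w ^ (-(n / 2 + μ + R + 1))) * g w) ^ q ∂(dV n μ)
  calc _ ≤ ∫⁻ z, ENNReal.ofReal (kE z ^ (-(R * q))) * (ENNReal.ofReal (C ^ q) * J) ∂(dV n μ) := by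
        refine lintegral_mono_dV fun z hz => ?_
        have hz' := kE_pos hz
        refine (ENNReal.rpow_le_rpow (H β ε hβ hε hε1 g hg z hz) (by linarith)).trans_eq ?_
        rw [ENNReal.mul_rpow_of_nonneg _ _ (by linarith), ← ENNReal.rpow_mul,
          one_div_mul_cancel (by linarith), ENNReal.rpow_one,
          ENNReal.ofReal_rpow_of_pos (by positivity), Real.mul_rpow hC.le (by positivity),
          ← Real.rpow_mul hz'.le, neg_mul, mul_comm (C ^ q), ENNReal.ofReal_mul (by positivity),
          mul_assoc]
    _ = I * (ENNReal.ofReal (C ^ q) * J) := lintegral_mul_const _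
        (continuous_kE.measurable.pow_const _).ennreal_ofReal
    _ ≤ ENNReal.ofReal (I.toReal + 1) * (ENNReal.ofReal (C ^ q) * J) := by
        refine mul_le_mul' ?_ le_rfl
        rw [ENNReal.ofReal_add ENNReal.toReal_nonneg zero_le_one, ENNReal.ofReal_toReal hI.ne]
        exact le_self_add
    _ = _ := by
        rw [← mul_assoc, ← ENNReal.ofReal_mul (by positivity), mul_comm (C ^ q)]

/-- The operators `Δ^j ∫ |kb|^{-(r+j)} f dV_β` on weighted spaces. -/
lemma pker_dl_weighted_bounded (hn : 2 ≤ n) {p q : ℝ} (hpq : p.HolderConjugate q)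
    {μ A B β j : ℝ} (hμ : (n : ℝ) / 2 - 1 < μ) (hA : 0 ≤ A) (hB : 0 ≤ B)
    (hj : B + n / 2 < j) (hβ : 2 * A + n + μ < β) :
    ∃ C : ℝ, 0 < C ∧ ∀ f : (Fin n → ℂ) → ℝ≥0∞, AEMeasurable f (volume.restrict (tube n)) →
      ∫⁻ z, (ENNReal.ofReal (kE z ^ A * dl z ^ (-B)) * (ENNReal.ofReal (dl z ^ j) *
        pker (β + n / 2 + j) β f z)) ^ q ∂(dV n μ) ≤
      ENNReal.ofReal C * ∫⁻ z, (ENNReal.ofReal (kE z ^ A * dl z ^ (-B)) * f z) ^ q ∂(dV n μ) := by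
  have hn' : (2 : ℝ) ≤ n := by exact_mod_cast hn
  have hq := hpq.symm.pos
  have ht : 0 < triC n := triC_pos
  obtain ⟨C, hC, H⟩ := kernel_bounded hn hpq (ez := j - B) (ew := β + B - 2 * A) (μ := μ) (t₁ := 0)
    (t₂ := 0) (by linarith) (by linarith) (by linarith) (by linarith) (by linarith) (by linarith)
    (by linarith) (by linarith) (by linarith)
  refine ⟨(triC n ^ A) ^ q * C, by positivity, fun f hf => ?_⟩
  have mW : Measurable fun w : Fin n → ℂ => ENNReal.ofReal (kE w ^ A * dl w ^ (-B)) :=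
    ((continuous_kE.measurable.pow_const _).mul
      (continuous_dl.measurable.pow_const _)).ennreal_ofReal
  have H' := H _ (mW.aemeasurable.mul hf)
  calc _ ≤ ∫⁻ z, ENNReal.ofReal ((triC n ^ A) ^ q) * (ENNReal.ofReal (dl z ^ (j - B)) *
        ∫⁻ w, ENNReal.ofReal (‖kb z w‖ ^ (-(j - B + (β + B - 2 * A) + n / 2))) *
          (ENNReal.ofReal (kE w ^ A * dl w ^ (-B)) * f w) ∂(dV n (β + B - 2 * A))) ^ q ∂(dV n μ) := by
        refine lintegral_mono_dV fun z hz => ?_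
        have hz' := kE_pos hz
        have hz0 := dl_pos hz
        rw [← ENNReal.ofReal_rpow_of_pos (x := triC n ^ A) (p := q) (by positivity),
          ← ENNReal.mul_rpow_of_nonneg _ _ hq.le]
        refine ENNReal.rpow_le_rpow ?_ hq.le
        rw [pker, ← lintegral_const_mul' _ _ ENNReal.ofReal_ne_top,
          ← lintegral_const_mul' _ _ ENNReal.ofReal_ne_top,
          ← lintegral_const_mul' _ _ ENNReal.ofReal_ne_top,
          ← lintegral_const_mul' _ _ ENNReal.ofReal_ne_top,
          show β + B - 2 * A = β + (B - 2 * A) by ring, ← lintegral_dV_shift]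
        refine lintegral_mono_dV fun w hw => ?_
        have hx := norm_kb_pos hz hw
        have hy := dl_pos hw
        have hw' := kE_pos hw
        simp only [← mul_assoc]
        rw [← ENNReal.ofReal_mul (by positivity), ← ENNReal.ofReal_mul (by positivity),
          ← ENNReal.ofReal_mul (by positivity), ← ENNReal.ofReal_mul (by positivity),
          ← ENNReal.ofReal_mul (by positivity), ← ENNReal.ofReal_mul (by positivity)]
        refine mul_le_mul' (ENNReal.ofReal_le_ofReal ?_) le_rfl
        have h := norm_kb_le iE_mem hz hw (n := n)
        rw [norm_kb_comm (iE n) z, norm_kb_comm (iE n) w] at h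
        have h' := weight_aux_left (r := β + n / 2 + j) (B := B) (j := j) hx hy hz' hw' hz0 ht hA h
        refine (le_of_eq ?_).trans (h'.trans_eq ?_)
        · ring_nf
        · ring_nf
    _ = _ := by
        rw [lintegral_const_mul' _ _ ENNReal.ofReal_ne_top]
    _ ≤ _ := by
        rw [ENNReal.ofReal_mul (by positivity), mul_assoc]
        exact mul_le_mul' le_rfl H'

end PositiveOperators

section BergmanOperators

variable {n : ℕ} [NeZero n]

/-- The Bergman-type operator with kernel `Ks s` with respect to `dV_b`. -/
def bop (s b : ℝ) (f : (Fin n → ℂ) → ℂ) (z : Fin n → ℂ) : ℂ :=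
  ∫ w, Ks s z w * f w ∂(dV n b)

lemma aesm_dV {f : (Fin n → ℂ) → ℂ} (hf : AEMeasurable f (volume.restrict (tube n))) (b : ℝ) :
    AEStronglyMeasurable f (dV n b) := (aemeas_dV hf b).aestronglyMeasurable

lemma aemeas_of_diff {F : (Fin n → ℂ) → ℂ} (hF : DifferentiableOn ℂ F (tube n)) :
    AEMeasurable F (volume.restrict (tube n)) :=
  hF.continuousOn.aemeasurable measurableSet_tube

lemma bop_congr (s b : ℝ) {f g : (Fin n → ℂ) → ℂ} (h : EqOn f g (tube n)) (z : Fin n → ℂ) :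
    bop s b f z = bop s b g z :=
  integral_congr_ae (by filter_upwards [ae_dV] with w hw; rw [h hw])

lemma bop_const_mul (s b : ℝ) (c : ℂ) (f : (Fin n → ℂ) → ℂ) (z : Fin n → ℂ) :
    bop s b (fun w => c * f w) z = c * bop s b f z := by
  rw [bop, bop, ← integral_const_mul]
  congr 1; ext w; ring

lemma enorm_bop_le (s b : ℝ) (f : (Fin n → ℂ) → ℂ) (z : Fin n → ℂ) :
    ‖bop s b f z‖ₑ ≤ pker s b (fun w => ‖f w‖ₑ) z := enorm_integral_Ks_le s b f z

lemma pker_add_le {s b k : ℝ} (hk : 0 ≤ k) (f : (Fin n → ℂ) → ℝ≥0∞) {z : Fin n → ℂ}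
    (hz : z ∈ tube n) :
    pker (s + k) b f z ≤ ENNReal.ofReal (dl z ^ (-k)) * pker s b f z := by
  rw [pker, pker, ← lintegral_const_mul' _ _ ENNReal.ofReal_ne_top]
  refine lintegral_mono_dV fun w hw => ?_
  have h1 := norm_kb_pos hz hw
  have h2 := dl_pos hz
  rw [← mul_assoc, ← ENNReal.ofReal_mul (by positivity)]
  refine mul_le_mul' (ENNReal.ofReal_le_ofReal ?_) le_rfl
  rw [neg_add, Real.rpow_add h1, mul_comm]
  exact mul_le_mul_of_nonneg_right (Real.rpow_le_rpow_of_nonpos h2 (dl_le_norm_kb_left hz hw)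
    (by linarith)) (by positivity)

lemma pker_add_lt_top {s b k : ℝ} (hk : 0 ≤ k) {f : (Fin n → ℂ) → ℝ≥0∞} {z : Fin n → ℂ}
    (hz : z ∈ tube n) (h : pker s b f z < ⊤) : pker (s + k) b f z < ⊤ :=
  (pker_add_le hk f hz).trans_lt (ENNReal.mul_lt_top ENNReal.ofReal_lt_top h)

lemma locDom_bop {s : ℝ} (hs : 0 ≤ s) {b : ℝ} {f : (Fin n → ℂ) → ℂ}
    (hf : AEMeasurable f (volume.restrict (tube n))) {z₀ : Fin n → ℂ} (hz₀ : z₀ ∈ tube n)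
    (h : pker s b (fun w => ‖f w‖ₑ) z₀ < ⊤) :
    LocDom (tube n) (dV n b) (fun z w => Ks s z w * f w) :=
  locDom_Ks hs (aesm_dV hf b) hz₀ ((integrable_Ks_iff (aesm_dV hf b) z₀).2 h)

lemma bop_differentiableOn {s : ℝ} (hs : 0 ≤ s) {b : ℝ} {f : (Fin n → ℂ) → ℂ}
    (hf : AEMeasurable f (volume.restrict (tube n))) {z₀ : Fin n → ℂ} (hz₀ : z₀ ∈ tube n)
    (h : pker s b (fun w => ‖f w‖ₑ) z₀ < ⊤) : DifferentiableOn ℂ (bop s b f) (tube n) :=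
  (locDom_bop hs hf hz₀ h).differentiableOn isOpen_tube

lemma BoxOp_iter_bop (hn : 2 ≤ n) {s : ℝ} (hs : 0 ≤ s) {b : ℝ} {f : (Fin n → ℂ) → ℂ}
    (hf : AEMeasurable f (volume.restrict (tube n))) {z₀ : Fin n → ℂ} (hz₀ : z₀ ∈ tube n)
    (h : pker s b (fun w => ‖f w‖ₑ) z₀ < ⊤) (k : ℕ) :
    EqOn (BoxOp^[k] (bop s b f)) (fun z => (boxC n s 0 k : ℂ) * bop (s + k) b f z) (tube n) := by
  intro z hz
  have h1 := (locDom_bop hs hf hz₀ h).boxOp_iter_integral isOpen_tube k z hz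
  refine h1.trans ?_
  show _ = (boxC n s 0 k : ℂ) * bop (s + k) b f z
  rw [bop, ← integral_const_mul]
  refine integral_congr_ae ?_
  filter_upwards [ae_dV] with w hw
  have e : (fun z => Ks s z w * f w) = fun z => f w * Ks s z w := by ext; ring
  rw [e, BoxOp_iter_const_mul isOpen_tube (Ks_differentiableOn s hw) (f w) k hz]
  show f w * BoxOp^[k] (fun z => Ks s z w) z = _
  rw [BoxOp_iter_Ks hn s k hw hz]
  ring

/-- Composition of the kernels. -/
lemma conv_kernel (hn : 2 ≤ n) {s γ : ℝ} (hs : (n : ℝ) / 2 - 1 < s) (hγ : (n : ℝ) / 2 - 1 < γ)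
    (hsγ : (n : ℝ) / 2 < s + γ) (j : ℕ) : ∃ c : ℂ, c ≠ 0 ∧ ∀ z ∈ tube n, ∀ v ∈ tube n,
      Ks (s + j) z v = c * ∫ w, Ks s z w * Ks (γ + n / 2 + j) w v ∂(dV n γ) := by
  have hn' : (2 : ℝ) ≤ n := by exact_mod_cast hn
  have hr := rfC_ne_zero hn hγ
  have hb1 := boxC_ne_zero hn hs j
  have hb2 := boxC_ne_zero hn (s := γ + n / 2) (by linarith) j
  have hs0 : 0 ≤ s := by linarith
  have hγ0 : 0 ≤ γ + n / 2 := by linarith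
  have key : ∀ z ∈ tube n, ∀ v ∈ tube n, ((boxC n (γ + n / 2) 0 j : ℝ) : ℂ) *
      ∫ w, Ks (γ + n / 2 + j) v w * Ks s w z ∂(dV n γ) =
        rfC n γ * ((boxC n s 0 j : ℝ) * Ks (s + j) v z) := by
    intro z hz v hv
    have hd := Ks_differentiableOn s hz
    have hF := aemeas_of_diff hd
    have hfin : ∀ v ∈ tube n, pker (γ + n / 2) γ (fun w => ‖Ks s w z‖ₑ) v < ⊤ := by
      intro v hv
      refine lt_of_le_of_lt (b := ∫⁻ w, ENNReal.ofReal (harC v z ^ s) *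
        ENNReal.ofReal (‖kb v w‖ ^ (-(s + γ + n / 2))) ∂(dV n γ)) ?_ ?_
      · refine lintegral_mono_dV fun w hw => ?_
        have h := norm_Ks_harnack hs0 hv hz hw
        have h1 := norm_kb_pos hv hw
        have h2 := harC_pos hv hz
        simp only
        rw [enorm_Ks, norm_kb_comm w z, ← norm_Ks s z w, ← ENNReal.ofReal_mul (by positivity),
          ← ENNReal.ofReal_mul (by positivity)]
        refine ENNReal.ofReal_le_ofReal ((mul_le_mul_of_nonneg_left h (by positivity)).trans_eq ?_)
        rw [norm_Ks, show -(s + γ + n / 2) = -(γ + n / 2) + -s by ring, Real.rpow_add h1]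
        ring
      · rw [lintegral_const_mul' _ _ ENNReal.ofReal_ne_top]
        exact ENNReal.mul_lt_top ENNReal.ofReal_lt_top
          (lintegral_kb_lt_top hn (by linarith) hγ (by linarith) hv)
    have hrep : EqOn (bop (γ + n / 2) γ (fun w => Ks s w z)) (fun v => rfC n γ * Ks s v z)
        (tube n) := fun v hv => reproducing γ hd hv
          ((integrable_Ks_iff (aesm_dV hF γ) v).2 (hfin v hv))
    have h1 := BoxOp_iter_bop hn hγ0 hF hv (hfin v hv) j hv
    rw [BoxOp_iter_congr isOpen_tube hrep j hv, BoxOp_iter_const_mul isOpen_tube hd _ j hv] at h1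
    simp only at h1
    rw [BoxOp_iter_Ks hn s j hz hv] at h1
    exact h1.symm
  refine ⟨(boxC n (γ + n / 2) 0 j : ℝ) / ((starRingEnd ℂ) (rfC n γ) * (boxC n s 0 j : ℝ)), ?_, ?_⟩
  · exact div_ne_zero (by exact_mod_cast hb2) (mul_ne_zero (by simpa using hr)
      (by exact_mod_cast hb1))
  · intro z hz v hv
    have h := congrArg (starRingEnd ℂ) (key z hz v hv)
    rw [map_mul, map_mul, map_mul, Complex.conj_ofReal, Complex.conj_ofReal, Ks_conj _ hv hz,
      ← integral_conj] at h
    have e : ∫ w, (starRingEnd ℂ) (Ks (γ + n / 2 + j) v w * Ks s w z) ∂(dV n γ) =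
        ∫ w, Ks s z w * Ks (γ + n / 2 + j) w v ∂(dV n γ) := by
      refine integral_congr_ae ?_
      filter_upwards [ae_dV] with w hw
      rw [map_mul, Ks_conj _ hv hw, Ks_conj _ hw hz, mul_comm]
    rw [e] at h
    have hr' : (starRingEnd ℂ) (rfC n γ) ≠ 0 := by simpa using hr
    have hb1' : ((boxC n s 0 j : ℝ) : ℂ) ≠ 0 := by exact_mod_cast hb1
    rw [div_mul_eq_mul_div, h]
    field_simp

lemma bop_bop (hn : 2 ≤ n) {s γ : ℝ} (hs : (n : ℝ) / 2 - 1 < s) (hγ : (n : ℝ) / 2 - 1 < γ)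
    (hsγ : (n : ℝ) / 2 < s + γ) (j : ℕ) : ∃ c : ℂ, c ≠ 0 ∧ ∀ (β : ℝ) (f : (Fin n → ℂ) → ℂ),
      AEMeasurable f (volume.restrict (tube n)) → ∀ z ∈ tube n,
      pker s γ (pker (γ + n / 2 + j) β (fun w => ‖f w‖ₑ)) z < ⊤ →
      bop (s + j) β f z = c * bop s γ (bop (γ + n / 2 + j) β f) z := by
  obtain ⟨c, hc, H⟩ := conv_kernel hn hs hγ hsγ j
  refine ⟨c, hc, fun β f hf z hz hfin => ?_⟩
  have hm : AEStronglyMeasurable (Function.uncurry fun w v : Fin n → ℂ =>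
      Ks s z w * (Ks (γ + n / 2 + j) w v * f v)) ((dV n γ).prod (dV n β)) :=
    ((measurable_Ks_right s z).comp measurable_fst).aestronglyMeasurable.mul
      ((measurable_Ks _).aestronglyMeasurable.mul (aesm_dV hf β).comp_snd)
  have hi : Integrable (Function.uncurry fun w v : Fin n → ℂ =>
      Ks s z w * (Ks (γ + n / 2 + j) w v * f v)) ((dV n γ).prod (dV n β)) := by
    refine ⟨hm, ?_⟩
    rw [HasFiniteIntegral, lintegral_prod _ hm.enorm]
    refine lt_of_eq_of_lt ?_ hfin
    refine lintegral_congr fun w => ?_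
    simp only [Function.uncurry, enorm_mul, enorm_Ks]
    rw [lintegral_const_mul' _ _ ENNReal.ofReal_ne_top]
    rfl
  have h1 := integral_integral_swap hi
  have h2 : bop s γ (bop (γ + n / 2 + j) β f) z =
      ∫ w, ∫ v, Ks s z w * (Ks (γ + n / 2 + j) w v * f v) ∂(dV n β) ∂(dV n γ) := by
    simp only [bop, integral_const_mul]
  rw [h2, h1, bop, ← integral_const_mul]
  refine integral_congr_ae ?_
  filter_upwards [ae_dV] with v hv
  rw [H z hz v hv, mul_assoc, ← integral_mul_const]
  simp only [mul_assoc]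

end BergmanOperators

section Dyadic

variable {n : ℕ} [NeZero n]

/-- An auxiliary weight which is large near the boundary and at infinity. -/
def omW (A B : ℝ) (w : Fin n → ℂ) : ℝ≥0∞ := ENNReal.ofReal (kE w ^ A * dl w ^ (-B))

/-- A perturbation of the `q`-th power of the norm of `L^q_μ`. -/
def wN (q μ A B : ℝ) (δ : ℝ≥0∞) (f : (Fin n → ℂ) → ℝ≥0∞) : ℝ≥0∞ :=
  ∫⁻ w, (1 + δ * omW A B w ^ q) * f w ^ q ∂(dV n μ)

/-- Boundedness of the Bergman operator with respect to the perturbed norm. -/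
def bopBd (n : ℕ) [NeZero n] (q μ A B β : ℝ) (δ C : ℝ≥0∞) : Prop :=
  ∀ f : (Fin n → ℂ) → ℂ, AEMeasurable f (volume.restrict (tube n)) →
    wN q μ A B δ (fun w => ‖f w‖ₑ) < ⊤ →
    ∫⁻ z, ‖bop (β + n / 2) β f z‖ₑ ^ q ∂(dV n μ) ≤ C * wN q μ A B δ (fun w => ‖f w‖ₑ)

lemma measurable_omW (A B : ℝ) : Measurable (omW A B : (Fin n → ℂ) → ℝ≥0∞) :=
  ((continuous_kE.measurable.pow_const _).mul (continuous_dl.measurable.pow_const _)).ennreal_ofReal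

lemma wN_eq {q : ℝ} (hq : 0 ≤ q) (μ A B : ℝ) (δ : ℝ≥0∞) {f : (Fin n → ℂ) → ℝ≥0∞}
    (hf : AEMeasurable f (volume.restrict (tube n))) :
    wN q μ A B δ f = ∫⁻ w, f w ^ q ∂(dV n μ) + δ * ∫⁻ w, (omW A B w * f w) ^ q ∂(dV n μ) := by
  have h1 := (aemeas_dV hf μ).pow_const q
  have h2 : AEMeasurable (fun w => (omW A B w * f w) ^ q) (dV n μ) :=
    ((measurable_omW A B).aemeasurable.mul (aemeas_dV hf μ)).pow_const q
  rw [← lintegral_const_mul'' _ h2, ← lintegral_add_left' h1]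
  refine lintegral_congr fun w => ?_
  rw [ENNReal.mul_rpow_of_nonneg _ _ hq]
  ring

lemma lintegral_le_wN (q μ A B : ℝ) (δ : ℝ≥0∞) (f : (Fin n → ℂ) → ℝ≥0∞) :
    ∫⁻ w, f w ^ q ∂(dV n μ) ≤ wN q μ A B δ f :=
  lintegral_mono fun _ => le_mul_of_one_le_left' le_self_add

lemma wN_mono {q : ℝ} (hq : 0 ≤ q) (μ A B : ℝ) (δ : ℝ≥0∞) {f g : (Fin n → ℂ) → ℝ≥0∞}
    (h : ∀ w ∈ tube n, f w ≤ g w) : wN q μ A B δ f ≤ wN q μ A B δ g :=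
  lintegral_mono_dV fun w hw => mul_le_mul' le_rfl (ENNReal.rpow_le_rpow (h w hw) hq)

lemma dyadic_sum {q x : ℝ} (hq : 1 ≤ q) (hx : 0 < x) :
    ∑' i : ℤ, (if (2 : ℝ) ^ i ≤ x then ENNReal.ofReal (((2 : ℝ) ^ (i + 1)) ^ q) else 0) ≤
      ENNReal.ofReal ((2 * x) ^ q) * 2 := by
  set i₀ := Int.log 2 x
  have hinj : Function.Injective fun k : ℕ => i₀ - (k : ℤ) := fun a b h => by
    simpa using h
  have h0 : (2 : ℝ) ^ i₀ ≤ x := by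
    simpa using Int.zpow_log_le_self (b := 2) (r := x) one_lt_two hx
  rw [← hinj.tsum_eq]
  · calc _ ≤ ∑' k : ℕ, ENNReal.ofReal ((2 * x) ^ q) * (2⁻¹ : ℝ≥0∞) ^ k := by
          refine ENNReal.tsum_le_tsum fun k => ?_
          refine (ite_le_sup _ _ _).trans ?_
          rw [sup_eq_left.2 zero_le]
          have e1 : (2⁻¹ : ℝ≥0∞) ^ k = ENNReal.ofReal ((2⁻¹ : ℝ) ^ k) := by
            rw [ENNReal.ofReal_pow (by norm_num), ENNReal.ofReal_inv_of_pos two_pos]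
            norm_num
          rw [e1, ← ENNReal.ofReal_mul (by positivity)]
          refine ENNReal.ofReal_le_ofReal ?_
          have e2 : (2 : ℝ) ^ (i₀ - (k : ℤ) + 1) = (2 * 2 ^ i₀) * (2⁻¹ : ℝ) ^ k := by
            rw [show i₀ - (k : ℤ) + 1 = 1 + i₀ + -(k : ℤ) by ring, zpow_add₀ two_ne_zero,
              zpow_add₀ two_ne_zero, zpow_neg, zpow_natCast, inv_pow, zpow_one]
          rw [e2, Real.mul_rpow (by positivity) (by positivity)]
          refine mul_le_mul (Real.rpow_le_rpow (by positivity) (by linarith) (by linarith)) ?_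
            (by positivity) (by positivity)
          exact Real.rpow_le_self_of_le_one (by positivity)
            (pow_le_one₀ (by norm_num) (by norm_num)) hq
    _ = _ := by
          rw [ENNReal.tsum_mul_left, ENNReal.tsum_geometric, ENNReal.one_sub_inv_two, inv_inv]
  · intro i hi
    have : (2 : ℝ) ^ i ≤ x := by
      by_contra h
      simp [h] at hi
    have h2 : i ≤ i₀ := by
      rw [← Int.zpow_le_iff_le_log (R := ℝ) one_lt_two hx]; simpa using this
    exact ⟨(i₀ - i).toNat, by simp only; omega⟩

lemma pker_near_le {r β L t : ℝ} (hL : 0 < L) (u : (Fin n → ℂ) → ℂ) {z : Fin n → ℂ}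
    (ht : t ≤ dl z) :
    pker r β (fun w => ‖{w | L * t ≤ dl w}ᶜ.indicator u w‖ₑ) z ≤
      ENNReal.ofReal ((L * dl z) ^ ((n : ℝ) / 2)) *
        pker r (β - n / 2) (fun w => ‖u w‖ₑ) z := by
  have e : β = β - n / 2 + n / 2 := by ring
  rw [pker, pker, ← lintegral_const_mul' _ _ ENNReal.ofReal_ne_top]
  conv_lhs => rw [e]
  rw [← lintegral_dV_shift]
  refine lintegral_mono_dV fun w hw => ?_
  by_cases h : w ∈ {w : Fin n → ℂ | L * t ≤ dl w}ᶜ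
  · rw [indicator_of_mem h]
    refine mul_le_mul' (ENNReal.ofReal_le_ofReal ?_) le_rfl
    have h1 : dl w < L * t := not_le.1 h
    exact Real.rpow_le_rpow (dl_pos hw).le (h1.le.trans (mul_le_mul_of_nonneg_left ht hL.le))
      (by positivity)
  · rw [indicator_of_notMem h]
    simp

lemma dyadic_pointwise {q r β L : ℝ} (hq : 1 ≤ q) (hL : 0 < L) {u : (Fin n → ℂ) → ℂ}
    (hu : AEMeasurable u (volume.restrict (tube n))) {z : Fin n → ℂ} (hz : z ∈ tube n)
    (hfin : pker r β (fun w => ‖u w‖ₑ) z < ⊤) :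
    (ENNReal.ofReal (dl z) * ‖bop r β u z‖ₑ) ^ q ≤ 2 ^ (q - 1) *
      (ENNReal.ofReal (L ^ ((n : ℝ) / 2)) ^ q * (ENNReal.ofReal (dl z) *
        (ENNReal.ofReal (dl z ^ ((n : ℝ) / 2)) * pker r (β - n / 2) (fun w => ‖u w‖ₑ) z)) ^ q +
      ∑' i : ℤ, ENNReal.ofReal (((2 : ℝ) ^ (i + 1)) ^ q) *
        ‖bop r β ({w | L * 2 ^ i ≤ dl w}.indicator u) z‖ₑ ^ q) := by
  have hq0 : 0 ≤ q := by linarith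
  have hz0 := dl_pos hz
  set i := Int.log 2 (dl z)
  have hi1 : (2 : ℝ) ^ i ≤ dl z := by
    simpa using Int.zpow_log_le_self (b := 2) (r := dl z) one_lt_two hz0
  have hi2 : dl z ≤ (2 : ℝ) ^ (i + 1) := by
    simpa using (Int.lt_zpow_succ_log_self (b := 2) one_lt_two (dl z)).le
  set S : Set (Fin n → ℂ) := {w | L * 2 ^ i ≤ dl w} with hS
  have hSm : MeasurableSet S := measurableSet_le measurable_const continuous_dl.measurable
  have hI := (integrable_Ks_iff (aesm_dV hu β) z).2 hfin
  have hsplit : bop r β u z = bop r β (Sᶜ.indicator u) z + bop r β (S.indicator u) z := by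
    have e : ∀ T : Set (Fin n → ℂ), (fun w => Ks r z w * T.indicator u w) =
        T.indicator fun w => Ks r z w * u w := fun T => by
      ext w; by_cases h : w ∈ T <;> simp [h]
    rw [bop, bop, bop, e, e, ← integral_add (hI.indicator hSm.compl) (hI.indicator hSm)]
    refine integral_congr_ae (Filter.Eventually.of_forall fun w => ?_)
    by_cases h : w ∈ S <;> simp [h]
  have h1 : ENNReal.ofReal (dl z) * ‖bop r β u z‖ₑ ≤
      ENNReal.ofReal (L ^ ((n : ℝ) / 2)) * (ENNReal.ofReal (dl z) *
        (ENNReal.ofReal (dl z ^ ((n : ℝ) / 2)) * pker r (β - n / 2) (fun w => ‖u w‖ₑ) z)) +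
      ENNReal.ofReal (2 ^ (i + 1)) * ‖bop r β (S.indicator u) z‖ₑ := by
    rw [hsplit]
    refine (mul_le_mul' le_rfl (enorm_add_le _ _)).trans ?_
    rw [mul_add]
    refine add_le_add ?_ (mul_le_mul' (ENNReal.ofReal_le_ofReal hi2) le_rfl)
    refine (mul_le_mul' le_rfl ((enorm_bop_le _ _ _ _).trans (pker_near_le hL u hi1))).trans_eq ?_
    rw [Real.mul_rpow hL.le hz0.le, ENNReal.ofReal_mul (by positivity)]
    ring
  refine (ENNReal.rpow_le_rpow h1 hq0).trans
    ((ENNReal.rpow_add_le_mul_rpow_add_rpow _ _ hq).trans (mul_le_mul' le_rfl ?_))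
  rw [ENNReal.mul_rpow_of_nonneg _ _ hq0]
  refine add_le_add le_rfl ?_
  rw [ENNReal.mul_rpow_of_nonneg _ _ hq0, ENNReal.ofReal_rpow_of_nonneg (by positivity) hq0]
  exact ENNReal.le_tsum (f := fun i : ℤ => ENNReal.ofReal (((2 : ℝ) ^ (i + 1)) ^ q) *
        ‖bop r β ({w | L * 2 ^ i ≤ dl w}.indicator u) z‖ₑ ^ q) i

lemma indicator_far_le {L t : ℝ} (hL : 0 < L) (ht : 0 < t) {u : (Fin n → ℂ) → ℂ}
    {v : (Fin n → ℂ) → ℝ≥0∞}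
    (huv : ∀ w ∈ tube n, ‖u w‖ₑ ≤ ENNReal.ofReal (dl w ^ (-1 : ℝ)) * v w) {w : Fin n → ℂ}
    (hw : w ∈ tube n) :
    ‖{w | L * t ≤ dl w}.indicator u w‖ₑ ≤ ENNReal.ofReal ((L * t)⁻¹) * v w := by
  by_cases h : w ∈ {w : Fin n → ℂ | L * t ≤ dl w}
  · rw [indicator_of_mem h]
    refine (huv w hw).trans (mul_le_mul' (ENNReal.ofReal_le_ofReal ?_) le_rfl)
    rw [Real.rpow_neg_one]
    exact inv_anti₀ (by positivity) h
  · rw [indicator_of_notMem h]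
    simp

lemma far_sum_le {q μ A B L : ℝ} (hq : 1 ≤ q) (hL : 0 < L) (δ : ℝ≥0∞) {u : (Fin n → ℂ) → ℂ}
    {v : (Fin n → ℂ) → ℝ≥0∞} (hu : AEMeasurable u (volume.restrict (tube n)))
    (huv : ∀ w ∈ tube n, ‖u w‖ₑ ≤ ENNReal.ofReal (dl w ^ (-1 : ℝ)) * v w) :
    ∑' i : ℤ, ENNReal.ofReal (((2 : ℝ) ^ (i + 1)) ^ q) *
      wN q μ A B δ (fun w => ‖{w | L * 2 ^ i ≤ dl w}.indicator u w‖ₑ) ≤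
    ENNReal.ofReal (2 * (2 / L) ^ q) * wN q μ A B δ v := by
  have hq0 : 0 ≤ q := by linarith
  have hS : ∀ i : ℤ, MeasurableSet {w : Fin n → ℂ | L * 2 ^ i ≤ dl w} := fun i =>
    measurableSet_le measurable_const continuous_dl.measurable
  have hm : ∀ i : ℤ, AEMeasurable (fun w => ENNReal.ofReal (((2 : ℝ) ^ (i + 1)) ^ q) *
      ((1 + δ * omW A B w ^ q) * ‖{w | L * 2 ^ i ≤ dl w}.indicator u w‖ₑ ^ q)) (dV n μ) := fun i =>
    ((((measurable_omW A B).pow_const q).const_mul δ).const_add 1).aemeasurable.mul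
      (((aemeas_dV hu μ).indicator (hS i)).enorm.pow_const q) |>.const_mul _
  have e : ∀ i : ℤ, ENNReal.ofReal (((2 : ℝ) ^ (i + 1)) ^ q) *
      wN q μ A B δ (fun w => ‖{w | L * 2 ^ i ≤ dl w}.indicator u w‖ₑ) =
      ∫⁻ w, ENNReal.ofReal (((2 : ℝ) ^ (i + 1)) ^ q) *
      ((1 + δ * omW A B w ^ q) * ‖{w | L * 2 ^ i ≤ dl w}.indicator u w‖ₑ ^ q) ∂(dV n μ) := fun i =>
    (lintegral_const_mul' _ _ ENNReal.ofReal_ne_top).symm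
  simp only [e]
  rw [← lintegral_tsum hm, wN, ← lintegral_const_mul' _ _ ENNReal.ofReal_ne_top]
  refine lintegral_mono_dV fun w hw => ?_
  have hw0 := dl_pos hw
  have h1 : ∀ i : ℤ, ENNReal.ofReal (((2 : ℝ) ^ (i + 1)) ^ q) *
      ((1 + δ * omW A B w ^ q) * ‖{w | L * 2 ^ i ≤ dl w}.indicator u w‖ₑ ^ q) =
      (if (2 : ℝ) ^ i ≤ dl w / L then ENNReal.ofReal (((2 : ℝ) ^ (i + 1)) ^ q) else 0) *
        ((1 + δ * omW A B w ^ q) * ‖u w‖ₑ ^ q) := fun i => by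
    have h2 : ((2 : ℝ) ^ i ≤ dl w / L) ↔ w ∈ {w : Fin n → ℂ | L * 2 ^ i ≤ dl w} := by
      rw [le_div_iff₀ hL, mul_comm]; rfl
    by_cases h : w ∈ {w : Fin n → ℂ | L * 2 ^ i ≤ dl w}
    · rw [if_pos (h2.2 h), indicator_of_mem h]
    · rw [if_neg (fun h' => h (h2.1 h')), indicator_of_notMem h, enorm_zero,
        ENNReal.zero_rpow_of_pos (by linarith)]
      simp
  simp only [h1]
  rw [ENNReal.tsum_mul_right]
  refine (mul_le_mul' (dyadic_sum hq (by positivity)) (mul_le_mul' le_rfl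
    (ENNReal.rpow_le_rpow (huv w hw) hq0))).trans_eq ?_
  rw [ENNReal.mul_rpow_of_nonneg _ _ hq0, ENNReal.ofReal_rpow_of_nonneg (by positivity) hq0]
  have e3 : ENNReal.ofReal (2 * (2 / L) ^ q) = ENNReal.ofReal ((2 * (dl w / L)) ^ q) * 2 *
      ENNReal.ofReal ((dl w ^ (-1 : ℝ)) ^ q) := by
    rw [show (2 : ℝ≥0∞) = ENNReal.ofReal 2 by simp, ← ENNReal.ofReal_mul (by positivity),
      ← ENNReal.ofReal_mul (by positivity)]
    congr 1
    rw [mul_right_comm, ← Real.mul_rpow (by positivity) (by positivity), Real.rpow_neg_one,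
      mul_comm]
    congr 2
    field_simp
  rw [e3]
  ring

end Dyadic

section HardyStep

variable {n : ℕ} [NeZero n]

lemma bop_shift (s b t : ℝ) (f : (Fin n → ℂ) → ℂ) (z : Fin n → ℂ) :
    bop s (b + t) f z = bop s b (fun w => ((dl w ^ t : ℝ) : ℂ) * f w) z := by
  rw [bop, bop, integral_dV, integral_dV]
  refine setIntegral_congr_fun measurableSet_tube fun w hw => ?_
  have h0 := dl_pos hw
  rw [show b + t - (n : ℝ) / 2 = b - n / 2 + t by ring, Real.rpow_add h0]
  push_cast
  ring

lemma lpInt_eq {q : ℝ} (hq : 0 ≤ q) (μ : ℝ) (f : (Fin n → ℂ) → ℂ) :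
    lpInt n q μ f = ∫⁻ z, ‖f z‖ₑ ^ q ∂(dV n μ) := by
  refine lintegral_congr fun z => ?_
  rw [← ENNReal.ofReal_rpow_of_nonneg (norm_nonneg _) hq, ofReal_norm]

lemma omW_finite_of_wN {q : ℝ} (hq : 0 ≤ q) {μ A B : ℝ} {δ : ℝ≥0∞} (hδ : δ ≠ 0)
    {f : (Fin n → ℂ) → ℝ≥0∞} (hf : AEMeasurable f (volume.restrict (tube n)))
    (h : wN q μ A B δ f < ⊤) : ∫⁻ w, (omW A B w * f w) ^ q ∂(dV n μ) < ⊤ := by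
  rw [wN_eq hq μ A B δ hf, ENNReal.add_lt_top] at h
  exact (ENNReal.mul_lt_top_iff.1 h.2).elim (fun h => h.2) fun h =>
    h.elim (fun h => absurd h hδ) fun h => h ▸ ENNReal.zero_lt_top

lemma pker_lt_top_of_wN (hn : 2 ≤ n) {p q : ℝ} (hpq : p.HolderConjugate q) {μ R β ε : ℝ}
    (hμ : (n : ℝ) / 2 - 1 < μ) (hR : n + μ + 1 ≤ R) (hβ : R ≤ β + n / 2) (hε : 0 ≤ ε)
    (hε1 : ε ≤ 1) {δ : ℝ≥0∞} (hδ : δ ≠ 0)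
    {f : (Fin n → ℂ) → ℝ≥0∞} (hf : AEMeasurable f (volume.restrict (tube n)))
    (h : wN q μ (3 * R + 1) (n / 2 + μ + R + 1) δ f < ⊤) {z : Fin n → ℂ} (hz : z ∈ tube n) :
    pker (β + n / 2) β (fun w => ENNReal.ofReal (dl w ^ (-ε)) * f w) z < ⊤ := by
  have hn' : (2 : ℝ) ≤ n := by exact_mod_cast hn
  have hq := hpq.symm.pos
  obtain ⟨C, -, H⟩ := pker_weighted_bounded hn hpq hμ hR
  have h1 := (H β ε hβ hε hε1 f hf).trans_lt (ENNReal.mul_lt_top ENNReal.ofReal_lt_top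
    (omW_finite_of_wN hq.le hδ hf h))
  refine pker_lt_top_of_lintegral (by linarith) (s := 0) (μ := μ) hq
    (f := fun w => ENNReal.ofReal (dl w ^ (-ε)) * f w)
    ((continuous_dl.measurable.pow_const _).ennreal_ofReal.aemeasurable.mul hf) ?_ hz
  simpa using h1

lemma dyadic_step (hn : 2 ≤ n) {p q : ℝ} (hpq : p.HolderConjugate q) {μ R β : ℝ}
    (hμ : (n : ℝ) / 2 - 1 < μ) (hR : n + μ + 1 ≤ R) (hβ : R ≤ β + n / 2) (hβ2 : μ + q + n ≤ β) :
    ∃ K : ℝ, 0 < K ∧ ∀ (L : ℝ) (δ C : ℝ≥0∞), 0 < L → δ ≠ 0 →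
      bopBd n q μ (3 * R + 1) (n / 2 + μ + R + 1) β δ C →
      ∀ (u : (Fin n → ℂ) → ℂ) (v : (Fin n → ℂ) → ℝ≥0∞),
      AEMeasurable u (volume.restrict (tube n)) → AEMeasurable v (volume.restrict (tube n)) →
      (∀ w ∈ tube n, ‖u w‖ₑ ≤ ENNReal.ofReal (dl w ^ (-1 : ℝ)) * v w) →
      wN q μ (3 * R + 1) (n / 2 + μ + R + 1) δ v < ⊤ →
      ∫⁻ z, (ENNReal.ofReal (dl z) * ‖bop (β + n / 2) β u z‖ₑ) ^ q ∂(dV n μ) ≤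
        2 ^ (q - 1) * (ENNReal.ofReal (L ^ ((n : ℝ) / 2)) ^ q * ENNReal.ofReal K +
          C * ENNReal.ofReal (2 * (2 / L) ^ q)) *
            wN q μ (3 * R + 1) (n / 2 + μ + R + 1) δ v := by
  have hn' : (2 : ℝ) ≤ n := by exact_mod_cast hn
  have hq := hpq.symm.pos
  have hq1 := hpq.symm.lt.le
  have hβ0 : 0 ≤ β + n / 2 := by linarith
  obtain ⟨K, hK, HK⟩ := kernel_bounded hn hpq (ez := n / 2) (ew := β - n / 2) (μ := μ + q)
    (t₁ := 0) (t₂ := 0) (by linarith) (by linarith) (by linarith) (by linarith) (by linarith)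
    (by linarith) (by linarith) (by linarith) (by linarith)
  refine ⟨K, hK, fun L δ C hL hδ hbd u v hu hv huv hfin => ?_⟩
  have hpk : ∀ z ∈ tube n, pker (β + n / 2) β (fun w => ‖u w‖ₑ) z < ⊤ := fun z hz =>
    (pker_mono huv z).trans_lt
      (pker_lt_top_of_wN hn hpq hμ hR hβ zero_le_one le_rfl hδ hv hfin hz)
  have hSm : ∀ i : ℤ, MeasurableSet {w : Fin n → ℂ | L * 2 ^ i ≤ dl w} := fun i =>
    measurableSet_le measurable_const continuous_dl.measurable
  have hum : ∀ i : ℤ, AEMeasurable ({w : Fin n → ℂ | L * 2 ^ i ≤ dl w}.indicator u)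
    (volume.restrict (tube n)) := fun i => hu.indicator (hSm i)
  have hbm : ∀ i : ℤ, AEMeasurable (fun z => ENNReal.ofReal (((2 : ℝ) ^ (i + 1)) ^ q) *
      ‖bop (β + n / 2) β ({w | L * 2 ^ i ≤ dl w}.indicator u) z‖ₑ ^ q) (dV n μ) := fun i => by
    refine ((aemeas_dV (aemeas_of_diff (bop_differentiableOn hβ0 (hum i) iE_mem ?_))
      μ).enorm.pow_const q).const_mul _
    refine (pker_mono (fun w _ => ?_) _).trans_lt (hpk _ iE_mem)
    exact enorm_indicator_le_enorm_self u w
  have hnear : ∫⁻ z, (ENNReal.ofReal (dl z) * (ENNReal.ofReal (dl z ^ ((n : ℝ) / 2)) *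
      pker (β + n / 2) (β - n / 2) (fun w => ‖u w‖ₑ) z)) ^ q ∂(dV n μ) ≤
      ENNReal.ofReal K * wN q μ (3 * R + 1) (n / 2 + μ + R + 1) δ v := by
    have h1 := HK _ hu.enorm
    have e1 : (n : ℝ) / 2 + (β - n / 2) + n / 2 = β + n / 2 := by ring
    rw [e1, ← lintegral_dV_shift, ← lintegral_dV_shift] at h1
    refine (le_of_eq ?_).trans (h1.trans (mul_le_mul' le_rfl
      (le_trans ?_ (lintegral_le_wN q μ _ _ δ v))))
    · refine lintegral_congr_dV fun z hz => ?_
      rw [ENNReal.mul_rpow_of_nonneg _ _ hq.le, ENNReal.ofReal_rpow_of_pos (dl_pos hz)]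
      rfl
    · refine lintegral_mono_dV fun z hz => ?_
      rw [← ENNReal.ofReal_rpow_of_pos (dl_pos hz), ← ENNReal.mul_rpow_of_nonneg _ _ hq.le]
      refine ENNReal.rpow_le_rpow ((mul_le_mul' le_rfl (huv z hz)).trans_eq ?_) hq.le
      have h0 := dl_pos hz
      rw [← mul_assoc, ← ENNReal.ofReal_mul h0.le, Real.rpow_neg_one, mul_inv_cancel₀ h0.ne',
        ENNReal.ofReal_one, one_mul]
  have hfar : ∑' i : ℤ, ∫⁻ z, ENNReal.ofReal (((2 : ℝ) ^ (i + 1)) ^ q) *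
      ‖bop (β + n / 2) β ({w | L * 2 ^ i ≤ dl w}.indicator u) z‖ₑ ^ q ∂(dV n μ) ≤
      C * (ENNReal.ofReal (2 * (2 / L) ^ q) * wN q μ (3 * R + 1) (n / 2 + μ + R + 1) δ v) := by
    refine le_trans (ENNReal.tsum_le_tsum fun i => ?_) ((ENNReal.tsum_mul_left).trans_le
      (mul_le_mul' le_rfl (far_sum_le hq1 hL δ hu huv)))
    rw [lintegral_const_mul' _ _ ENNReal.ofReal_ne_top]
    refine (mul_le_mul' le_rfl (hbd _ (hum i) ?_)).trans_eq (by ring)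
    refine (wN_mono hq.le μ _ _ δ fun w hw =>
      indicator_far_le hL (t := 2 ^ i) (by positivity) huv hw).trans_lt ?_
    have e : wN q μ (3 * R + 1) (n / 2 + μ + R + 1) δ
        (fun w => ENNReal.ofReal ((L * 2 ^ i)⁻¹) * v w) = ENNReal.ofReal ((L * 2 ^ i)⁻¹) ^ q *
          wN q μ (3 * R + 1) (n / 2 + μ + R + 1) δ v := by
      rw [wN, wN, ← lintegral_const_mul' _ _
        (ENNReal.rpow_ne_top_of_nonneg hq.le ENNReal.ofReal_ne_top)]
      refine lintegral_congr fun w => ?_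
      rw [ENNReal.mul_rpow_of_nonneg _ _ hq.le]
      ring
    rw [e]
    exact ENNReal.mul_lt_top
      (ENNReal.rpow_lt_top_of_nonneg hq.le ENNReal.ofReal_ne_top) hfin
  have h2q : (2 : ℝ≥0∞) ^ (q - 1) ≠ ⊤ :=
    ENNReal.rpow_ne_top_of_nonneg (by linarith) (by norm_num)
  calc _ ≤ _ := lintegral_mono_dV fun z hz => dyadic_pointwise hq1 hL hu hz (hpk z hz)
    _ = 2 ^ (q - 1) * (ENNReal.ofReal (L ^ ((n : ℝ) / 2)) ^ q * ∫⁻ z, (ENNReal.ofReal (dl z) *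
        (ENNReal.ofReal (dl z ^ ((n : ℝ) / 2)) *
        pker (β + n / 2) (β - n / 2) (fun w => ‖u w‖ₑ) z)) ^ q ∂(dV n μ) +
        ∑' i : ℤ, ∫⁻ z, ENNReal.ofReal (((2 : ℝ) ^ (i + 1)) ^ q) *
        ‖bop (β + n / 2) β ({w | L * 2 ^ i ≤ dl w}.indicator u) z‖ₑ ^ q ∂(dV n μ)) := by
        rw [lintegral_const_mul' _ _ h2q, lintegral_add_left', lintegral_const_mul' _ _
          (ENNReal.rpow_ne_top_of_nonneg hq.le ENNReal.ofReal_ne_top), lintegral_tsum hbm]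
        refine (((continuous_dl.measurable.ennreal_ofReal.mul
          ((continuous_dl.measurable.pow_const _).ennreal_ofReal.mul
          (measurable_pker _ _ hu.enorm))).pow_const q).const_mul _).aemeasurable
    _ ≤ _ := mul_le_mul' le_rfl (add_le_add (mul_le_mul' le_rfl hnear) hfar)
    _ = _ := by ring

lemma bop_step (hn : 2 ≤ n) {p q : ℝ} (hpq : p.HolderConjugate q) {μ R : ℝ}
    (hμ : (n : ℝ) / 2 - 1 < μ) (hR : n + μ + 1 ≤ R) (hH : hardy n q μ) :
    ∃ β₀ : ℝ, ∀ β, β₀ ≤ β → ∃ C₀ : ℝ≥0∞, C₀ ≠ ⊤ ∧ ∀ δ : ℝ≥0∞, δ ≠ 0 → ∀ C : ℝ≥0∞,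
      bopBd n q μ (3 * R + 1) (n / 2 + μ + R + 1) β δ C →
      C ≠ ⊤ →
      bopBd n q μ (3 * R + 1) (n / 2 + μ + R + 1) β δ (C * 2⁻¹ + C₀) := by
  have hn' : (2 : ℝ) ≤ n := by exact_mod_cast hn
  have hq := hpq.symm.pos
  have hq1 := hpq.symm.lt.le
  set A := 3 * R + 1 with hA
  set B := n / 2 + μ + R + 1 with hB
  have hA0 : 0 ≤ A := by linarith
  have hB0 : 0 ≤ B := by linarith
  obtain ⟨k, hk⟩ := exists_nat_gt (B + n / 2)
  obtain ⟨CH, hCH, hHardy⟩ := hH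
  refine ⟨2 * A + n + μ + q + R + 1, fun β hβ => ?_⟩
  have hr0 : 0 ≤ β + n / 2 := by linarith
  have hj : B + n / 2 < (k : ℝ) + 1 := by linarith
  obtain ⟨K, hK, hdy⟩ := dyadic_step hn hpq hμ hR (β := β) (by linarith) (by linarith)
  obtain ⟨Ca, hCa, hwa⟩ := pker_dl_weighted_bounded hn hpq (A := A) (B := B) (β := β)
    (j := k + 1) hμ hA0 hB0 hj (by linarith)
  obtain ⟨Cb, hCb, hwb⟩ := pker_dl_weighted_bounded hn hpq (A := 0) (B := 0) (β := β)
    (j := k + 1) hμ le_rfl le_rfl (by linarith) (by linarith)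
  obtain ⟨c, hc, hconv⟩ := bop_bop hn (s := β + n / 2) (γ := β + k) (by linarith)
    (by have := Nat.cast_nonneg (α := ℝ) k; linarith)
    (by have := Nat.cast_nonneg (α := ℝ) k; linarith) 1
  set κ : ℝ≥0∞ := ‖((boxC n (β + n / 2) 0 1 : ℝ) : ℂ) * c‖ₑ with hκ
  have hκt : κ ≠ ⊤ := enorm_ne_top
  have h2q : (2 : ℝ≥0∞) ^ (q - 1) ≠ ⊤ :=
    ENNReal.rpow_ne_top_of_nonneg (by linarith) (by norm_num)
  set M : ℝ≥0∞ := ENNReal.ofReal CH * κ ^ q * 2 ^ (q - 1) * ENNReal.ofReal (Ca + Cb) with hM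
  have hMt : M ≠ ⊤ := by finiteness
  set D := M.toReal with hD
  have hD0 : 0 ≤ D := ENNReal.toReal_nonneg
  set L : ℝ := 2 * (4 * D + 1) with hL
  have hL0 : 0 < L := by positivity
  have hML : M * ENNReal.ofReal (2 * (2 / L) ^ q) ≤ 2⁻¹ := by
    rw [← ENNReal.ofReal_toReal hMt, ← ENNReal.ofReal_mul hD0,
      show (2⁻¹ : ℝ≥0∞) = ENNReal.ofReal (2⁻¹) by
        rw [ENNReal.ofReal_inv_of_pos two_pos]; norm_num]
    refine ENNReal.ofReal_le_ofReal ?_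
    have h1 : 2 / L = 1 / (4 * D + 1) := by rw [hL]; field_simp
    have h2 : (1 / (4 * D + 1)) ^ q ≤ 1 / (4 * D + 1) :=
      Real.rpow_le_self_of_le_one (by positivity)
        (by rw [div_le_one (by positivity)]; linarith) hq1
    rw [h1]
    calc _ ≤ D * (2 * (1 / (4 * D + 1))) := by gcongr
      _ ≤ _ := by
        rw [mul_one_div, ← mul_div_assoc, div_le_iff₀ (by positivity)]
        linarith
  refine ⟨M * (ENNReal.ofReal (L ^ ((n : ℝ) / 2)) ^ q * ENNReal.ofReal K), by finiteness,
    fun δ hδ C hbd hC f hf hfin => ?_⟩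
  set F : (Fin n → ℂ) → ℝ≥0∞ := fun w => ‖f w‖ₑ with hF
  have hFm : AEMeasurable F (volume.restrict (tube n)) := hf.enorm
  set V : (Fin n → ℂ) → ℝ≥0∞ := fun z => ENNReal.ofReal (dl z ^ ((k : ℝ) + 1)) *
    pker (β + n / 2 + (k + 1)) β F z with hV
  have hVm : AEMeasurable V (volume.restrict (tube n)) :=
    ((continuous_dl.measurable.pow_const _).ennreal_ofReal.mul
      (measurable_pker _ _ hFm)).aemeasurable
  have hpk : ∀ z ∈ tube n, pker (β + n / 2) β F z < ⊤ := fun z hz => by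
    simpa using pker_lt_top_of_wN hn hpq hμ hR (β := β) (by linarith) le_rfl zero_le_one hδ hFm
      hfin hz
  have hVN : wN q μ A B δ V ≤ ENNReal.ofReal (Ca + Cb) * wN q μ A B δ F := by
    rw [wN_eq hq.le μ A B δ hVm, wN_eq hq.le μ A B δ hFm, mul_add]
    have h1 := hwb F hFm
    simp only [Real.rpow_zero, neg_zero, mul_one, ENNReal.ofReal_one, one_mul] at h1
    refine add_le_add (h1.trans (mul_le_mul' (ENNReal.ofReal_le_ofReal (by linarith)) le_rfl)) ?_
    refine (mul_le_mul' le_rfl (hwa F hFm)).trans ?_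
    rw [mul_left_comm]
    exact mul_le_mul' (ENNReal.ofReal_le_ofReal (by linarith)) le_rfl
  have hVfin : wN q μ A B δ V < ⊤ :=
    hVN.trans_lt (ENNReal.mul_lt_top ENNReal.ofReal_lt_top hfin)
  have hrk : 0 ≤ β + n / 2 + ((k : ℝ) + 1) := by positivity
  have hpk1 : pker (β + n / 2 + ((k : ℝ) + 1)) β F (iE n) < ⊤ :=
    pker_add_lt_top (by positivity) iE_mem (hpk _ iE_mem)
  set g := bop (β + n / 2 + ((k : ℝ) + 1)) β f with hg
  have hgm : AEMeasurable g (volume.restrict (tube n)) :=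
    aemeas_of_diff (bop_differentiableOn hrk hf iE_mem hpk1)
  set u : (Fin n → ℂ) → ℂ := fun w => ((dl w ^ (k : ℝ) : ℝ) : ℂ) * g w with hu
  have hum : AEMeasurable u (volume.restrict (tube n)) :=
    (Complex.measurable_ofReal.comp (continuous_dl.measurable.pow_const _)).aemeasurable.mul hgm
  have huV : ∀ w ∈ tube n, ‖u w‖ₑ ≤ ENNReal.ofReal (dl w ^ (-1 : ℝ)) * V w := by
    intro w hw
    have h0 := dl_pos hw
    rw [hu, hV]
    simp only
    rw [enorm_mul, ← mul_assoc, ← ENNReal.ofReal_mul (by positivity), ← Real.rpow_add h0,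
      ← ofReal_norm, Complex.norm_real, Real.norm_of_nonneg (by positivity),
      show (-1 : ℝ) + (k + 1) = k by ring]
    exact mul_le_mul' le_rfl (enorm_bop_le _ _ _ _)
  have hbox : ∀ z ∈ tube n, BoxOp (bop (β + n / 2) β f) z =
      ((boxC n (β + n / 2) 0 1 : ℝ) : ℂ) * c * bop (β + n / 2) β u z := by
    intro z hz
    have h1 := BoxOp_iter_bop hn hr0 hf iE_mem (hpk _ iE_mem) 1 hz
    simp only [Function.iterate_one] at h1
    rw [h1, mul_assoc]
    congr 1
    have e1 : β + (k : ℝ) + n / 2 + ((1 : ℕ) : ℝ) = β + n / 2 + ((k : ℝ) + 1) := by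
      push_cast; ring
    rw [hconv β f hf z hz, bop_shift, e1]
    rw [e1]
    refine lt_of_le_of_lt (le_of_eq ?_) (pker_lt_top_of_wN hn hpq hμ hR (β := β) (by linarith)
      zero_le_one le_rfl hδ hVm hVfin hz)
    rw [pker, ← lintegral_dV_shift, pker]
    refine lintegral_congr_dV fun w hw => ?_
    have h0 := dl_pos hw
    have e2 : ENNReal.ofReal (dl w ^ (k : ℝ)) =
        ENNReal.ofReal (dl w ^ (-1 : ℝ)) * ENNReal.ofReal (dl w ^ ((k : ℝ) + 1)) := by
      rw [← ENNReal.ofReal_mul (by positivity), ← Real.rpow_add h0,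
        show (-1 : ℝ) + (k + 1) = k by ring]
    rw [e2, hV]
    ring
  have hmem : memA n q μ (bop (β + n / 2) β f) := by
    refine ⟨bop_differentiableOn hr0 hf iE_mem (hpk _ iE_mem), ?_⟩
    rw [lpInt_eq hq.le]
    exact (hbd f hf hfin).trans_lt (ENNReal.mul_lt_top hC.lt_top hfin)
  have h1 := hHardy _ hmem
  rw [lpInt_eq hq.le, lpInt_eq hq.le] at h1
  have h2 := hdy L δ C hL0 hδ hbd u V hum hVm huV hVfin
  have h3 : ∫⁻ z, ‖((lor (imP z) : ℝ) : ℂ) * BoxOp (bop (β + n / 2) β f) z‖ₑ ^ q ∂(dV n μ) =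
      κ ^ q * ∫⁻ z, (ENNReal.ofReal (dl z) * ‖bop (β + n / 2) β u z‖ₑ) ^ q ∂(dV n μ) := by
    rw [← lintegral_const_mul' _ _ (ENNReal.rpow_ne_top_of_nonneg hq.le hκt)]
    refine lintegral_congr_dV fun z hz => ?_
    rw [hbox z hz, ← ENNReal.mul_rpow_of_nonneg _ _ hq.le, enorm_mul, enorm_mul (_ * c), ← hκ,
      ← ofReal_norm ((lor (imP z) : ℝ) : ℂ), Complex.norm_real,
      Real.norm_of_nonneg (show 0 ≤ lor (imP z) from (dl_pos hz).le)]
    congr 1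
    exact mul_left_comm _ _ _
  rw [h3] at h1
  calc _ ≤ _ := h1
    _ ≤ ENNReal.ofReal CH * (κ ^ q * (2 ^ (q - 1) * (ENNReal.ofReal (L ^ ((n : ℝ) / 2)) ^ q *
        ENNReal.ofReal K + C * ENNReal.ofReal (2 * (2 / L) ^ q)) *
          (ENNReal.ofReal (Ca + Cb) * wN q μ A B δ F))) :=
        mul_le_mul' le_rfl (mul_le_mul' le_rfl (h2.trans (mul_le_mul' le_rfl hVN)))
    _ = (C * (M * ENNReal.ofReal (2 * (2 / L) ^ q)) +
        M * (ENNReal.ofReal (L ^ ((n : ℝ) / 2)) ^ q * ENNReal.ofReal K)) * wN q μ A B δ F := by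
        rw [hM]; ring
    _ ≤ _ := mul_le_mul' (add_le_add (mul_le_mul' le_rfl hML) le_rfl) le_rfl

end HardyStep

section BergmanBounded

variable {n : ℕ} [NeZero n]

lemma tendsto_inv_two_pow_mul {a : ℝ≥0∞} (ha : a ≠ ⊤) :
    Filter.Tendsto (fun k : ℕ => a * 2⁻¹ ^ k) Filter.atTop (nhds 0) := by
  have h := ENNReal.Tendsto.const_mul (a := a)
    (ENNReal.tendsto_pow_atTop_nhds_zero_of_lt_one (r := 2⁻¹) (by norm_num)) (Or.inr ha)
  simpa using h

lemma bop_bounded_of_weighted (hn : 2 ≤ n) {p q : ℝ} (hpq : p.HolderConjugate q) {μ R : ℝ}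
    (hμ : (n : ℝ) / 2 - 1 < μ) (hR : n + μ + 1 ≤ R) (hH : hardy n q μ) :
    ∃ β₀ : ℝ, ∀ β, β₀ ≤ β → ∃ C : ℝ≥0∞, C ≠ ⊤ ∧ ∀ f : (Fin n → ℂ) → ℂ,
      AEMeasurable f (volume.restrict (tube n)) →
      ∫⁻ w, ‖f w‖ₑ ^ q ∂(dV n μ) < ⊤ →
      ∫⁻ w, (omW (3 * R + 1) (n / 2 + μ + R + 1) w * ‖f w‖ₑ) ^ q ∂(dV n μ) < ⊤ →
      ∫⁻ z, ‖bop (β + n / 2) β f z‖ₑ ^ q ∂(dV n μ) ≤ C * ∫⁻ w, ‖f w‖ₑ ^ q ∂(dV n μ) := by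
  have hn' : (2 : ℝ) ≤ n := by exact_mod_cast hn
  have hq := hpq.symm.pos
  obtain ⟨β₁, H⟩ := bop_step hn hpq hμ hR hH
  obtain ⟨C₁, -, Hw⟩ := pker_weighted_bounded hn hpq hμ hR
  refine ⟨max β₁ R, fun β hβ => ?_⟩
  obtain ⟨C₀, hC₀, hstep⟩ := H β ((le_max_left _ _).trans hβ)
  have hβR : R ≤ β + n / 2 := by linarith [(le_max_right β₁ R).trans hβ]
  set A := 3 * R + 1
  set B := n / 2 + μ + R + 1
  have hbase : ∀ δ : ℝ≥0∞, δ ≠ 0 → δ ≠ ⊤ → bopBd n q μ A B β δ (ENNReal.ofReal C₁ * δ⁻¹) := by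
    intro δ hδ hδt f hf _
    have h1 := Hw β 0 hβR le_rfl zero_le_one (fun w => ‖f w‖ₑ) hf.enorm
    simp only [neg_zero, Real.rpow_zero, ENNReal.ofReal_one, one_mul] at h1
    refine (lintegral_mono fun z => ENNReal.rpow_le_rpow (enorm_bop_le _ _ _ _) hq.le).trans
      (h1.trans ?_)
    rw [mul_assoc]
    refine mul_le_mul' le_rfl ?_
    rw [wN_eq hq.le μ A B δ hf.enorm, mul_add, ← mul_assoc δ⁻¹ δ, ENNReal.inv_mul_cancel hδ hδt,
      one_mul]
    exact le_add_self
  have hiter : ∀ δ : ℝ≥0∞, δ ≠ 0 → δ ≠ ⊤ → ∀ k : ℕ,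
      bopBd n q μ A B β δ (ENNReal.ofReal C₁ * δ⁻¹ * 2⁻¹ ^ k + 2 * C₀) := by
    intro δ hδ hδt k
    have hδi : δ⁻¹ ≠ ⊤ := ENNReal.inv_ne_top.2 hδ
    induction k with
    | zero =>
      intro f hf hfin
      refine (hbase δ hδ hδt f hf hfin).trans (mul_le_mul' ?_ le_rfl)
      simp
    | succ k ih =>
      have h2 : (2 : ℝ≥0∞) * 2⁻¹ = 1 := ENNReal.mul_inv_cancel (by norm_num) (by norm_num)
      have := hstep δ hδ _ ih (by finiteness)
      convert this using 1
      rw [add_mul, mul_right_comm 2 C₀, h2, pow_succ]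
      ring
  have hlim : ∀ δ : ℝ≥0∞, δ ≠ 0 → δ ≠ ⊤ → bopBd n q μ A B β δ (2 * C₀) := by
    intro δ hδ hδt f hf hfin
    have hδi : δ⁻¹ ≠ ⊤ := ENNReal.inv_ne_top.2 hδ
    have h1 := ENNReal.Tendsto.mul_const (b := wN q μ A B δ fun w => ‖f w‖ₑ)
      ((tendsto_inv_two_pow_mul (a := ENNReal.ofReal C₁ * δ⁻¹) (by finiteness)).add_const (2 * C₀))
      (Or.inr hfin.ne)
    rw [zero_add] at h1
    exact ge_of_tendsto' h1 fun k => hiter δ hδ hδt k f hf hfin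
  refine ⟨2 * C₀, by finiteness, fun f hf h1 h2 => ?_⟩
  have h3 := ENNReal.Tendsto.const_mul (a := 2 * C₀)
    ((tendsto_inv_two_pow_mul h2.ne).const_add (∫⁻ w, ‖f w‖ₑ ^ q ∂(dV n μ)))
    (Or.inr (by finiteness))
  rw [add_zero] at h3
  refine ge_of_tendsto' h3 fun k => ?_
  have h4 := wN_eq hq.le μ A B (2⁻¹ ^ k) hf.enorm
  rw [mul_comm (2⁻¹ ^ k)] at h4
  rw [← h4]
  refine hlim _ (by simp) (by finiteness) f hf ?_
  rw [h4]
  finiteness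

end BergmanBounded

section KernelNorm

variable {n : ℕ} [NeZero n]

lemma pker_iE_eq (r β μ : ℝ) (f : (Fin n → ℂ) → ℝ≥0∞) :
    pker r β f (iE n) = ∫⁻ w, omW (-r) (μ - β) w * f w ∂(dV n μ) := by
  rw [pker, show β = μ + (β - μ) by ring, ← lintegral_dV_shift]
  refine lintegral_congr_dV fun w hw => ?_
  have h1 := kE_pos hw
  have h2 := dl_pos hw
  rw [norm_kb_comm, ← mul_assoc, ← ENNReal.ofReal_mul (by positivity), omW, kE, mul_comm (_ ^ _)]
  congr 4
  ring

lemma pker_iE_holder {p q : ℝ} (hpq : p.HolderConjugate q) (r β μ : ℝ)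
    {f : (Fin n → ℂ) → ℝ≥0∞} (hf : AEMeasurable f (volume.restrict (tube n))) :
    pker r β f (iE n) ≤ (∫⁻ w, omW (-r) (μ - β) w ^ p ∂(dV n μ)) ^ (1 / p) *
      (∫⁻ w, f w ^ q ∂(dV n μ)) ^ (1 / q) := by
  rw [pker_iE_eq r β μ]
  exact ENNReal.lintegral_mul_le_Lp_mul_Lq (dV n μ) hpq (measurable_omW _ _).aemeasurable
    (aemeas_dV hf μ)

lemma pker_lt_top_of_norm {p q : ℝ} (hpq : p.HolderConjugate q) {r β μ : ℝ} (hr : 0 ≤ r)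
    (h : ∫⁻ w, omW (-r) (μ - β) w ^ p ∂(dV n μ) < ⊤)
    {f : (Fin n → ℂ) → ℝ≥0∞} (hf : AEMeasurable f (volume.restrict (tube n)))
    (hfq : ∫⁻ w, f w ^ q ∂(dV n μ) < ⊤) {z : Fin n → ℂ} (hz : z ∈ tube n) :
    pker r β f z < ⊤ := by
  refine pker_lt_top_of hr iE_mem hz ((pker_iE_holder hpq r β μ hf).trans_lt ?_)
  have := hpq.pos
  have := hpq.symm.pos
  exact ENNReal.mul_lt_top (ENNReal.rpow_lt_top_of_nonneg (by positivity) h.ne)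
    (ENNReal.rpow_lt_top_of_nonneg (by positivity) hfq.ne)

lemma omW_zero_norm (hn : 2 ≤ n) {p μ r : ℝ} (hμ : (n : ℝ) / 2 - 1 < μ)
    (h1 : (n : ℝ) < r * p) (h2 : μ < r * p - n + 1) :
    ∫⁻ w : Fin n → ℂ, omW (-r) 0 w ^ p ∂(dV n μ) < ⊤ := by
  refine (le_of_eq ?_).trans_lt (lintegral_kE_lt_top hn h1 hμ h2)
  refine lintegral_congr_dV fun w hw => ?_
  have h1 := kE_pos hw
  rw [omW, neg_zero, Real.rpow_zero, mul_one, ENNReal.ofReal_rpow_of_pos (by positivity),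
    ← Real.rpow_mul h1.le, neg_mul]

lemma eval_bound (hn : 2 ≤ n) {p q : ℝ} (hpq : p.HolderConjugate q) {μ : ℝ}
    (hμ : (n : ℝ) / 2 - 1 < μ) : ∃ C : ℝ≥0∞, C ≠ ⊤ ∧ ∀ h : (Fin n → ℂ) → ℂ,
      DifferentiableOn ℂ h (tube n) → ∫⁻ w, ‖h w‖ₑ ^ q ∂(dV n μ) < ⊤ →
      ‖h (iE n)‖ₑ ≤ C * (∫⁻ w, ‖h w‖ₑ ^ q ∂(dV n μ)) ^ (1 / q) := by
  have hn' : (2 : ℝ) ≤ n := by exact_mod_cast hn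
  have hp := hpq.pos
  have hp1 := hpq.lt
  have hq := hpq.symm.pos
  have hr : 0 < μ + n / 2 + n := by linarith
  have hrp : μ + n / 2 + n ≤ (μ + n / 2 + n) * p := le_mul_of_one_le_right hr.le hp1.le
  have hfin := omW_zero_norm hn (r := μ + n / 2 + n) (p := p) hμ (by linarith) (by linarith)
  set c : ℂ := rfC n μ * Ks n (iE n) (iE n) with hc
  have hc0 : c ≠ 0 := mul_ne_zero (rfC_ne_zero hn hμ)
    (by rw [← norm_ne_zero_iff, norm_Ks, kb_iE_iE]; exact (Real.rpow_pos_of_pos (by simp) _).ne')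
  have hce : ‖c‖ₑ ≠ 0 := by simpa using hc0
  refine ⟨‖c‖ₑ⁻¹ * (∫⁻ w : Fin n → ℂ, omW (-(μ + n / 2 + n)) 0 w ^ p ∂(dV n μ)) ^ (1 / p), ?_,
    fun h hh hX => ?_⟩
  · refine ENNReal.mul_ne_top (ENNReal.inv_ne_top.2 hce) (ENNReal.rpow_ne_top_of_nonneg
      (by positivity) hfin.ne)
  have hm := aemeas_of_diff hh
  set F : (Fin n → ℂ) → ℂ := fun w => h w * Ks n w (iE n) with hF
  have hFd : DifferentiableOn ℂ F (tube n) := hh.mul (Ks_differentiableOn n iE_mem)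
  have e1 : pker (μ + n / 2) μ (fun w => ‖F w‖ₑ) (iE n) =
      pker (μ + n / 2 + n) μ (fun w => ‖h w‖ₑ) (iE n) := by
    refine lintegral_congr_dV fun w hw => ?_
    have h1 : 0 < ‖kb w (iE n)‖ := kE_pos hw
    simp only [hF]
    rw [enorm_mul, enorm_Ks, norm_kb_comm (iE n), neg_add (μ + n / 2) (n : ℝ),
      Real.rpow_add h1, ENNReal.ofReal_mul (by positivity)]
    ring
  have h1 := pker_iE_holder hpq (μ + n / 2 + n) μ μ hm.enorm
  rw [sub_self] at h1
  have h2 : pker (μ + n / 2) μ (fun w => ‖F w‖ₑ) (iE n) < ⊤ := by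
    rw [e1]
    have := pker_lt_top_of_norm hpq (r := μ + n / 2 + n) (β := μ) (μ := μ) hr.le
      (by rwa [sub_self]) hm.enorm hX iE_mem
    exact this
  have h3 := reproducing μ hFd iE_mem
    ((integrable_Ks_iff (aesm_dV (aemeas_of_diff hFd) μ) (iE n)).2 h2)
  have h4 : ‖c‖ₑ * ‖h (iE n)‖ₑ ≤ pker (μ + n / 2) μ (fun w => ‖F w‖ₑ) (iE n) := by
    rw [← enorm_mul, hc, mul_assoc, mul_comm (Ks _ _ _), ← h3]
    exact enorm_integral_Ks_le _ _ _ _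
  rw [e1] at h4
  rw [mul_assoc, ← ENNReal.div_eq_inv_mul, ENNReal.le_div_iff_mul_le (Or.inl hce)
    (Or.inl enorm_ne_top), mul_comm]
  exact h4.trans h1

/-- An exhaustion of the tube domain. -/
def trS (n : ℕ) [NeZero n] (N : ℕ) : Set (Fin n → ℂ) :=
  {w | kE w ≤ N + 1 ∧ ((N : ℝ) + 1)⁻¹ ≤ dl w}

lemma measurableSet_trS (N : ℕ) : MeasurableSet (trS n N) :=
  (measurableSet_le continuous_kE.measurable measurable_const).inter
    (measurableSet_le measurable_const continuous_dl.measurable)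

lemma trS_mono : Monotone (trS n) := by
  intro N M hNM w hw
  have h : (N : ℝ) + 1 ≤ M + 1 := by simpa using hNM
  exact ⟨hw.1.trans h, (inv_anti₀ (by positivity) h).trans hw.2⟩

lemma eventually_mem_trS {w : Fin n → ℂ} (hw : w ∈ tube n) :
    ∀ᶠ N in Filter.atTop, w ∈ trS n N := by
  have h0 := dl_pos hw
  obtain ⟨N, hN⟩ := exists_nat_ge (max (kE w) (dl w)⁻¹)
  filter_upwards [Filter.eventually_ge_atTop N] with M hM
  refine trS_mono hM ⟨by linarith [(le_max_left _ _).trans hN], ?_⟩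
  have h1 : (dl w)⁻¹ ≤ N + 1 := by linarith [(le_max_right _ _).trans hN]
  rw [inv_le_comm₀ (by positivity) h0]
  exact h1

lemma omW_le_of_mem_trS {A B : ℝ} (hA : 0 ≤ A) (hB : 0 ≤ B) {N : ℕ} {w : Fin n → ℂ}
    (hw : w ∈ tube n) (h : w ∈ trS n N) :
    omW A B w ≤ ENNReal.ofReal (((N : ℝ) + 1) ^ A * ((N : ℝ) + 1) ^ B) := by
  have h1 := kE_pos hw
  have h2 := dl_pos hw
  refine ENNReal.ofReal_le_ofReal ?_
  refine mul_le_mul (Real.rpow_le_rpow h1.le h.1 hA) ?_ (by positivity) (by positivity)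
  rw [Real.rpow_neg h2.le, ← Real.inv_rpow h2.le]
  refine Real.rpow_le_rpow (by positivity) ?_ hB
  rw [inv_le_comm₀ h2 (by positivity)]
  exact h.2

lemma omW_norm_trS_lt_top (hn : 2 ≤ n) {p μ β : ℝ} (hp : 1 ≤ p) (hμ : (n : ℝ) / 2 - 1 < μ)
    (hβ : μ ≤ β) (N : ℕ) :
    ∫⁻ w in trS n N, omW (-(β + n / 2)) (μ - β) w ^ p ∂(dV n μ) < ⊤ := by
  have hn' : (2 : ℝ) ≤ n := by exact_mod_cast hn
  have ha : (n : ℝ) / 2 + μ ≤ (n / 2 + μ) * p := le_mul_of_one_le_right (by linarith) hp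
  have h1 := lintegral_kE_lt_top hn (a := (n / 2 + μ) * p + n) (b := μ) (by linarith) hμ
    (by linarith)
  rw [← lintegral_indicator (measurableSet_trS N)]
  refine lt_of_le_of_lt (lintegral_mono_dV
    (g := fun w => ENNReal.ofReal (((N : ℝ) + 1) ^ (n : ℝ)) *
      ENNReal.ofReal (kE w ^ (-((n / 2 + μ) * p + n)))) fun w hw => ?_) ?_
  · by_cases h : w ∈ trS n N
    · rw [indicator_of_mem h]
      have h2 := kE_pos hw
      have h3 := dl_pos hw
      rw [omW, ENNReal.ofReal_rpow_of_pos (by positivity), ← ENNReal.ofReal_mul (by positivity)]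
      refine ENNReal.ofReal_le_ofReal ?_
      calc (kE w ^ (-(β + n / 2)) * dl w ^ (-(μ - β))) ^ p
          ≤ (kE w ^ (-(β + n / 2)) * kE w ^ (-(μ - β))) ^ p := by
            refine Real.rpow_le_rpow (by positivity) ?_ (by linarith)
            exact mul_le_mul_of_nonneg_left (Real.rpow_le_rpow h3.le (dl_le_kE hw) (by linarith))
              (by positivity)
        _ = kE w ^ (n : ℝ) * kE w ^ (-((n / 2 + μ) * p + n)) := by
            rw [← Real.rpow_add h2, ← Real.rpow_mul h2.le, ← Real.rpow_add h2]
            congr 1; ring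
        _ ≤ _ := mul_le_mul_of_nonneg_right (Real.rpow_le_rpow h2.le h.1 (by linarith))
            (by positivity)
    · rw [indicator_of_notMem h]; exact zero_le
  · rw [lintegral_const_mul' _ _ ENNReal.ofReal_ne_top]
    exact ENNReal.mul_lt_top ENNReal.ofReal_lt_top h1

lemma le_rpow_of_le_mul_rpow {p q : ℝ} (hpq : p.HolderConjugate q) {a C : ℝ≥0∞} (ha : a ≠ ⊤)
    (h : a ≤ C * a ^ (1 / q)) : a ≤ C ^ p := by
  have hp := hpq.pos
  have hq := hpq.symm.pos
  rcases eq_or_ne a 0 with rfl | h0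
  · exact zero_le
  have h1 : a = a ^ (1 / p) * a ^ (1 / q) := by
    rw [← ENNReal.rpow_add _ _ h0 ha, one_div, one_div, hpq.inv_add_inv_eq_one, ENNReal.rpow_one]
  have h2 : a ^ (1 / q) ≠ 0 := by simp [h0, ha]
  have h3 : a ^ (1 / q) ≠ ⊤ := ENNReal.rpow_ne_top_of_nonneg (by positivity) ha
  rw [h1] at h
  nth_rw 2 [← h1] at h
  rw [ENNReal.mul_le_mul_iff_left h2 h3] at h
  calc a = (a ^ (1 / p)) ^ p := by
        rw [← ENNReal.rpow_mul, one_div_mul_cancel hp.ne', ENNReal.rpow_one]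
    _ ≤ C ^ p := ENNReal.rpow_le_rpow h hp.le

end KernelNorm

section BergmanUnweighted

variable {n : ℕ} [NeZero n]

lemma enorm_bop_eq_pker {s b : ℝ} {f : (Fin n → ℂ) → ℂ}
    (hf : AEMeasurable f (volume.restrict (tube n))) {z : Fin n → ℂ}
    (h : pker s b (fun w => ‖f w‖ₑ) z < ⊤)
    (hp : ∀ w ∈ tube n, Ks s z w * f w = ((‖Ks s z w * f w‖ : ℝ) : ℂ)) :
    ‖bop s b f z‖ₑ = pker s b (fun w => ‖f w‖ₑ) z := by
  have hm : AEStronglyMeasurable (fun w => Ks s z w * f w) (dV n b) :=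
    (measurable_Ks_right s z).aestronglyMeasurable.mul (aesm_dV hf b)
  have h1 : bop s b f z = ((∫ w, ‖Ks s z w * f w‖ ∂(dV n b) : ℝ) : ℂ) := by
    rw [bop, ← integral_complex_ofReal]
    exact integral_congr_ae (by filter_upwards [ae_dV] with w hw using hp w hw)
  have h2 : ∫⁻ w, ‖Ks s z w * f w‖ₑ ∂(dV n b) = pker s b (fun w => ‖f w‖ₑ) z := by
    simp only [enorm_mul, enorm_Ks, pker]
  rw [h1, integral_norm_eq_lintegral_enorm hm, h2, ← ofReal_norm, Complex.norm_real,
    Real.norm_of_nonneg ENNReal.toReal_nonneg, ENNReal.ofReal_toReal h.ne]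

lemma kernel_norm_trS_le (hn : 2 ≤ n) {p q : ℝ} (hpq : p.HolderConjugate q) {μ A B β : ℝ}
    (hμ : (n : ℝ) / 2 - 1 < μ) (hA : 0 ≤ A) (hB : 0 ≤ B) (hβ : μ ≤ β) {C D : ℝ≥0∞}
    (hD : ∀ h : (Fin n → ℂ) → ℂ, DifferentiableOn ℂ h (tube n) →
      ∫⁻ w, ‖h w‖ₑ ^ q ∂(dV n μ) < ⊤ →
      ‖h (iE n)‖ₑ ≤ D * (∫⁻ w, ‖h w‖ₑ ^ q ∂(dV n μ)) ^ (1 / q)) (hC : C ≠ ⊤)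
    (H : ∀ f : (Fin n → ℂ) → ℂ, AEMeasurable f (volume.restrict (tube n)) →
      ∫⁻ w, ‖f w‖ₑ ^ q ∂(dV n μ) < ⊤ → ∫⁻ w, (omW A B w * ‖f w‖ₑ) ^ q ∂(dV n μ) < ⊤ →
      ∫⁻ z, ‖bop (β + n / 2) β f z‖ₑ ^ q ∂(dV n μ) ≤ C * ∫⁻ w, ‖f w‖ₑ ^ q ∂(dV n μ)) (N : ℕ) :
    ∫⁻ w in trS n N, omW (-(β + n / 2)) (μ - β) w ^ p ∂(dV n μ) ≤ (D * C ^ (1 / q)) ^ p := by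
  have hn' : (2 : ℝ) ≤ n := by exact_mod_cast hn
  have hp := hpq.pos
  have hp1 := hpq.lt
  have hq := hpq.symm.pos
  set r := β + n / 2 with hr
  have hr0 : 0 ≤ r := by linarith
  set g : (Fin n → ℂ) → ℝ≥0∞ := omW (-r) (μ - β) with hg
  set a := ∫⁻ w in trS n N, g w ^ p ∂(dV n μ) with ha
  have hat : a < ⊤ := omW_norm_trS_lt_top hn hp1.le hμ hβ N
  set t : (Fin n → ℂ) → ℝ := fun w => kE w ^ r * (kE w ^ (-r) * dl w ^ (-(μ - β))) ^ (p - 1)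
    with ht
  set f : (Fin n → ℂ) → ℂ := (trS n N).indicator
    (fun w => ((t w : ℝ) : ℂ) * (starRingEnd ℂ) (Ks r (iE n) w)) with hf
  have htm : Measurable t := (continuous_kE.measurable.pow_const _).mul
    (((continuous_kE.measurable.pow_const _).mul (continuous_dl.measurable.pow_const _)).pow_const _)
  have hfm : AEMeasurable f (volume.restrict (tube n)) :=
    (((Complex.measurable_ofReal.comp htm).mul
      (Complex.continuous_conj.measurable.comp (measurable_Ks_right r (iE n)))).indicator
      (measurableSet_trS N)).aemeasurable
  have e1 : ∀ w ∈ tube n, ‖f w‖ₑ = (trS n N).indicator (fun w => g w ^ (p - 1)) w := by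
    intro w hw
    by_cases h : w ∈ trS n N
    · have h1 := kE_pos hw
      have h2 := dl_pos hw
      rw [hf, indicator_of_mem h, indicator_of_mem h, hg, omW,
        ENNReal.ofReal_rpow_of_pos (by positivity), ← ofReal_norm, norm_mul, RCLike.norm_conj,
        norm_Ks, norm_kb_comm, Complex.norm_real, Real.norm_of_nonneg (by positivity)]
      congr 1
      change kE w ^ r * _ * kE w ^ (-r) = _
      rw [mul_right_comm, ← Real.rpow_add h1, add_neg_cancel, Real.rpow_zero, one_mul]
    · rw [hf, indicator_of_notMem h, indicator_of_notMem h, enorm_zero]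
  have e2 : ∫⁻ w, ‖f w‖ₑ ^ q ∂(dV n μ) = a := by
    rw [ha, ← lintegral_indicator (measurableSet_trS N)]
    refine lintegral_congr_dV fun w hw => ?_
    rw [e1 w hw]
    by_cases h : w ∈ trS n N
    · rw [indicator_of_mem h, indicator_of_mem h, ← ENNReal.rpow_mul, hpq.sub_one_mul_conj]
    · rw [indicator_of_notMem h, indicator_of_notMem h, ENNReal.zero_rpow_of_pos hq]
  have e3 : pker r β (fun w => ‖f w‖ₑ) (iE n) = a := by
    rw [pker_iE_eq r β μ, ha, ← lintegral_indicator (measurableSet_trS N)]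
    refine lintegral_congr_dV fun w hw => ?_
    rw [e1 w hw]
    by_cases h : w ∈ trS n N
    · rw [indicator_of_mem h, indicator_of_mem h, ← hg]
      nth_rw 1 [← ENNReal.rpow_one (g w)]
      rw [← ENNReal.rpow_add_of_nonneg _ _ zero_le_one (by linarith), add_sub_cancel]
    · rw [indicator_of_notMem h, indicator_of_notMem h, mul_zero]
  have e4 : ‖bop r β f (iE n)‖ₑ = a := by
    rw [← e3]
    refine enorm_bop_eq_pker hfm (e3 ▸ hat) fun w hw => ?_
    by_cases h : w ∈ trS n N
    · have h1 := kE_pos hw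
      have h2 := dl_pos hw
      have h3 : 0 ≤ t w := by positivity
      rw [hf, indicator_of_mem h, mul_left_comm, Complex.mul_conj, ← Complex.ofReal_mul,
        Complex.norm_real, Real.norm_of_nonneg (mul_nonneg h3 (Complex.normSq_nonneg _))]
    · rw [hf, indicator_of_notMem h]; simp
  have e5 : ∫⁻ w, (omW A B w * ‖f w‖ₑ) ^ q ∂(dV n μ) < ⊤ := by
    set M := ENNReal.ofReal (((N : ℝ) + 1) ^ A * ((N : ℝ) + 1) ^ B) with hM
    have hMq : M ^ q ≠ ⊤ := ENNReal.rpow_ne_top_of_nonneg hq.le ENNReal.ofReal_ne_top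
    refine lt_of_le_of_lt (lintegral_mono_dV (g := fun w => M ^ q * ‖f w‖ₑ ^ q)
      fun w hw => ?_) ?_
    · rw [← ENNReal.mul_rpow_of_nonneg _ _ hq.le]
      refine ENNReal.rpow_le_rpow ?_ hq.le
      by_cases h : w ∈ trS n N
      · exact mul_le_mul' (omW_le_of_mem_trS hA hB hw h) le_rfl
      · rw [hf, indicator_of_notMem h]; simp
    · rw [lintegral_const_mul' _ _ hMq, e2]
      exact ENNReal.mul_lt_top hMq.lt_top hat
  have h1 := H f hfm (e2 ▸ hat) e5
  rw [e2] at h1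
  have h2 := hD _ (bop_differentiableOn (b := β) hr0 hfm iE_mem (e3 ▸ hat))
    (h1.trans_lt (ENNReal.mul_lt_top hC.lt_top hat))
  rw [e4] at h2
  refine le_rpow_of_le_mul_rpow hpq hat.ne (h2.trans ?_)
  rw [mul_assoc, ← ENNReal.mul_rpow_of_nonneg _ _ (by positivity)]
  exact mul_le_mul' le_rfl (ENNReal.rpow_le_rpow h1 (by positivity))

lemma kernel_norm_lt_top (hn : 2 ≤ n) {p q : ℝ} (hpq : p.HolderConjugate q) {μ A B β : ℝ}
    (hμ : (n : ℝ) / 2 - 1 < μ) (hA : 0 ≤ A) (hB : 0 ≤ B) (hβ : μ ≤ β) {C : ℝ≥0∞} (hC : C ≠ ⊤)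
    (H : ∀ f : (Fin n → ℂ) → ℂ, AEMeasurable f (volume.restrict (tube n)) →
      ∫⁻ w, ‖f w‖ₑ ^ q ∂(dV n μ) < ⊤ → ∫⁻ w, (omW A B w * ‖f w‖ₑ) ^ q ∂(dV n μ) < ⊤ →
      ∫⁻ z, ‖bop (β + n / 2) β f z‖ₑ ^ q ∂(dV n μ) ≤ C * ∫⁻ w, ‖f w‖ₑ ^ q ∂(dV n μ)) :
    ∫⁻ w, omW (-(β + n / 2)) (μ - β) w ^ p ∂(dV n μ) < ⊤ := by
  have hp := hpq.pos
  have hq := hpq.symm.pos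
  obtain ⟨D, hDt, hD⟩ := eval_bound hn hpq hμ
  have h1 : (dV n μ).restrict (⋃ N, trS n N) = dV n μ := by
    refine Measure.restrict_eq_self_of_ae_mem ?_
    filter_upwards [ae_dV] with w hw
    exact mem_iUnion.2 (eventually_mem_trS hw).exists
  rw [← h1, setLIntegral_iUnion_of_directed _ trS_mono.directed_le]
  refine lt_of_le_of_lt (iSup_le fun N => kernel_norm_trS_le hn hpq hμ hA hB hβ hD hC H N) ?_
  exact ENNReal.rpow_lt_top_of_nonneg hp.le (ENNReal.mul_ne_top hDt
    (ENNReal.rpow_ne_top_of_nonneg (by positivity) hC))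

/-- Under the Hardy inequality for `(q, μ)` the Bergman operators of large order are bounded on
`L^q_μ`, and their kernels belong to the dual space. -/
theorem bergman_bounded (hn : 2 ≤ n) {p q : ℝ} (hpq : p.HolderConjugate q) {μ : ℝ}
    (hμ : (n : ℝ) / 2 - 1 < μ) (hH : hardy n q μ) :
    ∃ β₀ : ℝ, μ ≤ β₀ ∧ ∀ β, β₀ ≤ β → ∫⁻ w, omW (-(β + n / 2)) (μ - β) w ^ p ∂(dV n μ) < ⊤ ∧
      ∃ C : ℝ≥0∞, C ≠ ⊤ ∧ ∀ f : (Fin n → ℂ) → ℂ, AEMeasurable f (volume.restrict (tube n)) →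
        ∫⁻ w, ‖f w‖ₑ ^ q ∂(dV n μ) < ⊤ →
        ∫⁻ z, ‖bop (β + n / 2) β f z‖ₑ ^ q ∂(dV n μ) ≤ C * ∫⁻ w, ‖f w‖ₑ ^ q ∂(dV n μ) := by
  have hn' : (2 : ℝ) ≤ n := by exact_mod_cast hn
  have hq := hpq.symm.pos
  set R := n + μ + 1 with hR
  have hA : 0 ≤ 3 * R + 1 := by linarith
  have hB : 0 ≤ n / 2 + μ + R + 1 := by linarith
  obtain ⟨β₀, H⟩ := bop_bounded_of_weighted hn hpq hμ (R := R) le_rfl hH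
  refine ⟨max β₀ μ, le_max_right _ _, fun β hβ => ?_⟩
  obtain ⟨C, hC, HC⟩ := H β ((le_max_left _ _).trans hβ)
  have hβμ : μ ≤ β := (le_max_right _ _).trans hβ
  have hker := kernel_norm_lt_top hn hpq hμ hA hB hβμ hC HC
  refine ⟨hker, C, hC, fun f hf hfq => ?_⟩
  set X := ∫⁻ w, ‖f w‖ₑ ^ q ∂(dV n μ) with hX
  have hr0 : 0 ≤ β + n / 2 := by linarith
  set F : ℕ → (Fin n → ℂ) → ℂ := fun N => (trS n N).indicator f with hF
  have hFm : ∀ N, AEMeasurable (F N) (volume.restrict (tube n)) := fun N =>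
    hf.indicator (measurableSet_trS N)
  have hFle : ∀ N w, ‖F N w‖ₑ ≤ ‖f w‖ₑ := fun N w => enorm_indicator_le_enorm_self f w
  have hFX : ∀ N, ∫⁻ w, ‖F N w‖ₑ ^ q ∂(dV n μ) ≤ X := fun N =>
    lintegral_mono fun w => ENNReal.rpow_le_rpow (hFle N w) hq.le
  have hpk : ∀ z ∈ tube n, pker (β + n / 2) β (fun w => ‖f w‖ₑ) z < ⊤ := fun z hz =>
    pker_lt_top_of_norm hpq hr0 hker hf.enorm hfq hz
  have hbd : ∀ N, ∫⁻ z, ‖bop (β + n / 2) β (F N) z‖ₑ ^ q ∂(dV n μ) ≤ C * X := by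
    intro N
    refine (HC (F N) (hFm N) ((hFX N).trans_lt hfq) ?_).trans (mul_le_mul' le_rfl (hFX N))
    set M := ENNReal.ofReal (((N : ℝ) + 1) ^ (3 * R + 1) *
      ((N : ℝ) + 1) ^ (n / 2 + μ + R + 1)) with hM
    have hMq : M ^ q ≠ ⊤ := ENNReal.rpow_ne_top_of_nonneg hq.le ENNReal.ofReal_ne_top
    refine lt_of_le_of_lt (lintegral_mono_dV (g := fun w => M ^ q * ‖f w‖ₑ ^ q)
      fun w hw => ?_) ?_
    · rw [← ENNReal.mul_rpow_of_nonneg _ _ hq.le]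
      refine ENNReal.rpow_le_rpow ?_ hq.le
      by_cases h : w ∈ trS n N
      · exact mul_le_mul' (omW_le_of_mem_trS hA hB hw h) (hFle N w)
      · simp [hF, indicator_of_notMem h]
    · rw [lintegral_const_mul' _ _ hMq]
      exact ENNReal.mul_lt_top hMq.lt_top hfq
  have hlim : ∀ z ∈ tube n, Filter.Tendsto (fun N => ‖bop (β + n / 2) β (F N) z‖ₑ ^ q)
      Filter.atTop (nhds (‖bop (β + n / 2) β f z‖ₑ ^ q)) := by
    intro z hz
    refine ((ENNReal.continuous_rpow_const.tendsto _).comp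
      ((continuous_enorm.tendsto _).comp ?_))
    have hi := (integrable_Ks_iff (aesm_dV hf β) z).2 (hpk z hz)
    refine tendsto_integral_of_dominated_convergence _ (fun N =>
      (measurable_Ks_right _ z).aestronglyMeasurable.mul (aesm_dV (hFm N) β)) hi.norm
      (fun N => Filter.Eventually.of_forall fun w => ?_) ?_
    · rw [norm_mul, norm_mul]
      exact mul_le_mul_of_nonneg_left (norm_indicator_le_norm_self f w) (norm_nonneg _)
    · filter_upwards [ae_dV] with w hw
      refine tendsto_const_nhds.congr' ?_
      filter_upwards [eventually_mem_trS hw] with N hN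
      simp only [hF, indicator_of_mem hN]
  calc ∫⁻ z, ‖bop (β + n / 2) β f z‖ₑ ^ q ∂(dV n μ)
      = ∫⁻ z, Filter.liminf (fun N => ‖bop (β + n / 2) β (F N) z‖ₑ ^ q) Filter.atTop
          ∂(dV n μ) := lintegral_congr_dV fun z hz => (hlim z hz).liminf_eq.symm
    _ ≤ Filter.liminf (fun N => ∫⁻ z, ‖bop (β + n / 2) β (F N) z‖ₑ ^ q ∂(dV n μ))
          Filter.atTop := by
        refine lintegral_liminf_le' fun N => ((aemeas_dV (aemeas_of_diff
          (bop_differentiableOn hr0 (hFm N) iE_mem ?_)) μ).enorm.pow_const q)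
        exact (pker_mono (fun w _ => hFle N w) _).trans_lt (hpk _ iE_mem)
    _ ≤ C * X := Filter.liminf_le_of_le (by isBoundedDefault) fun b hb => by
        obtain ⟨N, hN⟩ := hb.exists
        exact hN.trans (hbd N)

end BergmanUnweighted

section Regularization

variable {n : ℕ} [NeZero n]

lemma ofReal_smul_mem_tube {c : ℝ} (hc : 0 < c) {w : Fin n → ℂ} (hw : w ∈ tube n) :
    (c : ℂ) • w ∈ tube n := by
  have e : imP ((c : ℂ) • w) = c • imP w := by
    ext i; simp [imP]
  show imP _ ∈ cone n
  rw [e]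
  exact cone_smul hc hw

lemma kb_smul_smul (c : ℝ) (z w : Fin n → ℂ) :
    kb ((c : ℂ) • z) ((c : ℂ) • w) = (c : ℂ) ^ 2 * kb z w := by
  have e : (c : ℂ) • z - cj ((c : ℂ) • w) = (c : ℂ) • (z - cj w) := by
    ext i; simp [cj]; ring
  rw [kb, e, lorC_smul, kb]
  ring

/-- A holomorphic regularizing factor, tending to `1` as `ε → 0`. -/
def regR (k : ℕ) (ε : ℝ) (w : Fin n → ℂ) : ℂ := ((kb ((ε : ℂ) • w) (iE n)) ^ k)⁻¹

lemma regR_differentiableOn (k : ℕ) {ε : ℝ} (hε : 0 < ε) :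
    DifferentiableOn ℂ (regR k ε) (tube n) := by
  intro w hw
  have h1 : DifferentiableAt ℂ (fun w : Fin n → ℂ => kb ((ε : ℂ) • w) (iE n)) w :=
    ((differentiable_kb (iE n)).comp (differentiable_id.const_smul (ε : ℂ))) w
  exact ((h1.fun_pow k).inv (pow_ne_zero _
    (kb_ne_zero (ofReal_smul_mem_tube hε hw) iE_mem))).differentiableWithinAt

lemma norm_regR_le_one (k : ℕ) {ε : ℝ} (hε : 0 < ε) {w : Fin n → ℂ} (hw : w ∈ tube n) :
    ‖regR k ε w‖ ≤ 1 := by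
  rw [regR, norm_inv, norm_pow]
  exact inv_le_one_of_one_le₀ (one_le_pow₀ (one_le_norm_kb_iE (ofReal_smul_mem_tube hε hw)))

lemma norm_regR_le (k : ℕ) {ε : ℝ} (hε : 0 < ε) : ∃ C : ℝ, 0 ≤ C ∧ ∀ w ∈ tube n,
    ‖regR k ε w‖ ≤ C * kE w ^ (-(k : ℝ)) := by
  set v : Fin n → ℂ := ((ε⁻¹ : ℝ) : ℂ) • iE n with hv
  have hvm : v ∈ tube n := ofReal_smul_mem_tube (inv_pos.2 hε) iE_mem
  have hH : 0 < harC (iE n) v := harC_pos iE_mem hvm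
  have hev : (ε : ℂ) • v = iE n := by
    rw [hv, smul_smul, ← ofReal_mul, mul_inv_cancel₀ hε.ne', ofReal_one, one_smul]
  refine ⟨(harC (iE n) v / ε ^ 2) ^ k, by positivity, fun w hw => ?_⟩
  have h1 : ‖kb w (iE n)‖ ≤ harC (iE n) v / ε ^ 2 * ‖kb ((ε : ℂ) • w) (iE n)‖ := by
    have h := norm_kb_harnack iE_mem hvm hw
    rw [norm_kb_comm, norm_kb_comm v] at h
    have e : ‖kb ((ε : ℂ) • w) (iE n)‖ = ε ^ 2 * ‖kb w v‖ := by
      conv_lhs => rw [← hev]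
      rw [kb_smul_smul, norm_mul, norm_pow, norm_real, Real.norm_of_nonneg hε.le]
    rw [e]
    refine h.trans (le_of_eq ?_)
    field_simp
  have h2 : 0 < ‖kb w (iE n)‖ := kE_pos hw
  have h3 : 0 < ‖kb ((ε : ℂ) • w) (iE n)‖ := kE_pos (ofReal_smul_mem_tube hε hw)
  rw [regR, norm_inv, norm_pow, kE, Real.rpow_neg h2.le, Real.rpow_natCast, ← div_eq_mul_inv,
    le_div_iff₀ (by positivity), inv_mul_le_iff₀ (by positivity), mul_comm, ← mul_pow]
  exact pow_le_pow_left₀ h2.le h1 k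

lemma tendsto_regR (k : ℕ) (w : Fin n → ℂ) :
    Filter.Tendsto (fun j : ℕ => regR k (1 / ((j : ℝ) + 1)) w) Filter.atTop (nhds 1) := by
  have h1 : Continuous fun ε : ℝ => kb ((ε : ℂ) • w) (iE n) :=
    (differentiable_kb (iE n)).continuous.comp
      (continuous_ofReal.smul (continuous_const (y := w)))
  have h0 : kb (((0 : ℝ) : ℂ) • w) (iE n) = 1 := by
    rw [kb_iE_right, ofReal_zero, zero_smul, zero_add, iE, lorC_smul]
    have : lorC (ofR (eVec n ℝ)) = 1 := by
      simp [lorC, ofR, eVec, Pi.single_apply, apply_ite, ite_pow]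
      norm_num
    rw [this]; simp
  have h2 := (h1.tendsto 0).comp tendsto_one_div_add_atTop_nhds_zero_nat
  rw [h0] at h2
  have h3 := (h2.pow k).inv₀ (by simp)
  rw [one_pow, inv_one] at h3
  exact h3

lemma pker_regR_lt_top (k : ℕ) {ε : ℝ} (hε : 0 < ε) {s b : ℝ} (h : (Fin n → ℂ) → ℂ)
    (hfin : pker (s + k) b (fun w => ‖h w‖ₑ) (iE n) < ⊤) :
    pker s b (fun w => ‖h w * regR k ε w‖ₑ) (iE n) < ⊤ := by
  obtain ⟨C, hC, H⟩ := norm_regR_le (n := n) k hε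
  refine lt_of_le_of_lt ?_ (ENNReal.mul_lt_top (ENNReal.ofReal_lt_top (r := C)) hfin)
  rw [pker, pker, ← lintegral_const_mul' _ _ ENNReal.ofReal_ne_top]
  refine lintegral_mono_dV fun w hw => ?_
  have h1 : 0 < ‖kb w (iE n)‖ := kE_pos hw
  rw [← mul_assoc, ← ENNReal.ofReal_mul hC, enorm_mul, ← ofReal_norm (regR k ε w), mul_left_comm,
    mul_comm (‖h w‖ₑ), ← ENNReal.ofReal_mul (by positivity)]
  refine mul_le_mul' (ENNReal.ofReal_le_ofReal ?_) le_rfl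
  rw [norm_kb_comm, neg_add, Real.rpow_add h1, mul_left_comm]
  exact mul_le_mul_of_nonneg_left (H w hw) (by positivity)

lemma tendsto_bop_regR {s b : ℝ} (k : ℕ) {h : (Fin n → ℂ) → ℂ}
    (hh : AEMeasurable h (volume.restrict (tube n)))
    {z : Fin n → ℂ} (hfin : pker s b (fun w => ‖h w‖ₑ) z < ⊤) :
    Filter.Tendsto (fun j : ℕ => bop s b (fun w => h w * regR k (1 / ((j : ℝ) + 1)) w) z)
      Filter.atTop (nhds (bop s b h z)) := by
  have hi := (integrable_Ks_iff (aesm_dV hh b) z).2 hfin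
  have hε : ∀ j : ℕ, (0 : ℝ) < 1 / ((j : ℝ) + 1) := fun j => by positivity
  refine tendsto_integral_of_dominated_convergence _ (fun j =>
    (measurable_Ks_right _ z).aestronglyMeasurable.mul ((aesm_dV hh b).mul
      (aesm_dV (aemeas_of_diff (regR_differentiableOn k (hε j))) b))) hi.norm (fun j => ?_) ?_
  · filter_upwards [ae_dV] with w hw
    rw [norm_mul, norm_mul, norm_mul]
    exact mul_le_mul_of_nonneg_left (mul_le_of_le_one_right (norm_nonneg _)
      (norm_regR_le_one k (hε j) hw)) (norm_nonneg _)
  · refine Filter.Eventually.of_forall fun w => ?_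
    simpa using (((tendsto_regR k w).const_mul (h w)).const_mul (Ks s z w))

/-- The reproducing formula after applying the wave operator. -/
lemma BoxOp_iter_reproducing (hn : 2 ≤ n) {γ : ℝ} (hγ : 0 ≤ γ + n / 2) {h : (Fin n → ℂ) → ℂ}
    (hh : DifferentiableOn ℂ h (tube n))
    (hfin : pker (γ + n / 2) γ (fun w => ‖h w‖ₑ) (iE n) < ⊤) (k : ℕ) {z : Fin n → ℂ}
    (hz : z ∈ tube n) : rfC n γ * BoxOp^[k] h z =
      (boxC n (γ + n / 2) 0 k : ℂ) * bop (γ + n / 2 + k) γ h z := by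
  have hm := aemeas_of_diff hh
  have h1 : EqOn (bop (γ + n / 2) γ h) (fun z => rfC n γ * h z) (tube n) := fun z hz =>
    reproducing γ hh hz ((integrable_Ks_iff (aesm_dV hm γ) z).2 (pker_lt_top_of hγ iE_mem hz hfin))
  have h2 := BoxOp_iter_bop hn hγ hm iE_mem hfin k hz
  rw [BoxOp_iter_congr isOpen_tube h1 k hz, BoxOp_iter_const_mul isOpen_tube hh _ k hz] at h2
  exact h2

/-- Bergman-type operators with different weights agree up to constants on holomorphic
functions. -/
lemma bop_change_weight (hn : 2 ≤ n) {α β : ℝ} (hα : 0 ≤ α + n / 2) (hβ : 0 ≤ β + n / 2)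
    (k : ℕ) {h : (Fin n → ℂ) → ℂ} (hh : DifferentiableOn ℂ h (tube n))
    (hfα : pker (α + n / 2 + k) α (fun w => ‖h w‖ₑ) (iE n) < ⊤)
    (hfβ : pker (β + n / 2 + k) β (fun w => ‖h w‖ₑ) (iE n) < ⊤) {z : Fin n → ℂ}
    (hz : z ∈ tube n) :
    rfC n β * ((boxC n (α + n / 2) 0 k : ℂ) * bop (α + n / 2 + k) α h z) =
      rfC n α * ((boxC n (β + n / 2) 0 k : ℂ) * bop (β + n / 2 + k) β h z) := by
  have hm := aemeas_of_diff hh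
  have hε : ∀ j : ℕ, (0 : ℝ) < 1 / ((j : ℝ) + 1) := fun j => by positivity
  have hk : (0 : ℝ) ≤ k := by positivity
  have lα := tendsto_bop_regR k hm (pker_lt_top_of (by linarith) iE_mem hz hfα)
  have lβ := tendsto_bop_regR k hm (pker_lt_top_of (by linarith) iE_mem hz hfβ)
  refine tendsto_nhds_unique ((lα.const_mul _).const_mul _)
    (((lβ.const_mul _).const_mul _).congr fun j => ?_)
  have hd := hh.mul (regR_differentiableOn k (hε j))
  have e1 := BoxOp_iter_reproducing hn hα hd (pker_regR_lt_top k (hε j) h hfα) k hz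
  have e2 := BoxOp_iter_reproducing hn hβ hd (pker_regR_lt_top k (hε j) h hfβ) k hz
  have e3 : rfC n β * (rfC n α * BoxOp^[k] (fun w => h w * regR k (1 / ((j : ℝ) + 1)) w) z) =
    rfC n α * (rfC n β * BoxOp^[k] (fun w => h w * regR k (1 / ((j : ℝ) + 1)) w) z) := by ring
  have e1' : rfC n α * BoxOp^[k] (fun w => h w * regR k (1 / ((j : ℝ) + 1)) w) z = _ := e1
  have e2' : rfC n β * BoxOp^[k] (fun w => h w * regR k (1 / ((j : ℝ) + 1)) w) z = _ := e2
  rw [e1', e2'] at e3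
  exact e3.symm

end Regularization

section Pairing

variable {n : ℕ} [NeZero n]

lemma pker_dl_bounded (hn : 2 ≤ n) {p q : ℝ} (hpq : p.HolderConjugate q) (hp2 : p ≤ q) {ν : ℝ}
    (hν : (n : ℝ) / 2 - 1 < ν) : ∃ M₀ : ℝ, ∀ M, M₀ ≤ M → ∃ C : ℝ, 0 < C ∧
      ∀ f : (Fin n → ℂ) → ℝ≥0∞, AEMeasurable f (volume.restrict (tube n)) →
      ∫⁻ z, (ENNReal.ofReal (dl z ^ M) * pker (ν + M + n / 2) ν f z) ^ q ∂(dV n ν) ≤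
        ENNReal.ofReal C * ∫⁻ z, f z ^ q ∂(dV n ν) := by
  have hn' : (2 : ℝ) ≤ n := by exact_mod_cast hn
  have hp := hpq.pos
  have hq := hpq.symm.pos
  set κ : ℝ := n / 2 - 1 with hκ
  have hκ0 : 0 ≤ κ := by rw [hκ]; linarith
  set t₂ : ℝ := -((ν - κ) / (2 * p)) with ht₂
  set t₁ : ℝ := -((κ / q + ν / p) / 2) with ht₁
  have h1 : κ / q < ν / p := by
    rw [div_lt_div_iff₀ hq hp]; nlinarith
  have e1 : t₂ * p = -((ν - κ) / 2) := by rw [ht₂]; field_simp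
  have e2 : ν / p * p = ν := by field_simp
  have e3 : κ / q * q = κ := by field_simp
  have h2 : t₁ * p < 0 := by
    have : 0 < (κ / q + ν / p) / 2 := by
      have : 0 ≤ κ / q := by positivity
      linarith
    rw [ht₁]; nlinarith
  have h3 : -ν < t₁ * p := by
    have := mul_lt_mul_of_pos_right h1 hp
    rw [ht₁]; nlinarith
  have h4 : t₁ * q < -κ := by
    have := mul_lt_mul_of_pos_right h1 hq
    rw [ht₁]; nlinarith
  have h5 : t₂ * q < 0 := by
    have : 0 < (ν - κ) / (2 * p) := by
      have : 0 < ν - κ := by linarith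
      positivity
    rw [ht₂]; nlinarith
  refine ⟨n + κ + |t₁ * q| + |t₂ * q|, fun M hM => ?_⟩
  have a1 := neg_abs_le (t₁ * q)
  have a2 := neg_abs_le (t₂ * q)
  have a3 := abs_nonneg (t₁ * q)
  have a4 := abs_nonneg (t₂ * q)
  obtain ⟨C, hC, H⟩ := kernel_bounded hn hpq (ez := M) (ew := ν) (μ := ν) (t₁ := t₁) (t₂ := t₂)
    (by linarith) (by linarith) (by linarith) (by linarith) (by linarith) (by linarith)
    (by linarith) (by linarith) (by linarith)
  refine ⟨C, hC, fun f hf => ?_⟩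
  have := H f hf
  rwa [add_comm M ν] at this

lemma aemeas_pow_dl {f : (Fin n → ℂ) → ℂ} (hf : AEMeasurable f (volume.restrict (tube n)))
    (t : ℝ) : AEMeasurable (fun w => ((dl w ^ t : ℝ) : ℂ) * f w) (volume.restrict (tube n)) :=
  ((continuous_dl.measurable.pow_const t).complex_ofReal.aemeasurable).mul hf

lemma lintegral_dl_mul {q : ℝ} (hq : 0 ≤ q) (t ν : ℝ) (f : (Fin n → ℂ) → ℝ≥0∞) :
    ∫⁻ w, (ENNReal.ofReal (dl w ^ t) * f w) ^ q ∂(dV n ν) =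
      ∫⁻ w, f w ^ q ∂(dV n (ν + t * q)) := by
  rw [← lintegral_dV_shift]
  refine lintegral_congr_dV fun w hw => ?_
  have := dl_pos hw
  rw [ENNReal.mul_rpow_of_nonneg _ _ hq, ENNReal.ofReal_rpow_of_pos (by positivity),
    ← Real.rpow_mul this.le]

lemma pker_shift (s b t : ℝ) (f : (Fin n → ℂ) → ℝ≥0∞) (z : Fin n → ℂ) :
    pker s (b + t) f z = pker s b (fun w => ENNReal.ofReal (dl w ^ t) * f w) z := by
  rw [pker, pker, ← lintegral_dV_shift]
  refine lintegral_congr fun w => ?_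
  ring

lemma enorm_dl_mul (t : ℝ) (f : (Fin n → ℂ) → ℂ) {w : Fin n → ℂ} (hw : w ∈ tube n) :
    ‖((dl w ^ t : ℝ) : ℂ) * f w‖ₑ = ENNReal.ofReal (dl w ^ t) * ‖f w‖ₑ := by
  have := dl_pos hw
  rw [enorm_mul, ← ofReal_norm, norm_real, Real.norm_of_nonneg (by positivity)]

/-- Functions in a Bergman space are reproduced by the weights in the pairing. -/
lemma pker_pairing_lt_top (hn : 2 ≤ n) {p q : ℝ} (hpq : p.HolderConjugate q) (hq2 : 2 ≤ q)
    {ν M : ℝ} (hν : (n : ℝ) / 2 - 1 < ν) (hM : 0 ≤ M) {F : (Fin n → ℂ) → ℂ}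
    (hF : AEMeasurable F (volume.restrict (tube n)))
    (hFp : ∫⁻ w, ‖F w‖ₑ ^ p ∂(dV n ν) < ⊤) {z : Fin n → ℂ} (hz : z ∈ tube n) :
    pker (ν + M + n / 2) (ν + M) (fun w => ‖F w‖ₑ) z < ⊤ := by
  have hn' : (2 : ℝ) ≤ n := by exact_mod_cast hn
  have hq := hpq.symm.pos
  have hMq : 0 ≤ M * q := by positivity
  have e0 : (ν + M + n / 2) * q = ν * q + M * q + n / 2 * q := by ring
  have e1 : ν * 2 ≤ ν * q := mul_le_mul_of_nonneg_left hq2 (by linarith)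
  have e2 : (n : ℝ) / 2 * 2 ≤ n / 2 * q := mul_le_mul_of_nonneg_left hq2 (by linarith)
  have hfin := lintegral_kE_lt_top hn (a := (ν + M + n / 2) * q) (b := ν + M * q)
    (by linarith) (by linarith) (by linarith)
  refine pker_lt_top_of_norm hpq.symm (μ := ν) (by linarith) ?_ hF.enorm hFp hz
  refine (le_of_eq ?_).trans_lt hfin
  rw [← lintegral_dl_mul hq.le M ν (fun w => ENNReal.ofReal (kE w ^ (-(ν + M + n / 2)))) |>.trans
    (lintegral_congr_dV fun w hw => ?_)]
  · refine lintegral_congr_dV fun w hw => ?_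
    have h1 := kE_pos hw
    have h2 := dl_pos hw
    rw [omW, ← ENNReal.ofReal_mul (by positivity), mul_comm]
    congr 4
    ring
  · have h1 := kE_pos hw
    rw [ENNReal.ofReal_rpow_of_pos (by positivity), ← Real.rpow_mul h1.le, neg_mul]

lemma bop_pairing (hn : 2 ≤ n) {p q : ℝ} (hpq : p.HolderConjugate q) (hq2 : 2 ≤ q)
    {ν M C : ℝ} (hν : (n : ℝ) / 2 - 1 < ν) (hM : 0 ≤ M)
    (hC : ∀ f : (Fin n → ℂ) → ℝ≥0∞, AEMeasurable f (volume.restrict (tube n)) →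
      ∫⁻ z, (ENNReal.ofReal (dl z ^ M) * pker (ν + M + n / 2) ν f z) ^ q ∂(dV n ν) ≤
        ENNReal.ofReal C * ∫⁻ z, f z ^ q ∂(dV n ν))
    {F f : (Fin n → ℂ) → ℂ} (hF : DifferentiableOn ℂ F (tube n))
    (hFp : ∫⁻ w, ‖F w‖ₑ ^ p ∂(dV n ν) < ⊤) (hf : AEMeasurable f (volume.restrict (tube n)))
    (hfq : ∫⁻ w, ‖f w‖ₑ ^ q ∂(dV n ν) < ⊤) :
    ∫ z, F z * (starRingEnd ℂ) (bop (ν + M + n / 2) ν f z) ∂(dV n (ν + M)) =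
      rfC n (ν + M) * ∫ w, F w * (starRingEnd ℂ) (f w) ∂(dV n ν) := by
  have hp := hpq.pos
  have hq := hpq.symm.pos
  have hFm := aemeas_of_diff hF
  have hconj : AEMeasurable (fun w => (starRingEnd ℂ) (f w)) (volume.restrict (tube n)) :=
    Complex.continuous_conj.measurable.comp_aemeasurable hf
  have hm : AEStronglyMeasurable (Function.uncurry fun z w : Fin n → ℂ =>
      F z * (starRingEnd ℂ) (Ks (ν + M + n / 2) z w * f w)) ((dV n (ν + M)).prod (dV n ν)) := by
    simp only [map_mul]
    exact (aesm_dV hFm _).comp_fst.mul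
      ((Complex.continuous_conj.measurable.comp (measurable_Ks _)).aestronglyMeasurable.mul
        (aesm_dV hconj _).comp_snd)
  have hi : Integrable (Function.uncurry fun z w : Fin n → ℂ =>
      F z * (starRingEnd ℂ) (Ks (ν + M + n / 2) z w * f w)) ((dV n (ν + M)).prod (dV n ν)) := by
    refine ⟨hm, ?_⟩
    rw [HasFiniteIntegral, lintegral_prod _ hm.enorm]
    have e : ∀ z, ∫⁻ w, ‖Function.uncurry (fun z w : Fin n → ℂ =>
        F z * (starRingEnd ℂ) (Ks (ν + M + n / 2) z w * f w)) (z, w)‖ₑ ∂(dV n ν) =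
        ‖F z‖ₑ * pker (ν + M + n / 2) ν (fun w => ‖f w‖ₑ) z := by
      intro z
      simp only [Function.uncurry, enorm_mul, RCLike.enorm_conj, enorm_Ks]
      rw [lintegral_const_mul' _ _ enorm_ne_top]
      rfl
    simp only [e]
    rw [← lintegral_dV_shift]
    have e2 := ENNReal.lintegral_mul_le_Lp_mul_Lq (dV n ν) hpq
      (aemeas_dV hFm.enorm ν)
      (g := fun z => ENNReal.ofReal (dl z ^ M) *
        pker (ν + M + n / 2) ν (fun w => ‖f w‖ₑ) z)
      ((continuous_dl.measurable.pow_const _).ennreal_ofReal.mul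
        (measurable_pker _ _ hf.enorm)).aemeasurable
    refine (le_of_eq ?_).trans_lt (e2.trans_lt ?_)
    · refine lintegral_congr fun z => ?_
      simp only [Pi.mul_apply]
      ring
    · refine ENNReal.mul_lt_top (ENNReal.rpow_lt_top_of_nonneg (by positivity) hFp.ne)
        (ENNReal.rpow_lt_top_of_nonneg (by positivity) ?_)
      exact ((hC _ hf.enorm).trans_lt (ENNReal.mul_lt_top ENNReal.ofReal_lt_top hfq)).ne
  have h1 := integral_integral_swap hi
  have h2 : ∫ z, F z * (starRingEnd ℂ) (bop (ν + M + n / 2) ν f z) ∂(dV n (ν + M)) =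
      ∫ z, ∫ w, F z * (starRingEnd ℂ) (Ks (ν + M + n / 2) z w * f w) ∂(dV n ν)
        ∂(dV n (ν + M)) := by
    congr 1; ext z
    rw [bop, integral_const_mul, integral_conj]
  rw [h2, h1, ← integral_const_mul]
  refine integral_congr_ae ?_
  filter_upwards [ae_dV] with w hw
  have h3 := reproducing (ν + M) hF hw ((integrable_Ks_iff (aesm_dV hFm (ν + M)) w).2
    (pker_pairing_lt_top hn hpq hq2 hν hM hFm hFp hw))
  rw [← mul_assoc, ← h3, mul_comm, ← integral_const_mul]
  refine integral_congr_ae ?_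
  filter_upwards [ae_dV] with z hz
  rw [map_mul, Ks_conj _ hz hw]
  ring

end Pairing

section Representation

variable {n : ℕ} [NeZero n]

lemma eq_zero_of_bop_eq_zero (hn : 2 ≤ n) {p q : ℝ} (hpq : p.HolderConjugate q) {μ α β : ℝ}
    {k : ℕ} (hμ : (n : ℝ) / 2 - 1 < μ) (hα : (n : ℝ) / 2 - 1 < α) (hk : n ≤ k) (hβ : μ + n ≤ β)
    (hN : ∫⁻ w : Fin n → ℂ, omW (-(β + n / 2)) (μ - β) w ^ p ∂(dV n μ) < ⊤)
    {h : (Fin n → ℂ) → ℂ} (hh : DifferentiableOn ℂ h (tube n))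
    (hhq : ∫⁻ w, ‖h w‖ₑ ^ q ∂(dV n μ) < ⊤)
    (hfα : pker (α + n / 2 + k) α (fun w => ‖h w‖ₑ) (iE n) < ⊤)
    (h0 : ∀ z ∈ tube n, bop (α + n / 2 + k) α h z = 0) : ∀ z ∈ tube n, h z = 0 := by
  have hn' : (2 : ℝ) ≤ n := by exact_mod_cast hn
  have hk' : (n : ℝ) ≤ k := by exact_mod_cast hk
  have hq := hpq.symm.pos
  have hm := aemeas_of_diff hh
  have hr : 0 ≤ β + n / 2 := by linarith
  have hpk : ∀ z ∈ tube n, pker (β + n / 2) β (fun w => ‖h w‖ₑ) z < ⊤ := fun z hz =>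
    pker_lt_top_of_norm hpq hr hN hm.enorm hhq hz
  have h1 : ∀ z ∈ tube n, bop (β + n / 2 + k) β h z = 0 := by
    intro z hz
    have e := bop_change_weight hn (by linarith) hr k hh hfα
      (pker_add_lt_top (by linarith) iE_mem (hpk _ iE_mem)) hz
    have b1 : ((boxC n (β + n / 2) 0 k : ℝ) : ℂ) ≠ 0 := by
      exact_mod_cast boxC_ne_zero hn (by linarith) k
    rw [h0 z hz, mul_zero, mul_zero, eq_comm, mul_eq_zero, mul_eq_zero] at e
    exact (e.resolve_left (rfC_ne_zero hn hα)).resolve_left b1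
  intro z hz
  obtain ⟨c, hc, H⟩ := bop_bop hn (s := β + n / 2) (γ := β + k) (by linarith) (by linarith)
    (by linarith) 0
  obtain ⟨C, hC, HC⟩ := kernel_bounded hn hpq (ez := k) (ew := β) (μ := μ) (t₁ := 0) (t₂ := 0)
    (by linarith) (by linarith) (by linarith) (by linarith) (by linarith) (by linarith)
    (by linarith) (by linarith) (by linarith)
  have e1 : β + k + n / 2 + ((0 : ℕ) : ℝ) = β + n / 2 + k := by push_cast; ring
  have e3 : (k : ℝ) + β + n / 2 = β + n / 2 + k := by ring
  rw [e1] at H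
  rw [e3] at HC
  have h2 : pker (β + n / 2) (β + k) (pker (β + n / 2 + k) β fun w => ‖h w‖ₑ) z < ⊤ := by
    rw [pker_shift]
    refine pker_lt_top_of_norm hpq hr hN
      ((continuous_dl.measurable.pow_const _).ennreal_ofReal.mul
        (measurable_pker _ _ hm.enorm)).aemeasurable ?_ hz
    exact (HC _ hm.enorm).trans_lt (ENNReal.mul_lt_top ENNReal.ofReal_lt_top hhq)
  have h3 := H β h hm z hz h2
  have h4 : bop (β + n / 2) (β + k) (bop (β + n / 2 + k) β h) z = 0 := by
    rw [bop_congr _ _ (g := fun _ => 0) (fun w hw => h1 w hw) z]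
    simp [bop]
  rw [h4, mul_zero, Nat.cast_zero, add_zero] at h3
  have h5 := reproducing β hh hz ((integrable_Ks_iff (aesm_dV hm β) z).2 (hpk z hz))
  have h6 : rfC n β * h z = 0 := h5.symm.trans h3
  exact (mul_eq_zero.1 h6).resolve_left (rfC_ne_zero hn (by linarith))

lemma exists_bop_eq (hn : 2 ≤ n) {p q : ℝ} (hpq : p.HolderConjugate q) {μ α β : ℝ}
    {k : ℕ} (hμ : (n : ℝ) / 2 - 1 < μ) (hα : (n : ℝ) / 2 - 1 < α) (hβ : μ ≤ β)
    (hN : ∫⁻ w : Fin n → ℂ, omW (-(β + n / 2)) (μ - β) w ^ p ∂(dV n μ) < ⊤)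
    (hT : ∃ C : ℝ≥0∞, C ≠ ⊤ ∧ ∀ f : (Fin n → ℂ) → ℂ, AEMeasurable f (volume.restrict (tube n)) →
      ∫⁻ w, ‖f w‖ₑ ^ q ∂(dV n μ) < ⊤ →
      ∫⁻ z, ‖bop (β + n / 2) β f z‖ₑ ^ q ∂(dV n μ) ≤ C * ∫⁻ w, ‖f w‖ₑ ^ q ∂(dV n μ))
    (hfα : ∀ h : (Fin n → ℂ) → ℂ, AEMeasurable h (volume.restrict (tube n)) →
      ∫⁻ w, ‖h w‖ₑ ^ q ∂(dV n μ) < ⊤ →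
      pker (α + n / 2 + k) α (fun w => ‖h w‖ₑ) (iE n) < ⊤) :
    ∃ C : ℝ≥0∞, C ≠ ⊤ ∧ ∀ G : (Fin n → ℂ) → ℂ, DifferentiableOn ℂ G (tube n) →
      ∫⁻ w, ‖((dl w ^ (k : ℝ) : ℝ) : ℂ) * G w‖ₑ ^ q ∂(dV n μ) < ⊤ →
      ∃ h : (Fin n → ℂ) → ℂ, DifferentiableOn ℂ h (tube n) ∧
        ∫⁻ w, ‖h w‖ₑ ^ q ∂(dV n μ) ≤
          C * ∫⁻ w, ‖((dl w ^ (k : ℝ) : ℝ) : ℂ) * G w‖ₑ ^ q ∂(dV n μ) ∧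
        ∀ z ∈ tube n, bop (α + n / 2 + k) α h z = G z := by
  have hn' : (2 : ℝ) ≤ n := by exact_mod_cast hn
  have hk0 : (0 : ℝ) ≤ k := by positivity
  have hq := hpq.symm.pos
  have hr : 0 ≤ β + n / 2 := by linarith
  obtain ⟨C, hC, HC⟩ := hT
  set c₁ : ℂ := rfC n β * (boxC n (α + n / 2) 0 k : ℂ) with hc₁
  set c₂ : ℂ := rfC n α * (boxC n (β + n / 2) 0 k * rfC n (β + k)) * rfC n β with hc₂
  have b1 : ((boxC n (β + n / 2) 0 k : ℝ) : ℂ) ≠ 0 := by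
    exact_mod_cast boxC_ne_zero hn (by linarith) k
  have r1 := rfC_ne_zero hn (γ := β) (by linarith)
  have r2 := rfC_ne_zero hn hα
  have r3 := rfC_ne_zero hn (γ := β + k) (by linarith)
  have hc₂0 : c₂ ≠ 0 := mul_ne_zero (mul_ne_zero r2 (mul_ne_zero b1 r3)) r1
  refine ⟨‖c₁ / c₂‖ₑ ^ q * C, ENNReal.mul_ne_top
    (ENNReal.rpow_ne_top_of_nonneg hq.le enorm_ne_top) hC, fun G hG hGq => ?_⟩
  set u : (Fin n → ℂ) → ℂ := fun w => ((dl w ^ (k : ℝ) : ℝ) : ℂ) * G w with hu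
  have hum : AEMeasurable u (volume.restrict (tube n)) := aemeas_pow_dl (aemeas_of_diff hG) _
  have hupk : pker (β + n / 2) β (fun w => ‖u w‖ₑ) (iE n) < ⊤ :=
    pker_lt_top_of_norm hpq hr hN hum.enorm hGq iE_mem
  set h₀ := bop (β + n / 2) β u with hh₀
  have hd : DifferentiableOn ℂ h₀ (tube n) := bop_differentiableOn hr hum iE_mem hupk
  have hdm := aemeas_of_diff hd
  have hb := HC u hum hGq
  have hq₀ : ∫⁻ w, ‖h₀ w‖ₑ ^ q ∂(dV n μ) < ⊤ :=
    hb.trans_lt (ENNReal.mul_lt_top hC.lt_top hGq)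
  have hhpk : pker (β + n / 2) β (fun w => ‖h₀ w‖ₑ) (iE n) < ⊤ :=
    pker_lt_top_of_norm hpq hr hN hdm.enorm hq₀ iE_mem
  have key : ∀ z ∈ tube n, c₁ * bop (α + n / 2 + k) α h₀ z = c₂ * G z := by
    intro z hz
    have e1 := bop_change_weight hn (by linarith) hr k hd (hfα h₀ hdm hq₀)
      (pker_add_lt_top hk0 iE_mem hhpk) hz
    have e2 := BoxOp_iter_reproducing hn hr hd hhpk k hz
    have e3 := BoxOp_iter_bop hn hr hum iE_mem hupk k hz
    have e4 : bop (β + n / 2 + k) β u z = rfC n (β + k) * G z := by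
      rw [hu, ← bop_shift, show β + (n : ℝ) / 2 + k = β + k + n / 2 by ring]
      refine reproducing (β + k) hG hz ((integrable_Ks_iff (aesm_dV (aemeas_of_diff hG) _) z).2 ?_)
      rw [pker_shift, show β + (k : ℝ) + n / 2 = β + n / 2 + k by ring]
      refine lt_of_eq_of_lt ?_ (pker_add_lt_top hk0 hz (pker_lt_top_of hr iE_mem hz hupk))
      refine lintegral_congr_dV fun w hw => ?_
      simp only [hu]
      rw [enorm_dl_mul _ _ hw]
    rw [← hh₀] at e3
    simp only at e3
    rw [e4] at e3
    rw [e3] at e2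
    calc c₁ * bop (α + n / 2 + k) α h₀ z
        = rfC n β * ((boxC n (α + n / 2) 0 k : ℂ) * bop (α + n / 2 + k) α h₀ z) := by
          rw [hc₁]; ring
      _ = rfC n α * ((boxC n (β + n / 2) 0 k : ℂ) * bop (β + n / 2 + k) β h₀ z) := by
          rw [e1]
      _ = c₂ * G z := by rw [← e2, hc₂]; ring
  refine ⟨fun z => c₁ / c₂ * h₀ z, hd.const_mul _, ?_, fun z hz => ?_⟩
  · simp only [enorm_mul, ENNReal.mul_rpow_of_nonneg _ _ hq.le]
    rw [lintegral_const_mul' _ _ (ENNReal.rpow_ne_top_of_nonneg hq.le enorm_ne_top), mul_assoc]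
    exact mul_le_mul' le_rfl hb |>.trans_eq (by simp only [hu, enorm_mul,
      ENNReal.mul_rpow_of_nonneg _ _ hq.le])
  · rw [bop_const_mul, div_mul_eq_mul_div, key z hz, mul_div_cancel_left₀ _ hc₂0]

/-- The pairing facts used in the duality theorem. -/
lemma pairing_representation (hn : 2 ≤ n) {p q : ℝ} (hpq : p.HolderConjugate q) (hp2 : p ≤ 2)
    (hq2 : 2 ≤ q) {ν : ℝ} (hν : (n : ℝ) / 2 - 1 < ν) (m : ℕ)
    (hH : hardy n q (ν + m * q)) :
    (∃ C : ℝ≥0∞, C ≠ ⊤ ∧ ∀ g : (Fin n → ℂ) → ℂ, AEMeasurable g (volume.restrict (tube n)) →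
      ∫⁻ w, ‖g w‖ₑ ^ q ∂(dV n ν) < ⊤ → ∃ h : (Fin n → ℂ) → ℂ, DifferentiableOn ℂ h (tube n) ∧
        ∫⁻ w, ‖h w‖ₑ ^ q ∂(dV n (ν + m * q)) ≤ C * ∫⁻ w, ‖g w‖ₑ ^ q ∂(dV n ν) ∧
        ∀ F : (Fin n → ℂ) → ℂ, DifferentiableOn ℂ F (tube n) →
          ∫⁻ w, ‖F w‖ₑ ^ p ∂(dV n ν) < ⊤ →
          ∫ w, F w * (starRingEnd ℂ) (g w) ∂(dV n ν) =
            ∫ w, F w * (starRingEnd ℂ) (((dl w ^ (m : ℝ) : ℝ) : ℂ) * h w) ∂(dV n ν)) ∧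
    (∀ h : (Fin n → ℂ) → ℂ, DifferentiableOn ℂ h (tube n) →
      ∫⁻ w, ‖h w‖ₑ ^ q ∂(dV n (ν + m * q)) < ⊤ →
      (∀ F : (Fin n → ℂ) → ℂ, DifferentiableOn ℂ F (tube n) →
        ∫⁻ w, ‖F w‖ₑ ^ p ∂(dV n ν) < ⊤ →
        ∫ w, F w * (starRingEnd ℂ) (((dl w ^ (m : ℝ) : ℝ) : ℂ) * h w) ∂(dV n ν) = 0) →
      ∀ z ∈ tube n, h z = 0) := by
  have hn' : (2 : ℝ) ≤ n := by exact_mod_cast hn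
  have hp := hpq.pos
  have hp1 := hpq.lt
  have hq := hpq.symm.pos
  have hm0 : (0 : ℝ) ≤ m := by positivity
  have hmq : 0 ≤ m * q := by positivity
  set μ : ℝ := ν + m * q with hμdef
  have hμ : (n : ℝ) / 2 - 1 < μ := by linarith
  obtain ⟨M₀, HM⟩ := pker_dl_bounded hn hpq (hp2.trans hq2) hν
  obtain ⟨k₀, hk₀⟩ := exists_nat_ge M₀
  set k : ℕ := k₀ + n with hkdef
  have hkn : n ≤ k := by omega
  have hkn' : (n : ℝ) ≤ k := by exact_mod_cast hkn
  have hkM : M₀ ≤ m + k := by rw [hkdef]; push_cast; linarith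
  obtain ⟨C₁, hC₁, H₁⟩ := HM (m + k) hkM
  obtain ⟨β₀, hβ₀, Hβ⟩ := bergman_bounded hn hpq hμ hH
  set β : ℝ := β₀ + n with hβ
  obtain ⟨hN, hT⟩ := Hβ β (by linarith)
  have es : ν + (m + k) + n / 2 = ν + m + n / 2 + k := by ring
  rw [es] at H₁
  have hs : (0 : ℝ) ≤ ν + m + n / 2 + k := by linarith
  have hdq : ∀ h : (Fin n → ℂ) → ℂ, ∫⁻ w, ‖((dl w ^ (m : ℝ) : ℝ) : ℂ) * h w‖ₑ ^ q ∂(dV n ν) =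
      ∫⁻ w, ‖h w‖ₑ ^ q ∂(dV n μ) := by
    intro h
    rw [hμdef, ← lintegral_dl_mul hq.le]
    refine lintegral_congr_dV fun w hw => ?_
    rw [enorm_dl_mul _ _ hw]
  have hfin : ∀ f : (Fin n → ℂ) → ℂ, AEMeasurable f (volume.restrict (tube n)) →
      ∫⁻ w, ‖f w‖ₑ ^ q ∂(dV n ν) < ⊤ →
      pker (ν + m + n / 2 + k) ν (fun w => ‖f w‖ₑ) (iE n) < ⊤ := fun f hf hfq =>
    pker_lt_top_of_lintegral hs hq hf.enorm ((H₁ _ hf.enorm).trans_lt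
      (ENNReal.mul_lt_top ENNReal.ofReal_lt_top hfq)) iE_mem
  have hfα : ∀ h : (Fin n → ℂ) → ℂ, AEMeasurable h (volume.restrict (tube n)) →
      ∫⁻ w, ‖h w‖ₑ ^ q ∂(dV n μ) < ⊤ →
      pker (ν + m + n / 2 + k) (ν + m) (fun w => ‖h w‖ₑ) (iE n) < ⊤ := by
    intro h hh hhq
    rw [pker_shift]
    refine lt_of_eq_of_lt (lintegral_congr_dV fun w hw => ?_)
      (hfin _ (aemeas_pow_dl hh m) (by rwa [hdq]))
    simp only [enorm_dl_mul _ _ hw]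
  obtain ⟨C₂, hC₂, H₂⟩ := exists_bop_eq hn hpq (k := k) hμ (α := ν + m) (by linarith)
    (β := β) (by linarith) hN hT hfα
  constructor
  · refine ⟨C₂ * ENNReal.ofReal C₁, ENNReal.mul_ne_top hC₂ ENNReal.ofReal_ne_top,
      fun g hg hgq => ?_⟩
    have hGd := bop_differentiableOn hs hg iE_mem (hfin g hg hgq)
    set G := bop (ν + m + n / 2 + k) ν g with hG
    have hGb : ∫⁻ w, ‖((dl w ^ (k : ℝ) : ℝ) : ℂ) * G w‖ₑ ^ q ∂(dV n μ) ≤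
        ENNReal.ofReal C₁ * ∫⁻ w, ‖g w‖ₑ ^ q ∂(dV n ν) := by
      refine le_trans ?_ (H₁ _ hg.enorm)
      rw [hμdef, ← lintegral_dl_mul hq.le]
      refine lintegral_mono_dV fun w hw => ?_
      have h1 := dl_pos hw
      rw [enorm_dl_mul _ _ hw, ← mul_assoc, ← ENNReal.ofReal_mul (by positivity),
        ← Real.rpow_add h1]
      exact ENNReal.rpow_le_rpow (mul_le_mul' le_rfl (enorm_bop_le _ _ _ _)) hq.le
    obtain ⟨h, hd, hhq, hEq⟩ := H₂ G hGd (hGb.trans_lt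
      (ENNReal.mul_lt_top ENNReal.ofReal_lt_top hgq))
    have hhb : ∫⁻ w, ‖h w‖ₑ ^ q ∂(dV n μ) ≤
        C₂ * ENNReal.ofReal C₁ * ∫⁻ w, ‖g w‖ₑ ^ q ∂(dV n ν) :=
      hhq.trans ((mul_le_mul' le_rfl hGb).trans_eq (mul_assoc _ _ _).symm)
    have hhlt : ∫⁻ w, ‖h w‖ₑ ^ q ∂(dV n μ) < ⊤ := hhb.trans_lt (ENNReal.mul_lt_top
      (ENNReal.mul_ne_top hC₂ ENNReal.ofReal_ne_top).lt_top hgq)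
    refine ⟨h, hd, hhb, fun F hF hFp => ?_⟩
    have P := fun (f : (Fin n → ℂ) → ℂ) hf hfq => bop_pairing hn hpq hq2 hν (M := m + k)
      (C := C₁) (f := f) (by positivity) (by rw [es]; exact H₁) hF hFp hf hfq
    rw [es] at P
    have P1 := P g hg hgq
    have P2 := P _ (aemeas_pow_dl (aemeas_of_diff hd) m) (by rwa [hdq])
    have e : ∫ z, F z * (starRingEnd ℂ) (bop (ν + m + n / 2 + k) ν g z)
        ∂(dV n (ν + (m + k))) = ∫ z, F z * (starRingEnd ℂ) (bop (ν + m + n / 2 + k) ν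
          (fun w => ((dl w ^ (m : ℝ) : ℝ) : ℂ) * h w) z) ∂(dV n (ν + (m + k))) := by
      refine integral_congr_ae ?_
      filter_upwards [ae_dV] with z hz
      rw [← bop_shift, hEq z hz]
    rw [P1, P2] at e
    exact mul_left_cancel₀ (rfC_ne_zero hn (by linarith)) e
  · intro h hd hhq H0
    refine eq_zero_of_bop_eq_zero hn hpq (α := ν + m) (k := k) hμ (by linarith) hkn
      (by linarith) hN hd hhq (hfα h (aemeas_of_diff hd) hhq) fun z hz => ?_
    have hsp : ν + m + n / 2 + k ≤ (ν + m + n / 2 + k) * p := le_mul_of_one_le_right hs hp1.le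
    have hF := H0 (fun w => Ks (ν + m + n / 2 + k) w z) (Ks_differentiableOn _ hz) (by
      refine (le_of_eq ?_).trans_lt (lintegral_kb_lt_top hn
        (a := (ν + m + n / 2 + k) * p) (b := ν) (by linarith) hν (by linarith) hz)
      refine lintegral_congr_dV fun w hw => ?_
      have h1 := norm_kb_pos hz hw
      rw [enorm_Ks, norm_kb_comm, ENNReal.ofReal_rpow_of_pos (by positivity),
        ← Real.rpow_mul h1.le, neg_mul])
    rw [bop_shift, bop, ← (starRingEnd ℂ).injective.eq_iff, map_zero, ← hF, ← integral_conj]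
    refine integral_congr_ae ?_
    filter_upwards [ae_dV] with w hw
    rw [map_mul, Ks_conj _ hz hw]

end Representation

section RieszRepresentation

variable {X : Type*} [MeasurableSpace X]

/-- The inclusion of `L²` into `L^P` for `P ≤ 2` over a finite measure. -/
lemma exists_inclusion (lam : Measure X) [IsFiniteMeasure lam] (P : ℝ≥0∞) [Fact (1 ≤ P)]
    (hP : P ≤ 2) : ∃ ι : Lp ℂ 2 lam →L[ℂ] Lp ℂ P lam, ∀ f : Lp ℂ 2 lam, ι f =ᵐ[lam] f := by
  have hc : lam univ ^ (1 / P.toReal - 1 / (2 : ℝ≥0∞).toReal) ≠ ⊤ := by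
    rcases eq_or_ne (lam univ) 0 with h | h
    · have hP0 : 0 < P.toReal := ENNReal.toReal_pos
        (zero_lt_one.trans_le (Fact.out : 1 ≤ P)).ne' (hP.trans_lt (by simp)).ne
      rw [h]
      refine ENNReal.rpow_ne_top_of_nonneg ?_ (by simp)
      have : P.toReal ≤ (2 : ℝ≥0∞).toReal := ENNReal.toReal_mono (by simp) hP
      exact sub_nonneg.2 (one_div_le_one_div_of_le hP0 this)
    · exact (ENNReal.rpow_lt_top_of_nonneg (sub_nonneg.2 (one_div_le_one_div_of_le
        (ENNReal.toReal_pos (zero_lt_one.trans_le (Fact.out : 1 ≤ P)).ne'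
          (hP.trans_lt (by simp)).ne) (ENNReal.toReal_mono (by simp) hP)))
        (measure_ne_top _ _)).ne
  let L : Lp ℂ 2 lam →ₗ[ℂ] Lp ℂ P lam :=
    { toFun := fun f => ((Lp.memLp f).mono_exponent hP).toLp f
      map_add' := fun f g => by
        ext1
        filter_upwards [MemLp.coeFn_toLp ((Lp.memLp (f + g)).mono_exponent hP),
          Lp.coeFn_add (((Lp.memLp f).mono_exponent hP).toLp f)
            (((Lp.memLp g).mono_exponent hP).toLp g),
          MemLp.coeFn_toLp ((Lp.memLp f).mono_exponent hP),
          MemLp.coeFn_toLp ((Lp.memLp g).mono_exponent hP), Lp.coeFn_add f g] with x h1 h2 h3 h4 h5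
        rw [h1, h2, h5, Pi.add_apply, Pi.add_apply, h3, h4]
      map_smul' := fun c f => by
        ext1
        filter_upwards [MemLp.coeFn_toLp ((Lp.memLp (c • f)).mono_exponent hP),
          Lp.coeFn_smul c (((Lp.memLp f).mono_exponent hP).toLp f),
          MemLp.coeFn_toLp ((Lp.memLp f).mono_exponent hP), Lp.coeFn_smul c f] with x h1 h2 h3 h4
        rw [h1, RingHom.id_apply, h2, h4, Pi.smul_apply, Pi.smul_apply, h3] }
  refine ⟨L.mkContinuous (lam univ ^ (1 / P.toReal - 1 / (2 : ℝ≥0∞).toReal)).toReal fun f => ?_,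
    fun f => MemLp.coeFn_toLp ((Lp.memLp f).mono_exponent hP)⟩
  have h1 := eLpNorm_le_eLpNorm_mul_rpow_measure_univ hP (Lp.memLp f).aestronglyMeasurable
  have h2 : ‖L f‖ = (eLpNorm f P lam).toReal := Lp.norm_toLp _ ((Lp.memLp f).mono_exponent hP)
  rw [h2, Lp.norm_def, ← ENNReal.toReal_mul, mul_comm]
  exact ENNReal.toReal_mono (ENNReal.mul_ne_top (Lp.memLp f).2.ne hc) h1

/-- The dual of `L^p` of a finite measure, `1 < p ≤ 2`. -/
lemma exists_integral_representation {p q : ℝ} (hpq : p.HolderConjugate q) (hp2 : p ≤ 2)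
    (lam : Measure X) [IsFiniteMeasure lam] [Fact (1 ≤ ENNReal.ofReal p)]
    (Γ : Lp ℂ (ENNReal.ofReal p) lam →L[ℂ] ℂ) : ∃ g : X → ℂ, AEStronglyMeasurable g lam ∧
      ∫⁻ x, ‖g x‖ₑ ^ q ∂lam ≤ ‖Γ‖ₑ ^ q ∧
      ∀ f : Lp ℂ (ENNReal.ofReal p) lam, Γ f = ∫ x, f x * g x ∂lam := by
  have hp := hpq.pos
  have hq := hpq.symm.pos
  have hq1 := hpq.symm.lt
  have hP : ENNReal.ofReal p ≤ 2 := by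
    rw [← ENNReal.ofReal_ofNat]; exact ENNReal.ofReal_le_ofReal hp2
  have hP0 : ENNReal.ofReal p ≠ 0 := by simpa using hp
  have hPr : (ENNReal.ofReal p).toReal = p := ENNReal.toReal_ofReal hp.le
  have hQ0 : ENNReal.ofReal q ≠ 0 := by simpa using hq
  have hQr : (ENNReal.ofReal q).toReal = q := ENNReal.toReal_ofReal hq.le
  obtain ⟨ι, hι⟩ := exists_inclusion lam (ENNReal.ofReal p) hP
  set G : Lp ℂ 2 lam := (InnerProductSpace.toDual ℂ (Lp ℂ 2 lam)).symm (Γ ∘L ι) with hG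
  set g : X → ℂ := fun x => (starRingEnd ℂ) (G x) with hg
  have hGm : AEStronglyMeasurable G lam := (Lp.memLp G).aestronglyMeasurable
  have hgm : AEStronglyMeasurable g lam :=
    Complex.continuous_conj.comp_aestronglyMeasurable hGm
  have hrep : ∀ f : Lp ℂ 2 lam, Γ (ι f) = ∫ x, f x * g x ∂lam := by
    intro f
    have h := InnerProductSpace.toDual_symm_apply (𝕜 := ℂ) (x := f) (y := Γ ∘L ι)
    rw [← hG, L2.inner_def] at h
    exact h.symm
  have hbd : ∫⁻ x, ‖g x‖ₑ ^ q ∂lam ≤ ‖Γ‖ₑ ^ q := by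
    set S : ℕ → Set X := fun N => {x | ‖hGm.mk G x‖ ≤ N} with hS
    have hSm : ∀ N, MeasurableSet (S N) := fun N =>
      hGm.stronglyMeasurable_mk.norm.measurable measurableSet_Iic
    set A : ℕ → ℝ≥0∞ := fun N => ∫⁻ x in S N, ‖hGm.mk G x‖ₑ ^ q ∂lam with hA
    have hAb : ∀ N, A N ≤ ‖Γ‖ₑ ^ q := by
      intro N
      set φ : X → ℂ := (S N).indicator fun x =>
        ((‖hGm.mk G x‖ ^ (q - 2) : ℝ) : ℂ) * hGm.mk G x with hφ
      have hq2 : 0 ≤ q - 2 := by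
        have := hpq.inv_add_inv_eq_one
        have h2 : (2 : ℝ)⁻¹ ≤ p⁻¹ := inv_anti₀ hp hp2
        have h3 : q⁻¹ ≤ (2 : ℝ)⁻¹ := by norm_num at h2 ⊢; linarith
        linarith [(inv_le_inv₀ hq (by norm_num)).1 h3]
      have hφm : AEStronglyMeasurable φ lam :=
        (((hGm.stronglyMeasurable_mk.norm.measurable.pow_const
          _).complex_ofReal.mul hGm.stronglyMeasurable_mk.measurable).indicator
            (hSm N)).aestronglyMeasurable
      have hφe : ∀ x ∈ S N, ‖φ x‖ = ‖hGm.mk G x‖ ^ (q - 1) := by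
        intro x hx
        rw [hφ, indicator_of_mem hx, norm_mul, norm_real, Real.norm_of_nonneg (by positivity),
          ← Real.rpow_add_one' (norm_nonneg _) (by linarith)]
        congr 1; ring
      have hφb : ∀ᵐ x ∂lam, ‖φ x‖ ≤ (N : ℝ) ^ (q - 1) := by
        refine Filter.Eventually.of_forall fun x => ?_
        by_cases hx : x ∈ S N
        · rw [hφe x hx]
          exact Real.rpow_le_rpow (norm_nonneg _) hx (by linarith)
        · rw [hφ, indicator_of_notMem hx, norm_zero]; positivity
      have hφ2 : MemLp φ 2 lam := MemLp.of_bound hφm _ hφb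
      have h1 := hrep (hφ2.toLp φ)
      have hAe : A N = ENNReal.ofReal (∫ x in S N, ‖hGm.mk G x‖ ^ q ∂lam) := by
        rw [ofReal_integral_eq_lintegral_ofReal]
        · refine lintegral_congr fun x => ?_
          rw [← ofReal_norm, ENNReal.ofReal_rpow_of_nonneg (norm_nonneg _) hq.le]
        · refine Integrable.of_bound (C := (N : ℝ) ^ q)
            (hGm.stronglyMeasurable_mk.norm.measurable.pow_const _).aestronglyMeasurable ?_
          filter_upwards [ae_restrict_mem (hSm N)] with x hx
          rw [Real.norm_of_nonneg (by positivity)]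
          exact Real.rpow_le_rpow (norm_nonneg _) hx hq.le
        · exact Filter.Eventually.of_forall fun x => by positivity
      have h2 : ∫ x, hφ2.toLp φ x * g x ∂lam =
          ((∫ x in S N, ‖hGm.mk G x‖ ^ q ∂lam : ℝ) : ℂ) := by
        rw [← integral_complex_ofReal, ← integral_indicator (hSm N)]
        refine integral_congr_ae ?_
        filter_upwards [hφ2.coeFn_toLp, hGm.ae_eq_mk] with x hx hx2
        rw [hx, hg]
        simp only
        rw [hx2]
        by_cases hxs : x ∈ S N
        · rw [indicator_of_mem hxs, hφ, indicator_of_mem hxs, mul_assoc, Complex.mul_conj,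
            ← ofReal_mul, normSq_eq_norm_sq]
          congr 1
          rw [← Real.rpow_natCast, ← Real.rpow_add' (norm_nonneg _) (by push_cast; linarith)]
          congr 1; push_cast; ring
        · rw [indicator_of_notMem hxs, hφ, indicator_of_notMem hxs, zero_mul]
      have h3 : ‖Γ (ι (hφ2.toLp φ))‖ₑ = A N := by
        rw [h1, h2, hAe, ← ofReal_norm, norm_real, Real.norm_of_nonneg]
        exact integral_nonneg fun x => by positivity
      have h4 : ‖ι (hφ2.toLp φ)‖ₑ = A N ^ (1 / p) := by
        rw [Lp.enorm_def, eLpNorm_congr_ae ((hι _).trans hφ2.coeFn_toLp),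
          eLpNorm_eq_lintegral_rpow_enorm_toReal hP0 ENNReal.ofReal_ne_top, hPr]
        congr 1
        rw [hA]
        simp only
        rw [← lintegral_indicator (hSm N)]
        refine lintegral_congr fun x => ?_
        by_cases hxs : x ∈ S N
        · rw [indicator_of_mem hxs, ← ofReal_norm, hφe x hxs,
            ENNReal.ofReal_rpow_of_nonneg (by positivity) hp.le, ← Real.rpow_mul (norm_nonneg _),
            hpq.symm.sub_one_mul_conj, ← ofReal_norm,
            ENNReal.ofReal_rpow_of_nonneg (norm_nonneg _) hq.le]
        · rw [indicator_of_notMem hxs, hφ, indicator_of_notMem hxs, enorm_zero,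
            ENNReal.zero_rpow_of_pos hp]
      refine le_rpow_of_le_mul_rpow hpq.symm (by rw [hAe]; exact ENNReal.ofReal_ne_top) ?_
      rw [← h4]
      conv_lhs => rw [← h3]
      exact Γ.le_opENorm _
    have hmono : Monotone S := fun N M hNM x (hx : ‖hGm.mk G x‖ ≤ N) =>
      show ‖hGm.mk G x‖ ≤ M from hx.trans (by exact_mod_cast hNM)
    have hU : ⋃ N, S N = univ := by
      refine eq_univ_of_forall fun x => mem_iUnion.2 ?_
      exact exists_nat_ge ‖hGm.mk G x‖
    calc ∫⁻ x, ‖g x‖ₑ ^ q ∂lam = ∫⁻ x in ⋃ N, S N, ‖hGm.mk G x‖ₑ ^ q ∂lam := by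
          rw [hU, setLIntegral_univ]
          refine lintegral_congr_ae ?_
          filter_upwards [hGm.ae_eq_mk] with x hx
          rw [hg]
          simp only
          rw [RCLike.enorm_conj, hx]
      _ = ⨆ N, A N := by
          rw [setLIntegral_iUnion_of_directed _ hmono.directed_le]
      _ ≤ ‖Γ‖ₑ ^ q := iSup_le hAb
  refine ⟨g, hgm, hbd, ?_⟩
  · intro f
    have hgq : ∫⁻ x, ‖g x‖ₑ ^ q ∂lam < ⊤ := hbd.trans_lt
      (ENNReal.rpow_lt_top_of_nonneg hq.le enorm_ne_top)
    have hgL : MemLp g (ENNReal.ofReal q) lam := by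
      refine ⟨hgm, ?_⟩
      rw [eLpNorm_eq_lintegral_rpow_enorm_toReal hQ0 ENNReal.ofReal_ne_top, hQr]
      exact ENNReal.rpow_lt_top_of_nonneg (by positivity) hgq.ne
    have : Fact (1 ≤ ENNReal.ofReal q) := ⟨by
      rw [← ENNReal.ofReal_one]; exact ENNReal.ofReal_le_ofReal hq1.le⟩
    have : ENNReal.HolderConjugate (ENNReal.ofReal q) (ENNReal.ofReal p) :=
      hpq.symm.ennrealOfReal
    set B : Lp ℂ (ENNReal.ofReal p) lam →L[ℂ] ℂ :=
      (ContinuousLinearMap.mul ℂ ℂ).lpPairing lam (ENNReal.ofReal q) (ENNReal.ofReal p)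
        (hgL.toLp g) with hB
    have hBe : ∀ f : Lp ℂ (ENNReal.ofReal p) lam, B f = ∫ x, f x * g x ∂lam := by
      intro f
      rw [hB, ContinuousLinearMap.lpPairing_eq_integral]
      refine integral_congr_ae ?_
      filter_upwards [hgL.coeFn_toLp] with x hx
      rw [hx, ContinuousLinearMap.mul_apply', mul_comm]
    rw [← hBe]
    refine Lp.induction ENNReal.ofReal_ne_top (motive := fun f => Γ f = B f) ?_ ?_ ?_ f
    · intro c s hs hμs
      have h2 : ι (indicatorConstLp 2 hs hμs.ne c) =
          (Lp.simpleFunc.indicatorConst (ENNReal.ofReal p) hs hμs.ne c :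
            Lp ℂ (ENNReal.ofReal p) lam) := by
        rw [Lp.simpleFunc.coe_indicatorConst]
        ext1
        exact ((hι _).trans indicatorConstLp_coeFn).trans indicatorConstLp_coeFn.symm
      rw [← h2, hrep, hBe]
      refine integral_congr_ae ?_
      filter_upwards [hι (indicatorConstLp 2 hs hμs.ne c)] with x hx
      rw [hx]
    · intro f g hf hg _ h1 h2
      rw [map_add, map_add, h1, h2]
    · exact isClosed_eq Γ.continuous B.continuous

end RieszRepresentation

section FunctionalRepresentation

variable {X : Type*} [MeasurableSpace X]

lemma lintegral_enorm_weight_mul {μ : Measure X} {w : X → NNReal} (hw : Measurable w) {s : ℝ}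
    (hs : 0 < s) (f : X → ℂ) :
    ∫⁻ x, ‖(((w x : ℝ) ^ (1 / s) : ℝ) : ℂ) * f x‖ₑ ^ s ∂μ =
      ∫⁻ x, ‖f x‖ₑ ^ s ∂(μ.withDensity fun x => (w x : ℝ≥0∞)) := by
  rw [lintegral_withDensity_eq_lintegral_mul_non_measurable _ hw.coe_nnreal_ennreal
    (Filter.Eventually.of_forall fun x => ENNReal.coe_lt_top)]
  refine lintegral_congr fun x => ?_
  rw [Pi.mul_apply, enorm_mul, ENNReal.mul_rpow_of_nonneg _ _ hs.le]
  congr 1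
  rw [← ofReal_norm, norm_real, Real.norm_of_nonneg (by positivity),
    ENNReal.ofReal_rpow_of_nonneg (by positivity) hs.le, ← Real.rpow_mul (by positivity),
    one_div_mul_cancel hs.ne', Real.rpow_one, ENNReal.ofReal_coe_nnreal]

/-- The dual of `L^p` of a σ-finite measure, `1 < p ≤ 2`. -/
lemma exists_integral_representation_of_sigmaFinite {p q : ℝ} (hpq : p.HolderConjugate q)
    (hp2 : p ≤ 2) (μ : Measure X) [SigmaFinite μ] [Fact (1 ≤ ENNReal.ofReal p)]
    (Γ : Lp ℂ (ENNReal.ofReal p) μ →L[ℂ] ℂ) : ∃ g : X → ℂ, AEStronglyMeasurable g μ ∧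
      ∫⁻ x, ‖g x‖ₑ ^ q ∂μ ≤ ‖Γ‖ₑ ^ q ∧
      ∀ f : Lp ℂ (ENNReal.ofReal p) μ, Γ f = ∫ x, f x * g x ∂μ := by
  have hp := hpq.pos
  have hq := hpq.symm.pos
  have hP0 : ENNReal.ofReal p ≠ 0 := by simpa using hp
  have hPr : (ENNReal.ofReal p).toReal = p := ENNReal.toReal_ofReal hp.le
  obtain ⟨w, hw0, hw, hwi⟩ := exists_pos_lintegral_lt_of_sigmaFinite μ (ε := 1) one_ne_zero
  set lam : Measure X := μ.withDensity fun x => (w x : ℝ≥0∞) with hlam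
  have : IsFiniteMeasure lam := isFiniteMeasure_withDensity (hwi.trans_le le_top).ne
  have hac : μ ≪ lam := withDensity_absolutelyContinuous' hw.coe_nnreal_ennreal.aemeasurable
    (Filter.Eventually.of_forall fun x => by simpa using (hw0 x).ne')
  have hac' : lam ≪ μ := withDensity_absolutelyContinuous _ _
  have hwp : ∀ s : ℝ, Measurable fun x => (((w x : ℝ) ^ s : ℝ) : ℂ) := fun s =>
    (hw.coe_nnreal_real.pow_const s).complex_ofReal
  have hnorm : ∀ f : X → ℂ,
      eLpNorm (fun x => (((w x : ℝ) ^ (1 / p) : ℝ) : ℂ) * f x) (ENNReal.ofReal p) μ =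
        eLpNorm f (ENNReal.ofReal p) lam := fun f => by
    rw [eLpNorm_eq_lintegral_rpow_enorm_toReal hP0 ENNReal.ofReal_ne_top, hPr,
      eLpNorm_eq_lintegral_rpow_enorm_toReal hP0 ENNReal.ofReal_ne_top, hPr,
      lintegral_enorm_weight_mul hw hp]
  have hmem : ∀ f : Lp ℂ (ENNReal.ofReal p) lam,
      MemLp (fun x => (((w x : ℝ) ^ (1 / p) : ℝ) : ℂ) * f x) (ENNReal.ofReal p) μ := fun f =>
    ⟨(hwp _).aestronglyMeasurable.mul ((Lp.memLp f).aestronglyMeasurable.mono_ac hac), by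
      rw [hnorm]; exact (Lp.memLp f).2⟩
  let L : Lp ℂ (ENNReal.ofReal p) lam →ₗ[ℂ] Lp ℂ (ENNReal.ofReal p) μ :=
    { toFun := fun f => (hmem f).toLp _
      map_add' := fun f g => by
        ext1
        filter_upwards [(hmem (f + g)).coeFn_toLp, Lp.coeFn_add ((hmem f).toLp _)
          ((hmem g).toLp _), (hmem f).coeFn_toLp, (hmem g).coeFn_toLp,
          hac.ae_le (Lp.coeFn_add f g)] with x h1 h2 h3 h4 h5
        rw [h1, h2, h5, Pi.add_apply, Pi.add_apply, h3, h4, mul_add]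
      map_smul' := fun c f => by
        ext1
        filter_upwards [(hmem (c • f)).coeFn_toLp, Lp.coeFn_smul c ((hmem f).toLp _),
          (hmem f).coeFn_toLp, hac.ae_le (Lp.coeFn_smul c f)] with x h1 h2 h3 h4
        rw [h1, RingHom.id_apply, h2, h4, Pi.smul_apply, Pi.smul_apply, h3, smul_eq_mul,
          smul_eq_mul, mul_left_comm] }
  have hL : ∀ f, ‖L f‖ ≤ 1 * ‖f‖ := fun f => by
    have h2 : ‖L f‖ = (eLpNorm (fun x => (((w x : ℝ) ^ (1 / p) : ℝ) : ℂ) * f x)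
      (ENNReal.ofReal p) μ).toReal := Lp.norm_toLp _ (hmem f)
    rw [h2, hnorm, one_mul, Lp.norm_def]
  set T := L.mkContinuous 1 hL with hT
  obtain ⟨g₀, hg₀, hgb, hgr⟩ := exists_integral_representation hpq hp2 lam (Γ ∘L T)
  refine ⟨fun x => (((w x : ℝ) ^ (1 / q) : ℝ) : ℂ) * g₀ x,
    (hwp _).aestronglyMeasurable.mul (hg₀.mono_ac hac), ?_, fun f => ?_⟩
  · rw [lintegral_enorm_weight_mul hw hq]
    refine hgb.trans (ENNReal.rpow_le_rpow ?_ hq.le)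
    have h1 : ‖Γ ∘L T‖ ≤ ‖Γ‖ := by
      refine (Γ.opNorm_comp_le T).trans ?_
      exact mul_le_of_le_one_right (norm_nonneg _) (L.mkContinuous_norm_le zero_le_one hL)
    rw [← ofReal_norm, ← ofReal_norm]
    exact ENNReal.ofReal_le_ofReal h1
  · have hw1 : ∀ x, (((w x : ℝ) ^ (1 / p) : ℝ) : ℂ) *
        ((((w x : ℝ) ^ (-(1 / p)) : ℝ) : ℂ) * f x) = f x := fun x => by
      rw [← mul_assoc, ← ofReal_mul, ← Real.rpow_add (by exact_mod_cast hw0 x),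
        add_neg_cancel, Real.rpow_zero, ofReal_one, one_mul]
    have hmf : MemLp (fun x => (((w x : ℝ) ^ (-(1 / p)) : ℝ) : ℂ) * f x) (ENNReal.ofReal p)
        lam := by
      refine ⟨((hwp _).aestronglyMeasurable.mul (Lp.memLp f).aestronglyMeasurable).mono_ac hac',
        ?_⟩
      rw [← hnorm]
      simp only [hw1]
      exact (Lp.memLp f).2
    have hTf : T (hmf.toLp _) = f := by
      ext1
      refine (hmem (hmf.toLp _)).coeFn_toLp.trans ?_
      filter_upwards [hac.ae_le hmf.coeFn_toLp] with x hx
      rw [hx, hw1]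
    have h1 := hgr (hmf.toLp _)
    rw [ContinuousLinearMap.comp_apply, hTf] at h1
    refine (h1.trans (integral_withDensity_eq_integral_smul hw _)).trans ?_
    refine integral_congr_ae ?_
    filter_upwards [hac.ae_le hmf.coeFn_toLp] with x hx
    have h2 : (w x : ℝ) * (w x : ℝ) ^ (-(1 / p)) = (w x : ℝ) ^ (1 / q) := by
      have := hpq.inv_add_inv_eq_one
      rw [← Real.rpow_one_add' (by positivity) (by
        rw [one_div]; intro h; have := inv_pos.2 hq; linarith)]
      congr 1
      rw [one_div, one_div]; linarith
    rw [hx, NNReal.smul_def, Complex.real_smul, ← h2]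
    push_cast
    ring

/-- A bounded functional on a linear space of `L^p` functions is integration against an `L^q`
function. -/
lemma exists_functional_representation {p q : ℝ} (hpq : p.HolderConjugate q)
    (hp2 : p ≤ 2) (μ : Measure X) [SigmaFinite μ] (A : Submodule ℂ (X → ℂ))
    (hA : ∀ F ∈ A, MemLp F (ENNReal.ofReal p) μ) (γ : A →ₗ[ℂ] ℂ) {C : ℝ} (hC : 0 ≤ C)
    (hγ : ∀ F : A, ‖γ F‖ ≤ C * (eLpNorm (F : X → ℂ) (ENNReal.ofReal p) μ).toReal) :
    ∃ g : X → ℂ, AEStronglyMeasurable g μ ∧ ∫⁻ x, ‖g x‖ₑ ^ q ∂μ ≤ ENNReal.ofReal C ^ q ∧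
      ∀ F : A, γ F = ∫ x, (F : X → ℂ) x * g x ∂μ := by
  have : Fact (1 ≤ ENNReal.ofReal p) := ⟨by
    rw [← ENNReal.ofReal_one]; exact ENNReal.ofReal_le_ofReal hpq.lt.le⟩
  let j : A →ₗ[ℂ] Lp ℂ (ENNReal.ofReal p) μ :=
    { toFun := fun F => (hA F F.2).toLp _
      map_add' := fun F G => rfl
      map_smul' := fun c F => rfl }
  have hj : ∀ F : A, ‖j F‖ = (eLpNorm (F : X → ℂ) (ENNReal.ofReal p) μ).toReal := fun F =>
    Lp.norm_toLp _ (hA F F.2)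
  have hker : LinearMap.ker j ≤ LinearMap.ker γ := fun F hF => by
    rw [LinearMap.mem_ker] at hF ⊢
    have h := hγ F
    rw [← hj, hF, norm_zero, mul_zero] at h
    exact norm_le_zero_iff.1 h
  let γ' : LinearMap.range j →ₗ[ℂ] ℂ :=
    (LinearMap.ker j).liftQ γ hker ∘ₗ j.quotKerEquivRange.symm.toLinearMap
  have hγ' : ∀ F : A, γ' ⟨j F, LinearMap.mem_range_self j F⟩ = γ F := fun F => by
    have h := j.quotKerEquivRange_symm_apply_image F (LinearMap.mem_range_self j F)
    show (LinearMap.ker j).liftQ γ hker (j.quotKerEquivRange.symm _) = _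
    rw [h]
    rfl
  have hγb : ∀ f : LinearMap.range j, ‖γ' f‖ ≤ C * ‖f‖ := by
    rintro ⟨_, F, rfl⟩
    rw [hγ' F, Submodule.coe_norm, hj]
    exact hγ F
  obtain ⟨Γ, hΓ, hΓn⟩ := exists_extension_norm_eq (LinearMap.range j) (γ'.mkContinuous C hγb)
  obtain ⟨g, hg, hgb, hgr⟩ := exists_integral_representation_of_sigmaFinite hpq hp2 μ Γ
  refine ⟨g, hg, hgb.trans (ENNReal.rpow_le_rpow ?_ hpq.symm.nonneg), fun F => ?_⟩
  · rw [← ofReal_norm, hΓn]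
    exact ENNReal.ofReal_le_ofReal (γ'.mkContinuous_norm_le hC hγb)
  · have h1 := hΓ ⟨j F, LinearMap.mem_range_self j F⟩
    rw [LinearMap.mkContinuous_apply, hγ'] at h1
    rw [← h1, hgr]
    refine integral_congr_ae ?_
    filter_upwards [(hA F F.2).coeFn_toLp] with x hx
    exact congrArg (· * g x) hx

end FunctionalRepresentation

section Solvability

variable {n : ℕ} [NeZero n]

open Polynomial in
/-- A polynomial with a zero of order `m` at `1`, equal to `1` up to a gap of length `κ` in its
coefficients. -/
lemma exists_gap_polynomial (m : ℕ) {κ : ℕ} (hκ : 0 < κ) :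
    ∃ g Q : ℂ[X], g = (X - C 1) ^ m * Q ∧ g.natDegree < κ + m ∧ g.coeff 0 = 1 ∧
      ∀ j, 0 < j → j < κ → g.coeff j = 0 := by
  have hmon : ((X - C 1 : ℂ[X]) ^ m).Monic := (monic_X_sub_C 1).pow m
  have hdeg : ((X - C 1 : ℂ[X]) ^ m).degree = m := by
    rw [degree_pow, degree_X_sub_C, nsmul_one]
  have hcop : IsCoprime (X ^ κ : ℂ[X]) ((X - C 1) ^ m) := by
    refine IsCoprime.pow ⟨1, -1, ?_⟩
    rw [C_1]; ring
  obtain ⟨u, v, huv⟩ := hcop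
  set P := (-u) %ₘ ((X - C 1) ^ m) with hP
  have hPd : P.degree < m := hdeg ▸ degree_modByMonic_lt _ hmon
  have hPe := modByMonic_add_div (-u) ((X - C 1 : ℂ[X]) ^ m)
  refine ⟨1 + X ^ κ * P, v - X ^ κ * ((-u) /ₘ (X - C 1) ^ m), ?_, ?_, ?_, fun j h0 hj => ?_⟩
  · linear_combination huv.symm + X ^ κ * hPe
  · rcases eq_or_ne P 0 with h | h
    · rw [h, mul_zero, add_zero, natDegree_one]; omega
    · have h1 : P.natDegree < m := (natDegree_lt_iff_degree_lt h).2 hPd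
      refine (natDegree_add_le _ _).trans_lt (max_lt (by rw [natDegree_one]; omega) ?_)
      refine natDegree_mul_le.trans_lt ?_
      rw [natDegree_X_pow]; omega
  · rw [coeff_add, coeff_one_zero, coeff_X_pow_mul', if_neg (by omega), add_zero]
  · rw [coeff_add, coeff_one, if_neg (by omega), coeff_X_pow_mul', if_neg (by omega), add_zero]

lemma boxC_eq_zero {s : ℝ} {j m : ℕ} (i : ℕ) (hi : i < m) (h : s + i + 1 - n / 2 - j = 0) :
    boxC n s j m = 0 :=
  Finset.prod_eq_zero (Finset.mem_range.2 hi) (by rw [h, mul_zero])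

lemma el_iE (hn : 2 ≤ n) : el (iE n) = 1 := by
  obtain ⟨k, rfl⟩ := Nat.exists_eq_add_of_le' hn
  rw [el, imP_iE, nul, eVec, Pi.single_eq_same, Pi.single_eq_of_ne (by simp), add_zero]

lemma nt_im (z w : Fin n → ℂ) : (nt z w).im = el z + el w := by
  have h := imP_sub_cj z w
  have h0 := congrFun h 0
  have h1 := congrFun h 1
  simp only [imP, Pi.add_apply] at h0 h1
  rw [nt, add_im, h0, h1, el, el, nul, nul]
  simp only [imP]
  ring

lemma one_add_el_le_norm_nt (hn : 2 ≤ n) (w : Fin n → ℂ) : 1 + el w ≤ ‖nt (iE n) w‖ := by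
  rw [← el_iE hn, ← nt_im]
  exact (le_abs_self _).trans (abs_im_le_norm _)

/-- Trading decay of the kernel for decay in the null direction. -/
lemma lintegral_trade (hn : 2 ≤ n) {r b t : ℝ} (ha : (n : ℝ) < r - t)
    (hb : (n : ℝ) / 2 - 1 < b) (hab : b < r - t - n / 2)
    (h : ∫⁻ w : Fin n → ℂ, ENNReal.ofReal (kE w ^ (-r)) ∂(dV n b) < ⊤) :
    ∫⁻ w : Fin n → ℂ, ENNReal.ofReal (kE w ^ (-(r - t))) *
      ENNReal.ofReal ((1 + el w) ^ (-t)) ∂(dV n b) < ⊤ := by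
  have hfr : ∀ a (φ : ℝ → ℝ≥0∞), Measurable φ →
      ∫⁻ w : Fin n → ℂ, ENNReal.ofReal (kE w ^ (-a)) * φ (el w) ∂(dV n b) = frC n a b *
        ∫⁻ u in Ioi (0 : ℝ), ENNReal.ofReal (u ^ (b - 1) * (1 + u) ^ (n - 1 - a)) * φ u := by
    intro a φ hφ
    have h1 := forelli_rudin_eq hn iE_mem a b hφ
    rw [el_iE hn, dl_iE, div_one, Real.one_rpow, Real.one_rpow, mul_one, ENNReal.ofReal_one,
      mul_one] at h1
    rw [← h1, lintegral_dV]
    refine lintegral_congr fun w => ?_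
    rw [kE, norm_kb_comm]
    ring
  have e1 : ∫⁻ w : Fin n → ℂ, ENNReal.ofReal (kE w ^ (-r)) ∂(dV n b) = frC n r b *
        ∫⁻ u in Ioi (0 : ℝ), ENNReal.ofReal (u ^ (b - 1) * (1 + u) ^ (n - 1 - r)) := by
    simpa using hfr r (fun _ => 1) measurable_const
  have hne : ∫⁻ w : Fin n → ℂ, ENNReal.ofReal (kE w ^ (-r)) ∂(dV n b) ≠ 0 := by
    intro h0
    rw [lintegral_eq_zero_iff (by
      exact (continuous_kE.measurable.pow_const _).ennreal_ofReal)] at h0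
    refine dV_tube_ne_zero (n := n) b (measure_mono_null (fun w hw => ?_) h0)
    have := Real.rpow_pos_of_pos (kE_pos hw) (-r)
    simpa using this
  rw [e1] at h hne
  rw [hfr (r - t) (fun x => ENNReal.ofReal ((1 + x) ^ (-t))) (by fun_prop)]
  refine ENNReal.mul_lt_top (frC_lt_top hn ha hb hab) ?_
  have e2 : ∫⁻ u in Ioi (0 : ℝ), ENNReal.ofReal (u ^ (b - 1) * (1 + u) ^ (n - 1 - (r - t))) *
      ENNReal.ofReal ((1 + u) ^ (-t)) =
      ∫⁻ u in Ioi (0 : ℝ), ENNReal.ofReal (u ^ (b - 1) * (1 + u) ^ (n - 1 - r)) := by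
    refine setLIntegral_congr_fun measurableSet_Ioi fun u hu => ?_
    have hu' : (0 : ℝ) < u := hu
    have hu1 : 0 < 1 + u := by linarith
    rw [← ENNReal.ofReal_mul (by positivity), mul_assoc, ← Real.rpow_add hu1]
    congr 3
    ring
  rw [e2]
  exact lt_top_iff_ne_top.2 fun hU => by
    rw [hU, ENNReal.mul_top (left_ne_zero_of_mul hne)] at h
    exact lt_irrefl _ h

lemma lintegral_trade_mul_lt_top (hn : 2 ≤ n) {p q : ℝ} (hpq : p.HolderConjugate q)
    {μ β t : ℝ} (hμ : (n : ℝ) / 2 - 1 < μ) (hβ : μ ≤ β) (ht : n ≤ β + n / 2 - t)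
    (htμ : t * q < μ + n / 2)
    (h : ∫⁻ w : Fin n → ℂ, omW (-(β + n / 2)) (μ - β) w ^ p ∂(dV n μ) < ⊤)
    {f : (Fin n → ℂ) → ℝ≥0∞} (hf : AEMeasurable f (volume.restrict (tube n)))
    (hfq : ∫⁻ w, f w ^ q ∂(dV n μ) < ⊤) :
    ∫⁻ w, ENNReal.ofReal (kE w ^ (-(β + n / 2 - t)) * (1 + el w) ^ (-t)) * f w ∂(dV n β) < ⊤ := by
  have hp := hpq.pos
  have hp1 := hpq.lt
  have hq := hpq.symm.pos
  have hn0 : (0 : ℝ) < n := by exact_mod_cast (by omega : 0 < n)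
  have hqp : q * (p - 1) = p := by rw [mul_comm]; exact hpq.sub_one_mul_conj
  have hb : (n : ℝ) / 2 - 1 < μ + (β - μ) * p := by nlinarith
  have htp : t * p < (μ + n / 2) * (p - 1) := by
    have := mul_lt_mul_of_pos_right htμ (sub_pos.2 hp1)
    rwa [mul_assoc, hqp] at this
  have e1 : ∫⁻ w : Fin n → ℂ, omW (-(β + n / 2)) (μ - β) w ^ p ∂(dV n μ) =
      ∫⁻ w : Fin n → ℂ, ENNReal.ofReal (kE w ^ (-((β + n / 2) * p)))
        ∂(dV n (μ + (β - μ) * p)) := by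
    rw [← lintegral_dV_shift]
    refine lintegral_congr_dV fun w hw => ?_
    have h1 := kE_pos hw
    have h2 := dl_pos hw
    rw [omW, ENNReal.ofReal_rpow_of_pos (by positivity), ← ENNReal.ofReal_mul (by positivity),
      Real.mul_rpow (by positivity) (by positivity), ← Real.rpow_mul h1.le,
      ← Real.rpow_mul h2.le, mul_comm, neg_sub, neg_mul]
  rw [e1] at h
  have h3 := lintegral_trade hn (t := t * p) (b := μ + (β - μ) * p) (by nlinarith) hb
    (by nlinarith) h
  set A : (Fin n → ℂ) → ℝ≥0∞ := fun w =>
    ENNReal.ofReal (dl w ^ (β - μ) * (kE w ^ (-(β + n / 2 - t)) * (1 + el w) ^ (-t))) with hA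
  have hAm : Measurable A := by
    refine ((continuous_dl.measurable.pow_const _).mul
      ((continuous_kE.measurable.pow_const _).mul
        ((continuous_el.measurable.const_add 1).pow_const _))).ennreal_ofReal
  have e2 : ∫⁻ w, A w ^ p ∂(dV n μ) < ⊤ := by
    refine lt_of_eq_of_lt ?_ h3
    rw [← lintegral_dV_shift]
    refine lintegral_congr_dV fun w hw => ?_
    have h1 := kE_pos hw
    have h2 := dl_pos hw
    have h4 : 0 < 1 + el w := by linarith [el_pos hn hw]
    rw [hA]
    simp only
    rw [ENNReal.ofReal_rpow_of_pos (by positivity), ← ENNReal.ofReal_mul (by positivity),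
      ← ENNReal.ofReal_mul (by positivity), Real.mul_rpow (by positivity) (by positivity),
      Real.mul_rpow (by positivity) (by positivity), ← Real.rpow_mul h1.le,
      ← Real.rpow_mul h2.le, ← Real.rpow_mul h4.le]
    congr 4 <;> ring
  have e3 : ∫⁻ w, ENNReal.ofReal (kE w ^ (-(β + n / 2 - t)) * (1 + el w) ^ (-t)) * f w
      ∂(dV n β) = ∫⁻ w, A w * f w ∂(dV n μ) := by
    conv_lhs => rw [show β = μ + (β - μ) by ring, ← lintegral_dV_shift]
    refine lintegral_congr_dV fun w hw => ?_
    have h2 := dl_pos hw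
    rw [← mul_assoc, ← ENNReal.ofReal_mul (by positivity), hA]
    simp only [add_sub_cancel]
  rw [e3]
  refine (ENNReal.lintegral_mul_le_Lp_mul_Lq (dV n μ) hpq hAm.aemeasurable
    (aemeas_dV hf μ)).trans_lt ?_
  exact ENNReal.mul_lt_top (ENNReal.rpow_lt_top_of_nonneg (by positivity) e2.ne)
    (ENNReal.rpow_lt_top_of_nonneg (by positivity) hfq.ne)

end Solvability

section SolvabilityMain

variable {n : ℕ} [NeZero n]

/-- Surjectivity of `□^m` onto a weighted Bergman space. -/
theorem exists_BoxOp_iter_eq (hn : 2 ≤ n) {p q : ℝ} (hpq : p.HolderConjugate q) {μ : ℝ}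
    (hμ : (n : ℝ) / 2 - 1 < μ) (hH : hardy n q μ) (m : ℕ) (hmμ : m * q < μ + n / 2)
    {h : (Fin n → ℂ) → ℂ} (hh : DifferentiableOn ℂ h (tube n))
    (hhq : ∫⁻ w, ‖h w‖ₑ ^ q ∂(dV n μ) < ⊤) :
    ∃ G : (Fin n → ℂ) → ℂ, DifferentiableOn ℂ G (tube n) ∧
      ∀ z ∈ tube n, BoxOp^[m] G z = h z := by
  have hn' : (2 : ℝ) ≤ n := by exact_mod_cast hn
  obtain ⟨β₀, hβ₀, HB⟩ := bergman_bounded hn hpq hμ hH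
  obtain ⟨N, hN⟩ := exists_nat_ge (β₀ + m + n)
  have hm0 : (0 : ℝ) ≤ m := Nat.cast_nonneg m
  have hβμ : μ ≤ (N : ℝ) := by linarith
  have hfin := (HB N (by linarith)).1
  have hmN : m < N := by
    have : (m : ℝ) < N := by linarith
    exact_mod_cast this
  set κ := N - m + 1 with hκ
  have hκ0 : 0 < κ := by omega
  obtain ⟨g, Q, hg, hgd, hg0, hgz⟩ := exists_gap_polynomial m hκ0
  set s : ℝ := N + n / 2 - m with hs
  have hs0 : 0 ≤ s := by linarith
  have hsm : s + m = N + n / 2 := by rw [hs]; ring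
  have hb0 : ((boxC n s 0 m : ℝ) : ℂ) ≠ 0 := by
    exact_mod_cast boxC_ne_zero hn (by linarith) m
  have hbj : ∀ j ∈ Finset.range (κ + m), j ≠ 0 → ((boxC n s j m : ℝ) : ℂ) * g.coeff j = 0 := by
    intro j hj hj0
    rw [Finset.mem_range] at hj
    rcases lt_or_ge j κ with h1 | h1
    · rw [hgz j (by omega) h1, mul_zero]
    · rw [boxC_eq_zero (j - κ) (by omega), ofReal_zero, zero_mul]
      rw [Nat.cast_sub h1, hκ, Nat.cast_add, Nat.cast_sub hmN.le, Nat.cast_one, hs]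
      ring
  have hmeas := aemeas_of_diff hh
  have hrf := rfC_ne_zero (n := n) hn (γ := N) (by linarith)
  set c : ℂ := (((boxC n s 0 m : ℝ) : ℂ) * rfC n N)⁻¹ with hc
  set R : (Fin n → ℂ) → (Fin n → ℂ) → ℂ := fun z w =>
    ∑ j ∈ Finset.range (κ + m), (c * h w * (g.coeff j / nt (iE n) w ^ j)) *
      (Ks s z w * nt z w ^ j) with hR
  have hnt : ∀ w ∈ tube n, nt (iE n) w ≠ 0 := fun w hw h0 => by
    have h1 := one_add_el_le_norm_nt hn w
    rw [h0, norm_zero] at h1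
    linarith [el_pos hn hw]
  have hRe : ∀ z, ∀ w ∈ tube n,
      R z w = c * h w * (Ks s z w * g.eval (nt z w / nt (iE n) w)) := by
    intro z w hw
    rw [hR, Polynomial.eval_eq_sum_range' hgd, Finset.mul_sum, Finset.mul_sum]
    refine Finset.sum_congr rfl fun j _ => ?_
    rw [div_pow]
    ring
  have hRd : ∀ w ∈ tube n, DifferentiableOn ℂ (fun z => R z w) (tube n) := fun w hw =>
    DifferentiableOn.fun_sum fun j _ => (Ks_nt_differentiableOn s j hw).const_mul _
  have hRb : ∀ w ∈ tube n, ∀ z ∈ tube n, BoxOp^[m] (fun z => R z w) z =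
      (rfC n N)⁻¹ * (Ks (N + n / 2) z w * h w) := by
    intro w hw z hz
    have h1 := BoxOp_iter_sum isOpen_tube (Finset.range (κ + m))
      (F := fun j z => (c * h w * (g.coeff j / nt (iE n) w ^ j)) * (Ks s z w * nt z w ^ j))
      (fun j _ => (Ks_nt_differentiableOn s j hw).const_mul _) m hz
    rw [hR]
    refine h1.trans ?_
    simp only
    rw [Finset.sum_eq_single 0]
    · rw [BoxOp_iter_const_mul isOpen_tube (Ks_nt_differentiableOn s 0 hw) _ m hz]
      simp only
      rw [BoxOp_iter_Ks_nt hn s 0 m hw hz, hsm, hg0, hc]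
      simp only [pow_zero]
      field_simp
    · intro j hj hj0
      rw [BoxOp_iter_const_mul isOpen_tube (Ks_nt_differentiableOn s j hw) _ m hz]
      simp only
      rw [BoxOp_iter_Ks_nt hn s j m hw hz]
      linear_combination (c * h w / nt (iE n) w ^ j * (Ks (s + m) z w * nt z w ^ j)) *
        hbj j hj hj0
    · intro h0
      exact absurd (Finset.mem_range.2 (by omega)) h0
  have hloc : LocDom (tube n) (dV n N) R := by
    set E : (Fin n → ℂ) → ℂ := fun z => (z - iE n) 0 + (z - iE n) 1 with hE
    have hEc : Continuous E := by
      rw [hE]; simp only [Pi.sub_apply]; fun_prop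
    set B : (Fin n → ℂ) → ℝ := fun z =>
      ∑ i ∈ Finset.range (Q.natDegree + 1), ‖Q.coeff i‖ * (1 + ‖E z‖) ^ i with hB
    have hBc : Continuous B := by
      rw [hB]
      exact continuous_finsetSum _ fun i _ => by fun_prop
    refine LocDom.of_bound isOpen_tube (ae_dV.mono hRd) (fun z _ => ?_)
      (C := fun z => ‖c‖ * (harC (iE n) z ^ s * (‖E z‖ ^ m * B z)))
      (continuousOn_const.mul (((continuousOn_harC (iE n)).rpow_const fun z _ => Or.inr hs0).mul
        ((hEc.norm.pow m).mul hBc).continuousOn))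
      (g := fun w => |kE w ^ (-s) * (1 + el w) ^ (-(m : ℝ))| * ‖h w‖) ?_
      (fun w => by positivity) ?_
    · have hntm : ∀ z : Fin n → ℂ, Measurable fun w => nt z w := fun z => by
        unfold nt cj
        simp only [Pi.sub_apply]
        fun_prop
      rw [hR]
      refine Finset.aestronglyMeasurable_fun_sum _ fun j _ => ?_
      refine (((aesm_dV hmeas N).const_mul c).mul
        (((hntm _).pow_const j).const_div _).aestronglyMeasurable).mul
        ((measurable_Ks_right s z).mul ((hntm _).pow_const j)).aestronglyMeasurable
    · have h1 := lintegral_trade_mul_lt_top hn hpq hμ hβμ (t := m) (by linarith) hmμ hfin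
        hmeas.enorm hhq
      refine ⟨?_, ?_⟩
      · refine AEStronglyMeasurable.mul ?_ (aesm_dV hmeas N).norm
        exact (((continuous_kE.measurable.pow_const _).mul
          ((continuous_el.measurable.const_add 1).pow_const _)).norm).aestronglyMeasurable
      · refine lt_of_eq_of_lt (lintegral_congr_dV fun w hw => ?_) h1
        have h2 := kE_pos hw
        have h4 : 0 < 1 + el w := by linarith [el_pos hn hw]
        rw [enorm_mul, enorm_norm, abs_of_pos (by positivity), ← ofReal_norm,
          Real.norm_of_nonneg (by positivity)]
    · refine ae_dV.mono fun w hw z hz => ?_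
      have h2 := kE_pos hw
      have he := el_pos hn hw
      have h4 : 0 < 1 + el w := by linarith
      have h5 := one_add_el_le_norm_nt hn w
      have h6 : 0 < ‖nt (iE n) w‖ := h4.trans_le h5
      set x := nt z w / nt (iE n) w with hx
      have hx1 : x - 1 = E z / nt (iE n) w := by
        rw [hx, div_sub_one (hnt w hw), hE, nt, nt]
        simp only [Pi.sub_apply]
        ring
      have hx2 : ‖x - 1‖ ≤ ‖E z‖ * (1 + el w)⁻¹ := by
        rw [hx1, norm_div, div_eq_mul_inv]
        exact mul_le_mul_of_nonneg_left (inv_anti₀ h4 h5) (norm_nonneg _)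
      have hx3 : ‖x‖ ≤ 1 + ‖E z‖ := by
        have h7 : ‖x‖ ≤ ‖(1 : ℂ)‖ + ‖x - 1‖ := by
          simpa using norm_add_le (1 : ℂ) (x - 1)
        rw [norm_one] at h7
        have h8 : ‖E z‖ * (1 + el w)⁻¹ ≤ ‖E z‖ :=
          mul_le_of_le_one_right (norm_nonneg _) (inv_le_one_of_one_le₀ (by linarith))
        linarith
      have hQ : ‖Q.eval x‖ ≤ B z := by
        rw [Polynomial.eval_eq_sum_range]
        refine (norm_sum_le _ _).trans (Finset.sum_le_sum fun i _ => ?_)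
        rw [norm_mul, norm_pow]
        gcongr
      have hgx : ‖g.eval x‖ ≤ ‖E z‖ ^ m * (1 + el w) ^ (-(m : ℝ)) * B z := by
        rw [hg, Polynomial.eval_mul, Polynomial.eval_pow, Polynomial.eval_sub,
          Polynomial.eval_X, Polynomial.eval_C, norm_mul, norm_pow, Real.rpow_neg h4.le,
          Real.rpow_natCast, ← inv_pow, ← mul_pow]
        gcongr
      have hK := norm_Ks_harnack hs0 iE_mem hz hw
      have hK2 : ‖Ks s (iE n) w‖ = kE w ^ (-s) := by rw [norm_Ks, norm_kb_comm, kE]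
      have hB0 : 0 ≤ B z := (norm_nonneg _).trans hQ
      have hh0 := harC_pos (iE_mem (n := n)) hz
      rw [hRe z w hw, norm_mul, norm_mul, norm_mul, abs_of_pos (by positivity)]
      rw [hK2] at hK
      calc ‖c‖ * ‖h w‖ * (‖Ks s z w‖ * ‖g.eval x‖) ≤ ‖c‖ * ‖h w‖ *
            (harC (iE n) z ^ s * kE w ^ (-s) * (‖E z‖ ^ m * (1 + el w) ^ (-(m : ℝ)) * B z)) := by
            gcongr
        _ = _ := by ring
  refine ⟨fun z => ∫ w, R z w ∂(dV n N), hloc.differentiableOn isOpen_tube, fun z hz => ?_⟩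
  rw [hloc.boxOp_iter_integral isOpen_tube m z hz,
    integral_congr_ae (ae_dV.mono fun w hw => hRb w hw z hz), integral_const_mul,
    reproducing N hh hz ((integrable_Ks_iff (aesm_dV hmeas N) z).2
      (pker_lt_top_of_norm hpq (by linarith) hfin hmeas.enorm hhq hz)), inv_mul_cancel_left₀ hrf]

end SolvabilityMain

section DualityPairing

variable {n : ℕ} [NeZero n]

lemma lpNorm_eq_eLpNorm {p : ℝ} (hp : 0 < p) (ν : ℝ) (F : (Fin n → ℂ) → ℂ) :
    lpNorm n p ν F = eLpNorm F (ENNReal.ofReal p) (dV n ν) := by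
  rw [eLpNorm_eq_lintegral_rpow_enorm_toReal (by simpa using hp) ENNReal.ofReal_ne_top,
    ENNReal.toReal_ofReal hp.le, _root_.lpNorm, lpInt_eq hp.le]

lemma lpInt_lt_top_iff {p : ℝ} (hp : 0 < p) (ν : ℝ) (F : (Fin n → ℂ) → ℂ) :
    lpInt n p ν F < ⊤ ↔ eLpNorm F (ENNReal.ofReal p) (dV n ν) < ⊤ := by
  rw [← lpNorm_eq_eLpNorm hp, _root_.lpNorm, ENNReal.rpow_lt_top_iff_of_pos (by positivity)]

lemma memA.memLp {p ν : ℝ} (hp : 0 < p) {F : (Fin n → ℂ) → ℂ} (hF : memA n p ν F) :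
    MemLp F (ENNReal.ofReal p) (dV n ν) :=
  ⟨aesm_dV (aemeas_of_diff hF.1) ν, (lpInt_lt_top_iff hp ν F).1 hF.2⟩

lemma memA_iff {p ν : ℝ} (hp : 0 < p) {F : (Fin n → ℂ) → ℂ} :
    memA n p ν F ↔ DifferentiableOn ℂ F (tube n) ∧ MemLp F (ENNReal.ofReal p) (dV n ν) :=
  ⟨fun h => ⟨h.1, h.memLp hp⟩, fun h => ⟨h.1, (lpInt_lt_top_iff hp ν F).2 h.2.2⟩⟩

/-- The Bergman space `A^p_ν` as a subspace of the space of all functions. -/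
def bergmanSpace (n : ℕ) [NeZero n] {p : ℝ} (hp : 0 < p) (ν : ℝ) :
    Submodule ℂ ((Fin n → ℂ) → ℂ) where
  carrier := {F | memA n p ν F}
  add_mem' := by
    intro F G hF hG
    rw [mem_ofPred_eq, memA_iff hp] at hF hG ⊢
    exact ⟨hF.1.add hG.1, hF.2.add hG.2⟩
  zero_mem' := by
    rw [mem_ofPred_eq, memA_iff hp]
    exact ⟨differentiableOn_const 0, MemLp.zero⟩
  smul_mem' := by
    intro c F hF
    rw [mem_ofPred_eq, memA_iff hp] at hF ⊢
    exact ⟨hF.1.const_smul c, hF.2.const_smul c⟩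

lemma memA_sub {p ν : ℝ} (hp : 0 < p) {F G : (Fin n → ℂ) → ℂ} (hF : memA n p ν F)
    (hG : memA n p ν G) : memA n p ν (F - G) :=
  (bergmanSpace n hp ν).sub_mem hF hG

lemma exists_memA_lpNorm_pos (hn : 2 ≤ n) {p ν : ℝ} (hp : 0 < p) (hν : (n : ℝ) / 2 - 1 < ν) :
    ∃ F, memA n p ν F ∧ 0 < (lpNorm n p ν F).toReal := by
  obtain ⟨a, ha⟩ := exists_gt (max (n : ℝ) (ν + n - 1))
  rw [max_lt_iff] at ha
  have hI : lpInt n p ν (fun z => Ks (a / p) z (iE n)) =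
      ∫⁻ w, ENNReal.ofReal (kE w ^ (-a)) ∂dV n ν := by
    refine lintegral_congr_dV fun w hw => ?_
    rw [norm_Ks, kE, ← Real.rpow_mul (norm_nonneg _)]
    congr 2
    field_simp
  have hfin := lintegral_kE_lt_top hn ha.1 hν (by linarith [ha.2])
  refine ⟨fun z => Ks (a / p) z (iE n), ⟨Ks_differentiableOn _ iE_mem, hI ▸ hfin⟩, ?_⟩
  rw [_root_.lpNorm, hI]
  refine ENNReal.toReal_pos ?_ (ENNReal.rpow_ne_top_of_nonneg (by positivity) hfin.ne)
  rw [Ne, ENNReal.rpow_eq_zero_iff_of_pos (by positivity)]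
  intro h0
  have hmeas : Measurable fun w : Fin n → ℂ => ENNReal.ofReal (kE w ^ (-a)) := by
    exact (continuous_kE.measurable.pow_const _).ennreal_ofReal
  rw [lintegral_eq_zero_iff hmeas] at h0
  have hF : ∀ᵐ w ∂dV n ν, False := by
    filter_upwards [h0, ae_dV (n := n) (ν := ν)] with w h1 hw
    have := Real.rpow_pos_of_pos (kE_pos hw) (-a)
    simp only [Pi.zero_apply, ENNReal.ofReal_eq_zero] at h1
    linarith
  rw [ae_iff] at hF
  simp only [not_false_eq_true, ofPred_true] at hF
  exact dV_tube_ne_zero ν (measure_mono_null (subset_univ _) hF)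

lemma restrict_tube_ac_dV (ν : ℝ) : volume.restrict (tube n) ≪ dV n ν := by
  refine withDensity_absolutelyContinuous' ?_ ?_
  · exact (continuous_dl.measurable.pow_const _).ennreal_ofReal.aemeasurable
  · filter_upwards [ae_restrict_mem measurableSet_tube] with z hz
    simpa using Real.rpow_pos_of_pos hz.1 _

lemma mul_pow_eq_mul_conj (m : ℕ) (a b : ℂ) (z : Fin n → ℂ) :
    a * (starRingEnd ℂ) b * ((lor (imP z) : ℂ)) ^ m =
      a * (starRingEnd ℂ) (((dl z ^ (m : ℝ) : ℝ) : ℂ) * b) := by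
  rw [map_mul, conj_ofReal, Real.rpow_natCast, ofReal_pow, dl]
  ring

lemma lpInt_pow_mul {q : ℝ} (hq : 0 ≤ q) (ν : ℝ) (m : ℕ) (f : (Fin n → ℂ) → ℂ) :
    lpInt n q ν (fun z => ((lor (imP z) : ℂ)) ^ m * f z) =
      ∫⁻ w, ‖f w‖ₑ ^ q ∂(dV n (ν + m * q)) := by
  rw [lpInt_eq hq, ← lintegral_dl_mul hq]
  refine lintegral_congr_dV fun w hw => ?_
  rw [← enorm_dl_mul _ f hw, Real.rpow_natCast, ofReal_pow, dl]

/-- Hölder's inequality for the pairing of a Bergman space with its dual. -/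
lemma holder_pairing {p q ν : ℝ} (hpq : p.HolderConjugate q) {F K : (Fin n → ℂ) → ℂ}
    (hF : memA n p ν F) (hK : AEMeasurable K (volume.restrict (tube n)))
    (hKq : lpInt n q ν K < ⊤) :
    Integrable (fun z => F z * (starRingEnd ℂ) (K z)) (dV n ν) ∧
      ‖∫ z, F z * (starRingEnd ℂ) (K z) ∂dV n ν‖ ≤
        (lpNorm n q ν K).toReal * (lpNorm n p ν F).toReal := by
  have hFm := aemeas_dV (aemeas_of_diff hF.1) ν
  have hKm := aemeas_dV hK ν
  have hH : ∫⁻ z, ‖F z * (starRingEnd ℂ) (K z)‖ₑ ∂dV n ν ≤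
      lpNorm n p ν F * lpNorm n q ν K := by
    rw [_root_.lpNorm, _root_.lpNorm, lpInt_eq hpq.nonneg, lpInt_eq hpq.symm.nonneg]
    refine le_trans (le_of_eq ?_)
      (ENNReal.lintegral_mul_le_Lp_mul_Lq (dV n ν) hpq hFm.enorm hKm.enorm)
    refine lintegral_congr fun z => ?_
    rw [enorm_mul, RCLike.enorm_conj, Pi.mul_apply]
  have hfin : lpNorm n p ν F * lpNorm n q ν K < ⊤ :=
    ENNReal.mul_lt_top (ENNReal.rpow_lt_top_of_nonneg (by have := hpq.pos; positivity) hF.2.ne)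
      (ENNReal.rpow_lt_top_of_nonneg (by have := hpq.symm.pos; positivity) hKq.ne)
  refine ⟨⟨(hFm.mul (continuous_conj.measurable.comp_aemeasurable hKm)).aestronglyMeasurable,
    hH.trans_lt hfin⟩, ?_⟩
  rw [mul_comm, ← ENNReal.toReal_mul, ← toReal_enorm]
  exact ENNReal.toReal_mono hfin.ne ((enorm_integral_le_lintegral_enorm _).trans hH)

end DualityPairing

section DualityMain

variable {n : ℕ} [NeZero n]

/-- Every bounded functional on `A^p_ν` is given by pairing with an `L^q_ν` function. -/
lemma exists_Lq_representation {p q ν Cγ : ℝ} (hpq : p.HolderConjugate q) (hp2 : p ≤ 2)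
    {γ : ((Fin n → ℂ) → ℂ) → ℂ} (hγ : isBddFunc n p ν γ) (hC : 0 ≤ Cγ)
    (hCγ : ∀ F, memA n p ν F → ‖γ F‖ ≤ Cγ * (lpNorm n p ν F).toReal) :
    ∃ g : (Fin n → ℂ) → ℂ, AEMeasurable g (volume.restrict (tube n)) ∧
      ∫⁻ z, ‖g z‖ₑ ^ q ∂dV n ν ≤ ENNReal.ofReal Cγ ^ q ∧
      ∀ F, memA n p ν F → γ F = ∫ z, F z * (starRingEnd ℂ) (g z) ∂dV n ν := by
  let γA : bergmanSpace n hpq.pos ν →ₗ[ℂ] ℂ :=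
    { toFun := fun F => γ F
      map_add' := fun F G => hγ.1 F G F.2 G.2
      map_smul' := fun c F => hγ.2.1 c F F.2 }
  obtain ⟨g, hgm, hgq, hg⟩ := exists_functional_representation hpq hp2 (dV n ν)
    (bergmanSpace n hpq.pos ν) (fun F hF => memA.memLp hpq.pos hF) γA hC (fun F => by
      rw [← lpNorm_eq_eLpNorm hpq.pos]
      exact hCγ F F.2)
  refine ⟨fun z => (starRingEnd ℂ) (g z), ?_, ?_, fun F hF => ?_⟩
  · exact continuous_conj.measurable.comp_aemeasurable
      (hgm.aemeasurable.mono_ac (restrict_tube_ac_dV ν))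
  · simpa only [RCLike.enorm_conj] using hgq
  · simp only [conj_conj]
    exact hg ⟨F, hF⟩

end DualityMain

/-- Corollary: `(A^p_ν)^* ≅ 𝔹^{p'}_ν` for `1 < p ≤ 2` under the pairing
`γ_G(F) = ∫ F conj(□^m G) Δ(Im z)^m dV_ν`. -/
theorem dual_Ap_is_besov (n : ℕ) [NeZero n] (hn : 3 ≤ n) (ν p : ℝ) (m : ℕ)
    (hν : (n : ℝ) / 2 - 1 < ν) (hp1 : 1 < p) (hp2 : p ≤ 2)
    (hm1 : (n : ℝ) / 2 - 1 < ν + (m : ℝ) * (p / (p - 1)))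
    (hm2 : hardy n (p / (p - 1)) (ν + (m : ℝ) * (p / (p - 1)))) :
    (∃ C : ℝ, ∀ G : (Fin n → ℂ) → ℂ, DifferentiableOn ℂ G (tube n) →
      lpInt n (p / (p - 1)) ν (fun z => ((lor (imP z) : ℂ)) ^ m * BoxOp^[m] G z) < ⊤ →
      ∀ F, memA n p ν F →
        Integrable
          (fun z => F z * (starRingEnd ℂ) (BoxOp^[m] G z) * ((lor (imP z) : ℂ)) ^ m)
          (dV n ν) ∧
        ‖∫ z, F z * (starRingEnd ℂ) (BoxOp^[m] G z) * ((lor (imP z) : ℂ)) ^ m ∂(dV n ν)‖ ≤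
          C * (lpNorm n (p / (p - 1)) ν
                (fun z => ((lor (imP z) : ℂ)) ^ m * BoxOp^[m] G z)).toReal *
            (lpNorm n p ν F).toReal) ∧
    (∃ C : ℝ, ∀ γ : ((Fin n → ℂ) → ℂ) → ℂ, isBddFunc n p ν γ →
      ∀ Cγ : ℝ, (∀ F, memA n p ν F → ‖γ F‖ ≤ Cγ * (lpNorm n p ν F).toReal) →
      ∃ G : (Fin n → ℂ) → ℂ, DifferentiableOn ℂ G (tube n) ∧
        lpInt n (p / (p - 1)) ν (fun z => ((lor (imP z) : ℂ)) ^ m * BoxOp^[m] G z) < ⊤ ∧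
        (lpNorm n (p / (p - 1)) ν
            (fun z => ((lor (imP z) : ℂ)) ^ m * BoxOp^[m] G z)).toReal ≤ C * Cγ ∧
        ∀ F, memA n p ν F →
          γ F = ∫ z, F z * (starRingEnd ℂ) (BoxOp^[m] G z) * ((lor (imP z) : ℂ)) ^ m
            ∂(dV n ν)) ∧
    (∀ G₁ G₂ : (Fin n → ℂ) → ℂ,
      DifferentiableOn ℂ G₁ (tube n) →
      lpInt n (p / (p - 1)) ν (fun z => ((lor (imP z) : ℂ)) ^ m * BoxOp^[m] G₁ z) < ⊤ →
      DifferentiableOn ℂ G₂ (tube n) →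
      lpInt n (p / (p - 1)) ν (fun z => ((lor (imP z) : ℂ)) ^ m * BoxOp^[m] G₂ z) < ⊤ →
      ((∀ F, memA n p ν F →
          ∫ z, F z * (starRingEnd ℂ) (BoxOp^[m] G₁ z) * ((lor (imP z) : ℂ)) ^ m ∂(dV n ν) =
            ∫ z, F z * (starRingEnd ℂ) (BoxOp^[m] G₂ z) * ((lor (imP z) : ℂ)) ^ m
              ∂(dV n ν)) ↔
        Set.EqOn (BoxOp^[m] G₁) (BoxOp^[m] G₂) (tube n))) := by
  have hpq : p.HolderConjugate (p / (p - 1)) := Real.HolderConjugate.conjExponent hp1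
  set q := p / (p - 1) with hq
  have hn2 : 2 ≤ n := by omega
  have hq2 : 2 ≤ q := by
    rw [hq, le_div_iff₀ (by linarith)]
    linarith
  have hp0 := hpq.pos
  have hq0 := hpq.symm.pos
  obtain ⟨⟨C, hCtop, hrep⟩, huniq⟩ := pairing_representation hn2 hpq hp2 hq2 hν m hm2
  have hmemA : ∀ F, DifferentiableOn ℂ F (tube n) → ∫⁻ z, ‖F z‖ₑ ^ p ∂dV n ν < ⊤ →
      memA n p ν F := fun F h1 h2 => ⟨h1, by rwa [lpInt_eq hp0.le]⟩
  have hHol : ∀ G : (Fin n → ℂ) → ℂ, DifferentiableOn ℂ G (tube n) →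
      lpInt n q ν (fun z => ((lor (imP z) : ℂ)) ^ m * BoxOp^[m] G z) < ⊤ →
      ∀ F, memA n p ν F →
        Integrable
          (fun z => F z * (starRingEnd ℂ) (BoxOp^[m] G z) * ((lor (imP z) : ℂ)) ^ m)
          (dV n ν) ∧
        ‖∫ z, F z * (starRingEnd ℂ) (BoxOp^[m] G z) * ((lor (imP z) : ℂ)) ^ m ∂(dV n ν)‖ ≤
          (lpNorm n q ν (fun z => ((lor (imP z) : ℂ)) ^ m * BoxOp^[m] G z)).toReal *
            (lpNorm n p ν F).toReal := by
    intro G hG hGq F hF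
    have hK : AEMeasurable (fun z => ((lor (imP z) : ℂ)) ^ m * BoxOp^[m] G z)
        (volume.restrict (tube n)) :=
      ((continuous_ofReal.comp continuous_dl).pow m).measurable.aemeasurable.mul
        (aemeas_of_diff (BoxOp_iter_differentiableOn isOpen_tube hG m))
    have hcong : (fun z => F z * (starRingEnd ℂ) (BoxOp^[m] G z) * ((lor (imP z) : ℂ)) ^ m) =
        fun z => F z * (starRingEnd ℂ) (((lor (imP z) : ℂ)) ^ m * BoxOp^[m] G z) := by
      funext z
      rw [map_mul, map_pow, conj_ofReal]
      ring
    rw [hcong]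
    exact holder_pairing hpq hF hK hGq
  refine ⟨⟨1, fun G hG hGq F hF => ?_⟩, ⟨(C ^ (1 / q)).toReal, fun γ hγ Cγ hCγ => ?_⟩,
    fun G₁ G₂ h₁ hq₁ h₂ hq₂ => ⟨fun h => ?_, fun h F hF => ?_⟩⟩
  · rw [one_mul]
    exact hHol G hG hGq F hF
  · have hC0 : 0 ≤ Cγ := by
      obtain ⟨F, hF, hpos⟩ := exists_memA_lpNorm_pos hn2 hp0 hν
      exact nonneg_of_mul_nonneg_left ((norm_nonneg _).trans (hCγ F hF)) hpos
    obtain ⟨g, hgm, hgq, hg⟩ := exists_Lq_representation hpq hp2 hγ hC0 hCγ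
    have hCq : ENNReal.ofReal Cγ ^ q < ⊤ :=
      ENNReal.rpow_lt_top_of_nonneg hq0.le ENNReal.ofReal_ne_top
    obtain ⟨h, hh, hhq, hhF⟩ := hrep g hgm (hgq.trans_lt hCq)
    have hle : ∫⁻ z, ‖h z‖ₑ ^ q ∂dV n (ν + m * q) ≤ C * ENNReal.ofReal Cγ ^ q :=
      hhq.trans (mul_le_mul_right hgq C)
    have hfin := hle.trans_lt (ENNReal.mul_lt_top hCtop.lt_top hCq)
    have hnpos : (3 : ℝ) ≤ n := by exact_mod_cast hn
    obtain ⟨G, hG, hGh⟩ := exists_BoxOp_iter_eq hn2 hpq hm1 hm2 m (by linarith) hh hfin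
    have hGint : lpInt n q ν (fun z => ((lor (imP z) : ℂ)) ^ m * BoxOp^[m] G z) =
        ∫⁻ z, ‖h z‖ₑ ^ q ∂dV n (ν + m * q) := by
      rw [lpInt_pow_mul hq0.le]
      exact lintegral_congr_dV fun z hz => by rw [hGh z hz]
    refine ⟨G, hG, hGint ▸ hfin, ?_, fun F hF => ?_⟩
    · rw [_root_.lpNorm, hGint]
      have h1 : (∫⁻ z, ‖h z‖ₑ ^ q ∂dV n (ν + m * q)) ^ (1 / q) ≤
          C ^ (1 / q) * ENNReal.ofReal Cγ := by
        refine (ENNReal.rpow_le_rpow hle (by positivity)).trans (le_of_eq ?_)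
        rw [ENNReal.mul_rpow_of_nonneg _ _ (by positivity), ← ENNReal.rpow_mul,
          mul_one_div_cancel hq0.ne', ENNReal.rpow_one]
      have h2 : C ^ (1 / q) ≠ ⊤ := ENNReal.rpow_ne_top_of_nonneg (by positivity) hCtop
      have h3 := ENNReal.toReal_mono (ENNReal.mul_ne_top h2 ENNReal.ofReal_ne_top) h1
      rwa [ENNReal.toReal_mul, ENNReal.toReal_ofReal hC0] at h3
    · rw [hg F hF, hhF F hF.1 (by rw [← lpInt_eq hp0.le]; exact hF.2)]
      refine integral_congr_ae ?_
      filter_upwards [ae_dV (n := n) (ν := ν)] with z hz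
      rw [mul_pow_eq_mul_conj, hGh z hz]
  · have hB₁ := BoxOp_iter_differentiableOn isOpen_tube h₁ m
    have hB₂ := BoxOp_iter_differentiableOn isOpen_tube h₂ m
    have hI : ∀ {G : (Fin n → ℂ) → ℂ}, DifferentiableOn ℂ (BoxOp^[m] G) (tube n) →
        lpInt n q ν (fun z => ((lor (imP z) : ℂ)) ^ m * BoxOp^[m] G z) < ⊤ →
        memA n q (ν + m * q) (BoxOp^[m] G) := fun hB hBq =>
      ⟨hB, by rwa [lpInt_eq hq0.le, ← lpInt_pow_mul hq0.le]⟩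
    have hsub := memA_sub hq0 (hI hB₁ hq₁) (hI hB₂ hq₂)
    intro z hz
    refine sub_eq_zero.1 (huniq _ hsub.1 ?_ (fun F hF hFp => ?_) z hz)
    · rw [← lpInt_eq hq0.le]
      exact hsub.2
    · have hFA := hmemA F hF hFp
      have hd := sub_eq_zero.2 (h F hFA)
      rw [← integral_sub (hHol G₁ h₁ hq₁ F hFA).1 (hHol G₂ h₂ hq₂ F hFA).1] at hd
      rw [← hd]
      refine integral_congr_ae (Filter.Eventually.of_forall fun w => ?_)
      simp only [mul_pow_eq_mul_conj, Pi.sub_apply, mul_sub, map_sub]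
  · refine integral_congr_ae ?_
    filter_upwards [ae_dV (n := n) (ν := ν)] with z hz
    rw [h hz]
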